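/- Let γ ∈ C³_b(ℝ^{n−1}), Q ∈ SO(n), p ∈ [1,∞), and suppose ρ satisfies Assumptions (A1) and (A2) with M = I, and that ‖γ‖_{C¹_b(ℝ^{n−1})} is sufficiently small. Then on the rotated curved half space Qℝⁿ_γ the following hold: the nonlocal operator u ↦ P.V. ∫_{Qℝⁿ_γ} J_ε(·−y)(u(·)−u(y)) dy extends to a bounded linear operator L_ε^{Qℝⁿ_γ} : W^{2,p}_N(Qℝⁿ_γ) → L^p(Qℝⁿ_γ) with norm bounded uniformly in ε ∈ (0,1]; there is C > 0 depending only on γ, ρ, p such that ‖L_ε^{Qℝⁿ_γ} u + Δu‖_{L^p(Qℝⁿ_γ)} ≤ C ε^{1/p} ‖u‖_{W^{3,p}(Qℝⁿ_γ)} for all ε ∈ (0,1] and all u ∈ W^{3,p}_N(Qℝⁿ_γ); and L_ε^{Qℝⁿ_γ} u → −Δu in L^p(Qℝⁿ_γ) as ε → 0 for all u ∈ W^{2,p}_N(Qℝⁿ_γ). -/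

import Mathlib

open MeasureTheory Filter Topology ENNReal Matrix

noncomputable section

abbrev EV (n : ℕ) := EuclideanSpace ℝ (Fin n)

/-- The kernel `J(x) = ρ(x)/|x|²`. -/
def kernelJ {n : ℕ} (ρ : EV n → ℝ) (x : EV n) : ℝ := ρ x / ‖x‖ ^ 2

/-- The rescaled density `ρ_ε(x) = ε^{-n} ρ(x/ε)`. -/
def scaled {n : ℕ} (ρ : EV n → ℝ) (ε : ℝ) (x : EV n) : ℝ := (ε ^ n)⁻¹ * ρ (ε⁻¹ • x)

/-- Assumption (A1): `ρ` is measurable, nonnegative, not a.e. zero, even,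
and `∫ ρ(x)(1+|x|) dx < ∞`. -/
def A1 {n : ℕ} (ρ : EV n → ℝ) : Prop :=
  Measurable ρ ∧ (∀ x, 0 ≤ ρ x) ∧ ¬ (ρ =ᵐ[volume] (fun _ => (0 : ℝ))) ∧
  (∀ᵐ x : EV n ∂volume, ρ (-x) = ρ x) ∧
  Integrable (fun x : EV n => ρ x * (1 + ‖x‖)) volume

/-- `L_ε u (x) = ∫_{ℝⁿ} J_ε(x-y) (u(x) - u(y) - ∇u(x)·(x-y)) dy`. -/
def nlOp {n : ℕ} (ρ : EV n → ℝ) (ε : ℝ) (u : EV n → ℝ) (x : EV n) : ℝ :=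
  ∫ y : EV n, kernelJ (scaled ρ ε) (x - y) * (u x - u y - fderiv ℝ u x (x - y))

/-- The classical partial derivative `∂ᵢ u`. -/
def partialD {n : ℕ} (i : Fin n) (u : EV n → ℝ) : EV n → ℝ :=
  fun x => fderiv ℝ u x (EuclideanSpace.single i 1)

/-- Iterated classical partial derivatives along a list of directions. -/
def partialDList {n : ℕ} : List (Fin n) → (EV n → ℝ) → (EV n → ℝ)
  | [], u => u
  | i :: l, u => partialD i (partialDList l u)

/-- The momentum matrix `M = (1/2)∫_{ℝⁿ} J(z) z ⊗ z dz`. -/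
def momentum {n : ℕ} (ρ : EV n → ℝ) : Matrix (Fin n) (Fin n) ℝ :=
  Matrix.of fun i j => (1 / 2 : ℝ) * ∫ z : EV n, kernelJ ρ z * z i * z j

/-- Multiplication of a vector of `ℝⁿ` by a matrix. -/
def mulVecE {m : ℕ} (Q : Matrix (Fin m) (Fin m) ℝ) (x : EV m) : EV m :=
  (WithLp.equiv 2 (Fin m → ℝ)).symm (Q.mulVec ((WithLp.equiv 2 (Fin m → ℝ)) x))

/-- The point `(z', zₙ) ∈ ℝⁿ` with first coordinates `z' ∈ ℝ^{n-1}` and last coordinate `zₙ`. -/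
def snocE {n : ℕ} (z' : EV n) (t : ℝ) : EV (n + 1) :=
  (WithLp.equiv 2 (Fin (n + 1) → ℝ)).symm
    (Fin.snoc ((WithLp.equiv 2 (Fin n → ℝ)) z') t)

/-- `v = ∂ᵢ u` weakly on `Ω`. -/
def WeakDerivOn {n : ℕ} (Ω : Set (EV n)) (i : Fin n) (u v : EV n → ℝ) : Prop :=
  ∀ φ : EV n → ℝ, ContDiff ℝ (⊤ : ℕ∞) φ → HasCompactSupport φ → tsupport φ ⊆ Ω →
    ∫ x in Ω, u x * partialD i φ x = - ∫ x in Ω, v x * φ x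

/-- `D` is a system of weak partial derivatives of `u` on `Ω` up to order `k`,
all lying in `L^p(Ω)`; i.e. `D` witnesses that `u ∈ W^{k,p}(Ω)`. -/
def IsSobDerivs {n : ℕ} (Ω : Set (EV n)) (k : ℕ) (p : ℝ≥0∞) (u : EV n → ℝ)
    (D : List (Fin n) → EV n → ℝ) : Prop :=
  D [] = u ∧
  (∀ l : List (Fin n), l.length < k → ∀ i : Fin n, WeakDerivOn Ω i (D l) (D (i :: l))) ∧
  (∀ l : List (Fin n), l.length ≤ k → MemLp (D l) p (volume.restrict Ω))

/-- `u ∈ W^{k,p}(Ω)`. -/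
def MemW {n : ℕ} (Ω : Set (EV n)) (k : ℕ) (p : ℝ≥0∞) (u : EV n → ℝ) : Prop :=
  ∃ D, IsSobDerivs Ω k p u D

/-- The `W^{k,p}`-norm computed from a system `D` of weak derivatives:
the sum of the `L^p` norms of all weak derivatives of order at most `k`. -/
def WNormD {n : ℕ} (k : ℕ) (p : ℝ≥0∞) (μ : Measure (EV n))
    (D : List (Fin n) → EV n → ℝ) : ℝ≥0∞ :=
  ∑' l : List (Fin n), if l.length ≤ k then eLpNorm (D l) p μ else 0

/-- The first `n` coordinates of a point of `ℝ^{n+1}`. -/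
def firstCoords {n : ℕ} (x : EV (n + 1)) : EV n :=
  (WithLp.equiv 2 (Fin n → ℝ)).symm (fun i => x i.castSucc)

/-- The curved half space `ℝⁿ_γ = {x : xₙ > γ(x₁,…,x_{n-1})}`. -/
def halfSpace {n : ℕ} (γ : EV n → ℝ) : Set (EV (n + 1)) :=
  {x : EV (n + 1) | γ (firstCoords x) < x (Fin.last n)}

/-- `γ ∈ C^k_b`: `γ` is `k` times continuously differentiable with bounded derivatives. -/
def Ckb {n : ℕ} (k : ℕ) (γ : EV n → ℝ) : Prop :=
  ContDiff ℝ k γ ∧ ∀ m : ℕ, m ≤ k → ∃ C : ℝ, ∀ x, ‖iteratedFDeriv ℝ m γ x‖ ≤ C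

/-- Assumption (A2): `ρ ∈ C¹(ℝⁿ∖{0})` with singularity bounds
`|ρ(x)| ≤ c₀|x|^{2-α-n}(1+|x|)^{-N}`, `|∇ρ(x)| ≤ c₁|x|^{1-α-n}(1+|x|)^{-N}` for some
`c₀, c₁ > 0`, `α ∈ (0,2)`, `N > 3-α`; and, with `A := √M`, the kernel satisfies
`∫_{ℝ^{n-1}} J(AQ(z', zₙ)) z' dz' = 0` for all `zₙ ∈ ℝ` and `Q ∈ SO(n)`.
(The ambient dimension is `n + 1`.) -/
def A2 {n : ℕ} (ρ : EV (n + 1) → ℝ) : Prop :=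
  ContDiffOn ℝ 1 ρ {(0 : EV (n + 1))}ᶜ ∧
  (∃ c₀ c₁ α N : ℝ, 0 < c₀ ∧ 0 < c₁ ∧ 0 < α ∧ α < 2 ∧ 3 - α < N ∧
    ∀ x : EV (n + 1), x ≠ 0 →
      |ρ x| ≤ c₀ * ‖x‖ ^ ((2 : ℝ) - α - (n + 1 : ℝ)) * (1 + ‖x‖) ^ (-N) ∧
      ‖fderiv ℝ ρ x‖ ≤ c₁ * ‖x‖ ^ ((1 : ℝ) - α - (n + 1 : ℝ)) * (1 + ‖x‖) ^ (-N)) ∧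
  (∃ A : Matrix (Fin (n + 1)) (Fin (n + 1)) ℝ, A.PosDef ∧ A * A = momentum ρ ∧
    ∀ t : ℝ, ∀ Q : Matrix (Fin (n + 1)) (Fin (n + 1)) ℝ, Qᵀ * Q = 1 → Q.det = 1 →
      (∫ z' : EV n, kernelJ ρ (mulVecE (A * Q) (snocE z' t)) • z') = 0)

/-- The homogeneous conormal boundary condition `M∇u · n = 0` on `∂Ω`, formulated weakly:
for any system of weak derivatives of `u ∈ W^{2,p}(Ω)` and any test function
`φ ∈ C_c^∞(ℝⁿ)`, Green's formula holds on `Ω` with no boundary contribution. -/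
def NeumannBC {m : ℕ} (Ω : Set (EV m)) (Mm : Matrix (Fin m) (Fin m) ℝ) (p : ℝ≥0∞)
    (u : EV m → ℝ) : Prop :=
  ∀ D : List (Fin m) → EV m → ℝ, IsSobDerivs Ω 2 p u D →
    ∀ φ : EV m → ℝ, ContDiff ℝ (⊤ : ℕ∞) φ → HasCompactSupport φ →
      (∑ i : Fin m, ∑ j : Fin m, Mm i j * ∫ x in Ω, D [i, j] x * φ x)
        = - ∑ i : Fin m, ∑ j : Fin m, Mm i j * ∫ x in Ω, D [j] x * partialD i φ x

/-- `u ∈ W^{k,p}(Ω)` together with the boundary condition `M∇u · n = 0` on `∂Ω`. -/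
def MemWN {m : ℕ} (Ω : Set (EV m)) (Mm : Matrix (Fin m) (Fin m) ℝ) (k : ℕ) (p : ℝ≥0∞)
    (u : EV m → ℝ) : Prop :=
  MemW Ω k p u ∧ NeumannBC Ω Mm p u

/-- `l` is the principal value `P.V. ∫_Ω J_ε(x-y)(u(x)-u(y)) dy` at the point `x`. -/
def pvAt {m : ℕ} (Ω : Set (EV m)) (ρ : EV m → ℝ) (ε : ℝ) (u : EV m → ℝ) (x : EV m)
    (l : ℝ) : Prop :=
  Tendsto
    (fun r : ℝ =>
      ∫ y in Ω ∩ {y : EV m | r ≤ dist x y}, kernelJ (scaled ρ ε) (x - y) * (u x - u y))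
    (𝓝[>] 0) (𝓝 l)

/-- `L` is a bounded linear extension to `W^{2,p}_M(Ω)` (Sobolev functions with the
boundary condition `M∇u · n = 0`), with operator bound `C`, of the nonlocal operator
`P.V. ∫_Ω J_ε(·-y)(u(·)-u(y)) dy` defined on `C_c²(cl Ω) ∩ W^{2,p}_M(Ω)`. -/
def IsNLExtOn {m : ℕ} (Ω : Set (EV m)) (Mm : Matrix (Fin m) (Fin m) ℝ) (ρ : EV m → ℝ)
    (p : ℝ≥0∞) (ε C : ℝ) (L : (EV m → ℝ) → EV m → ℝ) : Prop :=
  (∀ u : EV m → ℝ, ContDiff ℝ 2 u → HasCompactSupport u → MemWN Ω Mm 2 p u →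
    ∀ᵐ x ∂(volume.restrict Ω), pvAt Ω ρ ε u x (L u x)) ∧
  (∀ u v : EV m → ℝ, MemWN Ω Mm 2 p u → MemWN Ω Mm 2 p v → ∀ a b : ℝ,
    L (fun x => a * u x + b * v x) =ᵐ[volume.restrict Ω] fun x => a * L u x + b * L v x) ∧
  (∀ u : EV m → ℝ, MemWN Ω Mm 2 p u → MemLp (L u) p (volume.restrict Ω)) ∧
  (∀ u D, MemWN Ω Mm 2 p u → IsSobDerivs Ω 2 p u D →
    eLpNorm (L u) p (volume.restrict Ω)
      ≤ ENNReal.ofReal C * WNormD 2 p (volume.restrict Ω) D)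

/-- `Ω ⊆ ℝ^{n+1}` is an open set whose boundary is locally, up to a rotation, the region
above the graph of a `C^k` function with bounded derivatives (a domain of class `C^k`). -/
def IsGraphDomain {n : ℕ} (k : ℕ) (Ω : Set (EV (n + 1))) : Prop :=
  IsOpen Ω ∧ ∀ z ∈ frontier Ω,
    ∃ (U : Set (EV (n + 1))) (Q : Matrix (Fin (n + 1)) (Fin (n + 1)) ℝ) (γ : EV n → ℝ),
      IsOpen U ∧ z ∈ U ∧ Qᵀ * Q = 1 ∧ Q.det = 1 ∧ Ckb k γ ∧
      Ω ∩ U = (mulVecE Q '' halfSpace γ) ∩ U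

section PartOne

/-- Jensen-type inequality for `L^p` norms of averages. -/
lemma eLpNorm_lintegral_rpow_le {X Z : Type*} [MeasurableSpace X] [MeasurableSpace Z]
    (μ : Measure X) [SFinite μ] (m : Measure Z) [IsFiniteMeasure m] {p : ℝ≥0∞} (hp1 : 1 ≤ p)
    (hp : p ≠ ⊤) (g : X → Z → ℝ≥0∞) (hg : Measurable (Function.uncurry g)) :
    (eLpNorm (fun x => ∫⁻ z, g x z ∂m) p μ) ^ p.toReal
      ≤ m Set.univ ^ (p.toReal - 1) * ∫⁻ z, (eLpNorm (fun x => g x z) p μ) ^ p.toReal ∂m := by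
  have hp0 : p ≠ 0 := (lt_of_lt_of_le zero_lt_one hp1).ne'
  have hpr : 1 ≤ p.toReal := by
    rw [← ENNReal.toReal_one]; exact (ENNReal.toReal_le_toReal (by simp) hp).2 hp1
  have hpr0 : 0 < p.toReal := by linarith
  have key : ∀ f : Z → ℝ≥0∞, Measurable f →
      (∫⁻ z, f z ∂m) ^ p.toReal ≤ m Set.univ ^ (p.toReal - 1) * ∫⁻ z, f z ^ p.toReal ∂m := by
    intro f hf
    have h1 := eLpNorm_le_eLpNorm_mul_rpow_measure_univ (μ := m) hp1 hf.aestronglyMeasurable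
    rw [eLpNorm_one_eq_lintegral_enorm, eLpNorm_eq_lintegral_rpow_enorm_toReal hp0 hp] at h1
    simp only [enorm_eq_self] at h1
    have h2 := ENNReal.rpow_le_rpow h1 hpr0.le
    rw [ENNReal.mul_rpow_of_nonneg _ _ hpr0.le, ← ENNReal.rpow_mul, ← ENNReal.rpow_mul] at h2
    have e1 : 1 / p.toReal * p.toReal = 1 := by field_simp
    have e2 : (1 / (1 : ℝ≥0∞).toReal - 1 / p.toReal) * p.toReal = p.toReal - 1 := by
      simp; field_simp
    rw [e1, e2, ENNReal.rpow_one, mul_comm] at h2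
    exact h2
  have hpow : ∀ f : X → ℝ≥0∞, (eLpNorm f p μ) ^ p.toReal = ∫⁻ x, f x ^ p.toReal ∂μ := by
    intro f
    rw [eLpNorm_eq_lintegral_rpow_enorm_toReal hp0 hp, ← ENNReal.rpow_mul]
    have e1 : 1 / p.toReal * p.toReal = 1 := by field_simp
    rw [e1, ENNReal.rpow_one]; simp
  rw [hpow]
  simp_rw [hpow]
  calc ∫⁻ x, (∫⁻ z, g x z ∂m) ^ p.toReal ∂μ
      ≤ ∫⁻ x, m Set.univ ^ (p.toReal - 1) * ∫⁻ z, g x z ^ p.toReal ∂m ∂μ :=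
        lintegral_mono fun x => key _ (hg.comp measurable_prodMk_left)
    _ = m Set.univ ^ (p.toReal - 1) * ∫⁻ x, ∫⁻ z, g x z ^ p.toReal ∂m ∂μ := by
        rw [lintegral_const_mul]
        exact Measurable.lintegral_prod_right (hg.pow_const _)
    _ = _ := by
        rw [lintegral_lintegral_swap]
        exact (hg.pow_const _).aemeasurable

lemma eLpNorm_lintegral_le {X Z : Type*} [MeasurableSpace X] [MeasurableSpace Z]
    (μ : Measure X) [SFinite μ] (m : Measure Z) [IsFiniteMeasure m] {p : ℝ≥0∞} (hp1 : 1 ≤ p)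
    (hp : p ≠ ⊤) (g : X → Z → ℝ≥0∞) (hg : Measurable (Function.uncurry g)) (B : ℝ≥0∞)
    (hB : ∀ᵐ z ∂m, eLpNorm (fun x => g x z) p μ ≤ B) :
    eLpNorm (fun x => ∫⁻ z, g x z ∂m) p μ ≤ m Set.univ * B := by
  have hpr : 1 ≤ p.toReal := by
    rw [← ENNReal.toReal_one]; exact (ENNReal.toReal_le_toReal (by simp) hp).2 hp1
  have hpr0 : 0 < p.toReal := by linarith
  have h := eLpNorm_lintegral_rpow_le μ m hp1 hp g hg
  have h2 : (eLpNorm (fun x => ∫⁻ z, g x z ∂m) p μ) ^ p.toReal ≤ (m Set.univ * B) ^ p.toReal := by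
    refine h.trans ?_
    calc m Set.univ ^ (p.toReal - 1) * ∫⁻ z, (eLpNorm (fun x => g x z) p μ) ^ p.toReal ∂m
        ≤ m Set.univ ^ (p.toReal - 1) * ∫⁻ z, B ^ p.toReal ∂m := by
          gcongr 1
          refine lintegral_mono_ae ?_
          filter_upwards [hB] with z hz
          exact ENNReal.rpow_le_rpow hz hpr0.le
      _ = (m Set.univ * B) ^ p.toReal := by
          rw [lintegral_const, ENNReal.mul_rpow_of_nonneg _ _ hpr0.le, mul_comm (B ^ p.toReal),
            ← mul_assoc]
          congr 1
          rcases eq_or_ne (m Set.univ) 0 with h0 | h0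
          · rw [h0, ENNReal.zero_rpow_of_pos hpr0, mul_zero]
          · nth_rewrite 2 [← ENNReal.rpow_one (m Set.univ)]
            rw [← ENNReal.rpow_add _ _ h0 (measure_ne_top _ _)]
            congr 1; ring
  exact (ENNReal.rpow_le_rpow_iff hpr0).1 h2

lemma eLpNorm_translate {m : ℕ} {F : Type*} [NormedAddCommGroup F] (f : EV m → F) (hf : AEStronglyMeasurable f volume)
    (p : ℝ≥0∞) (a : EV m) (A B : Set (EV m)) (hA : MeasurableSet A) (hB : MeasurableSet B)
    (hAB : ∀ x ∈ A, x + a ∈ B) :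
    eLpNorm (fun x => f (x + a)) p (volume.restrict A) ≤ eLpNorm f p (volume.restrict B) := by
  have h1 : eLpNorm (fun x => f (x + a)) p (volume.restrict A)
      = eLpNorm (fun x => A.indicator (fun x => f (x + a)) x) p volume :=
    (eLpNorm_indicator_eq_eLpNorm_restrict hA).symm
  have h2 : eLpNorm f p (volume.restrict B)
      = eLpNorm (fun x => B.indicator f x) p volume :=
    (eLpNorm_indicator_eq_eLpNorm_restrict hB).symm
  have h3 : eLpNorm (fun x => B.indicator f x) p volume
      = eLpNorm ((fun x => B.indicator f x) ∘ (fun x => x + a)) p volume :=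
    (eLpNorm_comp_measurePreserving (hf.indicator hB) (measurePreserving_add_right volume a)).symm
  rw [h1, h2, h3]
  refine eLpNorm_mono fun x => ?_
  by_cases hx : x ∈ A
  · simp [hx, hAB x hx]
  · simp [hx]

/-- Continuity of translations in `L^p`. -/
lemma tendsto_eLpNorm_translate {m : ℕ} (f : EV m → ℝ) {p : ℝ≥0∞} (hp1 : 1 ≤ p) (hp : p ≠ ⊤)
    (hf : MemLp f p volume) :
    Tendsto (fun a : EV m => eLpNorm (fun x => f (x + a) - f x) p volume) (𝓝 0) (𝓝 0) := by
  haveI : Fact (1 ≤ p) := ⟨hp1⟩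
  rw [ENNReal.tendsto_nhds_zero]
  intro ε hε
  rcases eq_or_ne ε ⊤ with rfl | hεt
  · simp
  have hε3 : ε / 3 ≠ 0 := by
    simp [hε.ne']
  obtain ⟨g, hgc, hfg, hgcont, hgLp⟩ := hf.exists_hasCompactSupport_eLpNorm_sub_le hp hε3
  have hgu : UniformContinuous g := hgc.uniformContinuous_of_continuous hgcont
  -- bound for g
  obtain ⟨R, hR⟩ := hgc.isCompact.isBounded.subset_closedBall (0 : EV m)
  set B : Set (EV m) := Metric.closedBall 0 (R + 1) with hBdef
  have hBfin : volume B ≠ ⊤ := measure_closedBall_lt_top.ne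
  have hgz : ∀ x, x ∉ Metric.closedBall (0 : EV m) R → g x = 0 := fun x hx =>
    image_eq_zero_of_notMem_tsupport fun h => hx (hR h)
  have hp0 : p ≠ 0 := (lt_of_lt_of_le zero_lt_one hp1).ne'
  have hgt : ∀ᶠ a : EV m in 𝓝 0, eLpNorm (fun x => g (x + a) - g x) p volume ≤ ε / 3 := by
    -- choose η
    obtain ⟨η, hη0, hη⟩ : ∃ η : ℝ, 0 < η ∧ ENNReal.ofReal η * (volume B) ^ (1 / p.toReal) ≤ ε / 3 := by
      have hc : (volume B) ^ (1 / p.toReal) ≠ ⊤ := ENNReal.rpow_ne_top_of_nonneg (by positivity) hBfin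
      have ht : Tendsto (fun η : ℝ => ENNReal.ofReal η * (volume B) ^ (1 / p.toReal)) (𝓝[>] 0) (𝓝 0) := by
        have : Tendsto (fun η : ℝ => ENNReal.ofReal η * (volume B) ^ (1 / p.toReal)) (𝓝[>] 0)
            (𝓝 (ENNReal.ofReal 0 * (volume B) ^ (1 / p.toReal))) := by
          refine ENNReal.Tendsto.mul_const ?_ (Or.inr hc)
          exact (ENNReal.continuous_ofReal.tendsto 0).mono_left nhdsWithin_le_nhds
        simpa using this
      have := (ENNReal.tendsto_nhds_zero.1 ht) (ε / 3) (pos_iff_ne_zero.2 hε3)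
      obtain ⟨η, h1, h2⟩ := (this.and self_mem_nhdsWithin).exists
      exact ⟨η, h2, h1⟩
    rw [Metric.uniformContinuous_iff] at hgu
    obtain ⟨δ, hδ0, hδ⟩ := hgu η hη0
    filter_upwards [Metric.ball_mem_nhds (0 : EV m) (lt_min hδ0 one_pos)] with a ha
    rw [mem_ball_zero_iff] at ha
    have ha1 : ‖a‖ < δ := lt_of_lt_of_le ha (min_le_left _ _)
    have ha2 : ‖a‖ < 1 := lt_of_lt_of_le ha (min_le_right _ _)
    calc eLpNorm (fun x => g (x + a) - g x) p volume
        ≤ eLpNorm (B.indicator fun _ => η) p volume := by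
          refine eLpNorm_mono fun x => ?_
          by_cases hx : x ∈ B
          · rw [Set.indicator_of_mem hx, Real.norm_of_nonneg hη0.le, ← dist_eq_norm]
            exact (hδ (by simpa [dist_eq_norm] using ha1)).le
          · have hx1 : R + 1 < ‖x‖ := by simpa [hBdef] using hx
            have e1 : g x = 0 := hgz x (by simp; linarith)
            have e2 : g (x + a) = 0 := hgz _ (by
              simp only [Metric.mem_closedBall, dist_zero_right, not_le]
              have := norm_sub_le (x + a) a
              rw [add_sub_cancel_right] at this
              linarith)
            simp [e1, e2, hx]
      _ = ENNReal.ofReal η * (volume B) ^ (1 / p.toReal) := by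
          rw [eLpNorm_indicator_const Metric.isClosed_closedBall.measurableSet hp0 hp]
          rw [Real.enorm_eq_ofReal hη0.le]
      _ ≤ ε / 3 := hη
  filter_upwards [hgt] with a ha
  have hsm : ∀ h : EV m → ℝ, AEStronglyMeasurable h volume →
      AEStronglyMeasurable (fun x => h (x + a)) volume := fun h hh =>
    hh.comp_measurePreserving (measurePreserving_add_right volume a)
  have e : (fun x => f (x + a) - f x)
      = ((fun x => (f - g) (x + a)) + (fun x => g (x + a) - g x)) + (g - f) := by
    funext x; simp
  rw [e]
  have m1 := hsm _ (hf.1.sub hgLp.1)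
  have m2 : AEStronglyMeasurable (fun x => g (x + a) - g x) volume := (hsm _ hgLp.1).sub hgLp.1
  refine (eLpNorm_add_le (m1.add m2) (hgLp.1.sub hf.1) hp1).trans ?_
  have b1 : eLpNorm (fun x => (f - g) (x + a)) p volume ≤ ε / 3 := by
    have := eLpNorm_translate (f - g) (hf.1.sub hgLp.1) p a Set.univ Set.univ
      MeasurableSet.univ MeasurableSet.univ (by simp)
    simp only [Measure.restrict_univ] at this
    exact this.trans hfg
  have b3 : eLpNorm (g - f) p volume ≤ ε / 3 := by rw [eLpNorm_sub_comm]; exact hfg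
  calc _ ≤ (eLpNorm (fun x => (f - g) (x + a)) p volume
        + eLpNorm (fun x => g (x + a) - g x) p volume) + eLpNorm (g - f) p volume := by
        gcongr; exact eLpNorm_add_le m1 m2 hp1
    _ ≤ (ε / 3 + ε / 3) + ε / 3 := by gcongr
    _ = ε := ENNReal.add_thirds ε

end PartOne

section PartTwo

/-- Averaging with the weight `η` at scale `s`. -/
def moll {m : ℕ} (η : EV m → ℝ) (s : ℝ) (f : EV m → ℝ) (x : EV m) : ℝ :=
  ∫ y, η y * f (x - s • y)

/-- `g` is the weak derivative of `f` in direction `h` on `U`. -/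
def WeakDir {m : ℕ} (U : Set (EV m)) (h : EV m) (f g : EV m → ℝ) : Prop :=
  ∀ φ : EV m → ℝ, ContDiff ℝ (⊤ : ℕ∞) φ → HasCompactSupport φ → tsupport φ ⊆ U →
    ∫ x in U, f x * fderiv ℝ φ x h = - ∫ x in U, g x * φ x

variable {m : ℕ}

lemma moll_eq_conv (η : EV m → ℝ) {s : ℝ} (hs : 0 < s) (f : EV m → ℝ) :
    moll η s f = convolution (fun t => (s ^ m)⁻¹ * η (s⁻¹ • t)) f
      (ContinuousLinearMap.lsmul ℝ ℝ) volume := by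
  funext x
  rw [convolution_def, moll]
  have h := Measure.integral_comp_smul (volume : Measure (EV m))
    (fun t => η (s⁻¹ • t) * f (x - t)) s
  simp only [smul_smul, inv_mul_cancel₀ hs.ne', one_smul] at h
  rw [h, finrank_euclideanSpace_fin, abs_of_nonneg (by positivity), smul_eq_mul,
    ← integral_const_mul]
  simp [mul_assoc]

lemma moll_eq_int (η : EV m → ℝ) {s : ℝ} (hs : 0 < s) (f : EV m → ℝ) (x : EV m) :
    moll η s f x = (s ^ m)⁻¹ * ∫ y, η (s⁻¹ • (x - y)) * f y := by
  rw [moll_eq_conv η hs f, convolution_def, ← integral_const_mul]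
  rw [← integral_sub_left_eq_self (fun y => (s ^ m)⁻¹ * (η (s⁻¹ • (x - y)) * f y)) volume x]
  simp [mul_assoc]

lemma kernel_contDiff {η : EV m → ℝ} (hη : ContDiff ℝ (⊤ : ℕ∞) η) (s : ℝ) :
    ContDiff ℝ (⊤ : ℕ∞) (fun t => (s ^ m)⁻¹ * η (s⁻¹ • t)) :=
  contDiff_const.mul (hη.comp (contDiff_const_smul _))

lemma kernel_hcs {η : EV m → ℝ} (hc : HasCompactSupport η) {s : ℝ} (hs : 0 < s) :
    HasCompactSupport (fun t => (s ^ m)⁻¹ * η (s⁻¹ • t)) := by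
  have : HasCompactSupport (fun t => η (s⁻¹ • t)) := hc.comp_smul (inv_ne_zero hs.ne')
  exact this.mul_left

lemma moll_contDiff {η : EV m → ℝ} (hη : ContDiff ℝ (⊤ : ℕ∞) η) (hc : HasCompactSupport η)
    {s : ℝ} (hs : 0 < s) {f : EV m → ℝ} (hf : LocallyIntegrable f volume) :
    ContDiff ℝ (⊤ : ℕ∞) (moll η s f) := by
  rw [moll_eq_conv η hs f]
  exact (kernel_hcs hc hs).contDiff_convolution_left _ (kernel_contDiff hη s) hf

lemma fderivApply_contDiff {η : EV m → ℝ} (hη : ContDiff ℝ (⊤ : ℕ∞) η) (h : EV m) :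
    ContDiff ℝ (⊤ : ℕ∞) (fun y => fderiv ℝ η y h) :=
  (hη.fderiv_right (m := (⊤ : ℕ∞)) (by simp)).clm_apply contDiff_const

lemma fderivApply_hcs {η : EV m → ℝ} (hc : HasCompactSupport η) (h : EV m) :
    HasCompactSupport (fun y => fderiv ℝ η y h) :=
  hc.fderiv_apply (𝕜 := ℝ) h

lemma tsupport_fderivApply {η : EV m → ℝ} (h : EV m) :
    tsupport (fun y => fderiv ℝ η y h) ⊆ tsupport η :=
  tsupport_fderiv_apply_subset ℝ h

lemma moll_fderiv {η : EV m → ℝ} (hη : ContDiff ℝ (⊤ : ℕ∞) η) (hc : HasCompactSupport η)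
    {s : ℝ} (hs : 0 < s) {f : EV m → ℝ} (hf : LocallyIntegrable f volume) (x h : EV m) :
    fderiv ℝ (moll η s f) x h = s⁻¹ * moll (fun y => fderiv ℝ η y h) s f x := by
  have hκ := kernel_contDiff hη s
  have hκc := kernel_hcs hc hs
  have H := hκc.hasFDerivAt_convolution_left (ContinuousLinearMap.lsmul ℝ ℝ)
    (hκ.of_le (by exact_mod_cast le_top)) hf x
  rw [moll_eq_conv η hs f, H.fderiv, moll_eq_conv _ hs f, convolution_def, convolution_def]
  rw [ContinuousLinearMap.integral_apply]
  · rw [← integral_const_mul]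
    refine integral_congr_ae (Eventually.of_forall fun t => ?_)
    have e : fderiv ℝ (fun t => (s ^ m)⁻¹ * η (s⁻¹ • t)) t h
        = (s ^ m)⁻¹ * (s⁻¹ * fderiv ℝ η (s⁻¹ • t) h) := by
      have h1 : HasFDerivAt (fun t : EV m => s⁻¹ • t) (s⁻¹ • ContinuousLinearMap.id ℝ (EV m)) t :=
        (hasFDerivAt_id t).const_smul s⁻¹
      have h2 : HasFDerivAt (fun t : EV m => η (s⁻¹ • t)) _ t :=
        ((hη.differentiable (by simp)).differentiableAt (x := s⁻¹ • t)).hasFDerivAt.comp t h1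
      have h3 := h2.const_mul ((s ^ m)⁻¹)
      rw [h3.fderiv]
      simp
    simp only [ContinuousLinearMap.precompL_apply, ContinuousLinearMap.lsmul_apply, smul_eq_mul]
    rw [e]; ring
  · have hc1 : HasCompactSupport (fderiv ℝ (fun t => (s ^ m)⁻¹ * η (s⁻¹ • t))) :=
      hκc.fderiv (𝕜 := ℝ)
    have hc2 : Continuous (fderiv ℝ (fun t => (s ^ m)⁻¹ * η (s⁻¹ • t))) :=
      hκ.continuous_fderiv (by simp)
    have := hc1.convolutionExists_left
      ((ContinuousLinearMap.lsmul ℝ ℝ : ℝ →L[ℝ] ℝ →L[ℝ] ℝ).precompL (EV m)) hc2 hf x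
    exact this

/-- Mollification commutes with weak derivatives where the kernel stays inside `U`. -/
lemma moll_weak {η : EV m → ℝ} (hη : ContDiff ℝ (⊤ : ℕ∞) η) (hc : HasCompactSupport η)
    {s : ℝ} (hs : 0 < s) {f g : EV m → ℝ} {U : Set (EV m)} {h : EV m}
    (hfg : WeakDir U h f g) (x : EV m) (hx : ∀ y ∈ tsupport η, x - s • y ∈ U) :
    s⁻¹ * moll (fun y => fderiv ℝ η y h) s f x = moll η s g x := by
  set φ : EV m → ℝ := fun y => η (s⁻¹ • (x - y)) with hφ
  have hcont : Continuous (fun y : EV m => s⁻¹ • (x - y)) := by fun_prop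
  have hsup : ∀ y, y ∈ tsupport φ → s⁻¹ • (x - y) ∈ tsupport η := by
    intro y hy
    exact tsupport_comp_subset_preimage η hcont hy
  have hφU : tsupport φ ⊆ U := by
    intro y hy
    have := hx _ (hsup y hy)
    rw [smul_inv_smul₀ hs.ne'] at this
    have e : x - (x - y) = y := by abel
    rwa [e] at this
  have hφc : HasCompactSupport φ := by
    have h1 : HasCompactSupport (fun t => η (s⁻¹ • t)) := hc.comp_smul (inv_ne_zero hs.ne')
    exact h1.comp_homeomorph (Homeomorph.subLeft x)
  have hφs : ContDiff ℝ (⊤ : ℕ∞) φ := hη.comp ((contDiff_const.sub contDiff_id).const_smul _)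
  have H := hfg φ hφs hφc hφU
  have hd : ∀ y, fderiv ℝ φ y h = - (s⁻¹ * fderiv ℝ η (s⁻¹ • (x - y)) h) := by
    intro y
    have h1 : HasFDerivAt (fun y : EV m => s⁻¹ • (x - y)) (s⁻¹ • (-ContinuousLinearMap.id ℝ (EV m))) y :=
      ((hasFDerivAt_id y).const_sub x).const_smul s⁻¹
    have h2 : HasFDerivAt φ _ y :=
        ((hη.differentiable (by simp)).differentiableAt (x := s⁻¹ • (x - y))).hasFDerivAt.comp y h1
    rw [h2.fderiv]; simp
  have z1 : ∀ y ∉ U, f y * fderiv ℝ φ y h = 0 := by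
    intro y hy
    have : y ∉ tsupport (fun y => fderiv ℝ φ y h) := fun h' => hy (hφU (tsupport_fderivApply h h'))
    rw [image_eq_zero_of_notMem_tsupport this, mul_zero]
  have z2 : ∀ y ∉ U, g y * φ y = 0 := by
    intro y hy
    rw [image_eq_zero_of_notMem_tsupport (fun h' => hy (hφU h')), mul_zero]
  rw [setIntegral_eq_integral_of_forall_compl_eq_zero z1,
    setIntegral_eq_integral_of_forall_compl_eq_zero z2] at H
  rw [moll_eq_int _ hs, moll_eq_int _ hs]
  have e1 : ∫ y, f y * fderiv ℝ φ y h
      = - (s⁻¹ * ∫ y, fderiv ℝ η (s⁻¹ • (x - y)) h * f y) := by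
    rw [← integral_const_mul, ← integral_neg]
    congr 1; funext y; rw [hd]; ring
  have e2 : ∫ y, g y * φ y = ∫ y, η (s⁻¹ • (x - y)) * g y := by
    congr 1; funext y; rw [hφ]; ring
  rw [e1, e2] at H
  have H' : s⁻¹ * ∫ y, fderiv ℝ η (s⁻¹ • (x - y)) h * f y = ∫ y, η (s⁻¹ • (x - y)) * g y := by
    linarith
  rw [← H']; ring

/-- total mass of `|η|` -/
def mass (η : EV m → ℝ) : ℝ≥0∞ := ∫⁻ y, ‖η y‖ₑ

lemma mass_ne_top {η : EV m → ℝ} (hη : Continuous η) (hc : HasCompactSupport η) :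
    mass η ≠ ⊤ := (hη.integrable_of_hasCompactSupport hc).2.ne

lemma moll_pointwise {η : EV m → ℝ} (hη : Continuous η) (s : ℝ) {f : EV m → ℝ}
    (hf : Measurable f) (x : EV m) :
    ‖moll η s f x‖ₑ ≤ ∫⁻ y, ‖f (x - s • y)‖ₑ ∂(volume.withDensity fun y => ‖η y‖ₑ) := by
  rw [lintegral_withDensity_eq_lintegral_mul _ (by fun_prop) (by fun_prop)]
  refine (enorm_integral_le_lintegral_enorm _).trans (le_of_eq ?_)
  congr 1; funext y; simp [enorm_mul]

lemma massMeasure_finite {η : EV m → ℝ} (hη : Continuous η) (hc : HasCompactSupport η) :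
    IsFiniteMeasure ((volume : Measure (EV m)).withDensity fun y => ‖η y‖ₑ) :=
  isFiniteMeasure_withDensity (mass_ne_top hη hc)

lemma ae_massMeasure {η : EV m → ℝ} (hη : Continuous η) {P : EV m → Prop}
    (hP : ∀ y ∈ tsupport η, P y) :
    ∀ᵐ y ∂((volume : Measure (EV m)).withDensity fun y => ‖η y‖ₑ), P y := by
  rw [ae_withDensity_iff (by fun_prop)]
  refine Eventually.of_forall fun y hy => hP y (subset_tsupport _ ?_)
  simpa using hy

lemma massMeasure_univ (η : EV m → ℝ) :
    ((volume : Measure (EV m)).withDensity fun y => ‖η y‖ₑ) Set.univ = mass η := by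
  rw [withDensity_apply _ MeasurableSet.univ, Measure.restrict_univ, mass]

lemma moll_eLpNorm_le {η : EV m → ℝ} (hη : Continuous η) (hc : HasCompactSupport η) (s : ℝ)
    {f : EV m → ℝ} (hf : Measurable f) {p : ℝ≥0∞} (hp1 : 1 ≤ p) (hp : p ≠ ⊤) {A B : Set (EV m)}
    (hA : MeasurableSet A) (hB : MeasurableSet B)
    (hAB : ∀ x ∈ A, ∀ y ∈ tsupport η, x - s • y ∈ B) :
    eLpNorm (moll η s f) p (volume.restrict A) ≤ mass η * eLpNorm f p (volume.restrict B) := by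
  have := massMeasure_finite hη hc
  refine (eLpNorm_mono_enorm (g := fun x => ∫⁻ y, ‖f (x - s • y)‖ₑ
    ∂(volume.withDensity fun y => ‖η y‖ₑ)) fun x => ?_).trans ?_
  · simpa using moll_pointwise hη s hf x
  · rw [← massMeasure_univ]
    refine eLpNorm_lintegral_le _ _ hp1 hp (fun x y => ‖f (x - s • y)‖ₑ) ?_ _ ?_
    · simp only [Function.uncurry_def]; fun_prop
    · refine ae_massMeasure hη fun y hy => ?_
      rw [eLpNorm_enorm]
      simp_rw [sub_eq_add_neg]
      exact eLpNorm_translate f hf.aestronglyMeasurable p _ A B hA hB fun x hx => by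
        rw [← sub_eq_add_neg]; exact hAB x hx y hy

lemma integrable_mul_shift {η : EV m → ℝ} (hη : Continuous η) (hc : HasCompactSupport η) {s : ℝ}
    (hs : 0 < s) {f : EV m → ℝ} (hf : LocallyIntegrable f volume) (x : EV m) :
    Integrable (fun y => η y * f (x - s • y)) volume := by
  have h1 : HasCompactSupport (fun t => η (s⁻¹ • t)) := hc.comp_smul (inv_ne_zero hs.ne')
  have h2 : Continuous (fun t => η (s⁻¹ • t)) := by fun_prop
  have h3 := h1.convolutionExists_left (ContinuousLinearMap.lsmul ℝ ℝ) h2 hf x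
  have h4 := (integrable_comp_smul_iff volume (fun t => η (s⁻¹ • t) * f (x - t)) hs.ne').2 h3
  simpa [smul_smul, inv_mul_cancel₀ hs.ne'] using h4

lemma moll_sub_eLpNorm_le {η : EV m → ℝ} (hη : Continuous η) (hc : HasCompactSupport η)
    (h1 : ∫ y, η y = 1) {s : ℝ} (hs : 0 < s)
    {f : EV m → ℝ} (hf : Measurable f) (hfl : LocallyIntegrable f volume)
    {p : ℝ≥0∞} (hp1 : 1 ≤ p) (hp : p ≠ ⊤) {A : Set (EV m)} {B : ℝ≥0∞}
    (hB : ∀ y ∈ tsupport η, eLpNorm (fun x => f (x - s • y) - f x) p (volume.restrict A) ≤ B) :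
    eLpNorm (fun x => moll η s f x - f x) p (volume.restrict A) ≤ mass η * B := by
  have := massMeasure_finite hη hc
  refine (eLpNorm_mono_enorm (g := fun x => ∫⁻ y, ‖f (x - s • y) - f x‖ₑ
    ∂(volume.withDensity fun y => ‖η y‖ₑ)) fun x => ?_).trans ?_
  · have e : moll η s f x - f x = ∫ y, η y * (f (x - s • y) - f x) := by
      simp_rw [mul_sub]
      rw [integral_sub (integrable_mul_shift hη hc hs hfl x)
        ((hη.integrable_of_hasCompactSupport hc).mul_const _), integral_mul_const, h1, one_mul]
      rfl
    rw [e, enorm_eq_self, lintegral_withDensity_eq_lintegral_mul _ (by fun_prop) (by fun_prop)]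
    refine (enorm_integral_le_lintegral_enorm _).trans (le_of_eq ?_)
    congr 1; funext y; simp [enorm_mul]
  · rw [← massMeasure_univ]
    refine eLpNorm_lintegral_le _ _ hp1 hp (fun x y => ‖f (x - s • y) - f x‖ₑ) ?_ _ ?_
    · simp only [Function.uncurry_def]; fun_prop
    · refine ae_massMeasure hη fun y hy => ?_
      rw [eLpNorm_enorm]
      exact hB y hy

lemma tendsto_moll {η : EV m → ℝ} (hη : Continuous η) (hc : HasCompactSupport η)
    (h1 : ∫ y, η y = 1) {f : EV m → ℝ} (hf : Measurable f)
    {p : ℝ≥0∞} (hp1 : 1 ≤ p) (hp : p ≠ ⊤) (hfp : MemLp f p volume) :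
    Tendsto (fun s : ℝ => eLpNorm (fun x => moll η s f x - f x) p volume) (𝓝[>] 0) (𝓝 0) := by
  have ht := tendsto_eLpNorm_translate f hp1 hp hfp
  obtain ⟨R, hR⟩ := hc.isCompact.isBounded.subset_closedBall (0 : EV m)
  have hm := mass_ne_top hη hc
  rw [ENNReal.tendsto_nhds_zero]
  intro ε hε
  obtain ⟨δ, hδ0, hδ⟩ : ∃ δ : ℝ≥0∞, 0 < δ ∧ mass η * δ ≤ ε := by
    rcases eq_or_ne (mass η) 0 with h0 | h0
    · exact ⟨1, by simp, by simp [h0]⟩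
    · exact ⟨ε / mass η, by simp [hε.ne', hm], by rw [ENNReal.mul_div_cancel h0 hm]⟩
  have := (ENNReal.tendsto_nhds_zero.1 ht) δ hδ0
  obtain ⟨r, hr0, hr⟩ := Metric.eventually_nhds_iff.1 this
  have hpos : 0 < r / (|R| + 1) := by positivity
  filter_upwards [Ioo_mem_nhdsGT hpos] with s hs
  refine le_trans ?_ hδ
  have hl := moll_sub_eLpNorm_le (A := Set.univ) (B := δ) hη hc h1 hs.1 hf (hfp.locallyIntegrable hp1) hp1 hp ?_
  · simpa using hl
  · intro y hy
    rw [Measure.restrict_univ]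
    have hyR : ‖y‖ ≤ R := by simpa using hR hy
    have hlt : ‖-(s • y)‖ < r := by
      rw [norm_neg, norm_smul, Real.norm_of_nonneg hs.1.le]
      have h2 := hs.2
      rw [lt_div_iff₀ (by positivity)] at h2
      have : ‖y‖ ≤ |R| + 1 := hyR.trans (by linarith [le_abs_self R])
      calc s * ‖y‖ ≤ s * (|R| + 1) := by gcongr; exact hs.1.le
        _ < r := h2
    have := hr (y := -(s • y)) (by simpa using hlt)
    simpa [sub_eq_add_neg] using this

end PartTwo

section PartThree

variable {m : ℕ}

/-- A mollification kernel. -/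
structure Mol (η : EV m → ℝ) : Prop where
  smooth : ContDiff ℝ (⊤ : ℕ∞) η
  hcs : HasCompactSupport η
  int : ∫ y, η y = 1

/-- `U` is stable under the shifts used by mollification with `η`. -/
def StarU (η : EV m → ℝ) (U : Set (EV m)) : Prop :=
  ∀ x ∈ U, ∀ y ∈ tsupport η, ∀ s : ℝ, 0 < s → x - s • y ∈ U

lemma Mol.cont {η : EV m → ℝ} (h : Mol η) : Continuous η := h.smooth.continuous

lemma toReal_one_le {p : ℝ≥0∞} (hp1 : 1 ≤ p) (hp : p ≠ ⊤) : 1 ≤ p.toReal := by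
  rw [← ENNReal.toReal_one]; exact (ENNReal.toReal_le_toReal (by simp) hp).2 hp1

lemma jensen_lintegral {Z : Type*} [MeasurableSpace Z] (μ : Measure Z) (hμ : μ Set.univ = 1)
    {r : ℝ} (hr : 1 ≤ r) (f : Z → ℝ≥0∞) (hf : Measurable f) :
    (∫⁻ z, f z ∂μ) ^ r ≤ ∫⁻ z, f z ^ r ∂μ := by
  have hr0 : 0 < r := by linarith
  have h1 := eLpNorm_le_eLpNorm_mul_rpow_measure_univ (μ := μ) (p := 1) (q := ENNReal.ofReal r)
    (by simpa using hr) hf.aestronglyMeasurable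
  rw [eLpNorm_one_eq_lintegral_enorm, eLpNorm_eq_lintegral_rpow_enorm_toReal
    (by simpa using hr0) (by simp), hμ, ENNReal.one_rpow, mul_one, ENNReal.toReal_ofReal hr0.le] at h1
  simp only [enorm_eq_self] at h1
  have h2 := ENNReal.rpow_le_rpow h1 hr0.le
  rw [← ENNReal.rpow_mul] at h2
  have e1 : 1 / r * r = 1 := by field_simp
  rwa [e1, ENNReal.rpow_one] at h2

lemma eLpNorm_rpow_eq {X : Type*} [MeasurableSpace X] {F : Type*} [NormedAddCommGroup F]
    (μ : Measure X) {p : ℝ≥0∞} (hp1 : 1 ≤ p)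
    (hp : p ≠ ⊤) (f : X → F) :
    (eLpNorm f p μ) ^ p.toReal = ∫⁻ x, ‖f x‖ₑ ^ p.toReal ∂μ := by
  have hp0 : p ≠ 0 := (lt_of_lt_of_le zero_lt_one hp1).ne'
  have := toReal_one_le hp1 hp
  rw [eLpNorm_eq_lintegral_rpow_enorm_toReal hp0 hp, ← ENNReal.rpow_mul]
  have e1 : 1 / p.toReal * p.toReal = 1 := by field_simp
  rw [e1, ENNReal.rpow_one]

lemma eLpNorm_rpow_eq' {X : Type*} [MeasurableSpace X] 
    (μ : Measure X) {p : ℝ≥0∞} (hp1 : 1 ≤ p)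
    (hp : p ≠ ⊤) (f : X → ℝ≥0∞) :
    (eLpNorm f p μ) ^ p.toReal = ∫⁻ x, f x ^ p.toReal ∂μ := by
  have hp0 : p ≠ 0 := (lt_of_lt_of_le zero_lt_one hp1).ne'
  have := toReal_one_le hp1 hp
  rw [eLpNorm_eq_lintegral_rpow_enorm_toReal hp0 hp, ← ENNReal.rpow_mul]
  have e1 : 1 / p.toReal * p.toReal = 1 := by field_simp
  rw [e1, ENNReal.rpow_one]; simp

lemma enorm_sub_le_lintegral {F : EV m → ℝ} (hF : ContDiff ℝ 1 F) (x h : EV m) :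
    ‖F (x + h) - F x‖ₑ ≤ ∫⁻ σ in Set.Ioc (0 : ℝ) 1, ‖fderiv ℝ F (x + σ • h) h‖ₑ := by
  have hd : ∀ σ : ℝ, HasDerivAt (fun σ : ℝ => F (x + σ • h)) (fderiv ℝ F (x + σ • h) h) σ := by
    intro σ
    have h1 : HasDerivAt (fun σ : ℝ => x + σ • h) h σ := by
      simpa using ((hasDerivAt_id σ).smul_const h).const_add x
    exact ((hF.differentiable (by simp)).differentiableAt.hasFDerivAt).comp_hasDerivAt σ h1
  have hc : Continuous fun σ : ℝ => fderiv ℝ F (x + σ • h) h := by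
    have := hF.continuous_fderiv (by simp)
    fun_prop
  have e := intervalIntegral.integral_eq_sub_of_hasDerivAt (a := 0) (b := 1)
    (fun σ _ => hd σ) (hc.intervalIntegrable 0 1)
  simp only [one_smul, zero_smul, add_zero] at e
  rw [← e, intervalIntegral.integral_of_le zero_le_one]
  exact enorm_integral_le_lintegral_enorm _

lemma enorm_le_lintegral_line {F : EV m → ℝ} (hF : ContDiff ℝ 1 F) (x h : EV m) :
    ‖F x‖ₑ ≤ ∫⁻ σ in Set.Ioc (0 : ℝ) 1, (‖F (x + σ • h)‖ₑ + ‖fderiv ℝ F (x + σ • h) h‖ₑ) := by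
  have hcF := hF.continuous
  have hcf := hF.continuous_fderiv (by simp)
  have key : ∀ σ ∈ Set.Ioc (0:ℝ) 1, ‖F x‖ₑ ≤ ‖F (x + σ • h)‖ₑ +
      ∫⁻ σ in Set.Ioc (0 : ℝ) 1, ‖fderiv ℝ F (x + σ • h) h‖ₑ := by
    intro σ hσ
    have h1 := enorm_sub_le_lintegral hF x (σ • h)
    have h2 : ‖F x‖ₑ ≤ ‖F (x + σ • h)‖ₑ + ‖F (x + σ • h) - F x‖ₑ := by
      have : F x = F (x + σ • h) - (F (x + σ • h) - F x) := by ring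
      nth_rewrite 1 [this]
      exact enorm_sub_le
    refine h2.trans (add_le_add le_rfl ?_)
    -- bound via the derivative along the shorter segment
    have hd : ∀ σ : ℝ, HasDerivAt (fun σ : ℝ => F (x + σ • h)) (fderiv ℝ F (x + σ • h) h) σ := by
      intro σ
      have h1 : HasDerivAt (fun σ : ℝ => x + σ • h) h σ := by
        simpa using ((hasDerivAt_id σ).smul_const h).const_add x
      exact ((hF.differentiable (by simp)).differentiableAt.hasFDerivAt).comp_hasDerivAt σ h1
    have hc : Continuous fun σ : ℝ => fderiv ℝ F (x + σ • h) h := by fun_prop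
    have e := intervalIntegral.integral_eq_sub_of_hasDerivAt (a := 0) (b := σ)
      (fun σ _ => hd σ) (hc.intervalIntegrable 0 σ)
    simp only [zero_smul, add_zero] at e
    rw [← e, intervalIntegral.integral_of_le hσ.1.le]
    refine (enorm_integral_le_lintegral_enorm _).trans ?_
    exact lintegral_mono_set (Set.Ioc_subset_Ioc_right hσ.2)
  have hFm : Measurable fun σ : ℝ => ‖F (x + σ • h)‖ₑ :=
    (by fun_prop : Continuous fun σ : ℝ => F (x + σ • h)).measurable.enorm
  calc ‖F x‖ₑ = ∫⁻ σ in Set.Ioc (0 : ℝ) 1, ‖F x‖ₑ := by simp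
    _ ≤ ∫⁻ σ in Set.Ioc (0 : ℝ) 1, (‖F (x + σ • h)‖ₑ +
      ∫⁻ σ in Set.Ioc (0 : ℝ) 1, ‖fderiv ℝ F (x + σ • h) h‖ₑ) :=
        setLIntegral_mono (hFm.add_const _) key
    _ = _ := by
        rw [lintegral_add_left hFm, lintegral_add_left hFm]
        simp

lemma moll_fderiv_on {η : EV m → ℝ} (hη : Mol η) {U : Set (EV m)}
    (hst : StarU η U) {f g : EV m → ℝ} (hf : LocallyIntegrable f volume) {h : EV m}
    (hfg : WeakDir U h f g) {r : ℝ} (hr : 0 < r) {x : EV m} (hx : x ∈ U) :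
    fderiv ℝ (moll η r f) x h = moll η r g x := by
  rw [moll_fderiv hη.smooth hη.hcs hr hf, moll_weak hη.smooth hη.hcs hr hfg x]
  exact fun y hy => hst x hx y hy r hr

lemma moll_measurable {η : EV m → ℝ} (hη : Mol η) {f : EV m → ℝ} (hf : LocallyIntegrable f volume)
    {r : ℝ} (hr : 0 < r) : Measurable (moll η r f) :=
  (moll_contDiff hη.smooth hη.hcs hr hf).continuous.measurable

/-- Lemma T. -/
lemma weak_shift {η : EV m → ℝ} (hη : Mol η) {U A B : Set (EV m)} (hA : MeasurableSet A)
    (hB : MeasurableSet B) (hst : StarU η U) {f g : EV m → ℝ} (hf : Measurable f)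
    (hg : Measurable g) {p : ℝ≥0∞} (hp1 : 1 ≤ p) (hp : p ≠ ⊤) (hfp : MemLp f p volume)
    (hgp : MemLp g p volume) {h : EV m} (hfg : WeakDir U h f g)
    (hAB : ∀ x ∈ A, ∀ σ ∈ Set.Icc (0 : ℝ) 1, x + σ • h ∈ B) (hBU : B ⊆ U) :
    eLpNorm (fun x => f (x + h) - f x) p (volume.restrict A) ≤ eLpNorm g p (volume.restrict B) := by
  have hfl := hfp.locallyIntegrable hp1
  have hgl := hgp.locallyIntegrable hp1
  have step : ∀ r : ℝ, 0 < r → eLpNorm (fun x => moll η r f (x + h) - moll η r f x) p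
      (volume.restrict A) ≤ eLpNorm (moll η r g) p (volume.restrict B) := by
    intro r hr
    have hgm := moll_measurable hη hgl hr
    have hC1 : ContDiff ℝ 1 (moll η r f) :=
      (moll_contDiff hη.smooth hη.hcs hr hfl).of_le (by exact_mod_cast le_top)
    refine (eLpNorm_mono_enorm_ae (g := fun x => ∫⁻ σ in Set.Ioc (0:ℝ) 1, ‖moll η r g (x + σ • h)‖ₑ)
      ?_).trans ?_
    · filter_upwards [ae_restrict_mem hA] with x hx
      rw [enorm_eq_self]
      refine (enorm_sub_le_lintegral hC1 x h).trans (le_of_eq ?_)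
      refine setLIntegral_congr_fun measurableSet_Ioc fun σ hσ => ?_
      rw [moll_fderiv_on hη hst hfl hfg hr (hBU (hAB x hx σ ⟨hσ.1.le, hσ.2⟩))]
    · have := eLpNorm_lintegral_le (volume.restrict A) (volume.restrict (Set.Ioc (0:ℝ) 1)) hp1 hp
        (fun x σ => ‖moll η r g (x + σ • h)‖ₑ) (by simp only [Function.uncurry_def]; fun_prop)
        (eLpNorm (moll η r g) p (volume.restrict B)) ?_
      · simpa using this
      · filter_upwards [ae_restrict_mem measurableSet_Ioc] with σ hσ
        rw [eLpNorm_enorm]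
        exact eLpNorm_translate _ hgm.aestronglyMeasurable p _ A B hA hB
          fun x hx => hAB x hx σ ⟨hσ.1.le, hσ.2⟩
  have bound : ∀ r : ℝ, 0 < r → eLpNorm (fun x => f (x + h) - f x) p (volume.restrict A)
      ≤ eLpNorm (fun x => moll η r f x - f x) p volume +
        (eLpNorm (fun x => moll η r g x - g x) p volume + eLpNorm g p (volume.restrict B))
        + eLpNorm (fun x => moll η r f x - f x) p volume := by
    intro r hr
    have hgm := moll_measurable hη hgl hr
    have hfm := moll_measurable hη hfl hr
    have e : (fun x => f (x + h) - f x) = (fun x => - (moll η r f (x + h) - f (x + h)))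
        + (fun x => moll η r f (x + h) - moll η r f x) + (fun x => moll η r f x - f x) := by
      funext x; simp
    rw [e]
    have m1 : Measurable (fun x => - (moll η r f (x + h) - f (x + h))) := by fun_prop
    have m2 : Measurable (fun x => moll η r f (x + h) - moll η r f x) := by fun_prop
    have m3 : Measurable (fun x => moll η r f x - f x) := by fun_prop
    refine (eLpNorm_add_le (m1.add m2).aestronglyMeasurable m3.aestronglyMeasurable hp1).trans ?_
    gcongr
    · refine (eLpNorm_add_le m1.aestronglyMeasurable m2.aestronglyMeasurable hp1).trans ?_
      gcongr
      · have : eLpNorm (fun x => - (moll η r f (x + h) - f (x + h))) p (volume.restrict A)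
          = eLpNorm (fun x => (moll η r f (x + h) - f (x + h))) p (volume.restrict A) :=
          eLpNorm_neg (f := fun x => (moll η r f (x + h) - f (x + h))) ..
        rw [this]
        have := eLpNorm_translate (fun x => moll η r f x - f x) m3.aestronglyMeasurable p h A Set.univ
          hA MeasurableSet.univ (by simp)
        simpa using this
      · refine (step r hr).trans ?_
        have e2 : moll η r g = (fun x => moll η r g x - g x) + g := by funext x; simp
        have m4 : Measurable (fun x => moll η r g x - g x) := by fun_prop
        nth_rewrite 1 [e2]
        refine (eLpNorm_add_le m4.aestronglyMeasurable hg.aestronglyMeasurable hp1).trans ?_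
        gcongr
        exact Measure.restrict_le_self
    · exact Measure.restrict_le_self
  have tf := tendsto_moll hη.cont hη.hcs hη.int hf hp1 hp hfp
  have tg := tendsto_moll hη.cont hη.hcs hη.int hg hp1 hp hgp
  have lim := (tf.add (tg.add_const (eLpNorm g p (volume.restrict B)))).add tf
  simp only [zero_add, add_zero] at lim
  refine ge_of_tendsto lim ?_
  filter_upwards [self_mem_nhdsWithin] with r hr using bound r hr

/-- Smooth weighted trace inequality. -/
lemma weighted_trace_smooth {U : Set (EV m)} (hU : MeasurableSet U) {e : EV m}
    (hup : ∀ x ∈ U, ∀ s : ℝ, 0 < s → x + s • e ∈ U) {E : EV m → ℝ≥0∞} (hE : Measurable E)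
    {p : ℝ≥0∞} (hp1 : 1 ≤ p) (hp : p ≠ ⊤) {κ : ℝ≥0∞}
    (hκ : ∀ x, ∫⁻ s : ℝ, U.indicator (fun y => E y ^ p.toReal) (x + s • e) ≤ κ)
    {F : EV m → ℝ} (hF : ContDiff ℝ 1 F) :
    eLpNorm (fun x => E x * ‖F x‖ₑ) p (volume.restrict U)
      ≤ κ ^ (1 / p.toReal) * (eLpNorm F p (volume.restrict U)
        + eLpNorm (fun x => fderiv ℝ F x e) p (volume.restrict U)) := by
  have hr := toReal_one_le hp1 hp
  have hr0 : 0 < p.toReal := by linarith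
  have hcF := hF.continuous
  have hcf := hF.continuous_fderiv (by simp)
  set H : EV m → ℝ≥0∞ := fun x => ‖F x‖ₑ + ‖fderiv ℝ F x e‖ₑ with hH
  have hHm : Measurable H := by simp only [hH]; fun_prop
  have hHn : eLpNorm H p (volume.restrict U) ≤ eLpNorm F p (volume.restrict U)
        + eLpNorm (fun x => fderiv ℝ F x e) p (volume.restrict U) := by
    have := eLpNorm_add_le (μ := volume.restrict U) (f := fun x => ‖F x‖ₑ) (g := fun x => ‖fderiv ℝ F x e‖ₑ)
      (p := p) (by fun_prop) (by fun_prop) hp1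
    rw [eLpNorm_enorm, eLpNorm_enorm] at this
    exact this
  refine le_trans ?_ (mul_le_mul_right hHn _)
  rw [← ENNReal.rpow_le_rpow_iff hr0, ENNReal.mul_rpow_of_nonneg _ _ hr0.le, ← ENNReal.rpow_mul,
    one_div_mul_cancel hr0.ne', ENNReal.rpow_one, eLpNorm_rpow_eq' _ hp1 hp, eLpNorm_rpow_eq' _ hp1 hp]
  set Et : EV m → ℝ≥0∞ := U.indicator (fun y => E y ^ p.toReal) with hEt
  set Ht : EV m → ℝ≥0∞ := U.indicator (fun y => H y ^ p.toReal) with hHt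
  have hEtm : Measurable Et := (hE.pow_const _).indicator hU
  have hHtm : Measurable Ht := (hHm.pow_const _).indicator hU
  calc ∫⁻ x in U, (E x * ‖F x‖ₑ) ^ p.toReal
      ≤ ∫⁻ x, ∫⁻ s in Set.Ioc (0:ℝ) 1, Et x * Ht (x + s • e) := by
        rw [← lintegral_indicator hU]
        refine lintegral_mono fun x => ?_
        by_cases hx : x ∈ U
        · rw [Set.indicator_of_mem hx, lintegral_const_mul _ (by fun_prop), hEt,
            Set.indicator_of_mem hx, ENNReal.mul_rpow_of_nonneg _ _ hr0.le]
          gcongr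
          refine (ENNReal.rpow_le_rpow (enorm_le_lintegral_line hF x e) hr0.le).trans ?_
          refine (jensen_lintegral _ (by simp) hr _ (by fun_prop)).trans (le_of_eq ?_)
          refine setLIntegral_congr_fun measurableSet_Ioc fun s hs => ?_
          rw [hHt, Set.indicator_of_mem (hup x hx s hs.1)]
        · simp [hx]
    _ = ∫⁻ s in Set.Ioc (0:ℝ) 1, ∫⁻ x, Et x * Ht (x + s • e) := by
        rw [lintegral_lintegral_swap]
        simp only [Function.uncurry_def]
        exact (by fun_prop : Measurable _).aemeasurable
    _ = ∫⁻ s in Set.Ioc (0:ℝ) 1, ∫⁻ y, Et (y - s • e) * Ht y := by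
        congr 1; funext s
        rw [← lintegral_sub_right_eq_self (fun x => Et x * Ht (x + s • e)) (s • e)]
        simp
    _ = ∫⁻ y, ∫⁻ s in Set.Ioc (0:ℝ) 1, Et (y - s • e) * Ht y := by
        rw [lintegral_lintegral_swap]
        simp only [Function.uncurry_def]
        exact (by fun_prop : Measurable _).aemeasurable
    _ ≤ ∫⁻ y, κ * Ht y := by
        refine lintegral_mono fun y => ?_
        rw [lintegral_mul_const _ (by fun_prop)]
        gcongr
        refine (setLIntegral_le_lintegral _ _).trans ?_
        refine le_trans (le_of_eq ?_) (hκ y)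
        rw [← lintegral_neg_eq_self (fun s : ℝ => Et (y + s • e))]
        simp [sub_eq_add_neg]
    _ = κ * ∫⁻ x in U, H x ^ p.toReal := by
        rw [lintegral_const_mul _ hHtm, hHt, lintegral_indicator hU]

lemma weighted_trace {η : EV m → ℝ} (hη : Mol η) {U : Set (EV m)} (hU : MeasurableSet U) {e : EV m}
    (hst : StarU η U)
    (hup : ∀ x ∈ U, ∀ s : ℝ, 0 < s → x + s • e ∈ U) {E : EV m → ℝ≥0∞} (hE : Measurable E)
    {C : ℝ≥0∞} (hC : C ≠ ⊤) (hEC : ∀ x ∈ U, E x ≤ C)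
    {p : ℝ≥0∞} (hp1 : 1 ≤ p) (hp : p ≠ ⊤) {κ : ℝ≥0∞} (hκt : κ ≠ ⊤)
    (hκ : ∀ x, ∫⁻ s : ℝ, U.indicator (fun y => E y ^ p.toReal) (x + s • e) ≤ κ)
    {f g : EV m → ℝ} (hf : Measurable f)
    (hg : Measurable g) (hfp : MemLp f p volume)
    (hgp : MemLp g p volume) (hfg : WeakDir U e f g) :
    eLpNorm (fun x => E x * ‖f x‖ₑ) p (volume.restrict U)
      ≤ κ ^ (1 / p.toReal) * (eLpNorm f p (volume.restrict U) + eLpNorm g p (volume.restrict U)) := by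
  have hr := toReal_one_le hp1 hp
  have hr0 : 0 < p.toReal := by linarith
  have hfl := hfp.locallyIntegrable hp1
  have hgl := hgp.locallyIntegrable hp1
  have hκp : κ ^ (1 / p.toReal) ≠ ⊤ := ENNReal.rpow_ne_top_of_nonneg (by positivity) hκt
  have nrm : ∀ r : ℝ, 0 < r → ∀ f : EV m → ℝ, Measurable f → MemLp f p volume →
      eLpNorm (moll η r f) p (volume.restrict U) ≤
        eLpNorm (fun x => moll η r f x - f x) p volume + eLpNorm f p (volume.restrict U) := by
    intro r hr f hf hfp
    have hfm := moll_measurable hη (hfp.locallyIntegrable hp1) hr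
    have e2 : moll η r f = (fun x => moll η r f x - f x) + f := by funext x; simp
    have m4 : Measurable (fun x => moll η r f x - f x) := by fun_prop
    nth_rewrite 1 [e2]
    refine (eLpNorm_add_le m4.aestronglyMeasurable hf.aestronglyMeasurable hp1).trans ?_
    gcongr
    exact Measure.restrict_le_self
  have bound : ∀ r : ℝ, 0 < r → eLpNorm (fun x => E x * ‖f x‖ₑ) p (volume.restrict U)
      ≤ C * eLpNorm (fun x => moll η r f x - f x) p volume +
        κ ^ (1 / p.toReal) * ((eLpNorm (fun x => moll η r f x - f x) p volume
          + eLpNorm f p (volume.restrict U)) + (eLpNorm (fun x => moll η r g x - g x) p volume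
          + eLpNorm g p (volume.restrict U))) := by
    intro r hr
    have hgm := moll_measurable hη hgl hr
    have hfm := moll_measurable hη hfl hr
    have hC1 : ContDiff ℝ 1 (moll η r f) :=
      (moll_contDiff hη.smooth hη.hcs hr hfl).of_le (by exact_mod_cast le_top)
    have h1 := weighted_trace_smooth hU hup hE hp1 hp hκ hC1
    have h2 : eLpNorm (fun x => fderiv ℝ (moll η r f) x e) p (volume.restrict U)
        = eLpNorm (moll η r g) p (volume.restrict U) := by
      refine eLpNorm_congr_ae ?_
      filter_upwards [ae_restrict_mem hU] with x hx
      exact moll_fderiv_on hη hst hfl hfg hr hx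
    rw [h2] at h1
    have m3 : Measurable (fun x => moll η r f x - f x) := by fun_prop
    have a1 : eLpNorm (fun x => E x * ‖f x‖ₑ) p (volume.restrict U)
        ≤ eLpNorm ((fun x => E x * ‖moll η r f x - f x‖ₑ) + (fun x => E x * ‖moll η r f x‖ₑ)) p
          (volume.restrict U) := by
      refine eLpNorm_mono_enorm fun x => ?_
      simp only [enorm_eq_self, Pi.add_apply, ← mul_add]
      gcongr
      have : f x = moll η r f x - (moll η r f x - f x) := by ring
      nth_rewrite 1 [this]
      rw [add_comm]
      exact enorm_sub_le
    refine a1.trans ((eLpNorm_add_le (hE.mul m3.enorm).aestronglyMeasurable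
      (hE.mul hfm.enorm).aestronglyMeasurable hp1).trans ?_)
    gcongr
    · calc eLpNorm (fun x => E x * ‖moll η r f x - f x‖ₑ) p (volume.restrict U)
          ≤ eLpNorm (fun x => C * ‖moll η r f x - f x‖ₑ) p (volume.restrict U) := by
            refine eLpNorm_mono_enorm_ae ?_
            filter_upwards [ae_restrict_mem hU] with x hx
            simp only [enorm_eq_self]
            gcongr
            exact hEC x hx
        _ = eLpNorm (fun x => C.toReal * (moll η r f x - f x)) p (volume.restrict U) := by
            refine eLpNorm_congr_enorm_ae (Eventually.of_forall fun x => ?_)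
            simp only [enorm_eq_self, enorm_mul]
            congr 1
            rw [Real.enorm_eq_ofReal ENNReal.toReal_nonneg, ENNReal.ofReal_toReal hC]
        _ ≤ eLpNorm (fun x => C.toReal * (moll η r f x - f x)) p volume :=
            eLpNorm_mono_measure _ Measure.restrict_le_self
        _ = C * eLpNorm (fun x => moll η r f x - f x) p volume := by
            have := eLpNorm_const_smul (μ := volume) (p := p) C.toReal (fun x => moll η r f x - f x)
            rw [Real.enorm_eq_ofReal ENNReal.toReal_nonneg, ENNReal.ofReal_toReal hC] at this
            exact this
    · refine h1.trans ?_
      gcongr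
      · exact nrm r hr f hf hfp
      · exact nrm r hr g hg hgp
  have tf := tendsto_moll hη.cont hη.hcs hη.int hf hp1 hp hfp
  have tg := tendsto_moll hη.cont hη.hcs hη.int hg hp1 hp hgp
  have lim := (ENNReal.Tendsto.const_mul tf (Or.inr hC)).add
    (ENNReal.Tendsto.const_mul ((tf.add_const (eLpNorm f p (volume.restrict U))).add
      (tg.add_const (eLpNorm g p (volume.restrict U)))) (Or.inr hκp))
  simp only [zero_add, mul_zero] at lim
  refine ge_of_tendsto lim ?_
  filter_upwards [self_mem_nhdsWithin] with r hr using bound r hr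

end PartThree

section PartFour

variable {m : ℕ}

/-- Geometry of a domain `{τ > 0}` above a graph in direction `e`. -/
structure Geo (e : EV m) (τ : EV m → ℝ) (K : ℝ) : Prop where
  e1 : ‖e‖ = 1
  K1 : 1 ≤ K
  smooth : ContDiff ℝ 3 τ
  shift : ∀ (x : EV m) (s : ℝ), τ (x + s • e) = τ x + s
  bd : ∀ k : ℕ, 1 ≤ k → k ≤ 3 → ∀ x, ‖iteratedFDeriv ℝ k τ x‖ ≤ K

def Om (τ : EV m → ℝ) : Set (EV m) := {x | 0 < τ x}

/-- boundary layer -/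
def Sl (τ : EV m → ℝ) (h : ℝ) : Set (EV m) := {x | 0 < τ x ∧ τ x ≤ h}

namespace Geo

variable {e : EV m} {τ : EV m → ℝ} {K : ℝ}

lemma Kpos (G : Geo e τ K) : 0 < K := by linarith [G.K1]

lemma cont (G : Geo e τ K) : Continuous τ := G.smooth.continuous

lemma diff (G : Geo e τ K) : Differentiable ℝ τ := G.smooth.differentiable (by simp)

lemma openOm (G : Geo e τ K) : IsOpen (Om τ) := isOpen_lt continuous_const G.cont

lemma measOm (G : Geo e τ K) : MeasurableSet (Om τ) := G.openOm.measurableSet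

lemma measSl (G : Geo e τ K) (h : ℝ) : MeasurableSet (Sl τ h) :=
  (measurableSet_lt measurable_const G.cont.measurable).inter
    (measurableSet_le G.cont.measurable measurable_const)

lemma Sl_sub (h : ℝ) : Sl τ h ⊆ Om τ := fun _ hx => hx.1

lemma fderiv_bd (G : Geo e τ K) (x : EV m) : ‖fderiv ℝ τ x‖ ≤ K := by
  rw [← norm_iteratedFDeriv_one]; exact G.bd 1 le_rfl (by norm_num) x

lemma lip (G : Geo e τ K) (x y : EV m) : |τ x - τ y| ≤ K * ‖x - y‖ := by
  have := Convex.norm_image_sub_le_of_norm_fderiv_le (𝕜 := ℝ) (s := Set.univ) (f := τ) (C := K)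
    (fun x _ => G.diff x) (fun x _ => G.fderiv_bd x) convex_univ (Set.mem_univ y) (Set.mem_univ x)
  simpa using this

lemma fderiv_shift (G : Geo e τ K) (x : EV m) (s : ℝ) :
    fderiv ℝ τ (x + s • e) = fderiv ℝ τ x := by
  have h : (fun y => τ (y + s • e)) = fun y => τ y + s := by funext y; exact G.shift y s
  rw [← fderiv_comp_add_right, h, fderiv_add_const]

lemma fderiv_e (G : Geo e τ K) (x : EV m) : fderiv ℝ τ x e = 1 := by
  have h1 : HasDerivAt (fun s : ℝ => x + s • e) e 0 := by
    simpa using ((hasDerivAt_id (0:ℝ)).smul_const e).const_add x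
  have h0 : HasFDerivAt τ (fderiv ℝ τ x) (x + (0:ℝ) • e) := by
    simpa using (G.diff x).hasFDerivAt
  have h2 := h0.comp_hasDerivAt (0:ℝ) h1
  have h3 : HasDerivAt (fun s : ℝ => τ x + s) 1 0 := by
    simpa using (hasDerivAt_id (0:ℝ)).const_add (τ x)
  have h4 : (τ ∘ fun s : ℝ => x + s • e) = fun s => τ x + s := by funext s; exact G.shift x s
  rw [h4] at h2
  exact h2.unique h3

lemma up (G : Geo e τ K) {x : EV m} (hx : x ∈ Om τ) {s : ℝ} (hs : 0 < s) : x + s • e ∈ Om τ := by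
  have : 0 < τ x := hx
  show 0 < τ (x + s • e)
  rw [G.shift]; linarith

lemma tau_shift_bd (G : Geo e τ K) {x y : EV m} (hy : y ∈ Metric.closedBall (-(2 * K) • e) 1) {s : ℝ}
    (hs : 0 ≤ s) : τ x ≤ τ (x - s • y) ∧ τ (x - s • y) ≤ τ x + 3 * K * s := by
  have e1 : x - s • y = (x - s • (y - (-(2 * K) • e))) + (2 * K * s) • e := by
    module
  rw [e1, G.shift]
  have h := G.lip (x - s • (y - (-(2 * K) • e))) x
  have h2 : ‖x - s • (y - (-(2 * K) • e)) - x‖ ≤ s := by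
    have : x - s • (y - (-(2 * K) • e)) - x = -(s • (y - (-(2 * K) • e))) := by abel
    rw [this, norm_neg, norm_smul, Real.norm_of_nonneg hs]
    rw [Metric.mem_closedBall, dist_eq_norm] at hy
    nlinarith
  have h3 : |τ (x - s • (y - (-(2 * K) • e))) - τ x| ≤ K * s :=
    h.trans (mul_le_mul_of_nonneg_left h2 G.Kpos.le)
  have := abs_le.1 h3
  have := mul_nonneg G.Kpos.le hs
  constructor <;> nlinarith

/-- existence of an adapted mollifier -/
lemma exists_mol (G : Geo e τ K) : ∃ η : EV m → ℝ, Mol η ∧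
    tsupport η ⊆ Metric.closedBall (-(2 * K) • e) 1 ∧ StarU η (Om τ) := by
  let b : ContDiffBump (-(2 * K) • e) := ⟨1 / 2, 1, by norm_num, by norm_num⟩
  have hs : tsupport (b.normed volume) ⊆ Metric.closedBall (-(2 * K) • e) 1 := by
    rw [b.tsupport_normed_eq]
  refine ⟨b.normed volume, ⟨b.contDiff_normed, b.hasCompactSupport_normed, b.integral_normed⟩, hs, ?_⟩
  intro x hx y hy s hs0
  exact lt_of_lt_of_le hx (G.tau_shift_bd (hs hy) hs0.le).1

end Geo

lemma integrable_cc {f : EV m → ℝ} (hf : Continuous f) (hc : HasCompactSupport f) :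
    Integrable f volume := hf.integrable_of_hasCompactSupport hc

lemma ibp {f g : EV m → ℝ} (hf : ContDiff ℝ 1 f) (hg : ContDiff ℝ 1 g) (hc : HasCompactSupport g)
    (h : EV m) : ∫ x, f x * fderiv ℝ g x h = - ∫ x, fderiv ℝ f x h * g x := by
  have c1 := hf.continuous
  have c2 := hg.continuous
  have c3 := hf.continuous_fderiv (by simp)
  have c4 := hg.continuous_fderiv (by simp)
  refine integral_mul_fderiv_eq_neg_fderiv_mul_of_integrable ?_ ?_ ?_
    (fun x _ => hf.differentiable (by simp) x) (fun x _ => hg.differentiable (by simp) x)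
  · exact integrable_cc (by fun_prop) hc.mul_left
  · exact integrable_cc (by fun_prop) (hc.fderiv_apply (𝕜 := ℝ) h).mul_left
  · exact integrable_cc (by fun_prop) hc.mul_left

namespace Geo
variable {e : EV m} {τ : EV m → ℝ} {K : ℝ}

/-- cutoff function near the boundary -/
def cut (τ : EV m → ℝ) (k : ℕ) (x : EV m) : ℝ := Real.smoothTransition (k * τ x)

lemma cut_contDiff (G : Geo e τ K) (k : ℕ) : ContDiff ℝ 1 (cut τ k) := by
  have h1 : ContDiff ℝ 1 Real.smoothTransition := by
    exact_mod_cast Real.smoothTransition.contDiff (n := (1:ℕ∞))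
  exact h1.comp (contDiff_const.mul (G.smooth.of_le (by norm_num)))

lemma cut_fderiv (G : Geo e τ K) (k : ℕ) (x h : EV m) :
    fderiv ℝ (cut τ k) x h = k * deriv Real.smoothTransition (k * τ x) * fderiv ℝ τ x h := by
  have h1 : HasDerivAt Real.smoothTransition (deriv Real.smoothTransition (k * τ x)) (k * τ x) :=
    ((Real.smoothTransition.contDiff (n := 1)).differentiable (by simp)).differentiableAt.hasDerivAt
  have h2 : HasFDerivAt (fun x => (k:ℝ) * τ x) ((k:ℝ) • fderiv ℝ τ x) x :=
    (G.diff x).hasFDerivAt.const_mul _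
  have h3 : HasFDerivAt (cut τ k) _ x := h1.comp_hasFDerivAt x h2
  rw [h3.fderiv]
  simp; ring

lemma tendsto_cut (τ : EV m → ℝ) (x : EV m) :
    Tendsto (fun k : ℕ => cut τ k x) atTop (𝓝 ((Om τ).indicator (fun _ => 1) x)) := by
  by_cases hx : x ∈ Om τ
  · rw [Set.indicator_of_mem hx]
    refine tendsto_const_nhds.congr' ?_
    obtain ⟨k0, hk0⟩ := exists_nat_gt (1 / τ x)
    filter_upwards [eventually_ge_atTop k0] with k hk
    have hx' : 0 < τ x := hx
    rw [cut, Real.smoothTransition.one_of_one_le]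
    rw [div_lt_iff₀ hx'] at hk0
    have : (k0 : ℝ) ≤ k := by exact_mod_cast hk
    nlinarith
  · rw [Set.indicator_of_notMem hx]
    refine tendsto_const_nhds.congr fun k => ?_
    have hx' : τ x ≤ 0 := not_lt.1 hx
    rw [cut, Real.smoothTransition.zero_of_nonpos]
    exact mul_nonpos_of_nonneg_of_nonpos (by positivity) hx'

/-- dominated convergence for the cutoffs -/
lemma tendsto_integral_cut (G : Geo e τ K) {f : EV m → ℝ} (hf : Integrable f volume) :
    Tendsto (fun k : ℕ => ∫ x, cut τ k x * f x) atTop (𝓝 (∫ x in Om τ, f x)) := by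
  rw [← integral_indicator G.measOm]
  refine tendsto_integral_of_dominated_convergence (fun x => ‖f x‖) ?_ hf.norm ?_ ?_
  · intro k
    exact (G.cut_contDiff k).continuous.aestronglyMeasurable.mul hf.1
  · intro k
    refine Eventually.of_forall fun x => ?_
    rw [norm_mul, cut, Real.norm_of_nonneg (Real.smoothTransition.nonneg _)]
    exact mul_le_of_le_one_left (norm_nonneg _) (Real.smoothTransition.le_one _)
  · refine Eventually.of_forall fun x => ?_
    have := (tendsto_cut τ x).mul_const (f x)
    convert this using 2
    by_cases hx : x ∈ Om τ <;> simp [hx]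

lemma contDiff_N (G : Geo e τ K) (h : EV m) : ContDiff ℝ 2 (fun x => fderiv ℝ τ x h) :=
  (G.smooth.fderiv_right (m := 2) (by norm_num)).clm_apply contDiff_const

lemma fderiv_N_e (G : Geo e τ K) (h x : EV m) : fderiv ℝ (fun x => fderiv ℝ τ x h) x e = 0 := by
  have hd : DifferentiableAt ℝ (fun x => fderiv ℝ τ x h) x :=
    (G.contDiff_N h).differentiable (by simp) x
  have h1 : HasDerivAt (fun s : ℝ => x + s • e) e 0 := by
    simpa using ((hasDerivAt_id (0:ℝ)).smul_const e).const_add x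
  have h0 : HasFDerivAt (fun x => fderiv ℝ τ x h) (fderiv ℝ (fun x => fderiv ℝ τ x h) x)
      (x + (0:ℝ) • e) := by simpa using hd.hasFDerivAt
  have h2 := h0.comp_hasDerivAt (0:ℝ) h1
  have h4 : ((fun x => fderiv ℝ τ x h) ∘ fun s : ℝ => x + s • e) = fun s => fderiv ℝ τ x h := by
    funext s; simp [G.fderiv_shift]
  rw [h4] at h2
  exact h2.unique (hasDerivAt_const _ _)

/-- tangential integration by parts -/
lemma integral_tangential (G : Geo e τ K) {f : EV m → ℝ} (hf : ContDiff ℝ 1 f)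
    (hc : HasCompactSupport f) (h : EV m) :
    ∫ x in Om τ, (fderiv ℝ f x h - fderiv ℝ τ x h * fderiv ℝ f x e) = 0 := by
  have c1 := hf.continuous
  have c2 := hf.continuous_fderiv (by simp)
  have c3 := (G.contDiff_N h).continuous
  have i1 : Integrable (fun x => fderiv ℝ f x h) volume :=
    integrable_cc (by fun_prop) (hc.fderiv_apply (𝕜 := ℝ) h)
  have i2 : Integrable (fun x => fderiv ℝ τ x h * fderiv ℝ f x e) volume :=
    integrable_cc (by fun_prop) (hc.fderiv_apply (𝕜 := ℝ) e).mul_left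
  have hl := G.tendsto_integral_cut (i1.sub i2)
  refine tendsto_nhds_unique hl (tendsto_const_nhds.congr fun k => ?_)
  symm
  have hk := G.cut_contDiff k
  have ck := hk.continuous
  have hN1 : ContDiff ℝ 1 (fun x => fderiv ℝ τ x h) := (G.contDiff_N h).of_le (by norm_num)
  have e1 := ibp hk hf hc h
  have e2 := ibp (hk.mul hN1) hf hc e
  have j1 : Integrable (fun x => cut τ k x * fderiv ℝ f x h) volume :=
    integrable_cc (by fun_prop) (hc.fderiv_apply (𝕜 := ℝ) h).mul_left
  have j2 : Integrable (fun x => cut τ k x * fderiv ℝ τ x h * fderiv ℝ f x e) volume :=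
    integrable_cc (by fun_prop) (hc.fderiv_apply (𝕜 := ℝ) e).mul_left
  calc ∫ x, cut τ k x * (fderiv ℝ f x h - fderiv ℝ τ x h * fderiv ℝ f x e)
      = ∫ x, (cut τ k x * fderiv ℝ f x h - cut τ k x * fderiv ℝ τ x h * fderiv ℝ f x e) := by
        congr 1; funext x; ring
    _ = (∫ x, cut τ k x * fderiv ℝ f x h)
        - ∫ x, cut τ k x * fderiv ℝ τ x h * fderiv ℝ f x e := integral_sub j1 j2
    _ = 0 := by
        rw [e1, e2, sub_eq_zero]
        congr 1
        congr 1; funext x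
        congr 1
        rw [fderiv_fun_mul (hk.differentiable (by simp) x) (hN1.differentiable (by simp) x)]
        simp only [ContinuousLinearMap.add_apply, ContinuousLinearMap.smul_apply, smul_eq_mul,
          G.fderiv_N_e, G.cut_fderiv, G.fderiv_e]
        ring

lemma deriv_transition_bd : ∃ C : ℝ, 0 ≤ C ∧ ∀ t, |deriv Real.smoothTransition t| ≤ C := by
  have hc : Continuous (deriv Real.smoothTransition) :=
    (Real.smoothTransition.contDiff (n := 1)).continuous_deriv (by simp)
  have hs : ∀ t, t ∉ Set.Icc (0:ℝ) 1 → deriv Real.smoothTransition t = 0 := by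
    intro t ht
    rw [Set.mem_Icc, not_and_or, not_le, not_le] at ht
    rcases ht with h | h
    · have : Real.smoothTransition =ᶠ[𝓝 t] fun _ => 0 := by
        filter_upwards [gt_mem_nhds h] with y hy using Real.smoothTransition.zero_of_nonpos hy.le
      rw [this.deriv_eq]; simp
    · have : Real.smoothTransition =ᶠ[𝓝 t] fun _ => 1 := by
        filter_upwards [lt_mem_nhds h] with y hy using Real.smoothTransition.one_of_one_le hy.le
      rw [this.deriv_eq]; simp
  obtain ⟨C, hC⟩ := (HasCompactSupport.intro isCompact_Icc hs).exists_bound_of_continuous hc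
  exact ⟨C, (norm_nonneg _).trans (hC 0), hC⟩

lemma deriv_transition_zero {t : ℝ} (ht : t ≤ 0 ∨ 1 < t) : deriv Real.smoothTransition t = 0 := by
  have hs : ∀ t, t ∉ Set.Icc (0:ℝ) 1 → deriv Real.smoothTransition t = 0 := by
    intro t ht
    rw [Set.mem_Icc, not_and_or, not_le, not_le] at ht
    rcases ht with h | h
    · have : Real.smoothTransition =ᶠ[𝓝 t] fun _ => 0 := by
        filter_upwards [gt_mem_nhds h] with y hy using Real.smoothTransition.zero_of_nonpos hy.le
      rw [this.deriv_eq]; simp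
    · have : Real.smoothTransition =ᶠ[𝓝 t] fun _ => 1 := by
        filter_upwards [lt_mem_nhds h] with y hy using Real.smoothTransition.one_of_one_le hy.le
      rw [this.deriv_eq]; simp
  rcases ht with h | h
  · rcases eq_or_lt_of_le h with h0 | h0
    · have : IsLocalMin Real.smoothTransition t := by
        refine Eventually.of_forall fun y => ?_
        rw [h0, Real.smoothTransition.zero]; exact Real.smoothTransition.nonneg y
      exact this.deriv_eq_zero
    · exact hs t (fun h' => absurd h'.1 (not_le.2 h0))
  · exact hs t (fun h' => absurd h'.2 (not_le.2 h))

/-- no boundary term for functions vanishing on the boundary -/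
lemma integral_normal (G : Geo e τ K) {f : EV m → ℝ} (hf : ContDiff ℝ 1 f)
    (hc : HasCompactSupport f) (h0 : ∀ x, τ x = 0 → f x = 0) :
    ∫ x in Om τ, fderiv ℝ f x e = 0 := by
  have c1 := hf.continuous
  have c2 := hf.continuous_fderiv (by simp)
  have i1 : Integrable (fun x => fderiv ℝ f x e) volume :=
    integrable_cc (by fun_prop) (hc.fderiv_apply (𝕜 := ℝ) e)
  obtain ⟨L, hL⟩ := (hc.fderiv (𝕜 := ℝ)).exists_bound_of_continuous c2
  obtain ⟨C, hC0, hC⟩ := deriv_transition_bd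
  have hL0 : 0 ≤ L := (norm_nonneg _).trans (hL 0)
  have hfl : ∀ x, |f x| ≤ L * |τ x| := by
    intro x
    have hy : f (x + (-τ x) • e) = 0 := h0 _ (by rw [G.shift]; ring)
    have := Convex.norm_image_sub_le_of_norm_fderiv_le (𝕜 := ℝ) (s := Set.univ) (f := f) (C := L)
      (fun x _ => hf.differentiable (by simp) x) (fun x _ => hL x) convex_univ
      (Set.mem_univ (x + (-τ x) • e)) (Set.mem_univ x)
    rw [hy, sub_zero] at this
    have e3 : x - (x + (-τ x) • e) = τ x • e := by module
    rw [e3, norm_smul, G.e1, mul_one] at this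
    exact this
  have hl := G.tendsto_integral_cut i1
  refine tendsto_nhds_unique hl ?_
  have hlim : Tendsto (fun k : ℕ => - ∫ x, fderiv ℝ (cut τ k) x e * f x) atTop (𝓝 (- ∫ x : EV m, (0:ℝ))) := by
    refine Tendsto.neg ?_
    refine tendsto_integral_of_dominated_convergence
      (fun x => (tsupport f).indicator (fun _ => C * L) x) ?_ ?_ ?_ ?_
    · intro k
      have := (G.cut_contDiff k).continuous_fderiv (by simp)
      exact (by fun_prop : Continuous fun x => fderiv ℝ (cut τ k) x e * f x).aestronglyMeasurable
    · rw [integrable_indicator_iff (isClosed_tsupport f).measurableSet]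
      exact integrableOn_const hc.isCompact.measure_lt_top.ne
    · intro k
      refine Eventually.of_forall fun x => ?_
      by_cases hx : x ∈ tsupport f
      · rw [Set.indicator_of_mem hx, G.cut_fderiv, G.fderiv_e, mul_one, norm_mul]
        by_cases hk : (k:ℝ) * τ x ≤ 0 ∨ 1 < (k:ℝ) * τ x
        · rw [deriv_transition_zero hk]; simp; positivity
        · push Not at hk
          have hτ : 0 < τ x := by
            by_contra hneg
            have := mul_nonpos_of_nonneg_of_nonpos (Nat.cast_nonneg (α := ℝ) k) (not_lt.1 hneg)
            linarith
          rw [norm_mul]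
          have b1 := hfl x
          rw [abs_of_pos hτ] at b1
          calc ‖(k:ℝ)‖ * ‖deriv Real.smoothTransition (k * τ x)‖ * ‖f x‖
              ≤ k * C * (L * τ x) := by
                rw [Real.norm_of_nonneg (Nat.cast_nonneg k)]
                gcongr
                · exact hC _
                · exact b1
            _ = (C * L) * (k * τ x) := by ring
            _ ≤ C * L := mul_le_of_le_one_right (by positivity) hk.2
      · rw [image_eq_zero_of_notMem_tsupport hx]; simp [hx]
    · refine Eventually.of_forall fun x => ?_
      refine tendsto_const_nhds.congr' ?_
      by_cases hx : 0 < τ x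
      · obtain ⟨k0, hk0⟩ := exists_nat_gt (1 / τ x)
        filter_upwards [eventually_ge_atTop k0] with k hk
        rw [div_lt_iff₀ hx] at hk0
        have : (k0 : ℝ) ≤ k := by exact_mod_cast hk
        rw [G.cut_fderiv, deriv_transition_zero (Or.inr (by nlinarith))]; simp
      · filter_upwards with k
        rw [G.cut_fderiv, deriv_transition_zero (Or.inl ?_)]
        · simp
        · exact mul_nonpos_of_nonneg_of_nonpos (by positivity) (not_lt.1 hx)
  simp only [integral_zero, neg_zero] at hlim
  refine hlim.congr fun k => ?_
  rw [ibp (G.cut_contDiff k) hf hc e]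

end Geo

end PartFour

section PartFive

variable {m : ℕ}

/-- A clean system of weak derivatives. -/
structure Jet (Ω : Set (EV m)) (k : ℕ) (p : ℝ≥0∞) (D : List (Fin m) → EV m → ℝ) : Prop where
  meas : ∀ l, Measurable (D l)
  memLp : ∀ l, MemLp (D l) p volume
  zero : ∀ l, ∀ x ∉ Ω, D l x = 0
  weak : ∀ l : List (Fin m), l.length < k → ∀ i : Fin m, WeakDerivOn Ω i (D l) (D (i :: l))

lemma Jet.mono {Ω : Set (EV m)} {k k' : ℕ} {p : ℝ≥0∞} {D : List (Fin m) → EV m → ℝ}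
    (h : Jet Ω k p D) (hk : k' ≤ k) : Jet Ω k' p D :=
  ⟨h.meas, h.memLp, h.zero, fun l hl i => h.weak l (by omega) i⟩

lemma Jet.loc {Ω : Set (EV m)} {k : ℕ} {p : ℝ≥0∞} {D : List (Fin m) → EV m → ℝ}
    (h : Jet Ω k p D) (hp1 : 1 ≤ p) (l : List (Fin m)) : LocallyIntegrable (D l) volume :=
  (h.memLp l).locallyIntegrable hp1

lemma exists_jet {Ω : Set (EV m)} (hΩ : MeasurableSet Ω) {k : ℕ} {p : ℝ≥0∞} {u : EV m → ℝ}
    {D : List (Fin m) → EV m → ℝ} (h : IsSobDerivs Ω k p u D) :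
    ∃ D', Jet Ω k p D' ∧ ∀ l : List (Fin m), l.length ≤ k → D' l =ᵐ[volume.restrict Ω] D l := by
  classical
  let D' : List (Fin m) → EV m → ℝ := fun l =>
    if hl : l.length ≤ k then Ω.indicator ((h.2.2 l hl).1.mk (D l)) else 0
  have hae : ∀ l : List (Fin m), l.length ≤ k → D' l =ᵐ[volume.restrict Ω] D l := by
    intro l hl
    simp only [D', dif_pos hl]
    filter_upwards [ae_restrict_mem hΩ, (h.2.2 l hl).1.ae_eq_mk] with x hx h2
    rw [Set.indicator_of_mem hx, h2]
  refine ⟨D', ⟨?_, ?_, ?_, ?_⟩, hae⟩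
  · intro l
    by_cases hl : l.length ≤ k
    · simp only [D', dif_pos hl]
      exact (h.2.2 l hl).1.stronglyMeasurable_mk.measurable.indicator hΩ
    · simp only [D', dif_neg hl]; exact measurable_const
  · intro l
    by_cases hl : l.length ≤ k
    · simp only [D', dif_pos hl]
      rw [memLp_indicator_iff_restrict hΩ]
      exact (h.2.2 l hl).ae_eq (h.2.2 l hl).1.ae_eq_mk
    · simp only [D', dif_neg hl]; exact MemLp.zero
  · intro l x hx
    by_cases hl : l.length ≤ k
    · simp only [D', dif_pos hl]; simp [hx]
    · simp only [D', dif_neg hl]; simp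
  · intro l hl i φ h1 h2 h3
    have e1 : ∫ x in Ω, D' l x * partialD i φ x = ∫ x in Ω, D l x * partialD i φ x := by
      refine integral_congr_ae ?_
      filter_upwards [hae l hl.le] with x hx; rw [hx]
    have e2 : ∫ x in Ω, D' (i :: l) x * φ x = ∫ x in Ω, D (i :: l) x * φ x := by
      refine integral_congr_ae ?_
      filter_upwards [hae (i :: l) (by simpa using hl)] with x hx; rw [hx]
    rw [e1, e2]; exact h.2.1 l hl i φ h1 h2 h3

lemma integrable_mul_cc {f b : EV m → ℝ} (hf : LocallyIntegrable f volume) (hb : Continuous b)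
    (hc : HasCompactSupport b) : Integrable (fun x => f x * b x) volume := by
  have := hf.integrable_smul_left_of_hasCompactSupport hb hc
  simpa [mul_comm] using this

/-- derivative of a jet in direction `h` -/
def dirD (h : EV m) (D : List (Fin m) → EV m → ℝ) (l : List (Fin m)) (x : EV m) : ℝ :=
  ∑ i, h i * D (i :: l) x

lemma clm_eq_sum (T : EV m →L[ℝ] ℝ) (h : EV m) :
    T h = ∑ i, h i * T (EuclideanSpace.single i 1) := by
  have e : h = ∑ i, h i • EuclideanSpace.single i (1:ℝ) := by
    have := (EuclideanSpace.basisFun (Fin m) ℝ).sum_repr h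
    simpa using this.symm
  conv_lhs => rw [e]
  simp

lemma Jet.weakDir {Ω : Set (EV m)} {k : ℕ} {p : ℝ≥0∞} (hp1 : 1 ≤ p) {D : List (Fin m) → EV m → ℝ}
    (hD : Jet Ω k p D) (h : EV m) {l : List (Fin m)} (hl : l.length < k) :
    WeakDir Ω h (D l) (dirD h D l) := by
  intro φ h1 h2 h3
  have cφ := h1.continuous
  have cφ' := h1.continuous_fderiv (by simp)
  have i1 : ∀ i ∈ Finset.univ, Integrable (fun x => h i * (D l x * fderiv ℝ φ x (EuclideanSpace.single i 1)))
      (volume.restrict Ω) := fun i _ =>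
    ((integrable_mul_cc (hD.loc hp1 l) (by fun_prop) (h2.fderiv_apply (𝕜 := ℝ) _)).integrableOn).const_mul _
  have i2 : ∀ i ∈ Finset.univ, Integrable (fun x => h i * (D (i :: l) x * φ x))
      (volume.restrict Ω) := fun i _ =>
    ((integrable_mul_cc (hD.loc hp1 (i :: l)) cφ h2).integrableOn).const_mul _
  have e1 : ∀ x, D l x * fderiv ℝ φ x h
      = ∑ i, h i * (D l x * fderiv ℝ φ x (EuclideanSpace.single i 1)) := by
    intro x; rw [clm_eq_sum (fderiv ℝ φ x) h, Finset.mul_sum]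
    exact Finset.sum_congr rfl fun i _ => by ring
  have e2 : ∀ x, dirD h D l x * φ x = ∑ i, h i * (D (i :: l) x * φ x) := by
    intro x; rw [dirD, Finset.sum_mul]
    exact Finset.sum_congr rfl fun i _ => by ring
  simp_rw [e1, e2]
  rw [integral_finsetSum _ i1, integral_finsetSum _ i2, ← Finset.sum_neg_distrib]
  refine Finset.sum_congr rfl fun i _ => ?_
  rw [integral_const_mul, integral_const_mul]
  have := hD.weak l hl i φ h1 h2 h3
  simp only [partialD] at this
  rw [this]; ring

lemma Jet.dir_meas {Ω : Set (EV m)} {k : ℕ} {p : ℝ≥0∞} {D : List (Fin m) → EV m → ℝ}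
    (hD : Jet Ω k p D) (h : EV m) (l : List (Fin m)) : Measurable (dirD h D l) := by
  have := hD.meas
  unfold dirD; fun_prop

lemma Jet.dir_memLp {Ω : Set (EV m)} {k : ℕ} {p : ℝ≥0∞} {D : List (Fin m) → EV m → ℝ}
    (hD : Jet Ω k p D) (h : EV m) (l : List (Fin m)) : MemLp (dirD h D l) p volume := by
  unfold dirD
  exact memLp_finsetSum _ fun i _ => (hD.memLp (i :: l)).const_mul _

lemma Jet.dir_zero {Ω : Set (EV m)} {k : ℕ} {p : ℝ≥0∞} {D : List (Fin m) → EV m → ℝ}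
    (hD : Jet Ω k p D) (h : EV m) (l : List (Fin m)) {x : EV m} (hx : x ∉ Ω) : dirD h D l x = 0 := by
  unfold dirD
  exact Finset.sum_eq_zero fun i _ => by rw [hD.zero _ x hx, mul_zero]

/-- pairing with a compactly supported function is continuous in `L^p` -/
lemma tendsto_integral_pair {ι : Type*} {L : Filter ι} {Ω : Set (EV m)} 
    {p : ℝ≥0∞} (hp1 : 1 ≤ p) {F : ι → EV m → ℝ} {f b : EV m → ℝ} (hb : Continuous b)
    (hc : HasCompactSupport b) (hf : MemLp f p (volume.restrict Ω))
    (hF : ∀ᶠ i in L, MemLp (F i) p (volume.restrict Ω))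
    (ht : Tendsto (fun i => eLpNorm (fun x => F i x - f x) p (volume.restrict Ω)) L (𝓝 0)) :
    Tendsto (fun i => ∫ x in Ω, b x * F i x) L (𝓝 (∫ x in Ω, b x * f x)) := by
  have hq : p.HolderConjugate (ENNReal.conjExponent p) := ENNReal.HolderConjugate.conjExponent hp1
  have hq' := hq.symm
  set q := ENNReal.conjExponent p
  have hbq : MemLp b q (volume.restrict Ω) := (hb.memLp_of_hasCompactSupport hc).restrict Ω
  refine tendsto_integral_of_L1 _ (hb.aestronglyMeasurable.mul hf.1) ?_ ?_
  · filter_upwards [hF] with i hi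
    have : MemLp (b • F i) 1 (volume.restrict Ω) := hi.smul hbq
    exact memLp_one_iff_integrable.1 this
  · have hlim := ENNReal.Tendsto.const_mul (a := eLpNorm b q (volume.restrict Ω)) ht (Or.inr hbq.2.ne)
    rw [mul_zero] at hlim
    refine tendsto_of_tendsto_of_tendsto_of_le_of_le' tendsto_const_nhds hlim (by simp) ?_
    filter_upwards [hF] with i hi
    have h1 := eLpNorm_smul_le_mul_eLpNorm (μ := volume.restrict Ω) (p := q) (q := p) (r := 1)
      (f := fun x => F i x - f x) (φ := b) (hi.1.sub hf.1) hbq.1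
    rw [eLpNorm_one_eq_lintegral_enorm] at h1
    refine le_trans (le_of_eq ?_) h1
    congr 1; funext x; simp [mul_sub]

lemma tendsto_moll_restrict {η : EV m → ℝ} (hη : Mol η) {f : EV m → ℝ} (hf : Measurable f)
    {p : ℝ≥0∞} (hp1 : 1 ≤ p) (hp : p ≠ ⊤) (hfp : MemLp f p volume) (A : Set (EV m)) :
    Tendsto (fun s : ℝ => eLpNorm (fun x => moll η s f x - f x) p (volume.restrict A)) (𝓝[>] 0) (𝓝 0) :=
  tendsto_of_tendsto_of_tendsto_of_le_of_le tendsto_const_nhds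
    (tendsto_moll hη.cont hη.hcs hη.int hf hp1 hp hfp) (fun _ => zero_le)
    (fun _ => eLpNorm_mono_measure _ Measure.restrict_le_self)

lemma moll_memLp {η : EV m → ℝ} (hη : Mol η) {f : EV m → ℝ} (hf : Measurable f)
    {p : ℝ≥0∞} (hp1 : 1 ≤ p) (hp : p ≠ ⊤) (hfp : MemLp f p volume) {s : ℝ} (hs : 0 < s) :
    MemLp (moll η s f) p volume := by
  refine ⟨(moll_measurable hη (hfp.locallyIntegrable hp1) hs).aestronglyMeasurable, ?_⟩
  have := moll_eLpNorm_le hη.cont hη.hcs s hf hp1 hp MeasurableSet.univ MeasurableSet.univ (by simp)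
  simp only [Measure.restrict_univ] at this
  exact this.trans_lt (ENNReal.mul_lt_top (mass_ne_top hη.cont hη.hcs).lt_top hfp.2)

/-- normal component of the gradient -/
def nGrad (τ : EV m → ℝ) (D : List (Fin m) → EV m → ℝ) (x : EV m) : ℝ :=
  ∑ i, fderiv ℝ τ x (EuclideanSpace.single i 1) * D [i] x

def nGradE (τ : EV m → ℝ) (e : EV m) (D : List (Fin m) → EV m → ℝ) (x : EV m) : ℝ :=
  ∑ i, fderiv ℝ τ x (EuclideanSpace.single i 1) * dirD e D [i] x

namespace Geo
variable {e : EV m} {τ : EV m → ℝ} {K : ℝ}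

/-- The Sobolev version of the tangential identity -/
lemma jet_tangential (G : Geo e τ K) {p : ℝ≥0∞} (hp1 : 1 ≤ p) (hp : p ≠ ⊤)
    {D : List (Fin m) → EV m → ℝ} (hD : Jet (Om τ) 2 p D) {φ : EV m → ℝ}
    (h1 : ContDiff ℝ (⊤ : ℕ∞) φ) (h2 : HasCompactSupport φ) (i : Fin m) :
    (∫ x in Om τ, D [i, i] x * φ x) + (∫ x in Om τ, D [i] x * partialD i φ x)
     - ((∫ x in Om τ, fderiv ℝ τ x (EuclideanSpace.single i 1) * D [i] x * fderiv ℝ φ x e)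
     + ∫ x in Om τ, fderiv ℝ τ x (EuclideanSpace.single i 1) * dirD e D [i] x * φ x) = 0 := by
  obtain ⟨η, hη, hηs, hst⟩ := G.exists_mol
  have cφ := h1.continuous
  have cφ' := h1.continuous_fderiv (by simp)
  have cN := (G.contDiff_N (EuclideanSpace.single i 1)).continuous
  set ei : EV m := EuclideanSpace.single i 1 with hei
  set N : EV m → ℝ := fun x => fderiv ℝ τ x ei with hN
  have T : ∀ (f b : EV m → ℝ), Measurable f → MemLp f p volume → Continuous b → HasCompactSupport b →
      Tendsto (fun s => ∫ x in Om τ, b x * moll η s f x) (𝓝[>] 0) (𝓝 (∫ x in Om τ, b x * f x)) := by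
    intro f b hf hfp hb hbc
    refine tendsto_integral_pair hp1 hb hbc (hfp.restrict _) ?_
      (tendsto_moll_restrict hη hf hp1 hp hfp _)
    filter_upwards [self_mem_nhdsWithin] with s hs
    exact (moll_memLp hη hf hp1 hp hfp hs).restrict _
  have t1 := T (D [i, i]) φ (hD.meas _) (hD.memLp _) cφ h2
  have t2 := T (D [i]) (fun x => fderiv ℝ φ x ei) (hD.meas _) (hD.memLp _) (by fun_prop)
    (h2.fderiv_apply (𝕜 := ℝ) _)
  have t3 := T (D [i]) (fun x => N x * fderiv ℝ φ x e) (hD.meas _) (hD.memLp _) (by fun_prop)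
    (h2.fderiv_apply (𝕜 := ℝ) _).mul_left
  have t4 := T (dirD e D [i]) (fun x => N x * φ x) (hD.dir_meas _ _) (hD.dir_memLp _ _) (by fun_prop)
    h2.mul_left
  have t := (t1.add t2).sub (t3.add t4)
  have e0 : ∀ᶠ s in 𝓝[>] (0:ℝ), ((∫ x in Om τ, φ x * moll η s (D [i, i]) x)
      + ∫ x in Om τ, fderiv ℝ φ x ei * moll η s (D [i]) x)
      - ((∫ x in Om τ, N x * fderiv ℝ φ x e * moll η s (D [i]) x)
      + ∫ x in Om τ, N x * φ x * moll η s (dirD e D [i]) x) = 0 := by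
    filter_upwards [self_mem_nhdsWithin] with s hs
    have hs : 0 < s := hs
    have hM : ContDiff ℝ 1 (moll η s (D [i])) :=
      (moll_contDiff hη.smooth hη.hcs hs (hD.loc hp1 _)).of_le (by exact_mod_cast le_top)
    have hφ1 : ContDiff ℝ 1 φ := h1.of_le (by exact_mod_cast le_top)
    have key := G.integral_tangential (hφ1.mul hM) h2.mul_right ei
    have J : ∀ (f b : EV m → ℝ), Measurable f → MemLp f p volume → Continuous b → HasCompactSupport b →
        Integrable (fun x => b x * moll η s f x) (volume.restrict (Om τ)) := by
      intro f b hf hfp hb hbc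
      have hcm := (moll_contDiff hη.smooth hη.hcs hs (hfp.locallyIntegrable hp1)).continuous
      exact (integrable_cc (hb.mul hcm) hbc.mul_right).integrableOn
    rw [← integral_add (J _ _ (hD.meas _) (hD.memLp _) cφ h2)
      (J _ _ (hD.meas _) (hD.memLp _) (by fun_prop) (h2.fderiv_apply (𝕜 := ℝ) _)),
      ← integral_add (J _ (fun x => N x * fderiv ℝ φ x e) (hD.meas _) (hD.memLp _) (by fun_prop)
        (h2.fderiv_apply (𝕜 := ℝ) _).mul_left)
      (J _ (fun x => N x * φ x) (hD.dir_meas _ _) (hD.dir_memLp _ _) (by fun_prop) h2.mul_left), ← integral_sub]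
    · rw [← key]
      refine setIntegral_congr_fun G.measOm fun x hx => ?_
      have d1 := hφ1.differentiable (by simp) x
      have d2 := hM.differentiable (by simp) x
      have w1 : fderiv ℝ (moll η s (D [i])) x ei = moll η s (D [i, i]) x :=
        moll_fderiv_on hη hst (hD.loc hp1 _) (hD.weak [i] (by simp) i) hs hx
      have w2 : fderiv ℝ (moll η s (D [i])) x e = moll η s (dirD e D [i]) x :=
        moll_fderiv_on hη hst (hD.loc hp1 _) (hD.weakDir hp1 e (by simp)) hs hx
      simp only [fderiv_fun_mul d1 d2, ContinuousLinearMap.add_apply, ContinuousLinearMap.smul_apply,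
        smul_eq_mul, w1, w2]
      simp only [hN]
      ring
    · exact (J _ _ (hD.meas _) (hD.memLp _) cφ h2).add
        (J _ _ (hD.meas _) (hD.memLp _) (by fun_prop) (h2.fderiv_apply (𝕜 := ℝ) _))
    · exact (J _ (fun x => N x * fderiv ℝ φ x e) (hD.meas _) (hD.memLp _) (by fun_prop)
        (h2.fderiv_apply (𝕜 := ℝ) _).mul_left).add
        (J _ (fun x => N x * φ x) (hD.dir_meas _ _) (hD.dir_memLp _ _) (by fun_prop) h2.mul_left)
  have := tendsto_nhds_unique (t.congr' e0) tendsto_const_nhds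
  rw [← this]
  have q1 : ∫ x in Om τ, D [i, i] x * φ x = ∫ x in Om τ, φ x * D [i, i] x := by
    simp_rw [mul_comm]
  have q2 : ∫ x in Om τ, D [i] x * partialD i φ x = ∫ x in Om τ, fderiv ℝ φ x ei * D [i] x := by
    congr 1; funext x; rw [mul_comm]; rfl
  have q3 : ∫ x in Om τ, N x * D [i] x * fderiv ℝ φ x e
      = ∫ x in Om τ, N x * fderiv ℝ φ x e * D [i] x := by congr 1; funext x; ring
  have q4 : ∫ x in Om τ, N x * dirD e D [i] x * φ x
      = ∫ x in Om τ, N x * φ x * dirD e D [i] x := by congr 1; funext x; ring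
  rw [q1, q2, q3, q4]

/-- Weak Neumann condition for a jet -/
def JetBC (τ : EV m → ℝ) (D : List (Fin m) → EV m → ℝ) : Prop :=
  ∀ φ : EV m → ℝ, ContDiff ℝ (⊤ : ℕ∞) φ → HasCompactSupport φ →
    ∑ i, ∫ x in Om τ, D [i, i] x * φ x = - ∑ i, ∫ x in Om τ, D [i] x * partialD i φ x

lemma nGrad_weak (G : Geo e τ K) {p : ℝ≥0∞} (hp1 : 1 ≤ p) (hp : p ≠ ⊤)
    {D : List (Fin m) → EV m → ℝ} (hD : Jet (Om τ) 2 p D) (hbc : JetBC τ D) :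
    WeakDir Set.univ e (nGrad τ D) (nGradE τ e D) := by
  intro φ h1 h2 _
  have cφ := h1.continuous
  have cφ' := h1.continuous_fderiv (by simp)
  have cN : ∀ i : Fin m, Continuous fun x => fderiv ℝ τ x (EuclideanSpace.single i 1) :=
    fun i => (G.contDiff_N (EuclideanSpace.single i 1)).continuous
  have B := hbc φ h1 h2
  have S := Finset.sum_congr (s₁ := Finset.univ) rfl
    (fun i (_ : i ∈ Finset.univ) => G.jet_tangential hp1 hp hD h1 h2 i)
  rw [Finset.sum_sub_distrib, Finset.sum_add_distrib, Finset.sum_add_distrib, B] at S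
  have i1 : ∀ i ∈ (Finset.univ : Finset (Fin m)), Integrable (fun x =>
      fderiv ℝ τ x (EuclideanSpace.single i 1) * D [i] x * fderiv ℝ φ x e) (volume.restrict (Om τ)) := by
    intro i _
    have := (integrable_mul_cc (hD.loc hp1 [i])
      (b := fun x => fderiv ℝ τ x (EuclideanSpace.single i 1) * fderiv ℝ φ x e)
      ((cN i).mul (by fun_prop)) (h2.fderiv_apply (𝕜 := ℝ) _).mul_left).integrableOn (s := Om τ)
    exact this.congr (Eventually.of_forall fun x => by ring)
  have i2 : ∀ i ∈ (Finset.univ : Finset (Fin m)), Integrable (fun x =>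
      fderiv ℝ τ x (EuclideanSpace.single i 1) * dirD e D [i] x * φ x) (volume.restrict (Om τ)) := by
    intro i _
    have := (integrable_mul_cc ((hD.dir_memLp e [i]).locallyIntegrable hp1)
      (b := fun x => fderiv ℝ τ x (EuclideanSpace.single i 1) * φ x)
      ((cN i).mul (by fun_prop)) h2.mul_left).integrableOn (s := Om τ)
    exact this.congr (Eventually.of_forall fun x => by ring)
  rw [← integral_finsetSum _ i1, ← integral_finsetSum _ i2] at S
  have z1 : ∀ x ∉ Om τ, nGrad τ D x * fderiv ℝ φ x e = 0 := by
    intro x hx; simp [nGrad, hD.zero _ x hx]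
  have z2 : ∀ x ∉ Om τ, nGradE τ e D x * φ x = 0 := by
    intro x hx; simp [nGradE, hD.dir_zero e _ hx]
  rw [Measure.restrict_univ, ← setIntegral_eq_integral_of_forall_compl_eq_zero z1,
    ← setIntegral_eq_integral_of_forall_compl_eq_zero z2]
  simp only [nGrad, nGradE, Finset.sum_mul]
  simp at S
  linarith

lemma nGrad_meas (G : Geo e τ K) {p : ℝ≥0∞} {k : ℕ}
    {D : List (Fin m) → EV m → ℝ} (hD : Jet (Om τ) k p D) : Measurable (nGrad τ D) := by
  have cN : ∀ i : Fin m, Measurable fun x => fderiv ℝ τ x (EuclideanSpace.single i 1) :=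
    fun i => (G.contDiff_N (EuclideanSpace.single i 1)).continuous.measurable
  have := hD.meas
  exact Finset.measurable_sum _ fun i _ => (cN i).mul (this [i])

lemma nGradE_meas (G : Geo e τ K) {p : ℝ≥0∞} {k : ℕ}
    {D : List (Fin m) → EV m → ℝ} (hD : Jet (Om τ) k p D) : Measurable (nGradE τ e D) := by
  have cN : ∀ i : Fin m, Measurable fun x => fderiv ℝ τ x (EuclideanSpace.single i 1) :=
    fun i => (G.contDiff_N (EuclideanSpace.single i 1)).continuous.measurable
  exact Finset.measurable_sum _ fun i _ => (cN i).mul (hD.dir_meas e [i])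

lemma N_bd (G : Geo e τ K) (x : EV m) (i : Fin m) :
    ‖fderiv ℝ τ x (EuclideanSpace.single i 1)‖ ≤ K := by
  refine ((fderiv ℝ τ x).le_opNorm _).trans ?_
  simpa using G.fderiv_bd x

lemma N_mul_memLp (G : Geo e τ K) {p : ℝ≥0∞} {f : EV m → ℝ} (hf : MemLp f p volume) (i : Fin m) :
    MemLp (fun x => fderiv ℝ τ x (EuclideanSpace.single i 1) * f x) p volume := by
  have cN : Continuous fun x => fderiv ℝ τ x (EuclideanSpace.single i 1) :=
    (G.contDiff_N (EuclideanSpace.single i 1)).continuous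
  refine (hf.const_mul K).of_le (cN.aestronglyMeasurable.mul hf.1) (Eventually.of_forall fun x => ?_)
  rw [norm_mul, norm_mul, Real.norm_of_nonneg G.Kpos.le]
  gcongr
  exact G.N_bd x i

/-- Neumann–Poincaré inequality in the boundary layer. -/
lemma neumann_poincare (G : Geo e τ K) {p : ℝ≥0∞} (hp1 : 1 ≤ p) (hp : p ≠ ⊤)
    {D : List (Fin m) → EV m → ℝ} (hD : Jet (Om τ) 2 p D) (hbc : JetBC τ D) {h : ℝ} (hh : 0 ≤ h) :
    eLpNorm (nGrad τ D) p (volume.restrict (Sl τ h))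
      ≤ ENNReal.ofReal h * eLpNorm (nGradE τ e D) p (volume.restrict (Sl τ h)) := by
  obtain ⟨η, hη, -, -⟩ := G.exists_mol
  have m1 : MemLp (nGrad τ D) p volume := memLp_finsetSum _ fun i _ => G.N_mul_memLp (hD.memLp [i]) i
  have m2 : MemLp (nGradE τ e D) p volume :=
    memLp_finsetSum _ fun i _ => G.N_mul_memLp (hD.dir_memLp e [i]) i
  have hw := G.nGrad_weak hp1 hp hD hbc
  have hw' : WeakDir Set.univ ((-h) • e) (nGrad τ D) (fun x => -h * nGradE τ e D x) := by
    intro φ h1 h2 h3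
    have := hw φ h1 h2 h3
    simp only [map_smul, smul_eq_mul]
    have e1 : ∀ x, nGrad τ D x * (-h * fderiv ℝ φ x e) = -h * (nGrad τ D x * fderiv ℝ φ x e) :=
      fun x => by ring
    have e2 : ∀ x, -h * nGradE τ e D x * φ x = -h * (nGradE τ e D x * φ x) := fun x => by ring
    simp_rw [e1, e2]
    rw [integral_const_mul, integral_const_mul, this]; ring
  have key := weak_shift hη (U := Set.univ) (A := Sl τ h) (B := {x | τ x ≤ h}) (G.measSl h)
    (measurableSet_le G.cont.measurable measurable_const) (fun _ _ _ _ _ _ => Set.mem_univ _)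
    (G.nGrad_meas hD) ((G.nGradE_meas hD).const_mul _) hp1 hp m1 (m2.const_mul _) hw' ?_
    (Set.subset_univ _)
  · have l1 : eLpNorm (nGrad τ D) p (volume.restrict (Sl τ h))
        = eLpNorm (fun x => nGrad τ D (x + (-h) • e) - nGrad τ D x) p (volume.restrict (Sl τ h)) := by
      refine eLpNorm_congr_norm_ae ?_
      filter_upwards [ae_restrict_mem (G.measSl h)] with x hx
      have : x + (-h) • e ∉ Om τ := by
        intro h'
        have h'' : 0 < τ (x + (-h) • e) := h'
        rw [G.shift] at h''
        linarith [hx.2]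
      have : nGrad τ D (x + (-h) • e) = 0 :=
        Finset.sum_eq_zero fun i _ => by rw [hD.zero _ _ this, mul_zero]
      rw [this]; simp
    rw [l1]
    refine key.trans (le_of_eq ?_)
    have l2 : eLpNorm (fun x => -h * nGradE τ e D x) p (volume.restrict {x | τ x ≤ h})
        = ENNReal.ofReal h * eLpNorm (nGradE τ e D) p (volume.restrict {x | τ x ≤ h}) := by
      have := eLpNorm_const_smul (μ := volume.restrict {x | τ x ≤ h}) (p := p) (-h) (nGradE τ e D)
      rw [enorm_neg, Real.enorm_eq_ofReal hh] at this
      exact this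
    rw [l2, ← eLpNorm_indicator_eq_eLpNorm_restrict (measurableSet_le G.cont.measurable measurable_const),
      ← eLpNorm_indicator_eq_eLpNorm_restrict (G.measSl h)]
    congr 2
    funext x
    by_cases hx : x ∈ Om τ
    · by_cases hx2 : τ x ≤ h
      · rw [Set.indicator_of_mem (by exact hx2), Set.indicator_of_mem (by exact ⟨hx, hx2⟩)]
      · rw [Set.indicator_of_notMem (by exact hx2), Set.indicator_of_notMem (fun h' => hx2 h'.2)]
    · have : nGradE τ e D x = 0 := by simp [nGradE, hD.dir_zero e _ hx]
      rw [Set.indicator_of_notMem (fun h' : x ∈ Sl τ h => hx h'.1), Set.indicator_apply, this, ite_self]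
  · intro x hx σ hσ
    have e3 : x + σ • (-h) • e = x + (-(σ * h)) • e := by module
    show τ _ ≤ h
    rw [e3, G.shift]
    have := mul_nonneg hσ.1 hh
    linarith [hx.2]

end Geo

end PartFive

section PartSix

variable {m : ℕ}

lemma partialD_mul {a f : EV m → ℝ} (ha : Differentiable ℝ a) (hf : Differentiable ℝ f) (i : Fin m) :
    partialD i (fun x => a x * f x) = fun x => partialD i a x * f x + a x * partialD i f x := by
  funext x
  simp only [partialD, fderiv_fun_mul (ha x) (hf x), _root_.add_apply, _root_.smul_apply, smul_eq_mul]
  ring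

lemma partialD_add {a f : EV m → ℝ} (ha : Differentiable ℝ a) (hf : Differentiable ℝ f) (i : Fin m) :
    partialD i (fun x => a x + f x) = fun x => partialD i a x + partialD i f x := by
  funext x
  simp only [partialD, fderiv_fun_add (ha x) (hf x), _root_.add_apply]

lemma partialD_sub {a f : EV m → ℝ} (ha : Differentiable ℝ a) (hf : Differentiable ℝ f) (i : Fin m) :
    partialD i (fun x => a x - f x) = fun x => partialD i a x - partialD i f x := by
  funext x
  simp only [partialD, fderiv_fun_sub (ha x) (hf x)]
  rfl

lemma partialD_const_mul {f : EV m → ℝ} (c : ℝ) (i : Fin m) :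
    partialD i (fun x => c * f x) = fun x => c * partialD i f x := by
  funext x
  have : fderiv ℝ (c • f) x = c • fderiv ℝ f x := by rw [fderiv_const_smul_field]; rfl
  have e : (fun x => c * f x) = c • f := rfl
  simp only [partialD, e, this, _root_.smul_apply, smul_eq_mul]

lemma partialD_sum {ι : Type*} (s : Finset ι) {f : ι → EV m → ℝ} (hf : ∀ j, Differentiable ℝ (f j))
    (i : Fin m) :
    partialD i (fun x => ∑ j ∈ s, f j x) = fun x => ∑ j ∈ s, partialD i (f j) x := by
  funext x
  simp only [partialD, fderiv_fun_sum (fun j _ => hf j x)]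
  simp

lemma contDiff_partialD {k : ℕ} {f : EV m → ℝ} (hf : ContDiff ℝ (k + 1 : ℕ) f) (i : Fin m) :
    ContDiff ℝ k (partialD i f) := by
  have : ContDiff ℝ k (fderiv ℝ f) := hf.fderiv_right (by norm_cast)
  exact this.clm_apply contDiff_const

lemma contDiff_partialDList {k : ℕ} {f : EV m → ℝ} (l : List (Fin m))
    (hf : ContDiff ℝ (k + l.length : ℕ) f) : ContDiff ℝ k (partialDList l f) := by
  induction l generalizing k with
  | nil => exact hf
  | cons i l ih =>
    refine contDiff_partialD (ih ?_) i
    convert hf using 2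
    simp; ring

lemma partialDList_eq {f : EV m → ℝ} (l : List (Fin m)) (hf : ContDiff ℝ l.length f) (x : EV m) :
    partialDList l f x = iteratedFDeriv ℝ l.length f x (fun j => EuclideanSpace.single (l.get j) 1) := by
  induction l generalizing x with
  | nil => simp [partialDList]
  | cons i l ih =>
    have hf' : ContDiff ℝ l.length f := hf.of_le (by simp)
    have e : partialDList l f = fun x =>
      iteratedFDeriv ℝ l.length f x (fun j => EuclideanSpace.single (l.get j) 1) := funext fun x => ih hf' x
    show partialD i (partialDList l f) x = _
    rw [e]
    simp only [List.length_cons]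
    rw [iteratedFDeriv_succ_apply_left]
    have d : DifferentiableAt ℝ (iteratedFDeriv ℝ l.length f) x :=
      (hf.differentiable_iteratedFDeriv (by simp; exact_mod_cast Nat.lt_succ_self _)) x
    simp only [partialD]
    have := (d.hasFDerivAt.continuousMultilinear_apply_const
      (fun j => EuclideanSpace.single (l.get j) (1:ℝ))).fderiv
    rw [this]
    rfl

lemma partialDList_bd {f : EV m → ℝ} (l : List (Fin m)) (hf : ContDiff ℝ l.length f) (x : EV m) :
    |partialDList l f x| ≤ ‖iteratedFDeriv ℝ l.length f x‖ := by
  rw [partialDList_eq l hf x]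
  refine ((iteratedFDeriv ℝ l.length f x).le_opNorm _).trans ?_
  simp

structure PBs (C s : ℝ) (f : EV m → ℝ) : Prop where
  cd : ContDiff ℝ 2 f
  b0 : ∀ x, |f x| ≤ C
  b1 : ∀ i x, |partialD i f x| ≤ C / s
  b2 : ∀ i j x, |partialD i (partialD j f) x| ≤ C / s ^ 2

lemma PBs.pos {C s : ℝ} {f : EV m → ℝ} (h : PBs C s f) : 0 ≤ C := (abs_nonneg _).trans (h.b0 0)
lemma PBs.diff {C s : ℝ} {f : EV m → ℝ} (h : PBs C s f) : Differentiable ℝ f :=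
  h.cd.differentiable (by simp)
lemma PBs.cd1 {C s : ℝ} {f : EV m → ℝ} (h : PBs C s f) (i : Fin m) : ContDiff ℝ 1 (partialD i f) :=
  contDiff_partialD (k := 1) h.cd i
lemma PBs.diff1 {C s : ℝ} {f : EV m → ℝ} (h : PBs C s f) (i : Fin m) : Differentiable ℝ (partialD i f) :=
  (h.cd1 i).differentiable (by simp)

lemma PBs.small {C s : ℝ} {f : EV m → ℝ} (h : PBs C 1 f) (hs : 0 < s) (hs1 : s ≤ 1) : PBs C s f := by
  have hC := h.pos
  refine ⟨h.cd, h.b0, fun i x => (h.b1 i x).trans ?_, fun i j x => (h.b2 i j x).trans ?_⟩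
  · gcongr
  · gcongr

lemma PBs.mono {C C' s : ℝ} {f : EV m → ℝ} (h : PBs C s f) (hs : 0 < s) (hC : C ≤ C') : PBs C' s f := by
  refine ⟨h.cd, fun x => (h.b0 x).trans hC, fun i x => (h.b1 i x).trans ?_,
    fun i j x => (h.b2 i j x).trans ?_⟩
  · gcongr
  · gcongr

lemma partialD2_mul {a f : EV m → ℝ} (ha : ContDiff ℝ 2 a) (hf : ContDiff ℝ 2 f) (i j : Fin m) :
    partialD i (partialD j (fun x => a x * f x)) = fun x => partialD i (partialD j a) x * f x
      + partialD j a x * partialD i f x + partialD i a x * partialD j f x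
      + a x * partialD i (partialD j f) x := by
  have a0 := ha.differentiable (by simp)
  have f0 := hf.differentiable (by simp)
  have a1 := (contDiff_partialD (k := 1) ha j).differentiable (by simp)
  have f1 := (contDiff_partialD (k := 1) hf j).differentiable (by simp)
  rw [partialD_mul a0 f0, partialD_add (a1.fun_mul f0) (a0.fun_mul f1), partialD_mul a1 f0, partialD_mul a0 f1]
  funext x; ring

lemma PBs.mul {C C' s : ℝ} {f g : EV m → ℝ} (hf : PBs C s f) (hg : PBs C' s g) (hs : 0 < s) :
    PBs (4 * C * C') s (fun x => f x * g x) := by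
  have hC := hf.pos
  have hC' := hg.pos
  have hCC : 0 ≤ C * C' := mul_nonneg hC hC'
  have M : ∀ {a b A B : ℝ}, |a| ≤ A → |b| ≤ B → |a * b| ≤ A * B := fun h1 h2 => by
    rw [abs_mul]; exact mul_le_mul h1 h2 (abs_nonneg _) ((abs_nonneg _).trans h1)
  refine ⟨hf.cd.mul hg.cd, fun x => ?_, fun i x => ?_, fun i j x => ?_⟩
  · refine (M (hf.b0 x) (hg.b0 x)).trans (by linarith)
  · rw [partialD_mul hf.diff hg.diff]
    refine (abs_add_le _ _).trans ?_
    have e1 := M (hf.b1 i x) (hg.b0 x)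
    have e2 := M (hf.b0 x) (hg.b1 i x)
    have e3 : C / s * C' + C * (C' / s) = 2 * (C * C') / s := by field_simp; ring
    have e4 : 2 * (C * C') / s ≤ 4 * C * C' / s := by
      rw [mul_assoc]; gcongr; norm_num
    linarith
  · rw [partialD2_mul hf.cd hg.cd]
    refine (abs_add_le _ _).trans ?_
    have e0 := abs_add_le (partialD i (partialD j f) x * g x + partialD j f x * partialD i g x)
      (partialD i f x * partialD j g x)
    have e0' := abs_add_le (partialD i (partialD j f) x * g x) (partialD j f x * partialD i g x)
    have e1 := M (hf.b2 i j x) (hg.b0 x)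
    have e2 := M (hf.b0 x) (hg.b2 i j x)
    have e3 := M (hf.b1 i x) (hg.b1 j x)
    have e4 := M (hf.b1 j x) (hg.b1 i x)
    have e5 : C / s ^ 2 * C' + C / s * (C' / s) + C / s * (C' / s) + C * (C' / s ^ 2)
      = 4 * C * C' / s ^ 2 := by field_simp; ring
    linarith

lemma PBs.add {C C' s : ℝ} {f g : EV m → ℝ} (hf : PBs C s f) (hg : PBs C' s g) :
    PBs (C + C') s (fun x => f x + g x) := by
  refine ⟨hf.cd.add hg.cd, fun x => ?_, fun i x => ?_, fun i j x => ?_⟩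
  · exact (abs_add_le _ _).trans (add_le_add (hf.b0 x) (hg.b0 x))
  · rw [partialD_add hf.diff hg.diff, add_div]
    exact (abs_add_le _ _).trans (add_le_add (hf.b1 i x) (hg.b1 i x))
  · rw [partialD_add hf.diff hg.diff, partialD_add (hf.diff1 j) (hg.diff1 j), add_div]
    exact (abs_add_le _ _).trans (add_le_add (hf.b2 i j x) (hg.b2 i j x))

lemma PBs.zero {s : ℝ} : PBs 0 s (fun _ : EV m => (0:ℝ)) := by
  have h : ∀ i : Fin m, partialD i (fun _ : EV m => (0:ℝ)) = fun _ => 0 := by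
    intro i; funext x; simp [partialD]
  exact ⟨contDiff_const, by simp, by simp [h], by simp [h]⟩

lemma PBs.sum {ι : Type*} (S : Finset ι) {C s : ℝ} {f : ι → EV m → ℝ} (hf : ∀ j, PBs C s (f j)) :
    PBs (S.card * C) s (fun x => ∑ j ∈ S, f j x) := by
  classical
  induction S using Finset.induction_on with
  | empty => simpa using PBs.zero
  | insert a S ha ih =>
    simp only [Finset.sum_insert ha, Finset.card_insert_of_notMem ha]
    convert (hf a).add ih using 1
    push_cast; ring

lemma PBs.inv {C : ℝ} {f : EV m → ℝ} (hf : PBs C 1 f) (h1 : ∀ x, 1 ≤ f x) :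
    PBs (1 + C + 2 * C ^ 2) 1 (fun x => (f x)⁻¹) := by
  have hC := hf.pos
  have h0 : ∀ x, f x ≠ 0 := fun x => by linarith [h1 x]
  have hb : ∀ x, |(f x)⁻¹| ≤ 1 := fun x => by
    rw [abs_of_nonneg (inv_nonneg.2 (by linarith [h1 x]))]; exact inv_le_one_of_one_le₀ (h1 x)
  have hq : ContDiff ℝ 2 fun x => (f x)⁻¹ := hf.cd.inv h0
  have dq := hq.differentiable (by simp)
  have d1 : ∀ i, partialD i (fun x => (f x)⁻¹)
      = fun x => (-1) * ((f x)⁻¹ * (f x)⁻¹ * partialD i f x) := by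
    intro i; funext x
    simp only [partialD]
    have := ((hasDerivAt_inv (h0 x)).comp_hasFDerivAt x (hf.diff x).hasFDerivAt).fderiv
    have e : (fun x => (f x)⁻¹) = (fun y : ℝ => y⁻¹) ∘ f := rfl
    rw [e, this]
    simp [pow_two]
  have M : ∀ {a b A B : ℝ}, |a| ≤ A → |b| ≤ B → |a * b| ≤ A * B := fun h1 h2 => by
    rw [abs_mul]; exact mul_le_mul h1 h2 (abs_nonneg _) ((abs_nonneg _).trans h1)
  have q2 : ∀ x, |(f x)⁻¹ * (f x)⁻¹| ≤ 1 := fun x => by simpa using M (hb x) (hb x)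
  have b1 : ∀ i x, |partialD i f x| ≤ C := by simpa using hf.b1
  have b2 : ∀ i j x, |partialD i (partialD j f) x| ≤ C := by simpa using hf.b2
  have c1 : ∀ i x, |partialD i (fun x => (f x)⁻¹) x| ≤ C := by
    intro i x
    rw [d1]
    have := M (q2 x) (b1 i x)
    rw [abs_mul]; simpa using this
  refine ⟨hq, fun x => (hb x).trans (by nlinarith), fun i x => ?_, fun i j x => ?_⟩
  · exact (c1 i x).trans (by rw [div_one]; nlinarith)
  · rw [d1 j, partialD_const_mul, partialD_mul (dq.fun_mul dq) (hf.diff1 j), partialD_mul dq dq]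
    have e1 := M (M (c1 i x) (hb x)) (b1 j x)
    have e2 := M (q2 x) (b2 i j x)
    rw [abs_mul, abs_neg, abs_one, one_mul, one_pow, div_one]
    refine (abs_add_le _ _).trans ?_
    have e3 : (partialD i (fun x => (f x)⁻¹) x * (f x)⁻¹ + (f x)⁻¹ * partialD i (fun x => (f x)⁻¹) x)
        * partialD j f x = 2 * (partialD i (fun x => (f x)⁻¹) x * (f x)⁻¹ * partialD j f x) := by ring
    have e4 := congrArg abs e3
    rw [abs_mul 2, abs_two] at e4
    refine (add_le_add_left e4.le _).trans ?_
    nlinarith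

lemma PBs.const_mul {C s : ℝ} {f : EV m → ℝ} (hf : PBs C s f) (c : ℝ) :
    PBs (|c| * C) s (fun x => c * f x) := by
  refine ⟨contDiff_const.mul hf.cd, fun x => ?_, fun i x => ?_, fun i j x => ?_⟩
  · rw [abs_mul]; exact mul_le_mul_of_nonneg_left (hf.b0 x) (abs_nonneg _)
  · rw [partialD_const_mul, abs_mul, mul_div_assoc]
    exact mul_le_mul_of_nonneg_left (hf.b1 i x) (abs_nonneg _)
  · rw [partialD_const_mul, partialD_const_mul, abs_mul, mul_div_assoc]
    exact mul_le_mul_of_nonneg_left (hf.b2 i j x) (abs_nonneg _)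

/-- compactly supported `C²` functions are bounded -/
lemma PBs.of_cc {f : EV m → ℝ} (hf : ContDiff ℝ 2 f) (hc : HasCompactSupport f) : ∃ C, PBs C 1 f := by
  have B : ∀ k : ℕ, k ≤ 2 → ∃ C, ∀ x, ‖iteratedFDeriv ℝ k f x‖ ≤ C := fun k hk =>
    (hc.iteratedFDeriv (𝕜 := ℝ) k).exists_bound_of_continuous
      (hf.continuous_iteratedFDeriv (by exact_mod_cast hk))
  obtain ⟨C0, h0⟩ := B 0 (by simp)
  obtain ⟨C1, h1⟩ := B 1 (by simp)
  obtain ⟨C2, h2⟩ := B 2 (by simp)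
  refine ⟨max C0 (max C1 C2), hf, fun x => ?_, fun i x => ?_, fun i j x => ?_⟩
  · exact ((partialDList_bd [] (hf.of_le (by simp)) x).trans (h0 x)).trans (le_max_left _ _)
  · rw [div_one]
    exact ((partialDList_bd [i] (hf.of_le (by norm_num)) x).trans (h1 x)).trans
      ((le_max_left _ _).trans (le_max_right _ _))
  · rw [one_pow, div_one]
    exact ((partialDList_bd [i, j] hf x).trans (h2 x)).trans
      ((le_max_right _ _).trans (le_max_right _ _))

lemma PBs.scale {C : ℝ} {f : EV m → ℝ} (hf : PBs C 1 f) {s : ℝ} (hs : 0 < s) (hs1 : s ≤ 1) :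
    PBs C 1 (fun x => f (s • x)) := by
  have hC := hf.pos
  have d : ∀ (g : EV m → ℝ) (i : Fin m), Differentiable ℝ g →
      partialD i (fun x => g (s • x)) = fun x => s * partialD i g (s • x) := by
    intro g i hg; funext x
    have : HasFDerivAt (fun x => g (s • x)) _ x :=
      (hg (s • x)).hasFDerivAt.comp x ((hasFDerivAt_id x).const_smul s)
    simp only [partialD, this.fderiv]
    simp
  have hm : ∀ a : ℝ, |a| ≤ C → |s * a| ≤ C := fun a ha => by
    rw [abs_mul, abs_of_pos hs]; nlinarith [abs_nonneg a]
  refine ⟨hf.cd.comp (contDiff_const_smul s), fun x => hf.b0 _, fun i x => ?_, fun i j x => ?_⟩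
  · rw [d _ _ hf.diff]
    have := hm _ (by simpa using hf.b1 i (s • x))
    simpa using this
  · rw [d _ _ hf.diff, partialD_const_mul, d _ _ (hf.diff1 j)]
    have := hm _ (hm _ (by simpa using hf.b2 i j (s • x)))
    simpa using this

namespace Geo
variable {e : EV m} {τ : EV m → ℝ} {K : ℝ}

lemma PB_N (G : Geo e τ K) (i : Fin m) : PBs K 1 (partialD i τ) := by
  refine ⟨contDiff_partialD (k := 2) G.smooth i, fun x => ?_, fun j x => ?_, fun j k x => ?_⟩
  · exact (partialDList_bd [i] (G.smooth.of_le (by norm_num)) x).trans (G.bd 1 le_rfl (by norm_num) x)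
  · rw [div_one]
    exact (partialDList_bd [j, i] (G.smooth.of_le (by norm_num)) x).trans (G.bd 2 (by norm_num) (by norm_num) x)
  · rw [one_pow, div_one]
    exact (partialDList_bd [j, k, i] (G.smooth.of_le (by norm_num)) x).trans (G.bd 3 (by norm_num) (by norm_num) x)

lemma N_sq (G : Geo e τ K) (x : EV m) : 1 ≤ ∑ i, partialD i τ x * partialD i τ x := by
  have h := clm_eq_sum (fderiv ℝ τ x) e
  rw [G.fderiv_e] at h
  have cs := Finset.sum_mul_sq_le_sq_mul_sq Finset.univ (fun i => e i) (fun i => partialD i τ x)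
  have he : ∑ i, e i ^ 2 = 1 := by
    have := EuclideanSpace.norm_sq_eq e
    rw [G.e1] at this; simpa using this.symm
  rw [he, one_mul] at cs
  have : ∑ i, e i * partialD i τ x = 1 := h.symm
  rw [this] at cs
  simpa [pow_two] using cs

/-- the function `1/|N|²` -/
def qN (τ : EV m → ℝ) (x : EV m) : ℝ := (∑ i, partialD i τ x * partialD i τ x)⁻¹

lemma PB_q (G : Geo e τ K) : ∃ C, PBs C 1 (qN τ) := by
  have h1 : PBs _ 1 (fun x => ∑ i, partialD i τ x * partialD i τ x) :=
    PBs.sum Finset.univ (fun i => (G.PB_N i).mul (G.PB_N i) one_pos)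
  exact ⟨_, h1.inv G.N_sq⟩

/-- profile with `θ 0 = 0`, `θ' 0 = 1`, supported in `[-1,1]` -/
lemma exists_theta : ∃ θ : ℝ → ℝ, ContDiff ℝ (⊤ : ℕ∞) θ ∧ HasCompactSupport θ ∧ θ 0 = 0 ∧ deriv θ 0 = 1 ∧
    ∀ r, 1 < |r| → (∀ᶠ r' in 𝓝 r, θ r' = 0) := by
  let ψ : ContDiffBump (0:ℝ) := ⟨1/2, 1, by norm_num, by norm_num⟩
  refine ⟨fun r => r * ψ r, contDiff_id.mul ψ.contDiff, ψ.hasCompactSupport.mul_left, by simp, ?_, ?_⟩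
  · have h1 : DifferentiableAt ℝ (ψ : ℝ → ℝ) 0 := (ψ.contDiff (n := 1)).differentiable (by simp) 0
    have := (hasDerivAt_id (0:ℝ)).mul h1.hasDerivAt
    have e : ψ (0:ℝ) = 1 := ψ.one_of_mem_closedBall (by simp; exact ψ.rIn_pos.le)
    have h := this.deriv
    simp only [id, e] at h
    have h2 : (id * (ψ : ℝ → ℝ)) = fun r => r * ψ r := rfl
    rw [h2] at h
    rw [h]; simp
  · intro r hr
    have : r ∉ tsupport ψ := by rw [ψ.tsupport_eq]; simp [ψ]; exact hr
    have := (notMem_tsupport_iff_eventuallyEq).1 this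
    filter_upwards [this] with r' h'
    simp [h']

lemma PB_theta (G : Geo e τ K) {θ : ℝ → ℝ} (h1 : ContDiff ℝ (⊤ : ℕ∞) θ) (h2 : HasCompactSupport θ) :
    ∃ C, ∀ s : ℝ, 0 < s → s ≤ 1 → PBs C s (fun x => θ (τ x / s)) := by
  have c0 := h1.continuous
  have hd : ContDiff ℝ (⊤ : ℕ∞) (deriv θ) := ((contDiff_infty_iff_deriv).1 h1).2
  have hdd : ContDiff ℝ (⊤ : ℕ∞) (deriv (deriv θ)) := ((contDiff_infty_iff_deriv).1 hd).2
  obtain ⟨C0, B0⟩ := h2.exists_bound_of_continuous c0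
  obtain ⟨C1, B1⟩ := h2.deriv.exists_bound_of_continuous hd.continuous
  obtain ⟨C2, B2⟩ := h2.deriv.deriv.exists_bound_of_continuous hdd.continuous
  have p0 : 0 ≤ C0 := (norm_nonneg _).trans (B0 0)
  have p1 : 0 ≤ C1 := (norm_nonneg _).trans (B1 0)
  have p2 : 0 ≤ C2 := (norm_nonneg _).trans (B2 0)
  have pK := G.Kpos
  refine ⟨C0 + C1 * K + C2 * K ^ 2, fun s hs hs1 => ?_⟩
  have D : ∀ (g : ℝ → ℝ) (i : Fin m), Differentiable ℝ g →
      partialD i (fun x => g (τ x / s)) = fun x => s⁻¹ * (deriv g (τ x / s) * partialD i τ x) := by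
    intro g i hg; funext x
    have h3 : HasFDerivAt (fun x => τ x / s) (s⁻¹ • fderiv ℝ τ x) x := by
      have := (G.diff x).hasFDerivAt.const_smul s⁻¹
      refine this.congr_of_eventuallyEq (Eventually.of_forall fun y => ?_)
      simp [div_eq_inv_mul]
    have := (hg (τ x / s)).hasDerivAt.comp_hasFDerivAt x h3
    have h4 : fderiv ℝ (fun x => g (τ x / s)) x = _ := this.fderiv
    simp only [partialD, h4]
    simp; ring
  have d0 : Differentiable ℝ θ := h1.differentiable (by simp)
  have d1 : Differentiable ℝ (deriv θ) := hd.differentiable (by simp)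
  have dd : Differentiable ℝ (fun x => deriv θ (τ x / s)) := by
    have := G.diff
    simp only [div_eq_mul_inv]
    exact d1.comp (this.mul_const _)
  have M : ∀ {a b A B : ℝ}, |a| ≤ A → |b| ≤ B → |a * b| ≤ A * B := fun h1 h2 => by
    rw [abs_mul]; exact mul_le_mul h1 h2 (abs_nonneg _) ((abs_nonneg _).trans h1)
  have n1 : ∀ i x, |partialD i τ x| ≤ K := fun i x => (G.PB_N i).b0 x
  have n2 : ∀ i j x, |partialD i (partialD j τ) x| ≤ K := fun i j x => by simpa using (G.PB_N j).b1 i x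
  refine ⟨(contDiff_infty.1 h1 2).comp ((G.smooth.of_le (by norm_num)).div_const s),
    fun x => ?_, fun i x => ?_, fun i j x => ?_⟩
  · refine (B0 _).trans ?_; nlinarith [mul_nonneg p1 pK.le, mul_nonneg p2 (sq_nonneg K)]
  · rw [D θ i d0, abs_mul, abs_of_pos (inv_pos.2 hs), div_eq_inv_mul (_ + _) s]
    show s⁻¹ * |deriv θ (τ x / s) * partialD i τ x| ≤ s⁻¹ * _
    refine mul_le_mul_of_nonneg_left ((M (B1 _) (n1 i x)).trans ?_) (inv_pos.2 hs).le
    nlinarith [mul_nonneg p2 (sq_nonneg K)]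
  · rw [D θ j d0, partialD_const_mul, partialD_mul dd ((G.PB_N j).diff), D _ i d1]
    have e1 := M (M (B2 (τ x / s)) (n1 i x)) (n1 j x)
    have e2 := M (B1 (τ x / s)) (n2 i j x)
    have e3 : s⁻¹ * (s⁻¹ * (deriv (deriv θ) (τ x / s) * partialD i τ x) * partialD j τ x +
        deriv θ (τ x / s) * partialD i (partialD j τ) x)
      = (s ^ 2)⁻¹ * (deriv (deriv θ) (τ x / s) * partialD i τ x * partialD j τ x +
        s * (deriv θ (τ x / s) * partialD i (partialD j τ) x)) := by field_simp
    show |s⁻¹ * (s⁻¹ * (deriv (deriv θ) (τ x / s) * partialD i τ x) * partialD j τ x +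
        deriv θ (τ x / s) * partialD i (partialD j τ) x)| ≤ _
    rw [e3, abs_mul, abs_of_pos (show 0 < (s ^ 2)⁻¹ by positivity), div_eq_inv_mul (_ + _) (s ^ 2)]
    refine mul_le_mul_of_nonneg_left ?_ (by positivity)
    refine (abs_add_le _ _).trans ?_
    have e4 : |s * (deriv θ (τ x / s) * partialD i (partialD j τ) x)| ≤ C1 * K := by
      rw [abs_mul, abs_of_pos hs]
      have := mul_le_mul hs1 e2 (abs_nonneg _) zero_le_one
      linarith
    nlinarith
end Geo
end PartSix

section PartSeven

variable {m : ℕ}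

/-- small families in `L^p` -/
def LpO (p : ℝ≥0∞) (A : ℝ → Set (EV m)) (f : ℝ → EV m → ℝ) : Prop :=
  (∀ s, 0 < s → s ≤ 1 → Measurable (f s)) ∧
  Tendsto (fun s => eLpNorm (f s) p (volume.restrict (A s))) (𝓝[>] 0) (𝓝 0)

lemma ev01 {P : ℝ → Prop} (h : ∀ s, 0 < s → s ≤ 1 → P s) : ∀ᶠ s in 𝓝[>] (0:ℝ), P s := by
  filter_upwards [Ioc_mem_nhdsGT (zero_lt_one' ℝ)] with s hs using h s hs.1 hs.2

lemma tendsto_zero_of_le01 {F H : ℝ → ℝ≥0∞} (h : ∀ s, 0 < s → s ≤ 1 → F s ≤ H s)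
    (hH : Tendsto H (𝓝[>] 0) (𝓝 0)) : Tendsto F (𝓝[>] 0) (𝓝 0) :=
  tendsto_of_tendsto_of_tendsto_of_le_of_le' tendsto_const_nhds hH (by simp) (ev01 h)

lemma LpO.add {p : ℝ≥0∞} (hp1 : 1 ≤ p) {A : ℝ → Set (EV m)} {f g : ℝ → EV m → ℝ}
    (hf : LpO p A f) (hg : LpO p A g) : LpO p A (fun s x => f s x + g s x) := by
  refine ⟨fun s h0 h1 => (hf.1 s h0 h1).add (hg.1 s h0 h1), ?_⟩
  refine tendsto_zero_of_le01 (H := fun s => eLpNorm (f s) p (volume.restrict (A s))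
    + eLpNorm (g s) p (volume.restrict (A s))) (fun s h0 h1 => ?_) (by simpa using hf.2.add hg.2)
  exact eLpNorm_add_le (hf.1 s h0 h1).aestronglyMeasurable (hg.1 s h0 h1).aestronglyMeasurable hp1

lemma LpO.sum {p : ℝ≥0∞} (hp1 : 1 ≤ p) {A : ℝ → Set (EV m)} {ι : Type*} (S : Finset ι)
    {f : ι → ℝ → EV m → ℝ}
    (hf : ∀ i, LpO p A (f i)) : LpO p A (fun s x => ∑ i ∈ S, f i s x) := by
  classical
  induction S using Finset.induction_on with
  | empty => exact ⟨fun s _ _ => by simp, by simp⟩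
  | insert a S ha ih =>
    simp only [Finset.sum_insert ha]
    exact (hf a).add hp1 ih

lemma LpO.bmul {p : ℝ≥0∞} {A : ℝ → Set (EV m)} (hA : ∀ s, MeasurableSet (A s)) {a f : ℝ → EV m → ℝ}
    {C : ℝ} (ha : ∀ s, 0 < s → s ≤ 1 → Measurable (a s))
    (hb : ∀ s, 0 < s → s ≤ 1 → ∀ x, |a s x| ≤ C)
    (hf : LpO p A f) : LpO p A (fun s x => a s x * f s x) := by
  refine ⟨fun s h0 h1 => (ha s h0 h1).mul (hf.1 s h0 h1), ?_⟩
  have hlim := ENNReal.Tendsto.const_mul (a := ENNReal.ofReal C) hf.2 (Or.inr ENNReal.ofReal_ne_top)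
  rw [mul_zero] at hlim
  refine tendsto_zero_of_le01 (fun s h0 h1 => ?_) hlim
  refine eLpNorm_le_mul_eLpNorm_of_ae_le_mul (Eventually.of_forall fun x => ?_) p
  rw [norm_mul]
  exact mul_le_mul_of_nonneg_right (hb s h0 h1 x) (norm_nonneg _)

lemma LpO.congr {p : ℝ≥0∞} {A : ℝ → Set (EV m)} (hA : ∀ s, MeasurableSet (A s)) {f g : ℝ → EV m → ℝ}
    (hg : ∀ s, 0 < s → s ≤ 1 → Measurable (g s))
    (h : ∀ s, 0 < s → s ≤ 1 → ∀ x ∈ A s, g s x = f s x)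
    (hf : LpO p A f) : LpO p A g := by
  refine ⟨hg, tendsto_zero_of_le01 (fun s h0 h1 => ?_) hf.2⟩
  refine le_of_eq (eLpNorm_congr_ae ?_)
  filter_upwards [ae_restrict_mem (hA s)] with x hx using h s h0 h1 x hx

lemma LpO.extend {p : ℝ≥0∞} {A B : ℝ → Set (EV m)} (hA : ∀ s, MeasurableSet (A s))
    (hB : ∀ s, MeasurableSet (B s)) {f : ℝ → EV m → ℝ}
    (h : ∀ s, 0 < s → s ≤ 1 → ∀ x ∈ B s, x ∉ A s → f s x = 0)
    (hf : LpO p A f) : LpO p B f := by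
  refine ⟨hf.1, tendsto_zero_of_le01 (fun s h0 h1 => ?_) hf.2⟩
  rw [← eLpNorm_indicator_eq_eLpNorm_restrict (hB s), ← eLpNorm_indicator_eq_eLpNorm_restrict (hA s)]
  refine eLpNorm_mono fun x => ?_
  by_cases hx : x ∈ B s
  · by_cases hx' : x ∈ A s
    · simp [hx, hx']
    · simp [hx, hx', h s h0 h1 x hx hx']
  · simp [hx]

lemma tendsto_layer {τ : EV m → ℝ} (hτ : Continuous τ) {p : ℝ≥0∞} (hp1 : 1 ≤ p) (hp : p ≠ ⊤) {f : EV m → ℝ}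
    (hf : Measurable f) (hfp : MemLp f p volume) :
    Tendsto (fun h : ℝ => eLpNorm f p (volume.restrict (Sl τ h))) (𝓝[>] 0) (𝓝 0) := by
  have hS : ∀ h, MeasurableSet (Sl τ h) := fun h =>
    (measurableSet_lt measurable_const hτ.measurable).inter (measurableSet_le hτ.measurable measurable_const)
  have hr := toReal_one_le hp1 hp
  have hr0 : p.toReal ≠ 0 := by linarith
  have key : Tendsto (fun h : ℝ => ∫⁻ x, (Sl τ h).indicator (fun x => ‖f x‖ₑ ^ p.toReal) x) (𝓝[>] 0)
      (𝓝 (∫⁻ _ : EV m, 0)) := by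
    refine tendsto_lintegral_filter_of_dominated_convergence (fun x => ‖f x‖ₑ ^ p.toReal) ?_ ?_ ?_ ?_
    · exact Eventually.of_forall fun h => (by fun_prop : Measurable _).indicator (hS h)
    · exact Eventually.of_forall fun h => Eventually.of_forall fun x => Set.indicator_le_self _ _ _
    · rw [← eLpNorm_rpow_eq volume hp1 hp f]
      exact ENNReal.rpow_ne_top_of_nonneg (by linarith) hfp.2.ne
    · refine Eventually.of_forall fun x => ?_
      refine tendsto_const_nhds.congr' ?_
      by_cases hx : 0 < τ x
      · filter_upwards [Ioo_mem_nhdsGT hx] with h hh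
        rw [Set.indicator_of_notMem]
        exact fun h' => absurd h'.2 (not_le.2 hh.2)
      · filter_upwards with h
        rw [Set.indicator_of_notMem]
        exact fun h' => hx h'.1
  have key2 := key.ennrpow_const (1 / p.toReal)
  simp only [lintegral_zero] at key2
  rw [ENNReal.zero_rpow_of_pos (by positivity)] at key2
  refine key2.congr fun h => ?_
  rw [lintegral_indicator (hS h), ← eLpNorm_rpow_eq _ hp1 hp f, ← ENNReal.rpow_mul]
  simp [hr0]

lemma tendsto_mul_pos_nhdsGT {c : ℝ} (hc : 0 < c) : Tendsto (fun s : ℝ => c * s) (𝓝[>] 0) (𝓝[>] 0) := by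
  refine tendsto_nhdsWithin_iff.2 ⟨?_, ?_⟩
  · have : Tendsto (fun s : ℝ => c * s) (𝓝 0) (𝓝 (c * 0)) := tendsto_id.const_mul c
    rw [mul_zero] at this
    exact this.mono_left nhdsWithin_le_nhds
  · filter_upwards [self_mem_nhdsWithin] with s hs using mul_pos hc hs

lemma partialDList_eventually_zero {f : EV m → ℝ} {x : EV m} (h : ∀ᶠ y in 𝓝 x, f y = 0) (l : List (Fin m)) :
    ∀ᶠ y in 𝓝 x, partialDList l f y = 0 := by
  induction l with
  | nil => exact h
  | cons i l ih =>
    filter_upwards [ih.eventually_nhds] with y hy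
    have : partialDList l f =ᶠ[𝓝 y] fun _ => 0 := hy
    show fderiv ℝ (partialDList l f) y _ = 0
    rw [this.fderiv_eq]; simp

lemma cont_partialDList {f : EV m → ℝ} (hf : ContDiff ℝ 2 f) {l : List (Fin m)} (hl : l.length ≤ 2) :
    Continuous (partialDList l f) :=
  (contDiff_partialDList (k := 0) l (hf.of_le (by exact_mod_cast (by omega)))).continuous

/-- the correction product lemma -/
lemma LpO.product {p : ℝ≥0∞} (hp1 : 1 ≤ p) {S : ℝ → Set (EV m)} {Ω : Set (EV m)}
    (hS : ∀ s, MeasurableSet (S s)) (hΩ : MeasurableSet Ω) {g f : ℝ → EV m → ℝ} {C : ℝ}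
    (hg : ∀ s, 0 < s → s ≤ 1 → PBs C s (g s))
    (hz : ∀ s, 0 < s → s ≤ 1 → ∀ x ∈ Ω, x ∉ S s → ∀ᶠ y in 𝓝 x, g s y = 0)
    (hf : ∀ s, 0 < s → s ≤ 1 → ContDiff ℝ 2 (f s))
    (f0 : LpO p S (fun s x => s⁻¹ * f s x)) (f1 : ∀ i, LpO p S (fun s => partialD i (f s)))
    (f2 : ∀ i j, LpO p S (fun s x => s * partialD i (partialD j (f s)) x)) {l : List (Fin m)}
    (hl : l.length ≤ 2) : LpO p (fun _ => Ω) (fun s => partialDList l (fun x => s * g s x * f s x)) := by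
  have hzz : ∀ s, 0 < s → s ≤ 1 → ∀ x ∈ Ω, x ∉ S s →
      partialDList l (fun x => s * g s x * f s x) x = 0 := by
    intro s h0 h1 x hx hxs
    refine (partialDList_eventually_zero (x := x) ?_ l).self_of_nhds
    filter_upwards [hz s h0 h1 x hx hxs] with y hy
    rw [hy]; ring
  refine LpO.extend hS (fun _ => hΩ) hzz ?_
  have hm : ∀ s, 0 < s → s ≤ 1 → Measurable (partialDList l (fun x => s * g s x * f s x)) := fun s h0 h1 =>
    (cont_partialDList ((contDiff_const.mul (hg s h0 h1).cd).mul (hf s h0 h1)) hl).measurable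
  have c1 : ∀ s, 0 < s → s ≤ 1 → ∀ i, Measurable (partialD i (g s)) := fun s h0 h1 i =>
    ((hg s h0 h1).cd1 i).continuous.measurable
  have c2 : ∀ s, 0 < s → s ≤ 1 → ∀ i j, Measurable (partialD i (partialD j (g s))) := fun s h0 h1 i j =>
    (contDiff_partialD (k := 0) ((hg s h0 h1).cd1 j) i).continuous.measurable
  have c0 : ∀ s, 0 < s → s ≤ 1 → Measurable (g s) := fun s h0 h1 => (hg s h0 h1).cd.continuous.measurable
  have B0 : ∀ s, 0 < s → s ≤ 1 → ∀ x, |g s x| ≤ C := fun s h0 h1 x => (hg s h0 h1).b0 x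
  have B1 : ∀ s, 0 < s → s ≤ 1 → ∀ i x, |s * partialD i (g s) x| ≤ C := fun s h0 h1 i x => by
    rw [abs_mul, abs_of_pos h0]
    have := mul_le_mul_of_nonneg_left ((hg s h0 h1).b1 i x) h0.le
    rwa [mul_div_cancel₀ _ h0.ne'] at this
  have B2 : ∀ s, 0 < s → s ≤ 1 → ∀ i j x, |s ^ 2 * partialD i (partialD j (g s)) x| ≤ C := fun s h0 h1 i j x => by
    rw [abs_mul, abs_of_pos (by positivity)]
    have := mul_le_mul_of_nonneg_left ((hg s h0 h1).b2 i j x) (by positivity : 0 ≤ s ^ 2)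
    rwa [mul_div_cancel₀ _ (by positivity)] at this
  have sm : ∀ {s a : ℝ}, 0 < s → s ≤ 1 → |a| ≤ C → |s * a| ≤ C := fun {s a} h0 h1 h => by
    rw [abs_mul, abs_of_pos h0]; nlinarith [abs_nonneg a]
  have dsg : ∀ s, 0 < s → s ≤ 1 → ContDiff ℝ 2 fun x => s * g s x := fun s h0 h1 =>
    contDiff_const.mul (hg s h0 h1).cd
  match l, hl with
  | [], _ =>
    refine LpO.congr hS hm ?_ (LpO.bmul (a := fun s x => s * (s * g s x)) (C := C) hS ?_ ?_ f0)
    · intro s h0 h1 x _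
      show s * g s x * f s x = _
      field_simp
    · exact fun s h0 h1 => by have := c0 s h0 h1; fun_prop
    · exact fun s h0 h1 x => sm h0 h1 (sm h0 h1 (B0 s h0 h1 x))
  | [i], _ =>
    refine LpO.congr hS hm ?_ (LpO.add hp1 (LpO.bmul (a := fun s x => s * (s * partialD i (g s) x)) (C := C) hS ?_ ?_ f0)
      (LpO.bmul (a := fun s x => s * g s x) (C := C) hS ?_ ?_ (f1 i)))
    · intro s h0 h1 x _
      show partialD i (fun x => s * g s x * f s x) x = _
      rw [partialD_mul ((dsg s h0 h1).differentiable (by simp)) ((hf s h0 h1).differentiable (by simp)),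
        partialD_const_mul]
      field_simp
    · exact fun s h0 h1 => by have := c1 s h0 h1 i; fun_prop
    · exact fun s h0 h1 x => sm h0 h1 (B1 s h0 h1 i x)
    · exact fun s h0 h1 => by have := c0 s h0 h1; fun_prop
    · exact fun s h0 h1 x => sm h0 h1 (B0 s h0 h1 x)
  | [i, j], _ =>
    refine LpO.congr hS hm ?_ (LpO.add hp1 (LpO.add hp1 (LpO.add hp1
      (LpO.bmul (a := fun s x => s ^ 2 * partialD i (partialD j (g s)) x) (C := C) hS ?_ ?_ f0)
      (LpO.bmul (a := fun s x => s * partialD j (g s) x) (C := C) hS ?_ ?_ (f1 i)))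
      (LpO.bmul (a := fun s x => s * partialD i (g s) x) (C := C) hS ?_ ?_ (f1 j)))
      (LpO.bmul (a := fun s x => g s x) (C := C) hS ?_ ?_ (f2 i j)))
    · intro s h0 h1 x _
      show partialD i (partialD j (fun x => s * g s x * f s x)) x = _
      rw [partialD2_mul (dsg s h0 h1) (hf s h0 h1)]
      simp only [partialD_const_mul]
      field_simp
    · exact fun s h0 h1 => by have := c2 s h0 h1 i j; fun_prop
    · exact fun s h0 h1 x => (B2 s h0 h1 i j x)
    · exact fun s h0 h1 => by have := c1 s h0 h1 j; fun_prop
    · exact fun s h0 h1 x => (B1 s h0 h1 j x)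
    · exact fun s h0 h1 => by have := c1 s h0 h1 i; fun_prop
    · exact fun s h0 h1 x => (B1 s h0 h1 i x)
    · exact c0
    · exact B0
  | _ :: _ :: _ :: _, h => exact absurd h (by simp)

end PartSeven

section PartEight

variable {m : ℕ}

lemma Jet.moll_partial {Ω : Set (EV m)} {k : ℕ} {p : ℝ≥0∞} (hp1 : 1 ≤ p) {D : List (Fin m) → EV m → ℝ}
    (hD : Jet Ω k p D) {η : EV m → ℝ} (hη : Mol η) (hst : StarU η Ω) (hΩ : IsOpen Ω) {s : ℝ} (hs : 0 < s)
    (l : List (Fin m)) (hl : l.length ≤ k) {x : EV m} (hx : x ∈ Ω) :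
    partialDList l (moll η s (D [])) x = moll η s (D l) x := by
  induction l generalizing x with
  | nil => rfl
  | cons i l ih =>
    have hl' : l.length < k := by simpa using hl
    have e : partialDList l (moll η s (D [])) =ᶠ[𝓝 x] moll η s (D l) := by
      filter_upwards [hΩ.mem_nhds hx] with y hy using ih hl'.le hy
    show fderiv ℝ (partialDList l (moll η s (D []))) x _ = _
    rw [e.fderiv_eq]
    exact moll_fderiv_on hη hst (hD.loc hp1 l) (hD.weak l hl' i) hs hx

namespace Geo
variable {e : EV m} {τ : EV m → ℝ} {K : ℝ}

lemma LpO_moll_layer (G : Geo e τ K) {p : ℝ≥0∞} (hp1 : 1 ≤ p) (hp : p ≠ ⊤) {κ : EV m → ℝ}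
    (hκ : ContDiff ℝ (⊤ : ℕ∞) κ) (hc : HasCompactSupport κ)
    (hsup : tsupport κ ⊆ Metric.closedBall (-(2 * K) • e) 1) {f : EV m → ℝ} (hf : Measurable f)
    (hfp : MemLp f p volume) : LpO p (fun s => Sl τ s) (fun s => moll κ s f) := by
  refine ⟨fun s h0 _ => (moll_contDiff hκ hc h0 (hfp.locallyIntegrable hp1)).continuous.measurable, ?_⟩
  have pK := G.Kpos
  have h1 := (tendsto_layer G.cont hp1 hp hf hfp).comp
    (tendsto_mul_pos_nhdsGT (show 0 < 1 + 3 * K by linarith))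
  have h2 := ENNReal.Tendsto.const_mul (a := mass κ) h1 (Or.inr (mass_ne_top hκ.continuous hc))
  rw [mul_zero] at h2
  refine tendsto_zero_of_le01 (fun s h0 _ => ?_) h2
  refine moll_eLpNorm_le hκ.continuous hc s hf hp1 hp (G.measSl _) (G.measSl _) fun x hx y hy => ?_
  have := G.tau_shift_bd (x := x) (hsup hy) h0.le
  exact ⟨hx.1.trans_le this.1, this.2.trans (by linarith [hx.2])⟩

lemma layer_shift (G : Geo e τ K) {p : ℝ≥0∞} (hp1 : 1 ≤ p) (hp : p ≠ ⊤) {η : EV m → ℝ} (hη : Mol η)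
    (hsup : tsupport η ⊆ Metric.closedBall (-(2 * K) • e) 1) (hst : StarU η (Om τ))
    {D : List (Fin m) → EV m → ℝ} {k : ℕ} (hD : Jet (Om τ) k p D) {l : List (Fin m)} (hl : l.length < k)
    {s : ℝ} (hs : 0 < s) :
    eLpNorm (fun x => moll η s (D l) x - D l x) p (volume.restrict (Sl τ s))
      ≤ mass η * (ENNReal.ofReal (s * (2 * K + 1)) *
        ∑ j, eLpNorm (D (j :: l)) p (volume.restrict (Sl τ ((1 + 3 * K) * s)))) := by
  refine moll_sub_eLpNorm_le hη.cont hη.hcs hη.int hs (hD.meas l) (hD.loc hp1 l) hp1 hp fun y hy => ?_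
  have pK := G.Kpos
  have hw := hD.weakDir hp1 (-(s • y)) hl
  have h1 := weak_shift hη (U := Om τ) (A := Sl τ s) (B := Sl τ ((1 + 3 * K) * s)) (G.measSl _) (G.measSl _)
    hst (hD.meas l) (hD.dir_meas _ l) hp1 hp (hD.memLp l) (hD.dir_memLp _ l) hw ?_ (Sl_sub _)
  · simp only [sub_eq_add_neg] at h1 ⊢
    refine h1.trans ?_
    have yb : ‖y‖ ≤ 2 * K + 1 := by
      have h2 : ‖y - (-(2 * K) • e)‖ ≤ 1 := by simpa [dist_eq_norm] using hsup hy
      have h3 : ‖(-(2 * K)) • e‖ = 2 * K := by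
        rw [norm_smul, G.e1, mul_one, norm_neg, Real.norm_of_nonneg (by linarith)]
      calc ‖y‖ = ‖(y - (-(2 * K) • e)) + (-(2 * K)) • e‖ := by congr 1; module
        _ ≤ _ := norm_add_le _ _
        _ ≤ 2 * K + 1 := by rw [h3]; linarith
    have e1 : dirD (-(s • y)) D l = ∑ j, ((-(s • y)) j) • D (j :: l) := by
      funext x; simp [dirD]
    rw [e1, Finset.mul_sum]
    refine (eLpNorm_sum_le (fun j _ => ((hD.meas (j :: l)).aestronglyMeasurable.const_smul _)) hp1).trans ?_
    refine Finset.sum_le_sum fun j _ => ?_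
    rw [eLpNorm_const_smul]
    gcongr
    rw [Real.enorm_eq_ofReal_abs]
    refine ENNReal.ofReal_le_ofReal ?_
    have : |(-(s • y)) j| = s * |y j| := by
      simp [abs_mul, abs_of_pos hs]
    rw [this]
    gcongr
    exact (PiLp.norm_apply_le y j).trans yb
  · intro x hx σ hσ
    have e2 : x + σ • (-(s • y)) = x - (σ * s) • y := by module
    rw [e2]
    have := G.tau_shift_bd (x := x) (hsup hy) (mul_nonneg hσ.1 hs.le)
    refine ⟨hx.1.trans_le this.1, this.2.trans ?_⟩
    have h3 : σ * s ≤ s := by nlinarith [hσ.2]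
    have h4 : 3 * K * (σ * s) ≤ 3 * K * s := by gcongr
    linarith [hx.2]

lemma LpO_normal (G : Geo e τ K) {p : ℝ≥0∞} (hp1 : 1 ≤ p) (hp : p ≠ ⊤) {η : EV m → ℝ} (hη : Mol η)
    (hsup : tsupport η ⊆ Metric.closedBall (-(2 * K) • e) 1) (hst : StarU η (Om τ))
    {D : List (Fin m) → EV m → ℝ} (hD : Jet (Om τ) 2 p D) (hbc : JetBC τ D) :
    LpO p (fun s => Sl τ s) (fun s x => s⁻¹ * ∑ i, partialD i τ x * moll η s (D [i]) x) := by
  have hNm : ∀ i : Fin m, Measurable (partialD i τ) := fun i => (G.PB_N i).cd.continuous.measurable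
  have pK := G.Kpos
  have a1 : LpO p (fun s => Sl τ s) (fun s x => s⁻¹ * nGrad τ D x) := by
    refine ⟨fun s _ _ => (G.nGrad_meas hD).const_mul _, ?_⟩
    have m2 : MemLp (nGradE τ e D) p volume :=
      memLp_finsetSum _ fun i _ => G.N_mul_memLp (hD.dir_memLp e [i]) i
    refine tendsto_zero_of_le01 (fun s h0 _ => ?_) (tendsto_layer G.cont hp1 hp (G.nGradE_meas hD) m2)
    have h1 := eLpNorm_const_smul (μ := volume.restrict (Sl τ s)) (p := p) s⁻¹ (nGrad τ D)
    refine (le_of_eq h1).trans ?_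
    refine (mul_le_mul_right (G.neumann_poincare hp1 hp hD hbc h0.le) _).trans ?_
    rw [Real.enorm_eq_ofReal (inv_pos.2 h0).le, ← mul_assoc, ← ENNReal.ofReal_mul (inv_pos.2 h0).le,
      inv_mul_cancel₀ h0.ne']
    simp
  have a2 : ∀ i, LpO p (fun s => Sl τ s) (fun s x => s⁻¹ * (moll η s (D [i]) x - D [i] x)) := by
    intro i
    refine ⟨fun s h0 _ => (((moll_measurable hη (hD.loc hp1 _) h0)).sub (hD.meas _)).const_mul _, ?_⟩
    have h1 : Tendsto (fun s : ℝ => ∑ j, eLpNorm (D [j, i]) p (volume.restrict (Sl τ ((1 + 3 * K) * s))))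
        (𝓝[>] 0) (𝓝 0) := by
      have h0 : ∀ j : Fin m, Tendsto (fun s : ℝ => eLpNorm (D [j, i]) p (volume.restrict (Sl τ ((1 + 3 * K) * s))))
          (𝓝[>] 0) (𝓝 0) := fun j => (tendsto_layer G.cont hp1 hp (hD.meas _) (hD.memLp _)).comp
        (tendsto_mul_pos_nhdsGT (show 0 < 1 + 3 * K by linarith))
      simpa using tendsto_finsetSum Finset.univ (fun j _ => h0 j)
    have h2 := ENNReal.Tendsto.const_mul (a := mass η * ENNReal.ofReal (2 * K + 1)) h1
      (Or.inr (ENNReal.mul_ne_top (mass_ne_top hη.cont hη.hcs) ENNReal.ofReal_ne_top))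
    rw [mul_zero] at h2
    refine tendsto_zero_of_le01 (fun s h0 _ => ?_) h2
    have h3 := eLpNorm_const_smul (μ := volume.restrict (Sl τ s)) (p := p) s⁻¹
      (fun x => moll η s (D [i]) x - D [i] x)
    refine (le_of_eq h3).trans ?_
    refine (mul_le_mul_right (G.layer_shift hp1 hp hη hsup hst hD (l := [i]) (by simp) h0) _).trans ?_
    rw [ENNReal.ofReal_mul h0.le, Real.enorm_eq_ofReal (inv_pos.2 h0).le]
    have h4 : ENNReal.ofReal s⁻¹ * ENNReal.ofReal s = 1 := by
      rw [← ENNReal.ofReal_mul (inv_pos.2 h0).le, inv_mul_cancel₀ h0.ne']; simp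
    refine le_of_eq ?_
    calc _ = (ENNReal.ofReal s⁻¹ * ENNReal.ofReal s) * (mass η * ENNReal.ofReal (2 * K + 1) *
        ∑ j, eLpNorm (D [j, i]) p (volume.restrict (Sl τ ((1 + 3 * K) * s)))) := by ring
      _ = _ := by rw [h4, one_mul]
  have a3 := LpO.add hp1 a1 (LpO.sum hp1 Finset.univ fun i =>
    LpO.bmul (C := K) (G.measSl) (a := fun _ => partialD i τ) (fun _ _ _ => hNm i)
      (fun _ _ _ x => (G.PB_N i).b0 x) (a2 i))
  refine LpO.congr G.measSl ?_ ?_ a3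
  · intro s h0 _
    have := fun i => moll_measurable hη (hD.loc hp1 [i]) h0
    fun_prop
  · intro s h0 _ x _
    simp only [nGrad]
    rw [Finset.mul_sum, Finset.mul_sum, ← Finset.sum_add_distrib]
    refine Finset.sum_congr rfl fun i _ => ?_
    simp only [partialD]
    ring

/-- the normal derivative of the mollification -/
def bet (τ : EV m → ℝ) (η : EV m → ℝ) (D : List (Fin m) → EV m → ℝ) (s : ℝ) (x : EV m) : ℝ :=
  ∑ i, partialD i τ x * partialD i (moll η s (D [])) x

lemma bet_contDiff (G : Geo e τ K) {p : ℝ≥0∞} (hp1 : 1 ≤ p) {η : EV m → ℝ} (hη : Mol η)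
    {D : List (Fin m) → EV m → ℝ} {k : ℕ} (hD : Jet (Om τ) k p D) {s : ℝ} (hs : 0 < s) :
    ContDiff ℝ 2 (bet τ η D s) := by
  have hm := moll_contDiff hη.smooth hη.hcs hs (hD.loc hp1 [])
  refine ContDiff.sum fun i _ => ((G.PB_N i).cd).mul (contDiff_partialD (k := 2) (contDiff_infty.1 hm 3) i)

lemma bet_LpO (G : Geo e τ K) {p : ℝ≥0∞} (hp1 : 1 ≤ p) (hp : p ≠ ⊤) {η : EV m → ℝ} (hη : Mol η)
    (hsup : tsupport η ⊆ Metric.closedBall (-(2 * K) • e) 1) (hst : StarU η (Om τ))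
    {D : List (Fin m) → EV m → ℝ} (hD : Jet (Om τ) 2 p D) (hbc : JetBC τ D) :
    LpO p (fun s => Sl τ s) (fun s x => s⁻¹ * bet τ η D s x) ∧
    (∀ i, LpO p (fun s => Sl τ s) (fun s => partialD i (bet τ η D s))) ∧
    (∀ i j, LpO p (fun s => Sl τ s) (fun s x => s * partialD i (partialD j (bet τ η D s)) x)) := by
  have hm : ∀ s, 0 < s → ContDiff ℝ (⊤ : ℕ∞) (moll η s (D [])) := fun s hs =>
    moll_contDiff hη.smooth hη.hcs hs (hD.loc hp1 [])
  have hb := fun s (hs : 0 < s) => G.bet_contDiff hp1 hη hD hs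
  have P : ∀ {s}, 0 < s → ∀ l : List (Fin m), l.length ≤ 2 → ∀ x ∈ Om τ,
      partialDList l (moll η s (D [])) x = moll η s (D l) x := fun hs l hl x hx =>
    hD.moll_partial hp1 hη hst G.openOm hs l hl hx
  have N0 : ∀ i : Fin m, Measurable (partialD i τ) := fun i => (G.PB_N i).cd.continuous.measurable
  have N1 : ∀ i j : Fin m, Measurable (partialD j (partialD i τ)) := fun i j =>
    ((G.PB_N i).cd1 j).continuous.measurable
  have N2 : ∀ i j k : Fin m, Measurable (partialD k (partialD j (partialD i τ))) := fun i j k =>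
    (contDiff_partialD (k := 0) ((G.PB_N i).cd1 j) k).continuous.measurable
  have b0 : ∀ i x, |partialD i τ x| ≤ K := fun i x => (G.PB_N i).b0 x
  have b1 : ∀ i j x, |partialD j (partialD i τ) x| ≤ K := fun i j x => by simpa using (G.PB_N i).b1 j x
  have b2 : ∀ i j k x, |partialD k (partialD j (partialD i τ)) x| ≤ K := fun i j k x => by
    simpa using (G.PB_N i).b2 k j x
  have L : ∀ l, LpO p (fun s => Sl τ s) (fun s => moll η s (D l)) := fun l =>
    G.LpO_moll_layer hp1 hp hη.smooth hη.hcs hsup (hD.meas l) (hD.memLp l)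
  have L' : ∀ i l, LpO p (fun s => Sl τ s)
      (fun s => moll (fun y => fderiv ℝ η y (EuclideanSpace.single i 1)) s (D l)) := fun i l =>
    G.LpO_moll_layer hp1 hp (fderivApply_contDiff hη.smooth _) (fderivApply_hcs hη.hcs _)
      ((tsupport_fderivApply _).trans hsup) (hD.meas l) (hD.memLp l)
  have dm : ∀ s, 0 < s → ∀ i, ContDiff ℝ 2 (partialD i (moll η s (D []))) := fun s hs i =>
    contDiff_partialD (k := 2) (contDiff_infty.1 (hm s hs) 3) i
  have d1 : ∀ s, 0 < s → ∀ j, partialD j (bet τ η D s) = fun x => ∑ i, (partialD j (partialD i τ) x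
      * partialD i (moll η s (D [])) x + partialD i τ x * partialD j (partialD i (moll η s (D []))) x) := by
    intro s hs j
    unfold bet
    rw [partialD_sum _ fun i => ((G.PB_N i).diff).fun_mul ((dm s hs i).differentiable (by simp))]
    funext x
    refine Finset.sum_congr rfl fun i _ => ?_
    rw [partialD_mul ((G.PB_N i).diff) ((dm s hs i).differentiable (by simp))]
  have d2 : ∀ s, 0 < s → ∀ k j, partialD k (partialD j (bet τ η D s)) = fun x => ∑ i,
      (partialD k (partialD j (partialD i τ)) x * partialD i (moll η s (D [])) x
      + partialD j (partialD i τ) x * partialD k (partialD i (moll η s (D []))) x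
      + partialD k (partialD i τ) x * partialD j (partialD i (moll η s (D []))) x
      + partialD i τ x * partialD k (partialD j (partialD i (moll η s (D [])))) x) := by
    intro s hs k j
    have e0 : partialD j (bet τ η D s) = fun x => ∑ i,
        partialD j (fun x => partialD i τ x * partialD i (moll η s (D [])) x) x := by
      unfold bet
      rw [partialD_sum _ fun i => ((G.PB_N i).diff).fun_mul ((dm s hs i).differentiable (by simp))]
    rw [e0, partialD_sum]
    · funext x
      refine Finset.sum_congr rfl fun i _ => ?_
      rw [partialD2_mul ((G.PB_N i).cd) (dm s hs i)]
    · intro i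
      exact (contDiff_partialD (k := 1) (((G.PB_N i).cd).mul (dm s hs i)) j).differentiable (by simp)
  refine ⟨?_, ?_, ?_⟩
  · refine LpO.congr G.measSl (fun s h0 _ => (hb s h0).continuous.measurable.const_mul _) ?_
      (G.LpO_normal hp1 hp hη hsup hst hD hbc)
    intro s h0 _ x hx
    simp only [bet]
    congr 1
    refine Finset.sum_congr rfl fun i _ => ?_
    rw [← P h0 [i] (by simp) x hx.1]; rfl
  · intro j
    refine LpO.congr G.measSl (fun s h0 _ => (contDiff_partialD (k := 1) (hb s h0) j).continuous.measurable) ?_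
      (LpO.sum hp1 Finset.univ fun i => LpO.add hp1
        (LpO.bmul (C := K) G.measSl (a := fun _ => partialD j (partialD i τ)) (fun _ _ _ => N1 i j)
          (fun _ _ _ x => b1 i j x) (L [i]))
        (LpO.bmul (C := K) G.measSl (a := fun _ => partialD i τ) (fun _ _ _ => N0 i)
          (fun _ _ _ x => b0 i x) (L [j, i])))
    intro s h0 _ x hx
    rw [d1 s h0 j]
    refine Finset.sum_congr rfl fun i _ => ?_
    rw [← P h0 [i] (by simp) x hx.1, ← P h0 [j, i] (by simp) x hx.1]; rfl
  · intro k j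
    refine LpO.congr G.measSl (fun s h0 _ => ((contDiff_partialD (k := 0)
      (contDiff_partialD (k := 1) (hb s h0) j) k).continuous.measurable).const_mul _) ?_
      (LpO.sum hp1 Finset.univ fun i => LpO.add hp1 (LpO.add hp1 (LpO.add hp1
        (LpO.bmul (C := K) G.measSl (a := fun s x => s * partialD k (partialD j (partialD i τ)) x)
          (fun _ _ _ => (N2 i j k).const_mul _) (fun s h0 h1 x => ?_) (L [i]))
        (LpO.bmul (C := K) G.measSl (a := fun s x => s * partialD j (partialD i τ) x)
          (fun _ _ _ => (N1 i j).const_mul _) (fun s h0 h1 x => ?_) (L [k, i])))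
        (LpO.bmul (C := K) G.measSl (a := fun s x => s * partialD k (partialD i τ) x)
          (fun _ _ _ => (N1 i k).const_mul _) (fun s h0 h1 x => ?_) (L [j, i])))
        (LpO.bmul (C := K) G.measSl (a := fun _ => partialD i τ) (fun _ _ _ => N0 i)
          (fun _ _ _ x => b0 i x) (L' k [j, i])))
    · intro s h0 _ x hx
      rw [d2 s h0 k j, Finset.mul_sum]
      refine Finset.sum_congr rfl fun i _ => ?_
      have e3 : partialD k (partialD j (partialD i (moll η s (D [])))) x
          = s⁻¹ * moll (fun y => fderiv ℝ η y (EuclideanSpace.single k 1)) s (D [j, i]) x := by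
        rw [← moll_fderiv hη.smooth hη.hcs h0 (hD.loc hp1 _)]
        have : partialD j (partialD i (moll η s (D []))) =ᶠ[𝓝 x] moll η s (D [j, i]) := by
          filter_upwards [G.openOm.mem_nhds hx.1] with y hy using P h0 [j, i] (by simp) y hy
        show fderiv ℝ _ x _ = _
        rw [this.fderiv_eq]
      rw [e3, ← P h0 [i] (by simp) x hx.1, ← P h0 [j, i] (by simp) x hx.1, ← P h0 [k, i] (by simp) x hx.1]
      show s * (_ * _ + _ * _ + _ * _ + _) = s * _ * partialD i _ x + s * _ * partialD k (partialD i _) x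
        + s * _ * partialD j (partialD i _) x + _
      simp only [partialDList]
      field_simp
    all_goals
      rw [abs_mul, abs_of_pos h0]
    · nlinarith [b2 i j k x, abs_nonneg (partialD k (partialD j (partialD i τ)) x)]
    · nlinarith [b1 i j x, abs_nonneg (partialD j (partialD i τ) x)]
    · nlinarith [b1 i k x, abs_nonneg (partialD k (partialD i τ) x)]

end Geo
end PartEight

section PartNine

variable {m : ℕ}

lemma partialDList_sub (l : List (Fin m)) {a f : EV m → ℝ} (ha : ContDiff ℝ l.length a)
    (hf : ContDiff ℝ l.length f) :
    partialDList l (fun x => a x - f x) = fun x => partialDList l a x - partialDList l f x := by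
  induction l with
  | nil => rfl
  | cons i l ih =>
    have e1 := ih (ha.of_le (by simp)) (hf.of_le (by simp))
    simp only [partialDList, e1]
    rw [partialD_sub]
    · exact (contDiff_partialDList (k := 1) l (by simpa [add_comm] using ha)).differentiable (by simp)
    · exact (contDiff_partialDList (k := 1) l (by simpa [add_comm] using hf)).differentiable (by simp)

lemma partialDList_add (l : List (Fin m)) {a f : EV m → ℝ} (ha : ContDiff ℝ l.length a)
    (hf : ContDiff ℝ l.length f) :
    partialDList l (fun x => a x + f x) = fun x => partialDList l a x + partialDList l f x := by
  induction l with
  | nil => rfl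
  | cons i l ih =>
    have e1 := ih (ha.of_le (by simp)) (hf.of_le (by simp))
    simp only [partialDList, e1]
    rw [partialD_add]
    · exact (contDiff_partialDList (k := 1) l (by simpa [add_comm] using ha)).differentiable (by simp)
    · exact (contDiff_partialDList (k := 1) l (by simpa [add_comm] using hf)).differentiable (by simp)

lemma partialD_comp_smul {g : EV m → ℝ} (hg : Differentiable ℝ g) (s : ℝ) (i : Fin m) :
    partialD i (fun x => g (s • x)) = fun x => s * partialD i g (s • x) := by
  funext x
  have : HasFDerivAt (fun x => g (s • x)) _ x :=
    (hg (s • x)).hasFDerivAt.comp x ((hasFDerivAt_id x).const_smul s)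
  simp only [partialD, this.fderiv]
  simp

lemma LpO_cutoff {p : ℝ≥0∞} (hp1 : 1 ≤ p) (hp : p ≠ ⊤) {ζ : EV m → ℝ} (hζ : Continuous ζ)
    (hb : ∀ x, |ζ x - 1| ≤ 1) (h1 : ∀ᶠ x in 𝓝 0, ζ x = 1) {f : EV m → ℝ}
    (hf : Measurable f) (hfp : MemLp f p volume) (A : Set (EV m)) :
    LpO p (fun _ => A) (fun s x => (ζ (s • x) - 1) * f x) := by
  have mm : ∀ s : ℝ, Measurable (fun x => (ζ (s • x) - 1) * f x) := fun s =>
    (by fun_prop : Measurable fun x : EV m => ζ (s • x) - 1).mul hf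
  refine ⟨fun s _ _ => mm s, ?_⟩
  have hr := toReal_one_le hp1 hp
  have hr0 : p.toReal ≠ 0 := by linarith
  have key : Tendsto (fun s : ℝ => ∫⁻ x, ‖(ζ (s • x) - 1) * f x‖ₑ ^ p.toReal) (𝓝[>] 0)
      (𝓝 (∫⁻ _ : EV m, 0)) := by
    refine tendsto_lintegral_filter_of_dominated_convergence (fun x => ‖f x‖ₑ ^ p.toReal) ?_ ?_ ?_ ?_
    · exact Eventually.of_forall fun s => (mm s).enorm.pow_const _
    · refine Eventually.of_forall fun s => Eventually.of_forall fun x => ?_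
      refine ENNReal.rpow_le_rpow ?_ (by linarith)
      rw [enorm_mul]
      refine mul_le_of_le_one_left' ?_
      rw [Real.enorm_eq_ofReal_abs]
      exact ENNReal.ofReal_le_one.2 (hb _)
    · rw [← eLpNorm_rpow_eq volume hp1 hp f]
      exact ENNReal.rpow_ne_top_of_nonneg (by linarith) hfp.2.ne
    · refine Eventually.of_forall fun x => ?_
      refine tendsto_const_nhds.congr' ?_
      have hc : Tendsto (fun s : ℝ => s • x) (𝓝[>] 0) (𝓝 0) := by
        have : Tendsto (fun s : ℝ => s • x) (𝓝 0) (𝓝 ((0:ℝ) • x)) :=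
          (by fun_prop : Continuous fun s : ℝ => s • x).tendsto 0
        rw [zero_smul] at this
        exact this.mono_left nhdsWithin_le_nhds
      filter_upwards [hc.eventually h1] with s hs
      simp [hs, lt_of_lt_of_le one_pos hr]
  have key2 := key.ennrpow_const (1 / p.toReal)
  simp only [lintegral_zero] at key2
  rw [ENNReal.zero_rpow_of_pos (by positivity)] at key2
  refine tendsto_zero_of_le01 (fun s _ _ => ?_) key2
  refine (eLpNorm_mono_measure _ Measure.restrict_le_self).trans (le_of_eq ?_)
  rw [← eLpNorm_rpow_eq volume hp1 hp, ← ENNReal.rpow_mul]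
  simp [hr0]

lemma LpO_smul_fixed {p : ℝ≥0∞} {f : EV m → ℝ}
    (hf : Measurable f) (hfp : MemLp f p volume) (A : Set (EV m)) :
    LpO p (fun _ => A) (fun s x => s * f x) := by
  refine ⟨fun s _ _ => hf.const_mul s, ?_⟩
  have h1 : Tendsto (fun s : ℝ => ENNReal.ofReal s * eLpNorm f p volume) (𝓝[>] 0) (𝓝 0) := by
    have := ENNReal.Tendsto.mul_const (b := eLpNorm f p volume)
      (ENNReal.tendsto_ofReal (tendsto_id.mono_left (nhdsWithin_le_nhds (a := (0:ℝ)) (s := Set.Ioi 0))))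
      (Or.inr hfp.2.ne)
    simpa using this
  refine tendsto_zero_of_le01 (fun s h0 _ => ?_) h1
  refine (eLpNorm_mono_measure _ Measure.restrict_le_self).trans (le_of_eq ?_)
  have := eLpNorm_const_smul (μ := (volume : Measure (EV m))) (p := p) s f
  rw [Real.enorm_eq_ofReal h0.le] at this
  exact this

namespace Geo
variable {e : EV m} {τ : EV m → ℝ} {K : ℝ}

lemma cutoff_conv (G : Geo e τ K) {p : ℝ≥0∞} (hp1 : 1 ≤ p) (hp : p ≠ ⊤) {η : EV m → ℝ} (hη : Mol η)
    (hst : StarU η (Om τ)) {D : List (Fin m) → EV m → ℝ} (hD : Jet (Om τ) 2 p D)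
    {ζ : EV m → ℝ} (hζ : ContDiff ℝ (⊤ : ℕ∞) ζ) (hζc : HasCompactSupport ζ)
    (hb : ∀ x, |ζ x - 1| ≤ 1) (h1 : ∀ᶠ x in 𝓝 0, ζ x = 1) {l : List (Fin m)} (hl : l.length ≤ 2) :
    LpO p (fun _ => Om τ) (fun s x => partialDList l (fun x => ζ (s • x) * moll η s (D []) x) x - D l x) := by
  have hm : ∀ s, 0 < s → ContDiff ℝ (⊤ : ℕ∞) (moll η s (D [])) := fun s hs =>
    moll_contDiff hη.smooth hη.hcs hs (hD.loc hp1 [])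
  have hA : ∀ _ : ℝ, MeasurableSet (Om τ) := fun _ => G.measOm
  have P : ∀ {s}, 0 < s → ∀ l : List (Fin m), l.length ≤ 2 → ∀ x ∈ Om τ,
      partialDList l (moll η s (D [])) x = moll η s (D l) x := fun hs l hl x hx =>
    hD.moll_partial hp1 hη hst G.openOm hs l hl hx
  obtain ⟨C, hC⟩ := PBs.of_cc (contDiff_infty.1 hζ 2) hζc
  have cz : Continuous ζ := hζ.continuous
  have b1 : ∀ i x, |partialD i ζ x| ≤ C := fun i x => by simpa using hC.b1 i x
  have b2 : ∀ i j x, |partialD i (partialD j ζ) x| ≤ C := fun i j x => by simpa using hC.b2 i j x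
  have c1 : ∀ i, Continuous (partialD i ζ) := fun i => (hC.cd1 i).continuous
  have c2 : ∀ i j, Continuous (partialD i (partialD j ζ)) := fun i j =>
    (contDiff_partialD (k := 0) (hC.cd1 j) i).continuous
  have M0 : ∀ l, LpO p (fun _ => Om τ) (fun s x => moll η s (D l) x - D l x) := fun l =>
    ⟨fun s h0 _ => (moll_measurable hη (hD.loc hp1 l) h0).sub (hD.meas l),
      tendsto_moll_restrict hη (hD.meas l) hp1 hp (hD.memLp l) _⟩
  have main : ∀ l, LpO p (fun _ => Om τ) (fun s x => ζ (s • x) * moll η s (D l) x - D l x) := fun l => by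
    refine LpO.congr hA (fun s h0 _ => ?_) ?_ (LpO.add hp1
      (LpO.bmul hA (a := fun s x => ζ (s • x)) (C := C) (fun s _ _ => by fun_prop)
        (fun s _ _ x => hC.b0 _) (M0 l)) (LpO_cutoff hp1 hp cz hb h1 (hD.meas l) (hD.memLp l) _))
    · exact ((by fun_prop : Measurable fun x : EV m => ζ (s • x)).mul
        (moll_measurable hη (hD.loc hp1 l) h0)).sub (hD.meas l)
    · intro s _ _ x _; ring
  have Ms : ∀ l, LpO p (fun _ => Om τ) (fun s x => s * moll η s (D l) x) := fun l => by
    refine LpO.congr hA (fun s h0 _ => (moll_measurable hη (hD.loc hp1 l) h0).const_mul _) ?_ (LpO.add hp1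
      (LpO.bmul hA (a := fun s _ => s) (C := 1) (fun s _ _ => by fun_prop)
        (fun s h0 h1 x => by rw [abs_of_pos h0]; exact h1) (M0 l))
        (LpO_smul_fixed (hD.meas l) (hD.memLp l) _))
    intro s _ _ x _; ring
  have T1 : ∀ i l, LpO p (fun _ => Om τ) (fun s x => partialD i ζ (s • x) * (s * moll η s (D l) x)) :=
    fun i l => LpO.bmul hA (a := fun s x => partialD i ζ (s • x)) (C := C)
      (fun s _ _ => by have := c1 i; fun_prop) (fun s _ _ x => b1 i _) (Ms l)
  have T2 : ∀ i j l, LpO p (fun _ => Om τ)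
      (fun s x => (s * partialD i (partialD j ζ) (s • x)) * (s * moll η s (D l) x)) :=
    fun i j l => LpO.bmul hA (a := fun s x => s * partialD i (partialD j ζ) (s • x)) (C := C)
      (fun s _ _ => by have := c2 i j; fun_prop) (fun s h0 h1 x => by
        rw [abs_mul, abs_of_pos h0]; nlinarith [b2 i j (s • x), abs_nonneg (partialD i (partialD j ζ) (s • x))])
        (Ms l)
  have hw : ∀ s, 0 < s → ContDiff ℝ 2 (fun x => ζ (s • x) * moll η s (D []) x) := fun s h0 =>
    ((contDiff_infty.1 hζ 2).comp (contDiff_const_smul s)).mul (contDiff_infty.1 (hm s h0) 2)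
  have hmeas : ∀ s, 0 < s → s ≤ 1 → Measurable
      (fun x => partialDList l (fun x => ζ (s • x) * moll η s (D []) x) x - D l x) := fun s h0 _ =>
    (cont_partialDList (hw s h0) hl).measurable.sub (hD.meas l)
  have hz : Differentiable ℝ ζ := hC.diff
  have hzs : ∀ s : ℝ, ContDiff ℝ 2 (fun x => ζ (s • x)) := fun s => hC.cd.comp (contDiff_const_smul s)
  match l, hl with
  | [], _ => exact main []
  | [i], _ =>
    refine LpO.congr hA hmeas ?_ (LpO.add hp1 (T1 i []) (main [i]))
    intro s h0 _ x hx
    simp only [partialDList]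
    rw [partialD_mul ((hzs s).differentiable (by simp)) ((hm s h0).differentiable (by simp)),
      partialD_comp_smul hz, ← P h0 [i] (by simp) x hx]
    simp only [partialDList]; ring
  | [j, i], _ =>
    refine LpO.congr hA hmeas ?_ (LpO.add hp1 (LpO.add hp1 (LpO.add hp1 (T2 j i []) (T1 i [j])) (T1 j [i]))
      (main [j, i]))
    intro s h0 _ x hx
    simp only [partialDList]
    rw [partialD2_mul (hzs s) (contDiff_infty.1 (hm s h0) 2),
      partialD_comp_smul hz, partialD_comp_smul hz, partialD_const_mul, partialD_comp_smul (hC.diff1 i),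
      ← P h0 [i] (by simp) x hx, ← P h0 [j] (by simp) x hx, ← P h0 [j, i] (by simp) x hx]
    simp only [partialDList]; ring

lemma density (G : Geo e τ K) {p : ℝ≥0∞} (hp1 : 1 ≤ p) (hp : p ≠ ⊤)
    {D : List (Fin m) → EV m → ℝ} (hD : Jet (Om τ) 2 p D) (hbc : JetBC τ D) :
    ∃ U : ℝ → EV m → ℝ, (∀ s, 0 < s → s ≤ 1 → ContDiff ℝ 2 (U s) ∧ HasCompactSupport (U s) ∧
        ∀ x, τ x = 0 → ∑ i, partialD i τ x * partialD i (U s) x = 0) ∧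
      ∀ l : List (Fin m), l.length ≤ 2 → LpO p (fun _ => Om τ) (fun s x => partialDList l (U s) x - D l x) := by
  obtain ⟨η, hη, hsup, hst⟩ := G.exists_mol
  obtain ⟨θ, θs, θc, θ0, θ1, θz⟩ := exists_theta
  obtain ⟨Cθ, hCθ⟩ := G.PB_theta θs θc
  obtain ⟨Cq, hCq⟩ := G.PB_q
  let b : ContDiffBump (0 : EV m) := ⟨1, 2, by norm_num, by norm_num⟩
  have hζ : ContDiff ℝ (⊤ : ℕ∞) (b : EV m → ℝ) := b.contDiff
  have hζc : HasCompactSupport (b : EV m → ℝ) := b.hasCompactSupport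
  have hb : ∀ x, |b x - 1| ≤ 1 := fun x => by
    rw [abs_le]; constructor <;> linarith [b.nonneg (x := x), b.le_one (x := x)]
  have h1 : ∀ᶠ x in 𝓝 0, b x = 1 := b.eventuallyEq_one
  obtain ⟨C, hC⟩ := PBs.of_cc (contDiff_infty.1 hζ 2) hζc
  have hζ1 : ∀ i, ContDiff ℝ (⊤ : ℕ∞) (partialD i b) := fun i => fderivApply_contDiff hζ _
  have hZc : ∀ i, HasCompactSupport (partialD i b) := fun i => fderivApply_hcs hζc _
  have hC1 : ∃ C', ∀ i, PBs C' 1 (partialD i b) := by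
    have := fun i => PBs.of_cc (contDiff_infty.1 (hζ1 i) 2) (hZc i)
    choose c hc using this
    refine ⟨∑ i, c i, fun i => (hc i).mono one_pos ?_⟩
    exact Finset.single_le_sum (f := c) (fun j _ => (hc j).pos) (Finset.mem_univ i)
  obtain ⟨C1, hC1⟩ := hC1
  let mo : ℝ → EV m → ℝ := fun s => moll η s (D [])
  have hm : ∀ s, 0 < s → ContDiff ℝ (⊤ : ℕ∞) (mo s) := fun s hs =>
    moll_contDiff hη.smooth hη.hcs hs (hD.loc hp1 [])
  let B : ℝ → EV m → ℝ := fun s => bet τ η D s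
  have hB : ∀ s, 0 < s → ContDiff ℝ 2 (B s) := fun s hs => G.bet_contDiff hp1 hη hD hs
  let g1 : ℝ → EV m → ℝ := fun s x => θ (τ x / s) * (qN τ x * b (s • x))
  let g2 : ℝ → EV m → ℝ := fun s x => θ (τ x / s) * (qN τ x * ∑ i, partialD i τ x * partialD i b (s • x))
  have PB1 : ∃ C, ∀ s, 0 < s → s ≤ 1 → PBs C s (g1 s) := ⟨_, fun s h0 h1 =>
    (hCθ s h0 h1).mul ((hCq.mul (hC.scale h0 h1) one_pos).small h0 h1) h0⟩
  have PB2 : ∃ C, ∀ s, 0 < s → s ≤ 1 → PBs C s (g2 s) := ⟨_, fun s h0 h1 =>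
    (hCθ s h0 h1).mul ((hCq.mul (PBs.sum Finset.univ fun i =>
      (G.PB_N i).mul ((hC1 i).scale h0 h1) one_pos) one_pos).small h0 h1) h0⟩
  obtain ⟨K1, PB1⟩ := PB1
  obtain ⟨K2, PB2⟩ := PB2
  have Z : ∀ s, 0 < s → s ≤ 1 → ∀ x ∈ Om τ, x ∉ Sl τ s → ∀ᶠ y in 𝓝 x, θ (τ y / s) = 0 := by
    intro s h0 _ x hx hx'
    have : s < τ x := not_le.1 fun h => hx' ⟨hx, h⟩
    have h2 : 1 < |τ x / s| := by
      rw [abs_of_pos (div_pos hx h0)]; exact (one_lt_div h0).2 this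
    have hcont : Tendsto (fun y => τ y / s) (𝓝 x) (𝓝 (τ x / s)) :=
      (G.cont.div_const s).tendsto x
    exact hcont.eventually (θz _ h2)
  have L : ∀ l, LpO p (fun s => Sl τ s) (fun s => moll η s (D l)) := fun l =>
    G.LpO_moll_layer hp1 hp hη.smooth hη.hcs hsup (hD.meas l) (hD.memLp l)
  have P : ∀ {s}, 0 < s → ∀ l : List (Fin m), l.length ≤ 2 → ∀ x ∈ Om τ,
      partialDList l (moll η s (D [])) x = moll η s (D l) x := fun hs l hl x hx =>
    hD.moll_partial hp1 hη hst G.openOm hs l hl hx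
  obtain ⟨B0, B1, B2⟩ := G.bet_LpO hp1 hp hη hsup hst hD hbc
  have E1 : ∀ {l : List (Fin m)}, l.length ≤ 2 → LpO p (fun _ => Om τ)
      (fun s => partialDList l (fun x => s * g1 s x * B s x)) := fun hl =>
    LpO.product hp1 G.measSl G.measOm PB1 (fun s h0 h1 x hx hx' => by
      filter_upwards [Z s h0 h1 x hx hx'] with y hy
      simp [g1, hy]) (fun s h0 _ => hB s h0) B0 B1 B2 hl
  have E2 : ∀ {l : List (Fin m)}, l.length ≤ 2 → LpO p (fun _ => Om τ)
      (fun s => partialDList l (fun x => s * g2 s x * (s * mo s x))) := fun hl =>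
    LpO.product hp1 G.measSl G.measOm PB2 (fun s h0 h1 x hx hx' => by
      filter_upwards [Z s h0 h1 x hx hx'] with y hy
      simp [g2, hy]) (fun s h0 _ => contDiff_const.mul (contDiff_infty.1 (hm s h0) 2))
      (LpO.congr G.measSl (fun s h0 _ => by
          have := (hm s h0).continuous; fun_prop) (fun s h0 _ x _ => by
          show s⁻¹ * (s * mo s x) = moll η s (D []) x
          field_simp; rfl) (L []))
      (fun i => LpO.congr G.measSl (fun s h0 _ => by
          rw [partialD_const_mul]
          exact (contDiff_partialD (k := 0) (contDiff_infty.1 (hm s h0) 1) i).continuous.measurable.const_mul _)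
        (fun s h0 _ x hx => by
          rw [partialD_const_mul]
          show s * partialDList [i] (moll η s (D [])) x = _
          rw [P h0 [i] (by simp) x hx.1])
        (LpO.bmul G.measSl (a := fun s _ => s) (C := 1) (fun s _ _ => by fun_prop)
          (fun s h0 h1 x => by rw [abs_of_pos h0]; exact h1) (L [i])))
      (fun i j => LpO.congr G.measSl (fun s h0 _ => by
          rw [partialD_const_mul, partialD_const_mul]
          exact ((contDiff_partialD (k := 0) (contDiff_partialD (k := 1) (contDiff_infty.1 (hm s h0) 2) j)
            i).continuous.measurable.const_mul _).const_mul _)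
        (fun s h0 _ x hx => by
          rw [partialD_const_mul, partialD_const_mul]
          show s * (s * partialDList [i, j] (moll η s (D [])) x) = _
          rw [P h0 [i, j] (by simp) x hx.1, ← mul_assoc])
        (LpO.bmul G.measSl (a := fun s _ => s * s) (C := 1) (fun s _ _ => by fun_prop)
          (fun s h0 h1 x => by rw [abs_of_pos (by positivity)]; nlinarith) (L [i, j]))) hl
  let w : ℝ → EV m → ℝ := fun s x => b (s • x) * mo s x
  let v : ℝ → EV m → ℝ := fun s x => s * g1 s x * B s x + s * g2 s x * (s * mo s x)
  have hw : ∀ s, 0 < s → ContDiff ℝ 2 (w s) := fun s h0 =>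
    ((contDiff_infty.1 hζ 2).comp (contDiff_const_smul s)).mul (contDiff_infty.1 (hm s h0) 2)
  have hv1 : ∀ s, 0 < s → s ≤ 1 → ContDiff ℝ 2 (fun x => s * g1 s x * B s x) := fun s h0 h1 =>
    (contDiff_const.mul (PB1 s h0 h1).cd).mul (hB s h0)
  have hv2 : ∀ s, 0 < s → s ≤ 1 → ContDiff ℝ 2 (fun x => s * g2 s x * (s * mo s x)) := fun s h0 h1 =>
    (contDiff_const.mul (PB2 s h0 h1).cd).mul (contDiff_const.mul (contDiff_infty.1 (hm s h0) 2))
  refine ⟨fun s x => w s x - v s x, fun s h0 h1 => ⟨(hw s h0).sub ((hv1 s h0 h1).add (hv2 s h0 h1)), ?_, ?_⟩, ?_⟩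
  · have cs : ∀ f : EV m → ℝ, HasCompactSupport f → HasCompactSupport (fun x => f (s • x)) := fun f hf =>
      hf.comp_homeomorph (Homeomorph.smulOfNeZero s h0.ne')
    have cw : HasCompactSupport (w s) := (cs _ hζc).mul_right
    have c1 : HasCompactSupport (g1 s) := ((cs _ hζc).mul_left).mul_left
    have c2 : HasCompactSupport (g2 s) := by
      refine HasCompactSupport.mul_left (HasCompactSupport.mul_left ?_)
      refine (cs _ hζc).mono' ?_
      intro x hx
      by_contra hx'
      refine hx ?_
      refine Finset.sum_eq_zero fun i _ => ?_
      have : s • x ∉ tsupport (b : EV m → ℝ) := by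
        intro h
        apply hx'
        rw [show (fun x => b (s • x)) = (b : EV m → ℝ) ∘ (Homeomorph.smulOfNeZero s h0.ne') from rfl,
          tsupport_comp_eq_preimage]
        exact h
      have h2 : partialD i b (s • x) = 0 := by
        have := notMem_tsupport_iff_eventuallyEq.1 this
        simp only [partialD]
        rw [this.fderiv_eq]; simp
      rw [h2, mul_zero]
    have c3 : HasCompactSupport (v s) :=
      (HasCompactSupport.mul_right (c1.mul_left)).add (HasCompactSupport.mul_right (c2.mul_left))
    exact cw.sub c3
  · intro x hx
    have hvv : v s = fun x => (s * θ (τ x / s)) * (qN τ x * ∑ i, partialD i τ x * partialD i (w s) x) := by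
      funext x
      have : ∀ i, partialD i (w s) x = s * partialD i b (s • x) * mo s x + b (s • x) * partialD i (mo s) x := by
        intro i
        show partialD i (fun x => b (s • x) * mo s x) x = _
        have hbs : Differentiable ℝ (fun x : EV m => b (s • x)) :=
          (hC.cd.comp (contDiff_const_smul s)).differentiable (by simp)
        rw [partialD_mul hbs
          ((hm s h0).differentiable (by simp)), partialD_comp_smul hC.diff]
      simp only [this, v, g1, g2, B, bet, mo]
      have e1 : ∑ i, partialD i τ x * (s * partialD i b (s • x) * moll η s (D []) x
          + b (s • x) * partialD i (moll η s (D [])) x)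
          = s * moll η s (D []) x * (∑ i, partialD i τ x * partialD i b (s • x))
            + b (s • x) * ∑ i, partialD i τ x * partialD i (moll η s (D [])) x := by
        rw [Finset.mul_sum, Finset.mul_sum, ← Finset.sum_add_distrib]
        exact Finset.sum_congr rfl fun i _ => by ring
      rw [e1]; ring
    have hθd : DifferentiableAt ℝ (fun x => s * θ (τ x / s)) x := by
      have := (hCθ s h0 h1).diff x
      exact this.const_mul s
    have hrd : DifferentiableAt ℝ (fun x => qN τ x * ∑ i, partialD i τ x * partialD i (w s) x) x := by
      refine (hCq.diff x).mul (DifferentiableAt.fun_sum fun i _ => ((G.PB_N i).diff x).mul ?_)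
      exact (contDiff_partialD (k := 1) (hw s h0) i).differentiable (by simp) x
    have hdv : ∀ i, partialD i (v s) x = partialD i τ x * (qN τ x * ∑ i, partialD i τ x * partialD i (w s) x) := by
      intro i
      simp only [partialD] at hrd ⊢
      rw [hvv]
      have hθ' : HasDerivAt θ 1 (τ x / s) := by
        rw [hx, zero_div, ← θ1]
        exact ((θs.differentiable (by simp)) 0).hasDerivAt
      have h3 : HasFDerivAt (fun x => s * θ (τ x / s)) (fderiv ℝ τ x) x := by
        have h4 : HasFDerivAt (fun x => τ x / s) (s⁻¹ • fderiv ℝ τ x) x := by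
          simp only [div_eq_inv_mul]
          exact (G.diff x).hasFDerivAt.const_mul s⁻¹
        have h5 := (hθ'.comp_hasFDerivAt x h4).const_mul s
        have h8 : s • ((1:ℝ) • (s⁻¹ • fderiv ℝ τ x)) = fderiv ℝ τ x := by
          rw [one_smul, smul_smul, mul_inv_cancel₀ h0.ne', one_smul]
        rw [h8] at h5
        exact h5
      have h6 := h3.mul hrd.hasFDerivAt
      have h7 := h6.fderiv
      simp only [partialD] at h7 ⊢
      refine (congrArg (fun T => T (EuclideanSpace.single i 1)) h7).trans ?_
      simp [hx, θ0]
      ring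
    have hds : ∀ i, partialD i (fun x => w s x - v s x) x = partialD i (w s) x - partialD i (v s) x := fun i => by
      rw [partialD_sub ((hw s h0).differentiable (by simp))
        (((hv1 s h0 h1).add (hv2 s h0 h1)).differentiable (by simp))]
    simp only [hds, hdv]
    have hq : (∑ i, partialD i τ x * partialD i τ x) * qN τ x = 1 :=
      mul_inv_cancel₀ (by have := G.N_sq x; linarith)
    set S := ∑ i, partialD i τ x * partialD i (w s) x with hS
    have : ∑ i, partialD i τ x * (partialD i (w s) x - partialD i τ x * (qN τ x * S))
        = S - (∑ i, partialD i τ x * partialD i τ x) * qN τ x * S := by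
      rw [hS, Finset.sum_mul, Finset.sum_mul, ← Finset.sum_sub_distrib]
      exact Finset.sum_congr rfl fun i _ => by ring
    rw [this, hq]; ring
  · intro l hl
    have W := G.cutoff_conv hp1 hp hη hst hD hζ hζc hb h1 hl
    have hle : ((l.length : ℕ) : WithTop ℕ∞) ≤ 2 := by exact_mod_cast hl
    refine LpO.congr (fun _ => G.measOm) (fun s h0 h1 => ?_) ?_ (LpO.add hp1 W
      (LpO.bmul (fun _ => G.measOm) (a := fun _ _ => (-1:ℝ)) (C := 1) (fun s _ _ => by fun_prop)
        (fun _ _ _ _ => by simp) (LpO.add hp1 (E1 hl) (E2 hl))))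
    · exact (cont_partialDList ((hw s h0).sub ((hv1 s h0 h1).add (hv2 s h0 h1))) hl).measurable.sub (hD.meas l)
    · intro s h0 h1 x _
      have q1 := partialDList_sub l ((hw s h0).of_le hle) (((hv1 s h0 h1).add (hv2 s h0 h1)).of_le hle)
      have q2 := partialDList_add l ((hv1 s h0 h1).of_le hle) ((hv2 s h0 h1).of_le hle)
      have q1' : partialDList l (fun x => w s x - v s x) x = partialDList l (w s) x - partialDList l (v s) x :=
        congrFun q1 x
      have q2' := congrFun q2 x
      rw [q1']
      have q3 : partialDList l (v s) x = _ := q2'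
      rw [q3]
      simp only [w, mo]
      ring

end Geo
end PartNine

section PartTen

variable {m : ℕ}

lemma integrable_restrict_mul_cc {Ω : Set (EV m)} {p : ℝ≥0∞} (hp1 : 1 ≤ p) {f b : EV m → ℝ}
    (hf : MemLp f p (volume.restrict Ω)) (hb : Continuous b)
    (hc : HasCompactSupport b) : Integrable (fun x => f x * b x) (volume.restrict Ω) := by
  have h1 : LocallyIntegrable f (volume.restrict Ω) := hf.locallyIntegrable hp1
  have := h1.integrable_smul_left_of_hasCompactSupport hb hc
  simpa [mul_comm] using this

lemma weakDeriv_unique {Ω : Set (EV m)} (hΩ : IsOpen Ω) {p : ℝ≥0∞} (hp1 : 1 ≤ p) {i : Fin m}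
    {f f' g g' : EV m → ℝ} (h : WeakDerivOn Ω i f g) (h' : WeakDerivOn Ω i f' g')
    (hff : f =ᵐ[volume.restrict Ω] f') (hg : MemLp g p (volume.restrict Ω))
    (hg' : MemLp g' p (volume.restrict Ω)) : g =ᵐ[volume.restrict Ω] g' := by
  have h1 : LocallyIntegrable (fun x => g x - g' x) (volume.restrict Ω) := (hg.sub hg').locallyIntegrable hp1
  have key := hΩ.ae_eq_zero_of_integral_contDiff_smul_eq_zero (μ := volume.restrict Ω)
    (h1.locallyIntegrableOn Ω) ?_
  · filter_upwards [key, ae_restrict_mem hΩ.measurableSet] with x hx hm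
    have := hx hm
    linarith
  · intro φ φs φc φt
    have e1 := h φ φs φc φt
    have e2 := h' φ φs φc φt
    have e3 : ∫ x in Ω, f x * partialD i φ x = ∫ x in Ω, f' x * partialD i φ x := by
      refine integral_congr_ae ?_
      filter_upwards [hff] with x hx
      rw [hx]
    have i1 := integrable_restrict_mul_cc hp1 hg φs.continuous φc
    have i2 := integrable_restrict_mul_cc hp1 hg' φs.continuous φc
    have : (fun x => φ x • (g x - g' x)) = fun x => g x * φ x - g' x * φ x := by
      funext x; simp only [smul_eq_mul]; ring
    rw [this, integral_sub i1 i2]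
    linarith

lemma IsSobDerivs.unique {Ω : Set (EV m)} (hΩ : IsOpen Ω) {p : ℝ≥0∞} (hp1 : 1 ≤ p) {k : ℕ} {u : EV m → ℝ}
    {D D' : List (Fin m) → EV m → ℝ} (h : IsSobDerivs Ω k p u D) (h' : IsSobDerivs Ω k p u D')
    (l : List (Fin m)) (hl : l.length ≤ k) : D l =ᵐ[volume.restrict Ω] D' l := by
  induction l with
  | nil => rw [h.1, h'.1]
  | cons i l ih =>
    have hl' : l.length < k := by simpa using hl
    exact weakDeriv_unique hΩ hp1 (h.2.1 l hl' i) (h'.2.1 l hl' i) (ih hl'.le) (h.2.2 _ hl) (h'.2.2 _ hl)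

lemma IsSobDerivs.mono {Ω : Set (EV m)} {p : ℝ≥0∞} {k k' : ℕ} {u : EV m → ℝ}
    {D : List (Fin m) → EV m → ℝ} (h : IsSobDerivs Ω k p u D) (hk : k' ≤ k) : IsSobDerivs Ω k' p u D :=
  ⟨h.1, fun l hl i => h.2.1 l (by omega) i, fun l hl => h.2.2 l (by omega)⟩

lemma IsSobDerivs.comb {Ω : Set (EV m)} {p : ℝ≥0∞} (hp1 : 1 ≤ p) {k : ℕ} {u v : EV m → ℝ}
    {D E : List (Fin m) → EV m → ℝ} (h : IsSobDerivs Ω k p u D) (h' : IsSobDerivs Ω k p v E) (a b : ℝ) :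
    IsSobDerivs Ω k p (fun x => a * u x + b * v x) (fun l x => a * D l x + b * E l x) := by
  refine ⟨?_, ?_, ?_⟩
  · simp only [h.1, h'.1]
  · intro l hl i φ φs φc φt
    have e1 := h.2.1 l hl i φ φs φc φt
    have e2 := h'.2.1 l hl i φ φs φc φt
    have c1 : Continuous (partialD i φ) := (fderivApply_contDiff φs _).continuous
    have c2 : HasCompactSupport (partialD i φ) := fderivApply_hcs φc _
    have hl2 : (i :: l).length ≤ k := by simpa using hl
    have i1 := integrable_restrict_mul_cc hp1 (h.2.2 l hl.le) c1 c2
    have i2 := integrable_restrict_mul_cc hp1 (h'.2.2 l hl.le) c1 c2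
    have i3 := integrable_restrict_mul_cc hp1 (h.2.2 _ hl2) φs.continuous φc
    have i4 := integrable_restrict_mul_cc hp1 (h'.2.2 _ hl2) φs.continuous φc
    simp only [add_mul, mul_assoc]
    rw [integral_add (i1.const_mul a) (i2.const_mul b), integral_add (i3.const_mul a) (i4.const_mul b)]
    simp only [integral_const_mul, e1, e2]
    ring
  · intro l hl
    exact ((h.2.2 l hl).const_mul a).add ((h'.2.2 l hl).const_mul b)

lemma sum_one_mul (F : Fin m → Fin m → ℝ) :
    ∑ i : Fin m, ∑ j : Fin m, (1 : Matrix (Fin m) (Fin m) ℝ) i j * F i j = ∑ i, F i i := by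
  refine Finset.sum_congr rfl fun i _ => ?_
  rw [Finset.sum_eq_single i]
  · simp
  · intro j _ hj; rw [Matrix.one_apply_ne hj.symm, zero_mul]
  · simp

lemma NeumannBC_iff {Ω : Set (EV m)} (hΩ : IsOpen Ω) {p : ℝ≥0∞} (hp1 : 1 ≤ p) {u : EV m → ℝ}
    {D : List (Fin m) → EV m → ℝ} (h : IsSobDerivs Ω 2 p u D) :
    NeumannBC Ω 1 p u ↔ ∀ φ : EV m → ℝ, ContDiff ℝ (⊤ : ℕ∞) φ → HasCompactSupport φ →
    ∑ i, ∫ x in Ω, D [i, i] x * φ x = - ∑ i, ∫ x in Ω, D [i] x * partialD i φ x := by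
  constructor
  · intro H φ φs φc
    have := H D h φ φs φc
    rwa [sum_one_mul (fun i j => ∫ x in Ω, D [i, j] x * φ x),
      sum_one_mul (fun i j => ∫ x in Ω, D [j] x * partialD i φ x)] at this
  · intro H D' h' φ φs φc
    rw [sum_one_mul (fun i j => ∫ x in Ω, D' [i, j] x * φ x),
      sum_one_mul (fun i j => ∫ x in Ω, D' [j] x * partialD i φ x)]
    have e1 : ∀ (l : List (Fin m)) (g : EV m → ℝ), l.length ≤ 2 → ∫ x in Ω, D' l x * g x = ∫ x in Ω, D l x * g x := by
      intro l g hl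
      refine integral_congr_ae ?_
      filter_upwards [h'.unique hΩ hp1 h l hl] with x hx
      rw [hx]
    simp only [e1 [_, _] _ (by simp), e1 [_] _ (by simp)]
    exact H φ φs φc

lemma MemWN.comb {Ω : Set (EV m)} (hΩ : IsOpen Ω) {p : ℝ≥0∞} (hp1 : 1 ≤ p) {u v : EV m → ℝ}
    (hu : MemWN Ω 1 2 p u) (hv : MemWN Ω 1 2 p v) (a b : ℝ) :
    MemWN Ω 1 2 p (fun x => a * u x + b * v x) := by
  obtain ⟨⟨D, hD⟩, h1⟩ := hu
  obtain ⟨⟨E, hE⟩, h2⟩ := hv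
  have hc := hD.comb hp1 hE a b
  refine ⟨⟨_, hc⟩, ?_⟩
  rw [NeumannBC_iff hΩ hp1 hc]
  intro φ φs φc
  have e1 := (NeumannBC_iff hΩ hp1 hD).1 h1 φ φs φc
  have e2 := (NeumannBC_iff hΩ hp1 hE).1 h2 φ φs φc
  have key : ∀ (l : List (Fin m)) (g : EV m → ℝ), l.length ≤ 2 → Continuous g → HasCompactSupport g →
      ∫ x in Ω, (a * D l x + b * E l x) * g x = a * (∫ x in Ω, D l x * g x) + b * ∫ x in Ω, E l x * g x := by
    intro l g hl g1 g2
    have i1 := integrable_restrict_mul_cc hp1 (hD.2.2 l hl) g1 g2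
    have i2 := integrable_restrict_mul_cc hp1 (hE.2.2 l hl) g1 g2
    simp only [add_mul, mul_assoc]
    rw [integral_add (i1.const_mul a) (i2.const_mul b)]
    simp only [integral_const_mul]
  have k1 : ∀ i : Fin m, _ := fun i => key [i, i] φ (by simp) φs.continuous φc
  have k2 : ∀ i : Fin m, _ := fun i => key [i] (partialD i φ) (by simp) (fderivApply_contDiff φs _).continuous
    (fderivApply_hcs φc _)
  simp only [k1, k2, Finset.sum_add_distrib, ← Finset.mul_sum, e1, e2]
  ring

/-- the finset of multi-indices -/
def LL (m k : ℕ) : Finset (List (Fin m)) := (List.finite_length_le (Fin m) k).toFinset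

lemma mem_LL {k : ℕ} {l : List (Fin m)} : l ∈ LL m k ↔ l.length ≤ k := by simp [LL]

lemma WNormD_eq (k : ℕ) (p : ℝ≥0∞) (μ : Measure (EV m)) (D : List (Fin m) → EV m → ℝ) :
    WNormD k p μ D = ∑ l ∈ LL m k, eLpNorm (D l) p μ := by
  unfold WNormD
  rw [tsum_eq_sum (s := LL m k)]
  · refine Finset.sum_congr rfl fun l hl => ?_
    rw [if_pos (mem_LL.1 hl)]
  · intro l hl
    rw [if_neg (fun h => hl (mem_LL.2 h))]

lemma le_WNormD {k : ℕ} (p : ℝ≥0∞) (μ : Measure (EV m)) (D : List (Fin m) → EV m → ℝ) {l : List (Fin m)}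
    (hl : l.length ≤ k) : eLpNorm (D l) p μ ≤ WNormD k p μ D := by
  rw [WNormD_eq]
  exact Finset.single_le_sum (f := fun l => eLpNorm (D l) p μ) (fun _ _ => zero_le) (mem_LL.2 hl)

lemma WNormD_congr {k : ℕ} (p : ℝ≥0∞) {μ : Measure (EV m)} {D D' : List (Fin m) → EV m → ℝ}
    (h : ∀ l : List (Fin m), l.length ≤ k → D l =ᵐ[μ] D' l) : WNormD k p μ D = WNormD k p μ D' := by
  rw [WNormD_eq, WNormD_eq]
  exact Finset.sum_congr rfl fun l hl => eLpNorm_congr_ae (h l (mem_LL.1 hl))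

lemma partialDList_hcs {f : EV m → ℝ} (hc : HasCompactSupport f) (l : List (Fin m)) :
    HasCompactSupport (partialDList l f) := by
  induction l with
  | nil => exact hc
  | cons i l ih => exact ih.fderiv_apply (𝕜 := ℝ) _

lemma sob_of_cc {Ω : Set (EV m)} (hΩ : MeasurableSet Ω) {U : EV m → ℝ} {p : ℝ≥0∞} {k : ℕ} (hU : ContDiff ℝ k U)
    (hc : HasCompactSupport U) : IsSobDerivs Ω k p U (fun l => partialDList l U) := by
  refine ⟨rfl, ?_, ?_⟩
  · intro l hl i φ φs φc φt
    have h1 : ContDiff ℝ 1 (partialDList l U) :=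
      contDiff_partialDList (k := 1) l (hU.of_le (by exact_mod_cast (by omega)))
    have z1 : ∀ x, x ∉ Ω → φ x = 0 := fun x hx => image_eq_zero_of_notMem_tsupport fun h => hx (φt h)
    have z2 : ∀ x, x ∉ Ω → partialD i φ x = 0 := fun x hx =>
      image_eq_zero_of_notMem_tsupport fun h => hx (φt (tsupport_fderivApply _ h))
    rw [setIntegral_eq_integral_of_forall_compl_eq_zero (fun x hx => by rw [z2 x hx, mul_zero]),
      setIntegral_eq_integral_of_forall_compl_eq_zero (fun x hx => by rw [z1 x hx, mul_zero])]
    exact ibp h1 (φs.of_le (by simp)) φc _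
  · intro l hl
    have h1 : Continuous (partialDList l U) :=
      (contDiff_partialDList (k := 0) l (hU.of_le (by exact_mod_cast (by omega)))).continuous
    exact (h1.memLp_of_hasCompactSupport (partialDList_hcs hc l)).restrict _

lemma Geo.memWN_of_cc {e : EV m} {τ : EV m → ℝ} {K : ℝ} (G : Geo e τ K) {p : ℝ≥0∞} (hp1 : 1 ≤ p)
    {U : EV m → ℝ} (hU : ContDiff ℝ 2 U)
    (hc : HasCompactSupport U) (h0 : ∀ x, τ x = 0 → ∑ i, partialD i τ x * partialD i U x = 0) :
    MemWN (Om τ) 1 2 p U := by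
  have hs := sob_of_cc (p := p) G.measOm (k := 2) (by exact_mod_cast hU) hc
  refine ⟨⟨_, hs⟩, ?_⟩
  rw [NeumannBC_iff G.openOm hp1 hs]
  intro φ φs φc
  simp only [partialDList]
  have φ2 : ContDiff ℝ 1 φ := φs.of_le (by simp)
  have hd : ∀ i, ContDiff ℝ 1 (partialD i U) := fun i => contDiff_partialD (k := 1) hU i
  let f : Fin m → EV m → ℝ := fun i x => partialD i U x * φ x
  have hf : ∀ i, ContDiff ℝ 1 (f i) := fun i => (hd i).mul φ2
  have fc : ∀ i, HasCompactSupport (f i) := fun i => φc.mul_left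
  have ei : ∀ i, partialD i (f i) = fun x => partialD i (partialD i U) x * φ x + partialD i U x * partialD i φ x :=
    fun i => partialD_mul ((hd i).differentiable (by simp)) (φ2.differentiable (by simp)) i
  have cφ := φs.continuous
  have c1 : ∀ i, Continuous (partialD i U) := fun i => (hd i).continuous
  have c2 : ∀ i, Continuous (partialD i (partialD i U)) := fun i =>
    (contDiff_partialD (k := 0) (hd i) i).continuous
  have c3 : ∀ i, Continuous (partialD i φ) := fun i => (contDiff_partialD (k := 0) φ2 i).continuous
  have j1 : ∀ i, Integrable (fun x => partialD i (partialD i U) x * φ x) (volume.restrict (Om τ)) := fun i =>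
    (integrable_cc (by have := c2 i; fun_prop) φc.mul_left).integrableOn
  have j2 : ∀ i, Integrable (fun x => partialD i U x * partialD i φ x) (volume.restrict (Om τ)) := fun i =>
    (integrable_cc (by have := c1 i; have := c3 i; fun_prop) (fderivApply_hcs φc _).mul_left).integrableOn
  have step1 : ∀ i, (∫ x in Om τ, partialD i (partialD i U) x * φ x) + ∫ x in Om τ, partialD i U x * partialD i φ x
      = ∫ x in Om τ, fderiv ℝ (f i) x (EuclideanSpace.single i 1) := by
    intro i
    rw [← integral_add (j1 i) (j2 i)]
    exact congrArg (fun F => ∫ x in Om τ, F x) (ei i).symm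
  have cN : ∀ i : Fin m, Continuous (fun x => fderiv ℝ τ x (EuclideanSpace.single i 1)) := fun i =>
    (G.contDiff_N _).continuous
  have k0 : ∀ i h, Integrable (fun x => fderiv ℝ (f i) x h) volume := fun i h =>
    integrable_cc (by have := (hf i).continuous_fderiv (by simp); fun_prop) ((fc i).fderiv_apply (𝕜 := ℝ) h)
  have k1 : ∀ i, Integrable (fun x => fderiv ℝ τ x (EuclideanSpace.single i 1) * fderiv ℝ (f i) x e) volume := fun i =>
    integrable_cc (by have := (hf i).continuous_fderiv (by simp); have := cN i; fun_prop)
      ((fc i).fderiv_apply (𝕜 := ℝ) e).mul_left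
  have step2 : ∀ i, ∫ x in Om τ, fderiv ℝ (f i) x (EuclideanSpace.single i 1)
      = ∫ x in Om τ, fderiv ℝ τ x (EuclideanSpace.single i 1) * fderiv ℝ (f i) x e := by
    intro i
    have := G.integral_tangential (hf i) (fc i) (EuclideanSpace.single i 1)
    rw [integral_sub (k0 i _).integrableOn (k1 i).integrableOn] at this
    linarith
  let F : EV m → ℝ := fun x => ∑ i, fderiv ℝ τ x (EuclideanSpace.single i 1) * f i x
  have hN : ∀ i : Fin m, ContDiff ℝ 1 (fun x => fderiv ℝ τ x (EuclideanSpace.single i 1)) := fun i =>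
    (G.contDiff_N _).of_le (by norm_num)
  have hF : ContDiff ℝ 1 F := ContDiff.sum fun i _ => (hN i).mul (hf i)
  have hFc : HasCompactSupport F := by
    refine φc.mono' ?_
    intro x hx
    by_contra hx'
    refine hx ?_
    have : φ x = 0 := image_eq_zero_of_notMem_tsupport hx'
    simp [F, f, this]
  have step3 : ∫ x in Om τ, fderiv ℝ F x e = 0 := by
    refine G.integral_normal hF hFc fun x hx => ?_
    have := h0 x hx
    simp only [F, f]
    calc _ = (∑ i, partialD i τ x * partialD i U x) * φ x := by
          rw [Finset.sum_mul]; exact Finset.sum_congr rfl fun i _ => by simp only [partialD]; ring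
      _ = 0 := by rw [this, zero_mul]
  have step4 : ∀ x, fderiv ℝ F x e = ∑ i, fderiv ℝ τ x (EuclideanSpace.single i 1) * fderiv ℝ (f i) x e := by
    intro x
    simp only [F]
    rw [fderiv_fun_sum (fun i _ => ((hN i).mul (hf i)).differentiable (by simp) x)]
    rw [ContinuousLinearMap.sum_apply]
    refine Finset.sum_congr rfl fun i _ => ?_
    rw [fderiv_fun_mul ((hN i).differentiable (by simp) x) ((hf i).differentiable (by simp) x)]
    simp [G.fderiv_N_e]
  simp only [step4] at step3
  rw [integral_finsetSum _ fun i _ => (k1 i).integrableOn] at step3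
  rw [eq_neg_iff_add_eq_zero, ← Finset.sum_add_distrib]
  simp only [step1, step2]
  exact step3

end PartTen

section PartEleven

variable {m : ℕ}

/-- the path from `0` to `-z` staying in the domain -/
def pa (K : ℝ) (e z : EV m) (r : ℝ) : EV m := -(r • z) + (2 * K * ‖z‖ * (r * (1 - r))) • e

lemma pa_zero (K : ℝ) (e z : EV m) : pa K e z 0 = 0 := by simp [pa]
lemma pa_one (K : ℝ) (e z : EV m) : pa K e z 1 = -z := by simp [pa]

lemma pa_cont (K : ℝ) (e : EV m) : Continuous fun q : EV m × ℝ => pa K e q.1 q.2 := by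
  unfold pa; fun_prop

lemma pa_norm {K : ℝ} (hK : 0 ≤ K) {e : EV m} (he : ‖e‖ = 1) (z : EV m) {r : ℝ} (hr : r ∈ Set.Icc (0:ℝ) 1) :
    ‖pa K e z r‖ ≤ (1 + 2 * K) * ‖z‖ := by
  obtain ⟨h0, h1⟩ := hr
  have hz := norm_nonneg z
  have a1 : ‖-(r • z)‖ ≤ ‖z‖ := by
    rw [norm_neg, norm_smul, Real.norm_of_nonneg h0]; nlinarith
  have a2 : ‖(2 * K * ‖z‖ * (r * (1 - r))) • e‖ ≤ 2 * K * ‖z‖ := by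
    rw [norm_smul, he, mul_one, Real.norm_of_nonneg (by have : 0 ≤ 1 - r := by linarith
                                                        positivity)]
    have : r * (1 - r) ≤ 1 := by nlinarith
    have h3 : 0 ≤ 2 * K * ‖z‖ := by positivity
    nlinarith
  calc _ ≤ _ := norm_add_le _ _
    _ ≤ _ := by linarith

lemma pa_deriv (K : ℝ) (e z x : EV m) (r : ℝ) :
    HasDerivAt (fun r => x + pa K e z r) (-z + (2 * K * ‖z‖ * (1 - 2 * r)) • e) r := by
  unfold pa
  have h1 : HasDerivAt (fun r : ℝ => r • z) z r := by simpa using (hasDerivAt_id r).smul_const z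
  have h2 : HasDerivAt (fun r : ℝ => 2 * K * ‖z‖ * (r * (1 - r))) (2 * K * ‖z‖ * (1 - 2 * r)) r := by
    have := ((hasDerivAt_id r).mul ((hasDerivAt_const r (1:ℝ)).sub (hasDerivAt_id r))).const_mul (2 * K * ‖z‖)
    refine (this.congr_deriv ?_)
    simp only [Pi.sub_apply, id]
    ring
  exact (h1.neg.add (h2.smul_const e)).const_add x

lemma pa_deriv_norm {K : ℝ} (hK : 0 ≤ K) {e : EV m} (he : ‖e‖ = 1) (z : EV m) {r : ℝ} (hr : r ∈ Set.Icc (0:ℝ) 1) :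
    ‖-z + (2 * K * ‖z‖ * (1 - 2 * r)) • e‖ ≤ (1 + 2 * K) * ‖z‖ := by
  obtain ⟨h0, h1⟩ := hr
  have hz := norm_nonneg z
  have a2 : ‖(2 * K * ‖z‖ * (1 - 2 * r)) • e‖ ≤ 2 * K * ‖z‖ := by
    rw [norm_smul, he, mul_one, norm_mul, Real.norm_of_nonneg (by positivity)]
    have : ‖1 - 2 * r‖ ≤ 1 := by rw [Real.norm_eq_abs, abs_le]; constructor <;> linarith
    have h3 : 0 ≤ 2 * K * ‖z‖ := by positivity
    nlinarith
  calc _ ≤ _ := norm_add_le _ _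
    _ ≤ _ := by rw [norm_neg]; linarith

lemma path_bound {F : Type*} [NormedAddCommGroup F] [NormedSpace ℝ F] [CompleteSpace F]
    {K : ℝ} (hK : 0 ≤ K) {e : EV m} (he : ‖e‖ = 1)
    {f : EV m → F} (hf : ContDiff ℝ 1 f) (x z : EV m) (hx : f x = 0) {σ : ℝ} (hσ : σ ∈ Set.Icc (0:ℝ) 1) :
    ‖f (x + pa K e z σ)‖ₑ ≤ ENNReal.ofReal ((1 + 2 * K) * ‖z‖) *
      ∫⁻ r in Set.Ioc (0:ℝ) 1, ‖fderiv ℝ f (x + pa K e z r)‖ₑ := by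
  have hd : ∀ r : ℝ, HasDerivAt (fun r : ℝ => f (x + pa K e z r))
      (fderiv ℝ f (x + pa K e z r) (-z + (2 * K * ‖z‖ * (1 - 2 * r)) • e)) r := fun r =>
    ((hf.differentiable (by simp)).differentiableAt.hasFDerivAt).comp_hasDerivAt r (pa_deriv K e z x r)
  have hcd := hf.continuous_fderiv (by simp)
  have hpc : Continuous fun r => pa K e z r := (pa_cont K e).comp (by fun_prop : Continuous fun r : ℝ => (z, r))
  have hc : Continuous fun r : ℝ => fderiv ℝ f (x + pa K e z r) (-z + (2 * K * ‖z‖ * (1 - 2 * r)) • e) := by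
    fun_prop
  have e1 := intervalIntegral.integral_eq_sub_of_hasDerivAt (a := 0) (b := σ)
    (fun σ _ => hd σ) (hc.intervalIntegrable 0 σ)
  simp only [pa_zero, add_zero, hx, sub_zero] at e1
  rw [← e1, intervalIntegral.integral_of_le hσ.1, ← lintegral_const_mul' _ _ (by simp)]
  refine (enorm_integral_le_lintegral_enorm _).trans ?_
  refine (lintegral_mono_set (Set.Ioc_subset_Ioc_right hσ.2)).trans ?_
  refine setLIntegral_mono' measurableSet_Ioc fun r hr => ?_
  refine (ContinuousLinearMap.le_opENorm _ _).trans ?_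
  rw [mul_comm]
  gcongr
  rw [← ofReal_norm]
  exact ENNReal.ofReal_le_ofReal (pa_deriv_norm hK he z ⟨hr.1.le, hr.2⟩)

lemma enorm_clm_le {F : Type*} [NormedAddCommGroup F] [NormedSpace ℝ F] (T : EV m →L[ℝ] F) :
    ‖T‖ₑ ≤ ∑ i, ‖T (EuclideanSpace.single i 1)‖ₑ := by
  have h : ‖T‖ ≤ ∑ i, ‖T (EuclideanSpace.single i 1)‖ := by
    refine T.opNorm_le_bound (Finset.sum_nonneg fun i _ => norm_nonneg _) fun v => ?_
    have e : v = ∑ i, v i • EuclideanSpace.single i (1:ℝ) := by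
      have := (EuclideanSpace.basisFun (Fin m) ℝ).sum_repr v
      simpa using this.symm
    conv_lhs => rw [e]
    rw [map_sum, Finset.sum_mul]
    refine (norm_sum_le _ _).trans (Finset.sum_le_sum fun i _ => ?_)
    rw [map_smul, norm_smul, mul_comm]
    gcongr
    exact PiLp.norm_apply_le v i
  rw [← ofReal_norm]
  refine (ENNReal.ofReal_le_ofReal h).trans ?_
  rw [ENNReal.ofReal_sum_of_nonneg (fun i _ => norm_nonneg _)]
  simp

lemma snd_partial {U : EV m → ℝ} (hU : ContDiff ℝ 2 U) (i j : Fin m) (y : EV m) :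
    partialDList [i, j] U y = fderiv ℝ (fderiv ℝ U) y (EuclideanSpace.single i 1) (EuclideanSpace.single j 1) := by
  have h1 : ContDiff ℝ 1 (fderiv ℝ U) := hU.fderiv_right (by norm_num)
  have h2 : DifferentiableAt ℝ (fderiv ℝ U) y := (h1.differentiable (by simp)) y
  show fderiv ℝ (fun y => fderiv ℝ U y (EuclideanSpace.single j 1)) y (EuclideanSpace.single i 1) = _
  rw [fderiv_clm_apply h2 (by fun_prop)]
  simp

/-- second order Taylor remainder -/
def Rem (U : EV m → ℝ) (x z : EV m) : ℝ :=
  U (x - z) - U x + fderiv ℝ U x z - (1/2) * fderiv ℝ (fderiv ℝ U) x z z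

lemma taylor_path {K : ℝ} (hK : 0 ≤ K) {e : EV m} (he : ‖e‖ = 1) {U : EV m → ℝ} (hU : ContDiff ℝ 2 U)
    (x z : EV m) :
    ‖Rem U x z‖ₑ ≤ ENNReal.ofReal (((1 + 2 * K) * ‖z‖) ^ 2) *
      ∑ i, ∑ j, ∫⁻ r in Set.Ioc (0:ℝ) 1, ‖partialDList [i, j] U (x + pa K e z r) - partialDList [i, j] U x‖ₑ := by
  have h1 : ContDiff ℝ 1 (fderiv ℝ U) := hU.fderiv_right (by norm_num)
  have hd1 : Differentiable ℝ (fderiv ℝ U) := h1.differentiable (by simp)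
  have hdU : Differentiable ℝ U := hU.differentiable (by simp)
  set T := fderiv ℝ (fderiv ℝ U) x with hT
  have hs : ∀ v w, T v w = T w v := (hU.contDiffAt (x := x)).isSymmSndFDerivAt (by simp)
  set g : EV m → (EV m →L[ℝ] ℝ) := fun y => fderiv ℝ U y - fderiv ℝ U x - T (y - x) with hg
  set h : EV m → ℝ := fun y => U y - U x - fderiv ℝ U x (y - x) - (1/2) * T (y - x) (y - x) with hh
  have hgd : ∀ y, HasFDerivAt g (fderiv ℝ (fderiv ℝ U) y - T) y := by
    intro y
    have a := ((hd1 y).hasFDerivAt.sub_const (fderiv ℝ U x))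
    have b : HasFDerivAt (fun y => T (y - x)) T y := T.hasFDerivAt.comp y ((hasFDerivAt_id y).sub_const x)
    exact a.sub b
  have hhd : ∀ y, HasFDerivAt h (g y) y := by
    intro y
    have a := ((hdU y).hasFDerivAt.sub_const (U x))
    have b0 : HasFDerivAt (fun y : EV m => y - x) (ContinuousLinearMap.id ℝ (EV m)) y := (hasFDerivAt_id y).sub_const x
    have b : HasFDerivAt (fun y => fderiv ℝ U x (y - x)) (fderiv ℝ U x) y :=
      (fderiv ℝ U x).hasFDerivAt.comp y b0
    have c0 : HasFDerivAt (fun y => T (y - x)) T y := T.hasFDerivAt.comp y b0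
    have c := (c0.clm_apply b0).const_mul (1/2)
    refine ((a.sub b).sub c).congr_fderiv ?_
    ext v
    have e3 : T v (y - x) = T (y - x) v := hs v (y - x)
    simp only [hg, _root_.sub_apply, _root_.add_apply, _root_.smul_apply, ContinuousLinearMap.comp_apply,
      ContinuousLinearMap.flip_apply, ContinuousLinearMap.id_apply, smul_eq_mul, e3]
    ring
  have hgc : ContDiff ℝ 1 g := (h1.sub contDiff_const).sub (T.contDiff.comp (contDiff_id.sub contDiff_const))
  have hfh : fderiv ℝ h = g := funext fun y => (hhd y).fderiv
  have hhc : ContDiff ℝ 1 h := by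
    rw [contDiff_one_iff_fderiv]
    exact ⟨fun y => (hhd y).differentiableAt, by rw [hfh]; exact hgc.continuous⟩
  have e1 : Rem U x z = h (x + pa K e z 1) := by
    simp only [pa_one, hh, Rem, hT]
    simp [sub_eq_add_neg]
  rw [e1]
  set Lz := ENNReal.ofReal ((1 + 2 * K) * ‖z‖) with hL
  have s1 := path_bound hK he hhc x z (by simp [hh]) (σ := 1) ⟨by norm_num, le_rfl⟩
  rw [hfh] at s1
  have s2 : ∀ r ∈ Set.Ioc (0:ℝ) 1, ‖g (x + pa K e z r)‖ₑ ≤ Lz * ∑ i, ∑ j, ∫⁻ r in Set.Ioc (0:ℝ) 1,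
      ‖partialDList [i, j] U (x + pa K e z r) - partialDList [i, j] U x‖ₑ := by
    intro r hr
    refine (path_bound hK he hgc x z (by simp [hg]) ⟨hr.1.le, hr.2⟩).trans ?_
    gcongr
    have hm : ∀ i j, Measurable fun r : ℝ => ‖partialDList [i, j] U (x + pa K e z r) - partialDList [i, j] U x‖ₑ := by
      intro i j
      have hpc : Continuous fun r => pa K e z r := (pa_cont K e).comp (by fun_prop : Continuous fun r : ℝ => (z, r))
      have := cont_partialDList (l := [i, j]) (hU) (by simp)
      have h3 : Continuous fun r : ℝ => partialDList [i, j] U (x + pa K e z r) - partialDList [i, j] U x :=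
        (this.comp (by fun_prop : Continuous fun r : ℝ => x + pa K e z r)).sub continuous_const
      exact h3.measurable.enorm
    simp_rw [← lintegral_finsetSum' _ fun j _ => (hm _ j).aemeasurable]
    rw [← lintegral_finsetSum' _ fun i _ => (Finset.aemeasurable_fun_sum _ fun j _ => (hm i j).aemeasurable)]
    refine lintegral_mono fun r => ?_
    rw [(hgd _).fderiv]
    refine (enorm_clm_le _).trans (Finset.sum_le_sum fun i _ => ?_)
    refine (enorm_clm_le _).trans (Finset.sum_le_sum fun j _ => ?_)
    rw [snd_partial hU, snd_partial hU]
    simp [hT]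
  refine s1.trans ((mul_le_mul_right (setLIntegral_mono' measurableSet_Ioc s2) _).trans (le_of_eq ?_))
  rw [lintegral_const]
  simp only [Measure.restrict_apply, MeasurableSet.univ, Set.univ_inter, Real.volume_Ioc, sub_zero, ENNReal.ofReal_one, mul_one]
  rw [← mul_assoc, hL, ← ENNReal.ofReal_mul (by positivity), ← sq]

namespace Geo
variable {e : EV m} {τ : EV m → ℝ} {K : ℝ}

lemma pa_mem (G : Geo e τ K) {x z : EV m} (hx : x ∈ Om τ) (hz : x - z ∈ Om τ) {r : ℝ} (hr : r ∈ Set.Icc (0:ℝ) 1) :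
    x + pa K e z r ∈ Om τ := by
  obtain ⟨h0, h1⟩ := hr
  have e1 : x + pa K e z r = (x - r • z) + (2 * K * ‖z‖ * (r * (1 - r))) • e := by
    simp only [pa]; abel
  show 0 < τ _
  rw [e1, G.shift]
  have hx' : 0 < τ x := hx
  have hz' : 0 < τ (x - z) := hz
  have l1 := abs_le.1 (G.lip x (x - r • z))
  have l2 := abs_le.1 (G.lip (x - z) (x - r • z))
  have n1 : ‖x - (x - r • z)‖ = r * ‖z‖ := by
    rw [show x - (x - r • z) = r • z by abel, norm_smul, Real.norm_of_nonneg h0]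
  have n2 : ‖x - z - (x - r • z)‖ = (1 - r) * ‖z‖ := by
    have : x - z - (x - r • z) = (-(1 - r)) • z := by module
    rw [this, norm_smul, norm_neg, Real.norm_of_nonneg (by linarith)]
  rw [n1] at l1; rw [n2] at l2
  have b1 : τ x - K * (r * ‖z‖) ≤ τ (x - r • z) := by linarith [l1.2]
  have b2 : τ (x - z) - K * ((1 - r) * ‖z‖) ≤ τ (x - r • z) := by linarith [l2.2]
  rcases eq_or_lt_of_le h0 with rfl | hr0
  · simp at *; linarith
  · have c1 := mul_le_mul_of_nonneg_left b1 (by linarith : 0 ≤ 1 - r)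
    have c2 := mul_le_mul_of_nonneg_left b2 h0
    have c3 : 0 < r * τ (x - z) := by positivity
    have c4 : 0 ≤ (1 - r) * τ x := mul_nonneg (by linarith) hx'.le
    nlinarith

end Geo

end PartEleven

section PartTwelve

variable {m : ℕ}

/-- points of the domain which stay there after translation by `a` -/
def OmT (τ : EV m → ℝ) (a : EV m) : Set (EV m) := {x | x ∈ Om τ ∧ x + a ∈ Om τ}

/-- modulus of continuity in `L^p`, including the mass in a boundary layer -/
def mdl (τ : EV m → ℝ) (K : ℝ) (p : ℝ≥0∞) (f : EV m → ℝ) (t : ℝ) : ℝ≥0∞ :=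
  (⨆ a : EV m, ⨆ (_ : ‖a‖ ≤ (1 + 2 * K) * t),
    eLpNorm (fun x => f (x + a) - f x) p (volume.restrict (OmT τ a)))
  + eLpNorm f p (volume.restrict (Sl τ (K * t)))

lemma eLpNorm_dirD_le {p : ℝ≥0∞} (hp1 : 1 ≤ p) {D : List (Fin m) → EV m → ℝ} (hD : ∀ l, Measurable (D l))
    (h : EV m) (l : List (Fin m)) (μ : Measure (EV m)) :
    eLpNorm (dirD h D l) p μ ≤ ENNReal.ofReal ‖h‖ * ∑ i, eLpNorm (D (i :: l)) p μ := by
  have e : dirD h D l = ∑ i, fun x => h i * D (i :: l) x := by funext x; simp [dirD]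
  rw [e, Finset.mul_sum]
  refine (eLpNorm_sum_le (fun i _ => ((hD _).const_mul _).aestronglyMeasurable) hp1).trans
    (Finset.sum_le_sum fun i _ => ?_)
  have := eLpNorm_const_smul (h i) (D (i :: l)) p μ
  rw [show (fun x => h i * D (i :: l) x) = h i • D (i :: l) from rfl, this]
  gcongr
  rw [← ofReal_norm]
  exact ENNReal.ofReal_le_ofReal (PiLp.norm_apply_le h i)

namespace Geo
variable {e : EV m} {τ : EV m → ℝ} {K : ℝ}

lemma measOmT (G : Geo e τ K) (a : EV m) : MeasurableSet (OmT τ a) :=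
  G.measOm.inter ((measurable_id.add_const a) G.measOm)

lemma mdl_mono (G : Geo e τ K) (p : ℝ≥0∞) (f : EV m → ℝ) : Monotone (mdl τ K p f) := by
  intro t t' h
  have hK := G.Kpos
  unfold mdl
  refine add_le_add ?_ ?_
  · refine iSup_mono fun a => iSup_le fun ha => ?_
    exact le_iSup_of_le (ha.trans (mul_le_mul_of_nonneg_left h (by linarith))) le_rfl
  · refine eLpNorm_mono_measure _ (Measure.restrict_mono_set _ fun x hx => ⟨hx.1, hx.2.trans ?_⟩)
    exact mul_le_mul_of_nonneg_left h hK.le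

lemma shift_le_mdl (p : ℝ≥0∞) (f : EV m → ℝ) {t : ℝ} {a : EV m} (ha : ‖a‖ ≤ (1 + 2 * K) * t) :
    eLpNorm (fun x => f (x + a) - f x) p (volume.restrict (OmT τ a)) ≤ mdl τ K p f t :=
  (le_iSup₂_of_le (f := fun a (_ : ‖a‖ ≤ (1 + 2 * K) * t) =>
    eLpNorm (fun x => f (x + a) - f x) p (volume.restrict (OmT τ a))) a ha le_rfl).trans le_self_add

lemma layer_le_mdl (p : ℝ≥0∞) (f : EV m → ℝ) (t : ℝ) :
    eLpNorm f p (volume.restrict (Sl τ (K * t))) ≤ mdl τ K p f t := le_add_self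

lemma mdl_le (G : Geo e τ K) {p : ℝ≥0∞} (hp1 : 1 ≤ p) {f : EV m → ℝ} (hf : Measurable f) (t : ℝ) :
    mdl τ K p f t ≤ 3 * eLpNorm f p (volume.restrict (Om τ)) := by
  have e3 : 3 * eLpNorm f p (volume.restrict (Om τ)) = (eLpNorm f p (volume.restrict (Om τ)) +
    eLpNorm f p (volume.restrict (Om τ))) + eLpNorm f p (volume.restrict (Om τ)) := by ring
  rw [e3]
  unfold mdl
  refine add_le_add (iSup₂_le fun a _ => ?_) (eLpNorm_mono_measure _ (Measure.restrict_mono_set _ fun x hx => hx.1))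
  refine (eLpNorm_sub_le (by fun_prop : Measurable fun x => f (x + a)).aestronglyMeasurable
    hf.aestronglyMeasurable hp1).trans (add_le_add ?_ ?_)
  · exact eLpNorm_translate f hf.aestronglyMeasurable p a _ _ (G.measOmT a) G.measOm fun x hx => hx.2
  · exact eLpNorm_mono_measure _ (Measure.restrict_mono_set _ fun x hx => hx.1)

lemma mdl_add (_G : Geo e τ K) {p : ℝ≥0∞} (hp1 : 1 ≤ p) {f g : EV m → ℝ} (hf : Measurable f) (hg : Measurable g)
    (t : ℝ) : mdl τ K p (fun x => f x + g x) t ≤ mdl τ K p f t + mdl τ K p g t := by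
  unfold mdl
  rw [add_add_add_comm]
  refine add_le_add (iSup₂_le fun a ha => ?_) (eLpNorm_add_le (by fun_prop) (by fun_prop) hp1)
  have e1 : (fun x => f (x + a) + g (x + a) - (f x + g x)) = (fun x => f (x + a) - f x) + fun x => g (x + a) - g x := by
    funext x; simp; ring
  rw [e1]
  refine (eLpNorm_add_le (by fun_prop) (by fun_prop) hp1).trans (add_le_add ?_ ?_)
  · exact le_iSup₂_of_le (f := fun a (_ : ‖a‖ ≤ (1 + 2 * K) * t) =>
      eLpNorm (fun x => f (x + a) - f x) p (volume.restrict (OmT τ a))) a ha le_rfl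
  · exact le_iSup₂_of_le (f := fun a (_ : ‖a‖ ≤ (1 + 2 * K) * t) =>
      eLpNorm (fun x => g (x + a) - g x) p (volume.restrict (OmT τ a))) a ha le_rfl

lemma mdl_sub (G : Geo e τ K) {p : ℝ≥0∞} (hp1 : 1 ≤ p) {f g : EV m → ℝ} (hf : Measurable f) (hg : Measurable g)
    (t : ℝ) : mdl τ K p f t ≤ mdl τ K p g t + 3 * eLpNorm (fun x => f x - g x) p (volume.restrict (Om τ)) := by
  have h := G.mdl_add hp1 hg (hf.sub hg) t
  have e1 : (fun x => g x + (f - g) x) = f := by funext x; simp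
  rw [e1] at h
  exact h.trans (add_le_add le_rfl (G.mdl_le hp1 (hf.sub hg) t))

lemma mdl_tendsto (G : Geo e τ K) {p : ℝ≥0∞} (hp1 : 1 ≤ p) (hp : p ≠ ⊤) {f : EV m → ℝ} (hf : Measurable f)
    (hfp : MemLp f p volume) : Tendsto (mdl τ K p f) (𝓝[>] 0) (𝓝 0) := by
  have hK := G.Kpos
  have h1 := tendsto_eLpNorm_translate f hp1 hp hfp
  have h2 : Tendsto (fun t : ℝ => eLpNorm f p (volume.restrict (Sl τ (K * t)))) (𝓝[>] 0) (𝓝 0) := by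
    refine (tendsto_layer G.cont hp1 hp hf hfp).comp ?_
    refine tendsto_nhdsWithin_of_tendsto_nhds_of_eventually_within _ ?_ ?_
    · have : Tendsto (fun t : ℝ => K * t) (𝓝 0) (𝓝 (K * 0)) := (continuous_const.mul continuous_id).tendsto 0
      rw [mul_zero] at this
      exact this.mono_left nhdsWithin_le_nhds
    · filter_upwards [self_mem_nhdsWithin] with t ht
      exact mul_pos hK ht
  have h3 : Tendsto (fun t : ℝ => ⨆ a : EV m, ⨆ (_ : ‖a‖ ≤ (1 + 2 * K) * t),
    eLpNorm (fun x => f (x + a) - f x) p (volume.restrict (OmT τ a))) (𝓝[>] 0) (𝓝 0) := by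
    rw [ENNReal.tendsto_nhds_zero] at h1 ⊢
    intro ε hε
    obtain ⟨δ, hδ, hb⟩ := Metric.eventually_nhds_iff.1 (h1 ε hε)
    have : (0:ℝ) < δ / (1 + 2 * K) := by positivity
    filter_upwards [Ioo_mem_nhdsGT this] with t ht
    refine iSup₂_le fun a ha => (eLpNorm_mono_measure _ Measure.restrict_le_self).trans (hb ?_)
    rw [dist_zero_right]
    refine ha.trans_lt ?_
    have := (lt_div_iff₀ (by positivity)).1 ht.2
    linarith
  have := h3.add h2
  rw [add_zero] at this
  exact this

lemma shift_rate (G : Geo e τ K) {k : ℕ} {p : ℝ≥0∞} (hp1 : 1 ≤ p) (hp : p ≠ ⊤) {D : List (Fin m) → EV m → ℝ}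
    (hD : Jet (Om τ) k p D) {l : List (Fin m)} (hl : l.length < k) (a : EV m) :
    eLpNorm (fun x => D l (x + a) - D l x) p (volume.restrict (OmT τ a)) ≤
      ENNReal.ofReal ((1 + 2 * K) * ‖a‖) * ∑ i, eLpNorm (D (i :: l)) p (volume.restrict (Om τ)) := by
  obtain ⟨η, hη, -, hst⟩ := G.exists_mol
  have hK := G.Kpos
  set f := D l with hf
  have hfm : Measurable f := hD.meas l
  set b : ℝ := K * ‖a‖ with hb
  have hb0 : 0 ≤ b := by positivity
  set S := ∑ i, eLpNorm (D (i :: l)) p (volume.restrict (Om τ)) with hS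
  have hbe : ‖b • e‖ = b := by rw [norm_smul, G.e1, mul_one, Real.norm_of_nonneg hb0]
  set f1 : EV m → ℝ := fun x => f (x + b • e) - f x with hf1
  have hf1m : Measurable f1 := by fun_prop
  set f2 : EV m → ℝ := fun x => f (x + a) - f x with hf2
  have hf2m : Measurable f2 := by fun_prop
  have L1 : eLpNorm f1 p (volume.restrict (Om τ)) ≤ ENNReal.ofReal b * S := by
    refine (weak_shift hη (A := Om τ) (B := Om τ) G.measOm G.measOm hst hfm (hD.dir_meas (b • e) l) hp1 hp
      (hD.memLp l) (hD.dir_memLp _ l) (hD.weakDir hp1 (b • e) hl) ?_ subset_rfl).trans ?_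
    · intro x hx σ hσ
      show 0 < τ _
      rw [smul_smul, G.shift]
      have : 0 ≤ σ * b := mul_nonneg hσ.1 hb0
      have : 0 < τ x := hx
      linarith
    · have := eLpNorm_dirD_le hp1 hD.meas (b • e) l (volume.restrict (Om τ))
      rwa [hbe] at this
  set A2 : Set (EV m) := {y | b < τ y} with hA2
  have mA2 : MeasurableSet A2 := measurableSet_lt measurable_const G.cont.measurable
  have L2 : eLpNorm f2 p (volume.restrict A2) ≤ ENNReal.ofReal ‖a‖ * S := by
    refine (weak_shift hη (A := A2) (B := Om τ) mA2 G.measOm hst hfm (hD.dir_meas a l) hp1 hp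
      (hD.memLp l) (hD.dir_memLp _ l) (hD.weakDir hp1 a hl) ?_ subset_rfl).trans ?_
    · intro x hx σ hσ
      show 0 < τ _
      have h1 := (abs_le.1 (G.lip x (x + σ • a))).2
      have n1 : ‖x - (x + σ • a)‖ = σ * ‖a‖ := by
        rw [show x - (x + σ • a) = -(σ • a) by abel, norm_neg, norm_smul, Real.norm_of_nonneg hσ.1]
      rw [n1] at h1
      have : K * (σ * ‖a‖) ≤ b := by
        rw [hb]
        refine mul_le_mul_of_nonneg_left ?_ hK.le
        have := norm_nonneg a
        nlinarith [hσ.2]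
      have : b < τ x := hx
      linarith
    · exact eLpNorm_dirD_le hp1 hD.meas a l (volume.restrict (Om τ))
  have e1 : f2 = (f1 + fun x => f2 (x + b • e)) - fun x => f1 (x + a) := by
    funext x
    simp only [hf1, hf2, Pi.add_apply, Pi.sub_apply]
    rw [add_right_comm x (b • e) a]
    ring
  rw [e1]
  have T1 : eLpNorm f1 p (volume.restrict (OmT τ a)) ≤ ENNReal.ofReal b * S :=
    (eLpNorm_mono_measure _ (Measure.restrict_mono_set _ fun x hx => hx.1)).trans L1
  have T2 : eLpNorm (fun x => f2 (x + b • e)) p (volume.restrict (OmT τ a)) ≤ ENNReal.ofReal ‖a‖ * S := by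
    refine (eLpNorm_translate f2 hf2m.aestronglyMeasurable p (b • e) _ A2 (G.measOmT a) mA2 ?_).trans L2
    intro x hx
    show b < τ _
    rw [G.shift]
    have : 0 < τ x := hx.1
    linarith
  have T3 : eLpNorm (fun x => f1 (x + a)) p (volume.restrict (OmT τ a)) ≤ ENNReal.ofReal b * S :=
    (eLpNorm_translate f1 hf1m.aestronglyMeasurable p a _ _ (G.measOmT a) G.measOm fun x hx => hx.2).trans L1
  have q1 : AEStronglyMeasurable (fun x => f1 (x + a)) (volume.restrict (OmT τ a)) :=
    (hf1m.comp (measurable_id.add_const a)).aestronglyMeasurable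
  have q2 : AEStronglyMeasurable (fun x => f2 (x + b • e)) (volume.restrict (OmT τ a)) :=
    (hf2m.comp (measurable_id.add_const _)).aestronglyMeasurable
  refine (eLpNorm_sub_le (hf1m.aestronglyMeasurable.add q2) q1 hp1).trans ?_
  refine (add_le_add ((eLpNorm_add_le hf1m.aestronglyMeasurable q2 hp1).trans (add_le_add T1 T2)) T3).trans ?_
  rw [← add_mul, ← add_mul, ← ENNReal.ofReal_add hb0 (norm_nonneg _), ← ENNReal.ofReal_add (by positivity) hb0]
  gcongr
  rw [hb]; ring_nf; rfl

lemma layer_rate (G : Geo e τ K) {k : ℕ} {p : ℝ≥0∞} (hp1 : 1 ≤ p) (hp : p ≠ ⊤) {D : List (Fin m) → EV m → ℝ}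
    (hD : Jet (Om τ) k p D) {l : List (Fin m)} (hl : l.length < k) {h : ℝ} (hh : 0 ≤ h) :
    eLpNorm (D l) p (volume.restrict (Sl τ h)) ≤ ENNReal.ofReal h ^ (1 / p.toReal) *
      (eLpNorm (D l) p (volume.restrict (Om τ)) + ∑ i, eLpNorm (D (i :: l)) p (volume.restrict (Om τ))) := by
  obtain ⟨η, hη, -, hst⟩ := G.exists_mol
  have hr := toReal_one_le hp1 hp
  have hr0 : 0 < p.toReal := by linarith
  set E : EV m → ℝ≥0∞ := (Sl τ h).indicator 1 with hE
  have hEm : Measurable E := measurable_one.indicator (G.measSl h)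
  have key := weighted_trace hη (U := Om τ) G.measOm (e := e) hst (fun x hx s hs => G.up hx hs) hEm (C := 1) (by simp)
    (fun x _ => Set.indicator_le_self' (by simp) x) hp1 hp (κ := ENNReal.ofReal h) (by simp) ?_
    (hD.meas l) (hD.dir_meas e l) (hD.memLp l) (hD.dir_memLp e l) (hD.weakDir hp1 e hl)
  · have e1 : eLpNorm (D l) p (volume.restrict (Sl τ h)) ≤ eLpNorm (fun x => E x * ‖D l x‖ₑ) p (volume.restrict (Om τ)) := by
      have e2 : eLpNorm (D l) p (volume.restrict (Sl τ h)) = eLpNorm (fun x => E x * ‖D l x‖ₑ) p (volume.restrict (Sl τ h)) := by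
        rw [← eLpNorm_enorm]
        refine eLpNorm_congr_ae ?_
        filter_upwards [ae_restrict_mem (G.measSl h)] with x hx
        simp [hE, hx]
      rw [e2]
      exact eLpNorm_mono_measure _ (Measure.restrict_mono_set _ fun x hx => hx.1)
    refine e1.trans (key.trans ?_)
    gcongr
    have := eLpNorm_dirD_le hp1 hD.meas e l (volume.restrict (Om τ))
    rwa [G.e1, ENNReal.ofReal_one, one_mul] at this
  · intro x
    calc ∫⁻ s : ℝ, (Om τ).indicator (fun y => E y ^ p.toReal) (x + s • e)
        ≤ ∫⁻ s : ℝ, (Set.Icc (- τ x) (h - τ x)).indicator 1 s := by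
          refine lintegral_mono fun s => ?_
          by_cases hs : x + s • e ∈ Sl τ h
          · have h1 := hs.1
            have h2 := hs.2
            rw [G.shift] at h1 h2
            have hm : s ∈ Set.Icc (- τ x) (h - τ x) := ⟨by linarith, by linarith⟩
            rw [Set.indicator_of_mem hm, Set.indicator_of_mem (show x + s • e ∈ Om τ from hs.1)]
            simp [hE, hs]
          · have : (Om τ).indicator (fun y => E y ^ p.toReal) (x + s • e) = 0 := by
              refine Set.indicator_apply_eq_zero.2 fun _ => ?_
              simp [hE, hs, hr0]
            rw [this]; exact zero_le
      _ = _ := by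
          rw [lintegral_indicator_one measurableSet_Icc, Real.volume_Icc]
          congr 1; ring

lemma mdl_rate (G : Geo e τ K) {k : ℕ} {p : ℝ≥0∞} (hp1 : 1 ≤ p) (hp : p ≠ ⊤) {D : List (Fin m) → EV m → ℝ}
    (hD : Jet (Om τ) k p D) {l : List (Fin m)} (hl : l.length < k) {t : ℝ} (ht : 0 ≤ t) :
    mdl τ K p (D l) t ≤ ENNReal.ofReal ((1 + 2 * K) ^ 2 + K + 3) * ENNReal.ofReal t ^ (1 / p.toReal) *
      (eLpNorm (D l) p (volume.restrict (Om τ)) + ∑ i, eLpNorm (D (i :: l)) p (volume.restrict (Om τ))) := by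
  have hr := toReal_one_le hp1 hp
  have hr0 : 0 < p.toReal := by linarith
  have hK := G.Kpos
  have hK1 := G.K1
  have hp1' : 1 / p.toReal ≤ 1 := by rw [div_le_one hr0]; exact hr
  set X := eLpNorm (D l) p (volume.restrict (Om τ)) + ∑ i, eLpNorm (D (i :: l)) p (volume.restrict (Om τ)) with hX
  rcases le_or_gt t 1 with h1 | h1
  · have tt : ENNReal.ofReal t ≤ ENNReal.ofReal t ^ (1 / p.toReal) := by
      conv_lhs => rw [← ENNReal.rpow_one (ENNReal.ofReal t)]
      exact ENNReal.rpow_le_rpow_of_exponent_ge (by simpa using h1) hp1'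
    have a1 : (⨆ a : EV m, ⨆ (_ : ‖a‖ ≤ (1 + 2 * K) * t),
        eLpNorm (fun x => D l (x + a) - D l x) p (volume.restrict (OmT τ a))) ≤
        ENNReal.ofReal ((1 + 2 * K) ^ 2) * ENNReal.ofReal t ^ (1 / p.toReal) * X := by
      refine iSup₂_le fun a ha => (G.shift_rate hp1 hp hD hl a).trans ?_
      have : ENNReal.ofReal ((1 + 2 * K) * ‖a‖) ≤ ENNReal.ofReal ((1 + 2 * K) ^ 2) * ENNReal.ofReal t ^ (1 / p.toReal) := by
        refine le_trans ?_ (mul_le_mul_right tt _)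
        rw [← ENNReal.ofReal_mul (by positivity)]
        refine ENNReal.ofReal_le_ofReal ?_
        rw [sq, mul_assoc]
        exact mul_le_mul_of_nonneg_left ha (by linarith)
      exact mul_le_mul' this le_add_self
    have a2 : eLpNorm (D l) p (volume.restrict (Sl τ (K * t))) ≤
        ENNReal.ofReal K * ENNReal.ofReal t ^ (1 / p.toReal) * X := by
      refine (G.layer_rate hp1 hp hD hl (by positivity)).trans ?_
      gcongr
      rw [ENNReal.ofReal_mul hK.le, ENNReal.mul_rpow_of_nonneg _ _ (by positivity)]
      gcongr
      conv_rhs => rw [← ENNReal.rpow_one (ENNReal.ofReal K)]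
      exact ENNReal.rpow_le_rpow_of_exponent_le (by simpa using hK1) hp1'
    refine (add_le_add a1 a2).trans ?_
    rw [← add_mul, ← add_mul, ← ENNReal.ofReal_add (by positivity) hK.le]
    exact mul_le_mul' (mul_le_mul' (ENNReal.ofReal_le_ofReal (by linarith)) le_rfl) le_rfl
  · refine (G.mdl_le hp1 (hD.meas l) t).trans ?_
    have b1 : (1:ℝ≥0∞) ≤ ENNReal.ofReal t ^ (1 / p.toReal) :=
      ENNReal.one_le_rpow (by simpa using h1.le) (by positivity)
    have b2 : (3:ℝ≥0∞) ≤ ENNReal.ofReal ((1 + 2 * K) ^ 2 + K + 3) := by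
      rw [show (3:ℝ≥0∞) = ENNReal.ofReal 3 by simp]
      refine ENNReal.ofReal_le_ofReal ?_
      nlinarith
    refine mul_le_mul' ?_ le_self_add
    calc (3:ℝ≥0∞) = 3 * 1 := by ring
      _ ≤ _ := mul_le_mul' b2 b1

end Geo

end PartTwelve

section PartThirteen

variable {m : ℕ}

/-- admissible densities -/
structure Ker (k : EV m → ℝ) : Prop where
  meas : Measurable k
  nonneg : ∀ x, 0 ≤ k x
  even : ∀ᵐ x : EV m, k (-x) = k x
  int : Integrable k
  int1 : Integrable fun x => k x * ‖x‖

def muK (k : EV m → ℝ) : Measure (EV m) := volume.withDensity fun z => ENNReal.ofReal (k z)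

lemma Ker.finite {k : EV m → ℝ} (hk : Ker k) : IsFiniteMeasure (muK k) :=
  isFiniteMeasure_withDensity_ofReal hk.int.2

/-- the `L^p` average of a modulus -/
def avg (k : EV m → ℝ) (p : ℝ≥0∞) (W : ℝ → ℝ≥0∞) : ℝ≥0∞ :=
  (muK k Set.univ ^ (p.toReal - 1) * ∫⁻ z, W ‖z‖ ^ p.toReal ∂(muK k)) ^ (1 / p.toReal)

lemma mink_bound {k : EV m → ℝ} (hk : Ker k) {p : ℝ≥0∞} (hp1 : 1 ≤ p) (hp : p ≠ ⊤)
    {g : EV m → EV m → ℝ≥0∞} (hg : Measurable (Function.uncurry g)) {W : ℝ → ℝ≥0∞} {c : ℝ≥0∞} (hc : c ≠ ⊤)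
    (A : Set (EV m)) (h : ∀ z, eLpNorm (fun x => g x z) p (volume.restrict A) ≤ c * W ‖z‖) :
    eLpNorm (fun x => ∫⁻ z, g x z ∂(muK k)) p (volume.restrict A) ≤ c * avg k p W := by
  haveI := hk.finite
  have hr := toReal_one_le hp1 hp
  have hr0 : 0 < p.toReal := by linarith
  have h1 := eLpNorm_lintegral_rpow_le (volume.restrict A) (muK k) hp1 hp g hg
  rw [← ENNReal.rpow_le_rpow_iff hr0]
  refine h1.trans ?_
  rw [avg, ENNReal.mul_rpow_of_nonneg _ _ hr0.le, ← ENNReal.rpow_mul, one_div_mul_cancel hr0.ne', ENNReal.rpow_one,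
    mul_left_comm, ← lintegral_const_mul' _ _ (ENNReal.rpow_ne_top_of_nonneg hr0.le hc)]
  gcongr with z
  rw [← ENNReal.mul_rpow_of_nonneg _ _ hr0.le]
  exact ENNReal.rpow_le_rpow (h z) hr0.le

def X1 (τ : EV m → ℝ) (K : ℝ) (e : EV m) (k : EV m → ℝ) (f : EV m → ℝ) (x : EV m) : ℝ≥0∞ :=
  ∫⁻ z, (∫⁻ r in Set.Ioc (0:ℝ) 1, {q : EV m × EV m | q.1 - q.2 ∈ Om τ}.indicator
    (fun q => ‖f (q.1 + pa K e q.2 r) - f q.1‖ₑ) (x, z)) ∂(muK k)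

def X2 (τ : EV m → ℝ) (K : ℝ) (k : EV m → ℝ) (f : EV m → ℝ) (x : EV m) : ℝ≥0∞ :=
  ∫⁻ z, {q : EV m × EV m | τ q.1 ≤ K * ‖q.2‖}.indicator (fun q => ‖f q.1‖ₑ) (x, z) ∂(muK k)

def X3 (τ : EV m → ℝ) (K : ℝ) (k : EV m → ℝ) (f : EV m → ℝ) (x : EV m) : ℝ≥0∞ :=
  ∫⁻ z, {q : EV m × EV m | τ q.1 ≤ K * ‖q.2‖}.indicator
    (fun q => ENNReal.ofReal ‖q.2‖⁻¹ * ‖f q.1‖ₑ) (x, z) ∂(muK k)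

/-- total modulus of the second derivatives -/
def Wm (τ : EV m → ℝ) (K : ℝ) (p : ℝ≥0∞) (D : List (Fin m) → EV m → ℝ) (t : ℝ) : ℝ≥0∞ :=
  ∑ i, ∑ j, mdl τ K p (D [i, j]) t

lemma mdl_le_Wm (τ : EV m → ℝ) (K : ℝ) (p : ℝ≥0∞) (D : List (Fin m) → EV m → ℝ) (t : ℝ) (i j : Fin m) :
    mdl τ K p (D [i, j]) t ≤ Wm τ K p D t :=
  (Finset.single_le_sum (f := fun j => mdl τ K p (D [i, j]) t) (fun _ _ => zero_le) (Finset.mem_univ j)).trans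
    (Finset.single_le_sum (f := fun i => ∑ j, mdl τ K p (D [i, j]) t) (fun _ _ => zero_le) (Finset.mem_univ i))

namespace Geo
variable {e : EV m} {τ : EV m → ℝ} {K : ℝ}

lemma X1_meas_aux (G : Geo e τ K) {f : EV m → ℝ} (hf : Measurable f) :
    Measurable fun q : EV m × EV m => (∫⁻ r in Set.Ioc (0:ℝ) 1, {q : EV m × EV m | q.1 - q.2 ∈ Om τ}.indicator
    (fun q => ‖f (q.1 + pa K e q.2 r) - f q.1‖ₑ) q) := by
  refine Measurable.lintegral_prod_right' (f := fun w : (EV m × EV m) × ℝ =>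
    {q : EV m × EV m | q.1 - q.2 ∈ Om τ}.indicator (fun q => ‖f (q.1 + pa K e q.2 w.2) - f q.1‖ₑ) w.1) ?_
  have h1 : Measurable fun w : (EV m × EV m) × ℝ => ‖f (w.1.1 + pa K e w.1.2 w.2) - f w.1.1‖ₑ := by
    have h2 : Measurable fun w : (EV m × EV m) × ℝ => w.1.1 + pa K e w.1.2 w.2 := by
      unfold pa
      fun_prop
    exact ((hf.comp h2).sub (hf.comp (by fun_prop))).enorm
  have hS : MeasurableSet {w : (EV m × EV m) × ℝ | w.1.1 - w.1.2 ∈ Om τ} :=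
    (by fun_prop : Measurable fun w : (EV m × EV m) × ℝ => w.1.1 - w.1.2) G.measOm
  exact h1.indicator hS

lemma X1_bound (G : Geo e τ K) {k : EV m → ℝ} (hk : Ker k) {p : ℝ≥0∞} (hp1 : 1 ≤ p) (hp : p ≠ ⊤)
    {D : List (Fin m) → EV m → ℝ} {i j : Fin m} (hD : Measurable (D [i, j])) :
    eLpNorm (X1 τ K e k (D [i, j])) p (volume.restrict (Om τ)) ≤ avg k p (Wm τ K p D) := by
  have hm := G.X1_meas_aux hD
  rw [← one_mul (avg _ _ _)]
  refine mink_bound hk hp1 hp (W := Wm τ K p D) (g := fun x z => ∫⁻ r in Set.Ioc (0:ℝ) 1, {q : EV m × EV m | q.1 - q.2 ∈ Om τ}.indicator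
    (fun q => ‖D [i, j] (q.1 + pa K e q.2 r) - D [i, j] q.1‖ₑ) (x, z)) hm (by simp) _ fun z => ?_
  have hS : MeasurableSet {x : EV m | x - z ∈ Om τ} := (measurable_id.sub_const z) G.measOm
  have key := eLpNorm_lintegral_le (volume.restrict (Om τ)) (volume.restrict (Set.Ioc (0:ℝ) 1)) hp1 hp
    (fun x r => {q : EV m × EV m | q.1 - q.2 ∈ Om τ}.indicator
    (fun q => ‖D [i, j] (q.1 + pa K e q.2 r) - D [i, j] q.1‖ₑ) (x, z)) ?_ (Wm τ K p D ‖z‖) ?_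
  · simpa using key
  · have h1 : Measurable fun w : EV m × ℝ => ‖D [i, j] (w.1 + pa K e z w.2) - D [i, j] w.1‖ₑ := by
      have h2 : Measurable fun w : EV m × ℝ => w.1 + pa K e z w.2 := by
        unfold pa
        fun_prop
      exact ((hD.comp h2).sub (hD.comp (by fun_prop))).enorm
    have hS : MeasurableSet {w : EV m × ℝ | w.1 - z ∈ Om τ} :=
      (by fun_prop : Measurable fun w : EV m × ℝ => w.1 - z) G.measOm
    exact h1.indicator hS
  · filter_upwards [ae_restrict_mem measurableSet_Ioc] with r hr
    have hr' : r ∈ Set.Icc (0:ℝ) 1 := ⟨hr.1.le, hr.2⟩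
    have h3 : eLpNorm (fun x => {q : EV m × EV m | q.1 - q.2 ∈ Om τ}.indicator
      (fun q => ‖D [i, j] (q.1 + pa K e q.2 r) - D [i, j] q.1‖ₑ) (x, z)) p (volume.restrict (Om τ)) ≤
      eLpNorm (fun x => D [i, j] (x + pa K e z r) - D [i, j] x) p (volume.restrict (OmT τ (pa K e z r))) := by
      have e1 : (fun x => {q : EV m × EV m | q.1 - q.2 ∈ Om τ}.indicator
        (fun q => ‖D [i, j] (q.1 + pa K e q.2 r) - D [i, j] q.1‖ₑ) (x, z)) =
        {x : EV m | x - z ∈ Om τ}.indicator (fun x => ‖D [i, j] (x + pa K e z r) - D [i, j] x‖ₑ) := rfl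
      rw [e1, eLpNorm_indicator_eq_eLpNorm_restrict hS, eLpNorm_enorm, Measure.restrict_restrict hS]
      exact eLpNorm_mono_measure _ (Measure.restrict_mono_set _ fun x hx => ⟨hx.2, G.pa_mem hx.2 hx.1 hr'⟩)
    refine h3.trans ((shift_le_mdl p _ (t := ‖z‖) ?_).trans (mdl_le_Wm _ _ _ _ _ _ _))
    exact pa_norm G.Kpos.le G.e1 z hr'

lemma layer_ind (G : Geo e τ K) (p : ℝ≥0∞) (f : EV m → ℝ) (z : EV m) :
    eLpNorm (fun x => {q : EV m × EV m | τ q.1 ≤ K * ‖q.2‖}.indicator (fun q => ‖f q.1‖ₑ) (x, z)) p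
      (volume.restrict (Om τ)) = eLpNorm f p (volume.restrict (Sl τ (K * ‖z‖))) := by
  have hS : MeasurableSet {x : EV m | τ x ≤ K * ‖z‖} := measurableSet_le G.cont.measurable measurable_const
  have e1 : (fun x => {q : EV m × EV m | τ q.1 ≤ K * ‖q.2‖}.indicator (fun q => ‖f q.1‖ₑ) (x, z)) =
    {x : EV m | τ x ≤ K * ‖z‖}.indicator (fun x => ‖f x‖ₑ) := rfl
  rw [e1, eLpNorm_indicator_eq_eLpNorm_restrict hS, eLpNorm_enorm, Measure.restrict_restrict hS]
  congr 2
  ext x; exact and_comm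

lemma measS (G : Geo e τ K) : MeasurableSet {q : EV m × EV m | τ q.1 ≤ K * ‖q.2‖} :=
  measurableSet_le (G.cont.measurable.comp measurable_fst) (by fun_prop)

lemma X2_bound (G : Geo e τ K) {k : EV m → ℝ} (hk : Ker k) {p : ℝ≥0∞} (hp1 : 1 ≤ p) (hp : p ≠ ⊤)
    {D : List (Fin m) → EV m → ℝ} {i j : Fin m} (hD : Measurable (D [i, j])) :
    eLpNorm (X2 τ K k (D [i, j])) p (volume.restrict (Om τ)) ≤ avg k p (Wm τ K p D) := by
  rw [← one_mul (avg _ _ _)]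
  refine mink_bound hk hp1 hp (W := Wm τ K p D) (g := fun x z => {q : EV m × EV m | τ q.1 ≤ K * ‖q.2‖}.indicator
    (fun q => ‖D [i, j] q.1‖ₑ) (x, z)) ?_ (by simp) _ fun z => ?_
  · exact (by fun_prop : Measurable fun q : EV m × EV m => ‖D [i, j] q.1‖ₑ).indicator G.measS
  · rw [G.layer_ind, one_mul]
    exact (layer_le_mdl _ _ _).trans (mdl_le_Wm _ _ _ _ _ _ _)

lemma nGradE_le (G : Geo e τ K) {p : ℝ≥0∞} (hp1 : 1 ≤ p)
    {D : List (Fin m) → EV m → ℝ} (hD : ∀ i j, Measurable (D [i, j])) (t : ℝ) :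
    eLpNorm (nGradE τ e D) p (volume.restrict (Sl τ (K * t))) ≤ ENNReal.ofReal K * Wm τ K p D t := by
  have hN : ∀ (i : Fin m) x, ‖fderiv ℝ τ x (EuclideanSpace.single i 1)‖ ≤ K := fun i x => by
    refine ((fderiv ℝ τ x).le_opNorm _).trans ?_
    rw [EuclideanSpace.norm_single, norm_one, mul_one]
    exact G.fderiv_bd x
  have hNc : ∀ i : Fin m, Continuous fun x => fderiv ℝ τ x (EuclideanSpace.single i 1) :=
    fun i => (G.contDiff_N (EuclideanSpace.single i 1)).continuous
  have e1 : nGradE τ e D = ∑ i, ∑ j, fun x => fderiv ℝ τ x (EuclideanSpace.single i 1) * (e j * D [j, i] x) := by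
    funext x
    simp [nGradE, dirD, Finset.mul_sum]
  have hm : ∀ i j, Measurable fun x => fderiv ℝ τ x (EuclideanSpace.single i 1) * (e j * D [j, i] x) :=
    fun i j => (hNc i).measurable.mul ((hD j i).const_mul _)
  have ht : ∀ i j, eLpNorm (fun x => fderiv ℝ τ x (EuclideanSpace.single i 1) * (e j * D [j, i] x)) p
      (volume.restrict (Sl τ (K * t))) ≤ ENNReal.ofReal K * mdl τ K p (D [j, i]) t := by
    intro i j
    refine le_trans ?_ (mul_le_mul_right (layer_le_mdl (τ := τ) (K := K) p _ t) _)
    refine (eLpNorm_le_mul_eLpNorm_of_ae_le_mul (c := K) (g := D [j, i]) ?_ p)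
    refine Eventually.of_forall fun x => ?_
    rw [norm_mul, norm_mul]
    have h1 : ‖e j‖ ≤ 1 := by rw [← G.e1]; exact PiLp.norm_apply_le e j
    have h2 : ‖e j‖ * ‖D [j, i] x‖ ≤ 1 * ‖D [j, i] x‖ := mul_le_mul_of_nonneg_right h1 (norm_nonneg _)
    rw [one_mul] at h2
    exact mul_le_mul (hN i x) h2 (by positivity) G.Kpos.le
  have hi : ∀ i, eLpNorm (∑ j, fun x => fderiv ℝ τ x (EuclideanSpace.single i 1) * (e j * D [j, i] x)) p
      (volume.restrict (Sl τ (K * t))) ≤ ∑ j, ENNReal.ofReal K * mdl τ K p (D [j, i]) t := fun i =>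
    (eLpNorm_sum_le (fun j _ => (hm i j).aestronglyMeasurable) hp1).trans (Finset.sum_le_sum fun j _ => ht i j)
  rw [e1]
  refine (eLpNorm_sum_le (fun i _ => ?_) hp1).trans ((Finset.sum_le_sum fun i _ => hi i).trans (le_of_eq ?_))
  · exact Finset.aestronglyMeasurable_sum _ fun j _ => (hm i j).aestronglyMeasurable
  · rw [Wm, Finset.sum_comm, Finset.mul_sum]
    refine Finset.sum_congr rfl fun i _ => ?_
    rw [Finset.mul_sum]

lemma X3_bound (G : Geo e τ K) {k : EV m → ℝ} (hk : Ker k) {p : ℝ≥0∞} (hp1 : 1 ≤ p) (hp : p ≠ ⊤)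
    {D : List (Fin m) → EV m → ℝ} (hD : ∀ i j, Measurable (D [i, j])) (hN : Measurable (nGrad τ D))
    (hP : ∀ h : ℝ, 0 ≤ h → eLpNorm (nGrad τ D) p (volume.restrict (Sl τ h))
      ≤ ENNReal.ofReal h * eLpNorm (nGradE τ e D) p (volume.restrict (Sl τ h))) :
    eLpNorm (X3 τ K k (nGrad τ D)) p (volume.restrict (Om τ)) ≤ ENNReal.ofReal (K * K) * avg k p (Wm τ K p D) := by
  have hK := G.Kpos
  refine mink_bound hk hp1 hp (W := Wm τ K p D) (g := fun x z => {q : EV m × EV m | τ q.1 ≤ K * ‖q.2‖}.indicator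
    (fun q => ENNReal.ofReal ‖q.2‖⁻¹ * ‖nGrad τ D q.1‖ₑ) (x, z)) ?_ (by simp) _ fun z => ?_
  · exact (by fun_prop : Measurable fun q : EV m × EV m => ENNReal.ofReal ‖q.2‖⁻¹ * ‖nGrad τ D q.1‖ₑ).indicator G.measS
  · have e1 : (fun x => {q : EV m × EV m | τ q.1 ≤ K * ‖q.2‖}.indicator
      (fun q => ENNReal.ofReal ‖q.2‖⁻¹ * ‖nGrad τ D q.1‖ₑ) (x, z)) = fun x =>
      {q : EV m × EV m | τ q.1 ≤ K * ‖q.2‖}.indicator (fun q => ‖(‖z‖⁻¹ • nGrad τ D) q.1‖ₑ) (x, z) := by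
      funext x
      by_cases hx : τ x ≤ K * ‖z‖
      · rw [Set.indicator_of_mem (by exact hx), Set.indicator_of_mem (by exact hx), Pi.smul_apply, smul_eq_mul, enorm_mul,
          ← ofReal_norm (‖z‖⁻¹), Real.norm_of_nonneg (by positivity)]
      · rw [Set.indicator_of_notMem (by exact hx), Set.indicator_of_notMem (by exact hx)]
    rw [e1, G.layer_ind, eLpNorm_const_smul, ← ofReal_norm (‖z‖⁻¹), Real.norm_of_nonneg (by positivity)]
    refine (mul_le_mul_right (hP _ (by positivity)) _).trans ?_
    rw [← mul_assoc, ← ENNReal.ofReal_mul (by positivity)]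
    refine (mul_le_mul_right (G.nGradE_le hp1 hD _) _).trans ?_
    rw [← mul_assoc, ← ENNReal.ofReal_mul (by positivity)]
    gcongr
    rw [show ‖z‖⁻¹ * (K * ‖z‖) = K * (‖z‖⁻¹ * ‖z‖) by ring]
    have : ‖z‖⁻¹ * ‖z‖ ≤ 1 := inv_mul_le_one
    nlinarith

end Geo

end PartThirteen

section PartFourteen

variable {m : ℕ}

def Ax (τ : EV m → ℝ) (x : EV m) : Set (EV m) := {z | x - z ∈ Om τ}

/-- explicit formula for the principal value -/
def Lval (τ : EV m → ℝ) (k : EV m → ℝ) (U : EV m → ℝ) (x : EV m) : ℝ :=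
  (∫ z in Ax τ x, kernelJ k z * (U x - U (x - z) - fderiv ℝ U x z))
    - ∫ z in (Ax τ x)ᶜ, kernelJ k z * fderiv ℝ U x z

lemma Ker.measJ {k : EV m → ℝ} (hk : Ker k) : Measurable (kernelJ k) := by
  unfold kernelJ
  exact hk.meas.div (by fun_prop)

lemma Ker.J_nonneg {k : EV m → ℝ} (hk : Ker k) (z : EV m) : 0 ≤ kernelJ k z :=
  div_nonneg (hk.nonneg z) (by positivity)

lemma Ker.J_even {k : EV m → ℝ} (hk : Ker k) : ∀ᵐ z : EV m, kernelJ k (-z) = kernelJ k z := by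
  filter_upwards [hk.even] with z hz
  simp [kernelJ, hz]

lemma Ker.J_sq {k : EV m → ℝ} (hk : Ker k) (z : EV m) : kernelJ k z * ‖z‖ ^ 2 ≤ k z := by
  rw [kernelJ]
  rcases eq_or_ne (‖z‖ ^ 2) 0 with h | h
  · rw [h]; simpa using hk.nonneg z
  · rw [div_mul_cancel₀ _ h]

lemma Ker.J_one {k : EV m → ℝ} (_hk : Ker k) (z : EV m) : kernelJ k z * ‖z‖ = k z * ‖z‖⁻¹ := by
  rw [kernelJ]
  rcases eq_or_ne ‖z‖ 0 with h | h
  · rw [h]; simp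
  · field_simp

lemma integrable_of_J2 {k : EV m → ℝ} (hk : Ker k) {f : EV m → ℝ} (hf : Measurable f) {C : ℝ} (hC : 0 ≤ C)
    (h : ∀ z, |f z| ≤ C * ‖z‖ ^ 2) : Integrable fun z => kernelJ k z * f z := by
  refine (hk.int.const_mul C).mono' (hk.measJ.mul hf).aestronglyMeasurable (Eventually.of_forall fun z => ?_)
  rw [norm_mul, Real.norm_of_nonneg (hk.J_nonneg z), Real.norm_eq_abs]
  calc kernelJ k z * |f z| ≤ kernelJ k z * (C * ‖z‖ ^ 2) := mul_le_mul_of_nonneg_left (h z) (hk.J_nonneg z)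
    _ = C * (kernelJ k z * ‖z‖ ^ 2) := by ring
    _ ≤ C * k z := mul_le_mul_of_nonneg_left (hk.J_sq z) hC

/-- away from the origin linear functions are integrable against the kernel -/
lemma integrable_of_J1 {k : EV m → ℝ} (hk : Ker k) (T : EV m →L[ℝ] ℝ) {S : Set (EV m)} (hS : MeasurableSet S)
    {r : ℝ} (hr : 0 < r) (h : ∀ z ∈ S, r ≤ ‖z‖) : IntegrableOn (fun z => kernelJ k z * T z) S := by
  refine ((hk.int.const_mul (‖T‖ * r⁻¹)).integrableOn (s := S)).mono'
    ((hk.measJ.mul T.continuous.measurable).aestronglyMeasurable) ?_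
  filter_upwards [ae_restrict_mem hS] with z hz
  rw [norm_mul, Real.norm_of_nonneg (hk.J_nonneg z)]
  have hz' := h z hz
  calc kernelJ k z * ‖T z‖ ≤ kernelJ k z * (‖T‖ * ‖z‖) := mul_le_mul_of_nonneg_left (T.le_opNorm z) (hk.J_nonneg z)
    _ = ‖T‖ * (kernelJ k z * ‖z‖) := by ring
    _ = ‖T‖ * (k z * ‖z‖⁻¹) := by rw [hk.J_one]
    _ ≤ ‖T‖ * (k z * r⁻¹) := by
        have := hk.nonneg z
        gcongr
    _ = _ := by ring

lemma odd_integral {k : EV m → ℝ} (hk : Ker k) (T : EV m →L[ℝ] ℝ) (r : ℝ) :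
    ∫ z in {z : EV m | r ≤ ‖z‖}, kernelJ k z * T z = 0 := by
  have hS : MeasurableSet {z : EV m | r ≤ ‖z‖} := measurableSet_le measurable_const measurable_norm
  rw [← integral_indicator hS]
  set F := {z : EV m | r ≤ ‖z‖}.indicator fun z => kernelJ k z * T z with hF
  have h1 : ∫ z, F (-z) = ∫ z, F z := integral_neg_eq_self F volume
  have h2 : ∫ z, F (-z) = ∫ z, -F z := by
    refine integral_congr_ae ?_
    filter_upwards [hk.J_even] with z hz
    by_cases h : r ≤ ‖z‖
    · have h' : r ≤ ‖-z‖ := by rwa [norm_neg]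
      rw [hF, Set.indicator_of_mem (by exact h'), Set.indicator_of_mem (by exact h), hz]
      simp
    · have h' : ¬ r ≤ ‖-z‖ := by rwa [norm_neg]
      rw [hF, Set.indicator_of_notMem (by exact h'), Set.indicator_of_notMem (by exact h), neg_zero]
  rw [integral_neg] at h2
  linarith

lemma bdd_of_hcs {E F : Type*} [NormedAddCommGroup E] [NormedAddCommGroup F] (f : E → F) (hc : HasCompactSupport f) (h : Continuous f) :  ∃ C : ℝ, 0 ≤ C ∧ ∀ x, ‖f x‖ ≤ C := by
  obtain ⟨C, hC⟩ := hc.exists_bound_of_continuous h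
  exact ⟨max C 0, le_max_right _ _, fun x => (hC x).trans (le_max_left _ _)⟩
lemma snd_bounded_aux {E : Type*} [NormedAddCommGroup E] [NormedSpace ℝ E] {U : E → ℝ} (hU : ContDiff ℝ 2 U)
    (hc : HasCompactSupport U) : ∃ C : ℝ, 0 ≤ C ∧ ∀ x, ‖fderiv ℝ (fderiv ℝ U) x‖ ≤ C := by
  obtain ⟨C, h0, hC⟩ := bdd_of_hcs (iteratedFDeriv ℝ 2 U) (hc.iteratedFDeriv 2) (hU.continuous_iteratedFDeriv le_rfl)
  refine ⟨C, h0, fun x => ?_⟩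
  have h1 := norm_iteratedFDeriv_one (𝕜 := ℝ) (fderiv ℝ U) (x := x)
  have h2 := norm_iteratedFDeriv_fderiv (𝕜 := ℝ) (f := U) (n := 1) (x := x)
  rw [← h1, h2]; exact hC x

lemma snd_bounded {U : EV m → ℝ} (hU : ContDiff ℝ 2 U) (hc : HasCompactSupport U) :
    ∃ C : ℝ, 0 ≤ C ∧ ∀ x, ‖fderiv ℝ (fderiv ℝ U) x‖ ≤ C :=
  snd_bounded_aux hU hc

lemma taylor_one {U : EV m → ℝ} (hU : ContDiff ℝ 2 U) {C : ℝ} (hC0 : 0 ≤ C)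
    (hC : ∀ x, ‖fderiv ℝ (fderiv ℝ U) x‖ ≤ C) (x z : EV m) :
    |U x - U (x - z) - fderiv ℝ U x z| ≤ C * ‖z‖ ^ 2 := by
  have h1 : ContDiff ℝ 1 (fderiv ℝ U) := hU.fderiv_right (by norm_num)
  have lip : ∀ y, ‖fderiv ℝ U y - fderiv ℝ U x‖ ≤ C * ‖y - x‖ := fun y =>
    (convex_univ).norm_image_sub_le_of_norm_fderiv_le (𝕜 := ℝ)
      (fun y _ => (h1.differentiable (by simp)) y) (fun y _ => hC y) (Set.mem_univ x) (Set.mem_univ y)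
  have h2 := (convex_closedBall x ‖z‖).norm_image_sub_le_of_norm_fderiv_le' (𝕜 := ℝ) (f := U) (φ := fderiv ℝ U x)
    (C := C * ‖z‖) (x := x) (y := x - z)
    (fun y _ => (hU.differentiable (by simp)) y) (fun y hy => (lip y).trans ?_) (by simp) (by simp)
  · have e1 : U (x - z) - U x - fderiv ℝ U x (x - z - x) = -(U x - U (x - z) - fderiv ℝ U x z) := by
      rw [show x - z - x = -z by abel, map_neg]; ring
    rw [e1, norm_neg, Real.norm_eq_abs, show ‖x - z - x‖ = ‖z‖ by rw [show x - z - x = -z by abel, norm_neg]] at h2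
    rw [sq, ← mul_assoc]; exact h2
  · refine mul_le_mul_of_nonneg_left ?_ hC0
    rw [← dist_eq_norm]; exact hy

namespace Geo
variable {e : EV m} {τ : EV m → ℝ} {K : ℝ}

lemma measAx (G : Geo e τ K) (x : EV m) : MeasurableSet (Ax τ x) :=
  (measurable_id.const_sub x) G.measOm

lemma Axc_far (G : Geo e τ K) {x z : EV m} (hz : z ∈ (Ax τ x)ᶜ) : τ x ≤ K * ‖z‖ := by
  have h1 : ¬ (0 < τ (x - z)) := hz
  have h2 := (abs_le.1 (G.lip x (x - z))).2
  rw [show x - (x - z) = z by abel] at h2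
  linarith

theorem pv (G : Geo e τ K) {k : EV m → ℝ} (hk : Ker k) {U : EV m → ℝ} (hU : ContDiff ℝ 2 U)
    (hc : HasCompactSupport U) {x : EV m} (hx : x ∈ Om τ) :
    Tendsto (fun r : ℝ => ∫ y in Om τ ∩ {y : EV m | r ≤ dist x y}, kernelJ k (x - y) * (U x - U y))
      (𝓝[>] 0) (𝓝 (Lval τ k U x)) := by
  obtain ⟨C, hC0, hC⟩ := snd_bounded hU hc
  have hK := G.Kpos
  have hx' : 0 < τ x := hx
  have hUm : Measurable U := hU.continuous.measurable
  set g : EV m → ℝ := fun z => kernelJ k z * (U x - U (x - z) - fderiv ℝ U x z) with hg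
  have hgm : Measurable fun z => U x - U (x - z) - fderiv ℝ U x z :=
    (by fun_prop : Measurable fun z => U x - U (x - z)).sub (fderiv ℝ U x).continuous.measurable
  have hgi : Integrable g := integrable_of_J2 hk hgm hC0 (taylor_one hU hC0 hC x)
  have mA := G.measAx x
  set T := fderiv ℝ U x with hT
  set B : ℝ → Set (EV m) := fun r => {z | r ≤ ‖z‖} with hB
  have mB : ∀ r, MeasurableSet (B r) := fun r => measurableSet_le measurable_const measurable_norm
  have r0 : 0 < τ x / K := div_pos hx' hK
  have far : ∀ z ∈ (Ax τ x)ᶜ, τ x / K ≤ ‖z‖ := fun z hz => by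
    rw [div_le_iff₀ hK, mul_comm]; exact G.Axc_far hz
  -- the formula for small `r`
  have form : ∀ r : ℝ, 0 < r → r ≤ τ x / K →
      ∫ y in Om τ ∩ {y : EV m | r ≤ dist x y}, kernelJ k (x - y) * (U x - U y)
      = (∫ z in Ax τ x, (B r).indicator g z) - ∫ z in (Ax τ x)ᶜ, kernelJ k z * T z := by
    intro r hr hr1
    have hS : MeasurableSet (Om τ ∩ {y : EV m | r ≤ dist x y}) :=
      G.measOm.inter (measurableSet_le measurable_const (by fun_prop))
    have s1 : ∫ y in Om τ ∩ {y : EV m | r ≤ dist x y}, kernelJ k (x - y) * (U x - U y)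
        = ∫ z in Ax τ x ∩ B r, kernelJ k z * (U x - U (x - z)) := by
      rw [← integral_indicator hS, ← integral_indicator (mA.inter (mB r)), ← integral_sub_left_eq_self _ volume x]
      refine integral_congr_ae (Eventually.of_forall fun z => ?_)
      have e1 : x - (x - z) = z := by abel
      by_cases h : z ∈ Ax τ x ∩ B r
      · have h' : x - z ∈ Om τ ∩ {y : EV m | r ≤ dist x y} := by
          refine ⟨h.1, ?_⟩
          show r ≤ dist x (x - z)
          rw [dist_eq_norm, e1]; exact h.2
        simp only [Set.indicator_of_mem h, Set.indicator_of_mem h', e1]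
      · have h' : ¬ (x - z ∈ Om τ ∩ {y : EV m | r ≤ dist x y}) := by
          rintro ⟨h1, h2⟩
          refine h ⟨h1, ?_⟩
          have : r ≤ dist x (x - z) := h2
          rw [dist_eq_norm, e1] at this; exact this
        simp only [Set.indicator_of_notMem h, Set.indicator_of_notMem h']
    have i1 : IntegrableOn (fun z => kernelJ k z * T z) (B r) := integrable_of_J1 hk T (mB r) hr fun z hz => hz
    have s2 := odd_integral hk T r
    have s3 : ∫ z in B r, kernelJ k z * T z = (∫ z in Ax τ x ∩ B r, kernelJ k z * T z) +
        ∫ z in (Ax τ x)ᶜ, kernelJ k z * T z := by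
      rw [← integral_inter_add_sdiff mA i1, Set.inter_comm]
      congr 2
      rw [Set.sdiff_eq, Set.inter_eq_right.2]
      exact fun z hz => hr1.trans (far z hz)
    have s4 : ∫ z in Ax τ x ∩ B r, kernelJ k z * (U x - U (x - z)) =
        (∫ z in Ax τ x ∩ B r, g z) + ∫ z in Ax τ x ∩ B r, kernelJ k z * T z := by
      rw [← integral_add hgi.integrableOn (i1.mono_set Set.inter_subset_right)]
      congr 1; funext z; simp only [hg]; ring
    have s5 : ∫ z in Ax τ x, (B r).indicator g z = ∫ z in Ax τ x ∩ B r, g z := setIntegral_indicator (mB r)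
    rw [s1, s4, s5]
    have s6 : ∫ z in B r, kernelJ k z * T z = 0 := s2
    linarith
  have lim : Tendsto (fun r : ℝ => ∫ z in Ax τ x, (B r).indicator g z) (𝓝[>] 0) (𝓝 (∫ z in Ax τ x, g z)) := by
    refine tendsto_integral_filter_of_dominated_convergence (fun z => ‖g z‖) ?_ ?_ hgi.norm.integrableOn ?_
    · exact Eventually.of_forall fun r => (hgi.1.indicator (mB r)).restrict
    · exact Eventually.of_forall fun r => Eventually.of_forall fun z => norm_indicator_le_norm_self _ _
    · refine Eventually.of_forall fun z => ?_
      rcases eq_or_ne z 0 with rfl | hz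
      · have : g 0 = 0 := by simp [hg, kernelJ]
        have h2 : ∀ r, (B r).indicator g 0 = 0 := fun r => by
          rw [Set.indicator_apply]; simp [this]
        simp only [h2, this]
        exact tendsto_const_nhds
      · have hz' : 0 < ‖z‖ := norm_pos_iff.2 hz
        refine tendsto_const_nhds.congr' ?_
        filter_upwards [Ioc_mem_nhdsGT hz'] with r hr
        rw [Set.indicator_of_mem (show z ∈ B r from hr.2)]
  have := lim.sub_const (∫ z in (Ax τ x)ᶜ, kernelJ k z * T z)
  refine this.congr' ?_
  filter_upwards [Ioc_mem_nhdsGT r0] with r hr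
  exact (form r hr.1 hr.2).symm

end Geo

end PartFourteen

section PartFifteen

variable {m : ℕ}

/-- the kernel has no tangential first moments on half spaces -/
def HalfSym (k : EV m → ℝ) : Prop := ∀ N h : EV m, N ≠ 0 → inner ℝ N h = 0 → ∀ t : ℝ, 0 < t →
  ∫ z in {z : EV m | t ≤ inner ℝ N z}, kernelJ k z * inner ℝ h z = 0

lemma enorm_integral_le_muK {k : EV m → ℝ} (hk : Ker k) {f : EV m → ℝ} {F : EV m → ℝ≥0∞} (hF : Measurable F)
    (h : ∀ z, ‖f z‖ₑ ≤ ENNReal.ofReal (k z) * F z) : ‖∫ z, f z‖ₑ ≤ ∫⁻ z, F z ∂(muK k) := by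
  refine (enorm_integral_le_lintegral_enorm f).trans ?_
  rw [muK, lintegral_withDensity_eq_lintegral_mul _ hk.meas.ennreal_ofReal hF]
  exact lintegral_mono h

/-- error set near the tangent half space -/
def Es (τ : EV m → ℝ) (e : EV m) (K : ℝ) : Set (EV m × EV m) :=
  {q | |τ q.1 - fderiv ℝ τ q.1 q.2| ≤ K * ‖q.2 - (inner ℝ e q.2 : ℝ) • e‖ ^ 2}

def Ef (τ : EV m → ℝ) (e : EV m) (K : ℝ) (k : EV m → ℝ) (x : EV m) : ℝ≥0∞ :=
  ∫⁻ z, (Es τ e K).indicator (fun q => ENNReal.ofReal ‖q.2‖⁻¹) (x, z) ∂(muK k)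

lemma momentum_quad {k : EV m → ℝ} (hk : Ker k) (hmom : momentum k = 1) (B : EV m →L[ℝ] EV m →L[ℝ] ℝ) :
    (1/2) * ∫ z, kernelJ k z * B z z = ∑ i, B (EuclideanSpace.single i 1) (EuclideanSpace.single i 1) := by
  have e1 : ∀ z : EV m, kernelJ k z * B z z = ∑ i, ∑ j, (kernelJ k z * (z i * z j)) *
      B (EuclideanSpace.single i 1) (EuclideanSpace.single j 1) := by
    intro z
    have h1 : B z z = ∑ i, z i * B (EuclideanSpace.single i 1) z := by
      have := clm_eq_sum (B.flip z) z
      simpa using this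
    rw [h1, Finset.mul_sum]
    refine Finset.sum_congr rfl fun i _ => ?_
    rw [clm_eq_sum (B (EuclideanSpace.single i 1)) z, Finset.mul_sum, Finset.mul_sum]
    refine Finset.sum_congr rfl fun j _ => ?_
    ring
  have hInt : ∀ i j : Fin m, Integrable fun z : EV m => kernelJ k z * (z i * z j) := by
    intro i j
    refine integrable_of_J2 hk (by fun_prop) zero_le_one fun z => ?_
    rw [abs_mul, one_mul, sq]
    exact mul_le_mul (PiLp.norm_apply_le z i) (PiLp.norm_apply_le z j) (abs_nonneg _) (norm_nonneg _)
  have hm : ∀ i j : Fin m, ∫ z : EV m, kernelJ k z * (z i * z j) = if i = j then 2 else 0 := by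
    intro i j
    have := congrFun (congrFun hmom i) j
    rw [momentum, Matrix.of_apply, Matrix.one_apply] at this
    simp only [mul_assoc] at this
    split_ifs at this ⊢ <;> linarith
  simp only [e1]
  rw [integral_finsetSum _ fun i _ => integrable_finsetSum _ fun j _ => (hInt i j).mul_const _, Finset.mul_sum]
  refine Finset.sum_congr rfl fun i _ => ?_
  rw [integral_finsetSum _ fun j _ => (hInt i j).mul_const _]
  simp only [integral_mul_const, hm]
  simp [Finset.sum_ite_eq]

namespace Geo
variable {e : EV m} {τ : EV m → ℝ} {K : ℝ}

lemma measEs (G : Geo e τ K) : MeasurableSet (Es τ e K) := by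
  have h1 : Continuous fun q : EV m × EV m => fderiv ℝ τ q.1 q.2 :=
    ((G.smooth.continuous_fderiv (by simp)).comp continuous_fst).clm_apply continuous_snd
  have h2 : Continuous fun q : EV m × EV m => τ q.1 := G.cont.comp continuous_fst
  refine measurableSet_le ((h2.sub h1).abs.measurable) ?_
  fun_prop

lemma Ef_meas_aux (G : Geo e τ K) :
    Measurable ((Es τ e K).indicator (fun q : EV m × EV m => ENNReal.ofReal ‖q.2‖⁻¹)) :=
  Measurable.indicator (by fun_prop) G.measEs

lemma snd_bd (G : Geo e τ K) (x : EV m) : ‖fderiv ℝ (fderiv ℝ τ) x‖ ≤ K := by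
  have h1 := norm_iteratedFDeriv_one (𝕜 := ℝ) (fderiv ℝ τ) (x := x)
  have h2 := norm_iteratedFDeriv_fderiv (𝕜 := ℝ) (f := τ) (n := 1) (x := x)
  rw [← h1, h2]; exact G.bd 2 (by norm_num) (by norm_num) x

lemma flat (G : Geo e τ K) (x z : EV m) :
    |τ (x - z) - (τ x - fderiv ℝ τ x z)| ≤ K * ‖z - (inner ℝ e z : ℝ) • e‖ ^ 2 := by
  set s : ℝ := inner ℝ e z
  have h := taylor_one (G.smooth.of_le (by norm_num)) G.Kpos.le G.snd_bd x (z - s • e)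
  have h1 : τ (x - z) = τ (x - (z - s • e)) - s := by
    have := G.shift (x - (z - s • e)) (-s)
    rw [show x - (z - s • e) + -s • e = x - z by rw [neg_smul]; abel] at this
    rw [this]; ring
  rw [map_sub, map_smul, G.fderiv_e, smul_eq_mul, mul_one] at h
  rw [h1, abs_sub_comm]
  convert h using 2
  ring

lemma bad_set (G : Geo e τ K) {x z : EV m} (h : ¬ (z ∈ (Ax τ x)ᶜ ↔ τ x ≤ fderiv ℝ τ x z)) : (x, z) ∈ Es τ e K := by
  have h1 := abs_le.1 (G.flat x z)
  show |τ x - fderiv ℝ τ x z| ≤ K * ‖z - (inner ℝ e z : ℝ) • e‖ ^ 2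
  have h2 : z ∈ (Ax τ x)ᶜ ↔ τ (x - z) ≤ 0 := by
    rw [Set.mem_compl_iff, Ax, Set.mem_setOf_eq, Om, Set.mem_setOf_eq, not_lt]
  rw [h2] at h
  rw [abs_le]
  by_cases h3 : τ (x - z) ≤ 0
  · have h4 : ¬ τ x ≤ fderiv ℝ τ x z := fun h5 => h ⟨fun _ => h5, fun _ => h3⟩
    push Not at h4
    constructor <;> linarith
  · have h4 : τ x ≤ fderiv ℝ τ x z := by
      by_contra h5
      exact h ⟨fun h6 => absurd h6 h3, fun h6 => absurd h6 h5⟩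
    push Not at h3
    constructor <;> linarith

end Geo

end PartFifteen

section PartSixteen

variable {m : ℕ}

namespace Geo
variable {e : EV m} {τ : EV m → ℝ} {K : ℝ}

lemma third (G : Geo e τ K) {k : EV m → ℝ} (hk : Ker k) (hs : HalfSym k) (U : EV m → ℝ) {x : EV m} (hx : x ∈ Om τ) :
    ‖∫ z in (Ax τ x)ᶜ, kernelJ k z * fderiv ℝ U x z‖ₑ ≤
      X3 τ K k (nGrad τ fun l => partialDList l U) x + ‖fderiv ℝ U x‖ₑ * Ef τ e K k x := by
  have hx' : 0 < τ x := hx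
  have hK := G.Kpos
  have mA := (G.measAx x).compl
  set N : EV m := (InnerProductSpace.toDual ℝ (EV m)).symm (fderiv ℝ τ x) with hN
  set g : EV m := (InnerProductSpace.toDual ℝ (EV m)).symm (fderiv ℝ U x) with hg
  have iN : ∀ z, inner ℝ N z = fderiv ℝ τ x z := fun z => InnerProductSpace.toDual_symm_apply
  have ig : ∀ z, inner ℝ g z = fderiv ℝ U x z := fun z => InnerProductSpace.toDual_symm_apply
  have nN : ‖N‖ ≤ K := by
    rw [hN, LinearIsometryEquiv.norm_map]; exact G.fderiv_bd x
  have ng : ‖g‖ = ‖fderiv ℝ U x‖ := by rw [hg, LinearIsometryEquiv.norm_map]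
  have N1 : 1 ≤ ‖N‖ := by
    have h1 := real_inner_le_norm N e
    rw [iN, G.fderiv_e, G.e1, mul_one] at h1
    exact h1
  have N0 : N ≠ 0 := by
    intro h; rw [h, norm_zero] at N1; linarith
  have hNg : inner ℝ N g = nGrad τ (fun l => partialDList l U) x := by
    rw [iN, clm_eq_sum, nGrad]
    refine Finset.sum_congr rfl fun i _ => ?_
    have : g i = partialDList [i] U x := by
      show g i = fderiv ℝ U x (EuclideanSpace.single i 1)
      rw [← ig, EuclideanSpace.inner_single_right]; simp
    rw [this, mul_comm]
  set nG := nGrad τ (fun l => partialDList l U) x with hnG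
  set c : ℝ := nG / ‖N‖ ^ 2 with hc
  set h : EV m := g - c • N with hh
  have hort : inner ℝ N h = 0 := by
    rw [hh, inner_sub_right, inner_smul_right, hNg, real_inner_self_eq_norm_sq, hc]
    field_simp; ring
  have hle : ‖h‖ ≤ ‖g‖ := by
    have e1 : g = c • N + h := by rw [hh]; abel
    have h1 : inner ℝ (c • N) h = 0 := by rw [inner_smul_left, hort]; simp
    have h2 := norm_add_sq_eq_norm_sq_add_norm_sq_of_inner_eq_zero _ _ h1
    rw [← e1] at h2
    nlinarith [norm_nonneg h, norm_nonneg g, norm_nonneg (c • N), mul_self_nonneg ‖c • N‖]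
  have far : ∀ z ∈ (Ax τ x)ᶜ, τ x / K ≤ ‖z‖ := fun z hz => by
    rw [div_le_iff₀ hK, mul_comm]; exact G.Axc_far hz
  have r0 : 0 < τ x / K := div_pos hx' hK
  set H : Set (EV m) := {z | τ x ≤ inner ℝ N z} with hH
  have mH : MeasurableSet H := measurableSet_le measurable_const (by fun_prop)
  have farH : ∀ z ∈ H, τ x / K ≤ ‖z‖ := fun z hz => by
    rw [div_le_iff₀ hK, mul_comm]
    have h1 : τ x ≤ inner ℝ N z := hz
    exact h1.trans ((real_inner_le_norm N z).trans (mul_le_mul_of_nonneg_right nN (norm_nonneg _)))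
  have i1 : IntegrableOn (fun z => kernelJ k z * inner ℝ N z) (Ax τ x)ᶜ :=
    integrable_of_J1 hk (innerSL ℝ N) mA r0 far
  have i2 : IntegrableOn (fun z => kernelJ k z * inner ℝ h z) (Ax τ x)ᶜ :=
    integrable_of_J1 hk (innerSL ℝ h) mA r0 far
  have i3 : IntegrableOn (fun z => kernelJ k z * inner ℝ h z) H :=
    integrable_of_J1 hk (innerSL ℝ h) mH r0 farH
  have s1 : ∫ z in (Ax τ x)ᶜ, kernelJ k z * fderiv ℝ U x z =
      (∫ z, (Ax τ x)ᶜ.indicator (fun z => c * (kernelJ k z * inner ℝ N z)) z) +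
      ∫ z, ((Ax τ x)ᶜ.indicator (fun z => kernelJ k z * inner ℝ h z) z - H.indicator (fun z => kernelJ k z * inner ℝ h z) z) := by
    rw [integral_sub (i2.integrable_indicator mA) (i3.integrable_indicator mH), integral_indicator mH,
      hs N h N0 hort _ hx', sub_zero, integral_indicator mA, integral_indicator mA, ← integral_add (i1.const_mul c) i2]
    congr 1; funext z
    rw [← ig, hh, inner_sub_left, inner_smul_left]
    simp; ring
  rw [s1]
  refine (enorm_add_le _ _).trans (add_le_add ?_ ?_)
  · have mS : MeasurableSet {q : EV m × EV m | τ q.1 ≤ K * ‖q.2‖} :=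
      measurableSet_le (G.cont.measurable.comp measurable_fst) (by fun_prop)
    refine enorm_integral_le_muK hk (F := fun z => {q : EV m × EV m | τ q.1 ≤ K * ‖q.2‖}.indicator
      (fun q => ENNReal.ofReal ‖q.2‖⁻¹ * ‖nGrad τ (fun l => partialDList l U) q.1‖ₑ) (x, z)) ?_ fun z => ?_
    · have mS' : MeasurableSet {z : EV m | τ x ≤ K * ‖z‖} := measurableSet_le measurable_const (by fun_prop)
      have : Measurable ({z : EV m | τ x ≤ K * ‖z‖}.indicator
        (fun z => ENNReal.ofReal ‖z‖⁻¹ * ‖nGrad τ (fun l => partialDList l U) x‖ₑ)) :=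
        Measurable.indicator (by fun_prop) mS'
      exact this
    · by_cases hz : z ∈ (Ax τ x)ᶜ
      · rw [Set.indicator_of_mem hz, Set.indicator_of_mem (by exact G.Axc_far hz)]
        have hb : |c * (kernelJ k z * inner ℝ N z)| ≤ k z * (‖z‖⁻¹ * |nG|) := by
          have h1 : |inner ℝ N z| ≤ ‖N‖ * ‖z‖ := abs_real_inner_le_norm N z
          have h2 : |c| * ‖N‖ ≤ |nG| := by
            rw [hc, abs_div, abs_of_nonneg (by positivity : (0:ℝ) ≤ ‖N‖ ^ 2), div_mul_eq_mul_div, div_le_iff₀ (by positivity)]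
            exact mul_le_mul_of_nonneg_left (by nlinarith) (abs_nonneg _)
          rw [abs_mul, abs_mul, abs_of_nonneg (hk.J_nonneg z)]
          calc |c| * (kernelJ k z * |inner ℝ N z|) ≤ |c| * (kernelJ k z * (‖N‖ * ‖z‖)) := by
                have := hk.J_nonneg z
                gcongr
            _ = (|c| * ‖N‖) * (kernelJ k z * ‖z‖) := by ring
            _ ≤ |nG| * (kernelJ k z * ‖z‖) := mul_le_mul_of_nonneg_right h2 (mul_nonneg (hk.J_nonneg z) (norm_nonneg _))
            _ = _ := by rw [hk.J_one]; ring
        have hb' := ENNReal.ofReal_le_ofReal hb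
        rw [ENNReal.ofReal_mul (hk.nonneg z), ENNReal.ofReal_mul (by positivity), ← Real.norm_eq_abs, ← Real.norm_eq_abs,
          ofReal_norm, ofReal_norm] at hb'
        exact hb'
      · rw [Set.indicator_of_notMem hz]; simp
  · have hm : Measurable fun z => (Es τ e K).indicator (fun q : EV m × EV m => ENNReal.ofReal ‖q.2‖⁻¹) (x, z) :=
      G.Ef_meas_aux.comp (by fun_prop)
    rw [Ef, ← lintegral_const_mul _ hm]
    refine enorm_integral_le_muK hk (hm.const_mul _) fun z => ?_
    have hb : |kernelJ k z * inner ℝ h z| ≤ k z * (‖fderiv ℝ U x‖ * ‖z‖⁻¹) := by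
      rw [abs_mul, abs_of_nonneg (hk.J_nonneg z)]
      calc kernelJ k z * |inner ℝ h z| ≤ kernelJ k z * (‖h‖ * ‖z‖) :=
            mul_le_mul_of_nonneg_left (abs_real_inner_le_norm h z) (hk.J_nonneg z)
        _ = ‖h‖ * (kernelJ k z * ‖z‖) := by ring
        _ ≤ ‖g‖ * (kernelJ k z * ‖z‖) := mul_le_mul_of_nonneg_right hle (mul_nonneg (hk.J_nonneg z) (norm_nonneg _))
        _ = _ := by rw [hk.J_one, ng]; ring
    have hb' := ENNReal.ofReal_le_ofReal hb
    rw [ENNReal.ofReal_mul (hk.nonneg z), ENNReal.ofReal_mul (norm_nonneg _), ← Real.norm_eq_abs,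
      ofReal_norm, ofReal_norm] at hb'
    have hHz : z ∈ H ↔ τ x ≤ fderiv ℝ τ x z := by rw [hH, Set.mem_setOf_eq, iN]
    by_cases hz : z ∈ (Ax τ x)ᶜ ↔ z ∈ H
    · have : (Ax τ x)ᶜ.indicator (fun z => kernelJ k z * inner ℝ h z) z - H.indicator (fun z => kernelJ k z * inner ℝ h z) z = 0 := by
        by_cases h3 : z ∈ H
        · rw [Set.indicator_of_mem h3, Set.indicator_of_mem (hz.2 h3), sub_self]
        · rw [Set.indicator_of_notMem h3, Set.indicator_of_notMem (fun h4 => h3 (hz.1 h4)), sub_self]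
      rw [this]; simp
    · have h3 : (x, z) ∈ Es τ e K := G.bad_set (by rwa [← hHz])
      rw [Set.indicator_of_mem h3]
      refine le_trans (le_of_eq ?_) hb'
      by_cases h4 : z ∈ H
      · have h5 : z ∉ (Ax τ x)ᶜ := fun h6 => hz ⟨fun _ => h4, fun _ => h6⟩
        rw [Set.indicator_of_mem h4, Set.indicator_of_notMem h5, zero_sub, enorm_neg]
      · have h5 : z ∈ (Ax τ x)ᶜ := by
          by_contra h6
          exact hz ⟨fun h7 => absurd h7 h6, fun h7 => absurd h7 h4⟩
        rw [Set.indicator_of_notMem h4, Set.indicator_of_mem h5, sub_zero]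

end Geo

end PartSixteen

section PartSeventeen

variable {m : ℕ}

namespace Geo
variable {e : EV m} {τ : EV m → ℝ} {K : ℝ}

lemma cont_D2 {U : EV m → ℝ} (hU : ContDiff ℝ 2 U) (i j : Fin m) : Continuous (partialDList [i, j] U) :=
  cont_partialDList hU (by simp)

lemma first (G : Geo e τ K) {k : EV m → ℝ} (hk : Ker k) {U : EV m → ℝ} (hU : ContDiff ℝ 2 U) (x : EV m) :
    ‖∫ z in Ax τ x, kernelJ k z * Rem U x z‖ₑ ≤
      ENNReal.ofReal ((1 + 2 * K) ^ 2) * ∑ i, ∑ j, X1 τ K e k (partialDList [i, j] U) x := by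
  have mA := G.measAx x
  have hm : ∀ i j, Measurable fun z => ∫⁻ r in Set.Ioc (0:ℝ) 1, {q : EV m × EV m | q.1 - q.2 ∈ Om τ}.indicator
    (fun q => ‖partialDList [i, j] U (q.1 + pa K e q.2 r) - partialDList [i, j] U q.1‖ₑ) (x, z) := fun i j =>
    (G.X1_meas_aux (cont_D2 hU i j).measurable).comp (by fun_prop : Measurable fun z : EV m => (x, z))
  have e1 : ENNReal.ofReal ((1 + 2 * K) ^ 2) * ∑ i, ∑ j, X1 τ K e k (partialDList [i, j] U) x =
      ∫⁻ z, ENNReal.ofReal ((1 + 2 * K) ^ 2) * (∑ i, ∑ j, ∫⁻ r in Set.Ioc (0:ℝ) 1,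
      {q : EV m × EV m | q.1 - q.2 ∈ Om τ}.indicator
      (fun q => ‖partialDList [i, j] U (q.1 + pa K e q.2 r) - partialDList [i, j] U q.1‖ₑ) (x, z)) ∂(muK k) := by
    rw [lintegral_const_mul _ (Finset.measurable_sum _ fun i _ => Finset.measurable_sum _ fun j _ => hm i j),
      lintegral_finsetSum _ fun i _ => Finset.measurable_sum _ fun j _ => hm i j]
    congr 1
    refine Finset.sum_congr rfl fun i _ => ?_
    rw [lintegral_finsetSum _ fun j _ => hm i j]
    rfl
  rw [e1, ← integral_indicator mA]
  refine enorm_integral_le_muK hk (Measurable.const_mul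
    (Finset.measurable_sum _ fun i _ => Finset.measurable_sum _ fun j _ => hm i j) _) fun z => ?_
  by_cases hz : z ∈ Ax τ x
  · rw [Set.indicator_of_mem hz]
    have hz' : (x, z) ∈ {q : EV m × EV m | q.1 - q.2 ∈ Om τ} := hz
    simp only [Set.indicator_of_mem hz']
    rw [enorm_mul]
    have hJ : ‖kernelJ k z‖ₑ * ENNReal.ofReal (((1 + 2 * K) * ‖z‖) ^ 2) ≤
        ENNReal.ofReal (k z) * ENNReal.ofReal ((1 + 2 * K) ^ 2) := by
      rw [← ofReal_norm, Real.norm_of_nonneg (hk.J_nonneg z), ← ENNReal.ofReal_mul (hk.J_nonneg z),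
        ← ENNReal.ofReal_mul (hk.nonneg z)]
      refine ENNReal.ofReal_le_ofReal ?_
      have := mul_le_mul_of_nonneg_right (hk.J_sq z) (sq_nonneg (1 + 2 * K))
      calc _ = kernelJ k z * ‖z‖ ^ 2 * (1 + 2 * K) ^ 2 := by ring
        _ ≤ _ := this
    refine (mul_le_mul_right (taylor_path G.Kpos.le G.e1 hU x z) _).trans ?_
    rw [← mul_assoc, ← mul_assoc]
    exact mul_le_mul' hJ le_rfl
  · rw [Set.indicator_of_notMem hz]; simp

lemma second (G : Geo e τ K) {k : EV m → ℝ} (hk : Ker k) {U : EV m → ℝ} (hU : ContDiff ℝ 2 U) (x : EV m) :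
    ‖(1/2) * ∫ z in (Ax τ x)ᶜ, kernelJ k z * fderiv ℝ (fderiv ℝ U) x z z‖ₑ ≤
      ∑ i, ∑ j, X2 τ K k (partialDList [i, j] U) x := by
  have mA := (G.measAx x).compl
  have hm : ∀ i j, Measurable fun z => {q : EV m × EV m | τ q.1 ≤ K * ‖q.2‖}.indicator
      (fun q => ‖partialDList [i, j] U q.1‖ₑ) (x, z) := fun i j => by
    have mS' : MeasurableSet {z : EV m | τ x ≤ K * ‖z‖} := measurableSet_le measurable_const (by fun_prop)
    have : Measurable ({z : EV m | τ x ≤ K * ‖z‖}.indicator fun _ => ‖partialDList [i, j] U x‖ₑ) :=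
      Measurable.indicator (by fun_prop) mS'
    exact this
  have e1 : ∑ i, ∑ j, X2 τ K k (partialDList [i, j] U) x =
      ∫⁻ z, ∑ i, ∑ j, {q : EV m × EV m | τ q.1 ≤ K * ‖q.2‖}.indicator
      (fun q => ‖partialDList [i, j] U q.1‖ₑ) (x, z) ∂(muK k) := by
    rw [lintegral_finsetSum _ fun i _ => Finset.measurable_sum _ fun j _ => hm i j]
    refine Finset.sum_congr rfl fun i _ => ?_
    rw [lintegral_finsetSum _ fun j _ => hm i j]
    rfl
  rw [enorm_mul]
  have h12 : ‖(1/2 : ℝ)‖ₑ ≤ 1 := by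
    rw [← ofReal_norm]; norm_num
  refine (mul_le_of_le_one_left' h12).trans ?_
  rw [e1, ← integral_indicator mA]
  refine enorm_integral_le_muK hk
    (Finset.measurable_sum _ fun i _ => Finset.measurable_sum _ fun j _ => hm i j) fun z => ?_
  by_cases hz : z ∈ (Ax τ x)ᶜ
  · rw [Set.indicator_of_mem hz]
    have hz' : (x, z) ∈ {q : EV m × EV m | τ q.1 ≤ K * ‖q.2‖} := G.Axc_far hz
    simp only [Set.indicator_of_mem hz', snd_partial hU]
    set B := fderiv ℝ (fderiv ℝ U) x with hB
    have b1 : ‖B z z‖ₑ ≤ ENNReal.ofReal (‖z‖ ^ 2) * ‖B‖ₑ := by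
      rw [← ofReal_norm, ← ofReal_norm, ← ENNReal.ofReal_mul (by positivity)]
      refine ENNReal.ofReal_le_ofReal ?_
      have := B.le_opNorm₂ z z
      calc _ ≤ ‖B‖ * ‖z‖ * ‖z‖ := this
        _ = _ := by ring
    have b2 : ‖B‖ₑ ≤ ∑ i, ∑ j, ‖B (EuclideanSpace.single i 1) (EuclideanSpace.single j 1)‖ₑ :=
      (enorm_clm_le B).trans (Finset.sum_le_sum fun i _ => enorm_clm_le _)
    have hJ : ‖kernelJ k z‖ₑ * ENNReal.ofReal (‖z‖ ^ 2) ≤ ENNReal.ofReal (k z) := by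
      rw [← ofReal_norm, Real.norm_of_nonneg (hk.J_nonneg z), ← ENNReal.ofReal_mul (hk.J_nonneg z)]
      exact ENNReal.ofReal_le_ofReal (hk.J_sq z)
    rw [enorm_mul]
    refine (mul_le_mul_right b1 _).trans ?_
    rw [← mul_assoc]
    exact mul_le_mul' hJ b2
  · rw [Set.indicator_of_notMem hz]; simp

theorem decomp (G : Geo e τ K) {k : EV m → ℝ} (hk : Ker k) (hmom : momentum k = 1) {U : EV m → ℝ}
    (hU : ContDiff ℝ 2 U) (hc : HasCompactSupport U) (x : EV m) :
    Lval τ k U x + ∑ i, partialDList [i, i] U x = -(∫ z in Ax τ x, kernelJ k z * Rem U x z) +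
      (1/2) * (∫ z in (Ax τ x)ᶜ, kernelJ k z * fderiv ℝ (fderiv ℝ U) x z z) -
      ∫ z in (Ax τ x)ᶜ, kernelJ k z * fderiv ℝ U x z := by
  obtain ⟨C, hC0, hC⟩ := snd_bounded hU hc
  have mA := G.measAx x
  have hgm : Measurable fun z => U x - U (x - z) - fderiv ℝ U x z := by
    have := hU.continuous.measurable
    exact (by fun_prop : Measurable fun z => U x - U (x - z)).sub (fderiv ℝ U x).continuous.measurable
  set B := fderiv ℝ (fderiv ℝ U) x with hB
  have hBm : Measurable fun z => B z z := (B.continuous.clm_apply continuous_id).measurable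
  have i1 : Integrable fun z => kernelJ k z * (U x - U (x - z) - fderiv ℝ U x z) :=
    integrable_of_J2 hk hgm hC0 (taylor_one hU hC0 hC x)
  have i2 : Integrable fun z => kernelJ k z * B z z := by
    refine integrable_of_J2 hk hBm hC0 fun z => ?_
    have := B.le_opNorm₂ z z
    rw [Real.norm_eq_abs] at this
    have h2 : ‖B‖ * ‖z‖ * ‖z‖ ≤ C * ‖z‖ * ‖z‖ := by
      have := hC x
      gcongr
    nlinarith
  have e1 : ∀ z, kernelJ k z * Rem U x z = -(kernelJ k z * (U x - U (x - z) - fderiv ℝ U x z)) - (1/2) * (kernelJ k z * B z z) := by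
    intro z; rw [Rem]; ring
  have e2 : ∫ z in Ax τ x, kernelJ k z * Rem U x z = -(∫ z in Ax τ x, kernelJ k z * (U x - U (x - z) - fderiv ℝ U x z))
      - (1/2) * ∫ z in Ax τ x, kernelJ k z * B z z := by
    simp only [e1]
    have i3 : IntegrableOn (fun z => -(kernelJ k z * (U x - U (x - z) - fderiv ℝ U x z))) (Ax τ x) := i1.integrableOn.neg
    rw [integral_sub i3 (i2.integrableOn.const_mul _), integral_neg, integral_const_mul]
  have e3 := integral_add_compl mA i2
  have e4 := momentum_quad hk hmom B
  simp only [snd_partial hU]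
  rw [← hB, ← e4, ← e3, e2, Lval]
  ring

theorem main_pointwise (G : Geo e τ K) {k : EV m → ℝ} (hk : Ker k) (hs : HalfSym k) (hmom : momentum k = 1) {U : EV m → ℝ}
    (hU : ContDiff ℝ 2 U) (hc : HasCompactSupport U) {x : EV m} (hx : x ∈ Om τ) :
    ‖Lval τ k U x + ∑ i, partialDList [i, i] U x‖ₑ ≤
      ENNReal.ofReal ((1 + 2 * K) ^ 2) * ∑ i, ∑ j, X1 τ K e k (partialDList [i, j] U) x +
      ∑ i, ∑ j, X2 τ K k (partialDList [i, j] U) x +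
      (X3 τ K k (nGrad τ fun l => partialDList l U) x + ∑ i, Ef τ e K k x * ‖partialD i U x‖ₑ) := by
  rw [G.decomp hk hmom hU hc x]
  refine (enorm_sub_le).trans (add_le_add ((enorm_add_le _ _).trans (add_le_add ?_ (G.second hk hU x))) ?_)
  · rw [enorm_neg]; exact G.first hk hU x
  · refine (G.third hk hs U hx).trans (add_le_add le_rfl ?_)
    rw [← Finset.mul_sum, mul_comm]
    exact mul_le_mul_right (enorm_clm_le _) _

end Geo

end PartSeventeen

section PartEighteen

variable {m n : ℕ}

lemma mulVecE_apply (Q : Matrix (Fin m) (Fin m) ℝ) (x : EV m) (i : Fin m) :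
    mulVecE Q x i = ∑ j, Q i j * x j := rfl

lemma norm_mulVecE {Q : Matrix (Fin m) (Fin m) ℝ} (hQ : Qᵀ * Q = 1) (x : EV m) : ‖mulVecE Q x‖ = ‖x‖ := by
  have h : inner ℝ (mulVecE Q x) (mulVecE Q x) = inner ℝ x x := by
    rw [EuclideanSpace.inner_eq_star_dotProduct, EuclideanSpace.inner_eq_star_dotProduct]
    simp only [star_trivial]
    show (Q *ᵥ x.ofLp) ⬝ᵥ (Q *ᵥ x.ofLp) = x.ofLp ⬝ᵥ x.ofLp
    rw [Matrix.dotProduct_mulVec, Matrix.vecMul_mulVec, ← Matrix.dotProduct_mulVec, hQ, Matrix.one_mulVec]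
  rw [real_inner_self_eq_norm_sq, real_inner_self_eq_norm_sq] at h
  exact (sq_eq_sq₀ (norm_nonneg _) (norm_nonneg _)).1 h

/-- orthogonal matrices as isometries -/
def rotI {Q : Matrix (Fin m) (Fin m) ℝ} (hQ : Qᵀ * Q = 1) : EV m ≃ₗᵢ[ℝ] EV m :=
  LinearIsometry.toLinearIsometryEquiv
    { toFun := mulVecE Q
      map_add' := fun x y => by
        ext i; simp [mulVecE_apply, mul_add, Finset.sum_add_distrib]
      map_smul' := fun c x => by
        ext i; simp [mulVecE_apply, Finset.mul_sum, mul_left_comm]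
      norm_map' := norm_mulVecE hQ } rfl

lemma rotI_apply {Q : Matrix (Fin m) (Fin m) ℝ} (hQ : Qᵀ * Q = 1) (x : EV m) : rotI hQ x = mulVecE Q x := rfl

lemma snocE_castSucc (w : EV n) (s : ℝ) (i : Fin n) : snocE w s i.castSucc = w i := by
  show Fin.snoc (α := fun _ => ℝ) w.ofLp s i.castSucc = w i
  rw [Fin.snoc_castSucc]

lemma snocE_last (w : EV n) (s : ℝ) : snocE w s (Fin.last n) = s := by
  show Fin.snoc (α := fun _ => ℝ) w.ofLp s (Fin.last n) = s
  rw [Fin.snoc_last]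

lemma inner_snocE (w v : EV n) (s t : ℝ) : inner ℝ (snocE w s) (snocE v t) = inner ℝ w v + s * t := by
  rw [PiLp.inner_apply, PiLp.inner_apply, Fin.sum_univ_castSucc]
  simp only [snocE_castSucc, snocE_last]
  simp [mul_comm]

lemma snocE_add (w v : EV n) (s t : ℝ) : snocE w s + snocE v t = snocE (w + v) (s + t) := by
  ext i
  refine Fin.lastCases ?_ (fun i => ?_) i
  · rw [PiLp.add_apply]; simp only [snocE_last]
  · rw [PiLp.add_apply]; simp only [snocE_castSucc, PiLp.add_apply]

lemma snocE_smul (c : ℝ) (w : EV n) (s : ℝ) : c • snocE w s = snocE (c • w) (c * s) := by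
  ext i
  refine Fin.lastCases ?_ (fun i => ?_) i
  · rw [PiLp.smul_apply]; simp only [snocE_last, smul_eq_mul]
  · rw [PiLp.smul_apply]; simp only [snocE_castSucc, PiLp.smul_apply]

lemma norm_snocE_zero (w : EV n) : ‖snocE w 0‖ = ‖w‖ := by
  have h := inner_snocE w w 0 0
  rw [real_inner_self_eq_norm_sq, real_inner_self_eq_norm_sq, mul_zero, add_zero] at h
  exact (sq_eq_sq₀ (norm_nonneg _) (norm_nonneg _)).1 h

lemma norm_le_snocE (w : EV n) (s : ℝ) : ‖w‖ ≤ ‖snocE w s‖ := by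
  have h := inner_snocE w w s s
  rw [real_inner_self_eq_norm_sq, real_inner_self_eq_norm_sq] at h
  refine (sq_le_sq₀ (norm_nonneg _) (norm_nonneg _)).1 ?_
  rw [h]; nlinarith [mul_self_nonneg s]

lemma snocE_mp : MeasurePreserving (fun q : EV n × ℝ => snocE q.1 q.2) (volume.prod volume) volume := by
  have h1 : MeasurePreserving (Prod.swap : EV n × ℝ → ℝ × EV n) (volume.prod volume) (volume.prod volume) :=
    Measure.measurePreserving_swap
  have h2 : MeasurePreserving (Prod.map id (WithLp.ofLp) : ℝ × EV n → ℝ × (Fin n → ℝ)) (volume.prod volume)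
      (volume.prod volume) := (MeasurePreserving.id volume).prod (PiLp.volume_preserving_ofLp (Fin n))
  have h3 := (volume_preserving_piFinSuccAbove (fun _ : Fin (n+1) => ℝ) (Fin.last n)).symm
  have h4 := PiLp.volume_preserving_toLp (Fin (n+1))
  have h5 := ((h4.comp h3).comp h2).comp h1
  have he : (fun q : EV n × ℝ => snocE q.1 q.2) = (((WithLp.toLp 2 ∘ (MeasurableEquiv.piFinSuccAbove (fun _ : Fin (n+1) => ℝ)
      (Fin.last n)).symm) ∘ (Prod.map id (WithLp.ofLp) : ℝ × EV n → ℝ × (Fin n → ℝ))) ∘ Prod.swap) := by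
    funext q
    ext i
    refine Fin.lastCases ?_ (fun i => ?_) i
    · rw [snocE_last]
      simp [MeasurableEquiv.piFinSuccAbove]
    · rw [snocE_castSucc]
      simp [MeasurableEquiv.piFinSuccAbove]
  rw [he]; exact h5

def rotS (Q : Matrix (Fin (n+1)) (Fin (n+1)) ℝ) (q : EV n × ℝ) : EV (n+1) := mulVecE Q (snocE q.1 q.2)

lemma rotS_mp {Q : Matrix (Fin (n+1)) (Fin (n+1)) ℝ} (hQ : Qᵀ * Q = 1) :
    MeasurePreserving (rotS Q) (volume.prod volume) volume :=
  (rotI hQ).measurePreserving.comp snocE_mp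

lemma rotS_inner {Q : Matrix (Fin (n+1)) (Fin (n+1)) ℝ} (hQ : Qᵀ * Q = 1) (q r : EV n × ℝ) :
    inner ℝ (rotS Q q) (rotS Q r) = inner ℝ q.1 r.1 + q.2 * r.2 := by
  rw [← inner_snocE]
  exact (rotI hQ).inner_map_map _ _

lemma rotS_add {Q : Matrix (Fin (n+1)) (Fin (n+1)) ℝ} (hQ : Qᵀ * Q = 1) (w v : EV n) (s t : ℝ) :
    rotS Q (w, s) + rotS Q (v, t) = rotS Q (w + v, s + t) := by
  have := (rotI hQ).map_add (snocE w s) (snocE v t)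
  rw [snocE_add] at this
  exact this.symm

lemma rotS_smul {Q : Matrix (Fin (n+1)) (Fin (n+1)) ℝ} (hQ : Qᵀ * Q = 1) (c : ℝ) (w : EV n) (s : ℝ) :
    c • rotS Q (w, s) = rotS Q (c • w, c * s) := by
  have := (rotI hQ).map_smul c (snocE w s)
  rw [snocE_smul] at this
  exact this.symm

lemma rotS_norm_zero {Q : Matrix (Fin (n+1)) (Fin (n+1)) ℝ} (hQ : Qᵀ * Q = 1) (w : EV n) : ‖rotS Q (w, 0)‖ = ‖w‖ :=
  (norm_mulVecE hQ _).trans (norm_snocE_zero w)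

lemma norm_le_rotS {Q : Matrix (Fin (n+1)) (Fin (n+1)) ℝ} (hQ : Qᵀ * Q = 1) (w : EV n) (s : ℝ) : ‖w‖ ≤ ‖rotS Q (w, s)‖ :=
  (norm_le_snocE w s).trans (norm_mulVecE hQ _).ge

lemma rotS_dec {Q : Matrix (Fin (n+1)) (Fin (n+1)) ℝ} (hQ : Qᵀ * Q = 1) (w : EV n) (s : ℝ) :
    rotS Q (w, s) - (inner ℝ (rotS Q (0, 1)) (rotS Q (w, s)) : ℝ) • rotS Q (0, 1) = rotS Q (w, 0) := by
  rw [rotS_inner hQ, rotS_smul hQ, sub_eq_iff_eq_add, rotS_add hQ]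
  simp

lemma rotS_snd {Q : Matrix (Fin (n+1)) (Fin (n+1)) ℝ} (hQ : Qᵀ * Q = 1) (w : EV n) (s : ℝ) :
    rotS Q (w, s) = rotS Q (w, 0) + s • rotS Q (0, 1) := by
  rw [rotS_smul hQ, rotS_add hQ]; simp

end PartEighteen

section PartNineteen

variable {m n : ℕ}

lemma lintegral_smul_inv {ε : ℝ} (hε : 0 < ε) {f : EV m → ℝ≥0∞} (hf : Measurable f) :
    ∫⁻ w, f (ε⁻¹ • w) = ENNReal.ofReal (ε ^ m) * ∫⁻ w, f w := by
  have h1 := Measure.map_addHaar_smul (volume : Measure (EV m)) (inv_ne_zero hε.ne')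
  have h2 : ∫⁻ w, f w ∂(Measure.map (ε⁻¹ • ·) (volume : Measure (EV m))) = ∫⁻ w, f (ε⁻¹ • w) :=
    lintegral_map hf (by fun_prop)
  rw [← h2, h1, lintegral_smul_measure, finrank_euclideanSpace, Fintype.card_fin, inv_pow, inv_inv,
    abs_of_pos (by positivity), smul_eq_mul]

lemma muK_scaled {ρ : EV m → ℝ} (hρ : Measurable ρ) {ε : ℝ} (hε : 0 < ε) {F : EV m → ℝ≥0∞} (hF : Measurable F) :
    ∫⁻ z, F z ∂(muK (scaled ρ ε)) = ∫⁻ z, F (ε • z) ∂(muK ρ) := by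
  have hs : Measurable (scaled ρ ε) := by
    unfold scaled
    exact (hρ.comp (measurable_const_smul _)).const_mul _
  have hF' : Measurable fun z : EV m => F (ε • z) := hF.comp (measurable_const_smul _)
  rw [muK, muK, lintegral_withDensity_eq_lintegral_mul _ hs.ennreal_ofReal hF,
    lintegral_withDensity_eq_lintegral_mul _ hρ.ennreal_ofReal hF']
  have h1 : Measurable fun z : EV m => ENNReal.ofReal (ρ z) * F (ε • z) :=
    hρ.ennreal_ofReal.mul (hF.comp (measurable_const_smul _))
  have h := lintegral_smul_inv hε (h1.const_mul (ENNReal.ofReal ((ε ^ m)⁻¹)))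
  rw [lintegral_const_mul _ h1, ← mul_assoc, ← ENNReal.ofReal_mul (by positivity), mul_inv_cancel₀ (by positivity),
    ENNReal.ofReal_one, one_mul] at h
  refine Eq.trans ?_ h
  refine lintegral_congr fun z => ?_
  simp only [Pi.mul_apply, scaled]
  rw [smul_smul, mul_inv_cancel₀ hε.ne', one_smul, ENNReal.ofReal_mul (by positivity), mul_assoc]

lemma volume_abs_le (a b : ℝ) : volume {s : ℝ | |a - s| ≤ b} = ENNReal.ofReal (2 * b) := by
  have : {s : ℝ | |a - s| ≤ b} = Set.Icc (a - b) (a + b) := by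
    ext s
    simp only [Set.mem_setOf_eq, Set.mem_Icc, abs_le]
    constructor <;> rintro ⟨h1, h2⟩ <;> constructor <;> linarith
  rw [this, Real.volume_Icc]; congr 1; ring

namespace Geo

lemma Ef_meas {e : EV m} {τ : EV m → ℝ} {K : ℝ} (G : Geo e τ K) {k : EV m → ℝ} (hk : Ker k) : Measurable (Ef τ e K k) := by
  haveI := hk.finite
  exact Measurable.lintegral_prod_right' (f := (Es τ e K).indicator (fun q : EV m × EV m => ENNReal.ofReal ‖q.2‖⁻¹))
    G.Ef_meas_aux

lemma Ef_line {e : EV m} {τ : EV m → ℝ} {K : ℝ} (G : Geo e τ K) {k : EV m → ℝ} (hk : Ker k) (x : EV m) :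
    ∫⁻ s : ℝ, Ef τ e K k (x + s • e) ≤ ENNReal.ofReal (2 * K) * ∫⁻ z, ENNReal.ofReal ‖z‖ ∂(muK k) := by
  haveI := hk.finite
  have hK := G.Kpos
  unfold Ef
  have hmm : Measurable (Function.uncurry fun (s : ℝ) (z : EV m) =>
      (Es τ e K).indicator (fun q : EV m × EV m => ENNReal.ofReal ‖q.2‖⁻¹) (x + s • e, z)) :=
    G.Ef_meas_aux.comp (by fun_prop : Measurable fun w : ℝ × EV m => (x + w.1 • e, w.2))
  rw [lintegral_lintegral_swap hmm.aemeasurable, ← lintegral_const_mul _ (by fun_prop)]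
  refine lintegral_mono fun z => ?_
  set w := z - (inner ℝ e z : ℝ) • e with hw
  have hwz : ‖w‖ ≤ ‖z‖ := by
    have h1 : inner ℝ ((inner ℝ e z : ℝ) • e) w = 0 := by
      rw [inner_smul_left, hw, inner_sub_right, inner_smul_right, real_inner_self_eq_norm_sq, G.e1]; simp
    have h2 := norm_add_sq_eq_norm_sq_add_norm_sq_of_inner_eq_zero _ _ h1
    rw [show (inner ℝ e z : ℝ) • e + w = z by rw [hw]; abel] at h2
    nlinarith [norm_nonneg w, norm_nonneg z, mul_self_nonneg ‖(inner ℝ e z : ℝ) • e‖]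
  set a : ℝ := fderiv ℝ τ x z - τ x with ha
  have e1 : ∀ s : ℝ, (Es τ e K).indicator (fun q : EV m × EV m => ENNReal.ofReal ‖q.2‖⁻¹) (x + s • e, z) =
      {s : ℝ | |a - s| ≤ K * ‖w‖ ^ 2}.indicator (fun _ => ENNReal.ofReal ‖z‖⁻¹) s := by
    intro s
    have : (x + s • e, z) ∈ Es τ e K ↔ |a - s| ≤ K * ‖w‖ ^ 2 := by
      rw [Es, Set.mem_setOf_eq, G.shift, G.fderiv_shift, abs_sub_comm]
      rw [show fderiv ℝ τ x z - (τ x + s) = a - s by rw [ha]; ring]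
    by_cases h : |a - s| ≤ K * ‖w‖ ^ 2
    · rw [Set.indicator_of_mem (this.2 h), Set.indicator_of_mem (by exact h)]
    · rw [Set.indicator_of_notMem (fun h' => h (this.1 h')), Set.indicator_of_notMem (by exact h)]
  simp only [e1]
  have mS : MeasurableSet {s : ℝ | |a - s| ≤ K * ‖w‖ ^ 2} := measurableSet_le (by fun_prop) measurable_const
  rw [lintegral_indicator_const mS, volume_abs_le, ← ENNReal.ofReal_mul (by positivity), ← ENNReal.ofReal_mul (by positivity)]
  refine ENNReal.ofReal_le_ofReal ?_
  rcases eq_or_ne z 0 with rfl | hz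
  · simp
  · have hz' : 0 < ‖z‖ := norm_pos_iff.2 hz
    rw [inv_mul_le_iff₀ hz']
    have : ‖w‖ ^ 2 ≤ ‖z‖ ^ 2 := by gcongr
    nlinarith

lemma Ef_bound {Q : Matrix (Fin (n+1)) (Fin (n+1)) ℝ} (hQ : Qᵀ * Q = 1) {τ : EV (n+1) → ℝ} {K : ℝ}
    (G : Geo (rotS Q (0, 1)) τ K) {k : EV (n+1) → ℝ} (hk : Ker k) {Ψ : EV n → ℝ≥0∞}
    (hΨ : ∀ (w : EV n) (s : ℝ), w ≠ 0 → ENNReal.ofReal (k (rotS Q (w, s))) * ENNReal.ofReal ‖rotS Q (w, s)‖⁻¹ ≤ Ψ w)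
    (x : EV (n+1)) :
    Ef τ (rotS Q (0, 1)) K k x ≤ ∫⁻ w, Ψ w * ENNReal.ofReal (2 * (K * ‖w‖ ^ 2)) := by
  have hm : Measurable fun z => (Es τ (rotS Q (0, 1)) K).indicator (fun q : EV (n+1) × EV (n+1) => ENNReal.ofReal ‖q.2‖⁻¹) (x, z) :=
    G.Ef_meas_aux.comp (by fun_prop)
  rw [Ef, muK, lintegral_withDensity_eq_lintegral_mul _ hk.meas.ennreal_ofReal hm]
  have hm2 := hk.meas.ennreal_ofReal.mul hm
  have hm3 : Measurable fun a => ((fun x => ENNReal.ofReal (k x)) * fun z =>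
    (Es τ (rotS Q (0, 1)) K).indicator (fun q : EV (n+1) × EV (n+1) => ENNReal.ofReal ‖q.2‖⁻¹) (x, z)) (rotS Q a) :=
    hm2.comp (rotS_mp hQ).measurable
  rw [← (rotS_mp hQ).lintegral_comp hm2, lintegral_prod _ hm3.aemeasurable]
  refine lintegral_mono fun w => ?_
  set a : ℝ := τ x - fderiv ℝ τ x (rotS Q (w, 0)) with ha
  have mS : MeasurableSet {s : ℝ | |a - s| ≤ K * ‖w‖ ^ 2} := measurableSet_le (by fun_prop) measurable_const
  have iff : ∀ s : ℝ, (x, rotS Q (w, s)) ∈ Es τ (rotS Q (0, 1)) K ↔ |a - s| ≤ K * ‖w‖ ^ 2 := by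
    intro s
    rw [Es, Set.mem_setOf_eq]
    simp only
    rw [rotS_dec hQ, rotS_norm_zero hQ, rotS_snd hQ w s, map_add, map_smul, G.fderiv_e, smul_eq_mul, mul_one,
      ← sub_sub, ← ha]
  have key : ∀ c : ℝ≥0∞, (∀ s, ENNReal.ofReal (k (rotS Q (w, s))) * ENNReal.ofReal ‖rotS Q (w, s)‖⁻¹ ≤ c) →
      ∫⁻ s, ((fun z => ENNReal.ofReal (k z)) * fun z => (Es τ (rotS Q (0, 1)) K).indicator
        (fun q : EV (n+1) × EV (n+1) => ENNReal.ofReal ‖q.2‖⁻¹) (x, z)) (rotS Q (w, s)) ≤ c * ENNReal.ofReal (2 * (K * ‖w‖ ^ 2)) := by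
    intro c hc
    rw [← volume_abs_le a, ← lintegral_indicator_const mS]
    refine lintegral_mono fun s => ?_
    simp only [Pi.mul_apply]
    by_cases h : |a - s| ≤ K * ‖w‖ ^ 2
    · rw [Set.indicator_of_mem ((iff s).2 h), Set.indicator_of_mem (by exact h)]
      exact hc s
    · rw [Set.indicator_of_notMem (fun h' => h ((iff s).1 h')), mul_zero]
      exact zero_le
  rcases eq_or_ne w 0 with hw | hw
  · refine (key ⊤ fun s => le_top).trans ?_
    rw [hw]; simp
  · exact key (Ψ w) fun s => hΨ w s hw

end Geo

end PartNineteen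

section PartTwenty

variable {m n : ℕ}

lemma exists_rot (hn : n ≠ 0) {u : EV (n+1)} (hu : ‖u‖ = 1) :
    ∃ R : Matrix (Fin (n+1)) (Fin (n+1)) ℝ, Rᵀ * R = 1 ∧ R.det = 1 ∧ rotS R (0, 1) = u := by
  have ho : Orthonormal ℝ (({Fin.last n} : Set (Fin (n+1))).restrict fun _ => u) := by
    rw [orthonormal_iff_ite]
    rintro ⟨i, hi⟩ ⟨j, hj⟩
    rw [Set.mem_singleton_iff] at hi hj
    subst hi; subst hj
    rw [if_pos rfl]
    show inner ℝ u u = 1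
    rw [real_inner_self_eq_norm_sq, hu]; norm_num
  obtain ⟨b, hb⟩ := ho.exists_orthonormalBasis_extension_of_card_eq (by simp)
  have hbl : b (Fin.last n) = u := hb _ rfl
  set R : Matrix (Fin (n+1)) (Fin (n+1)) ℝ := Matrix.of fun i j => b j i with hR
  have hRR : Rᵀ * R = 1 := by
    ext j k
    rw [Matrix.mul_apply, Matrix.one_apply]
    have h := orthonormal_iff_ite.1 b.orthonormal j k
    rw [← h, PiLp.inner_apply]
    refine Finset.sum_congr rfl fun i _ => ?_
    simp [hR, mul_comm]
  have hcol : ∀ S : Matrix (Fin (n+1)) (Fin (n+1)) ℝ, (∀ i, S i (Fin.last n) = u i) → rotS S (0, 1) = u := by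
    intro S hS
    ext i
    rw [rotS, mulVecE_apply, Fin.sum_univ_castSucc]
    simp [snocE_castSucc, snocE_last, hS]
  have hdet : R.det = 1 ∨ R.det = -1 := by
    have h := congrArg Matrix.det hRR
    rw [Matrix.det_mul, Matrix.det_transpose, Matrix.det_one] at h
    exact mul_self_eq_one_iff.1 h
  rcases hdet with h | h
  · refine ⟨R, hRR, h, hcol R fun i => ?_⟩
    rw [hR, Matrix.of_apply, hbl]
  · set d : Fin (n+1) → ℝ := fun i => if i = 0 then -1 else 1 with hd
    have hd2 : ∀ i, d i * d i = 1 := fun i => by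
      simp only [hd]; split_ifs <;> norm_num
    refine ⟨R * Matrix.diagonal d, ?_, ?_, hcol _ fun i => ?_⟩
    · rw [Matrix.transpose_mul, Matrix.diagonal_transpose, Matrix.mul_assoc, ← Matrix.mul_assoc Rᵀ, hRR, Matrix.one_mul,
        Matrix.diagonal_mul_diagonal]
      simp only [hd2]
      exact Matrix.diagonal_one
    · rw [Matrix.det_mul, h, Matrix.det_diagonal, Finset.prod_ite_eq' Finset.univ (0 : Fin (n+1)) fun _ => (-1:ℝ)]
      simp
    · rw [Matrix.mul_diagonal, hR, Matrix.of_apply, hbl]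
      have : Fin.last n ≠ 0 := by
        intro h0
        exact hn (by simpa using congrArg Fin.val h0)
      simp [hd, this]

lemma snocE_firstCoords (x : EV (n+1)) : snocE (firstCoords x) (x (Fin.last n)) = x := by
  ext i
  refine Fin.lastCases ?_ (fun i => ?_) i
  · rw [snocE_last]
  · rw [snocE_castSucc]; rfl

lemma exists_rotS {R : Matrix (Fin (n+1)) (Fin (n+1)) ℝ} (hR : Rᵀ * R = 1) (h : EV (n+1)) : ∃ v r, h = rotS R (v, r) := by
  refine ⟨firstCoords ((rotI hR).symm h), (rotI hR).symm h (Fin.last n), ?_⟩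
  rw [rotS, snocE_firstCoords, ← rotI_apply hR, LinearIsometryEquiv.apply_symm_apply]

lemma posdef_sq_one {A : Matrix (Fin m) (Fin m) ℝ} (hA : A.PosDef) (h : A * A = 1) : A = 1 := by
  have h1 : (A + 1).PosDef := hA.add Matrix.PosDef.one
  have h2 : (A - 1) * (A + 1) = 0 := by
    rw [sub_mul, mul_add, mul_add, h]; simp; abel
  have h3 := h1.isUnit
  have h4 : A - 1 = 0 := by
    obtain ⟨u, hu⟩ := h3
    rw [← hu] at h2
    simpa using congrArg (· * (↑u⁻¹ : Matrix (Fin m) (Fin m) ℝ)) h2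
  exact sub_eq_zero.1 h4

lemma halfSym_of {k : EV (n+1) → ℝ} (hk : Ker k)
    (hs : ∀ (r : ℝ) (R : Matrix (Fin (n+1)) (Fin (n+1)) ℝ), Rᵀ * R = 1 → R.det = 1 →
      ∫ w : EV n, kernelJ k (rotS R (w, r)) • w = 0) : HalfSym k := by
  intro N h hN hort t ht
  rcases eq_or_ne h 0 with rfl | hh
  · simp
  have hNp : 0 < ‖N‖ := norm_pos_iff.2 hN
  have hn : n ≠ 0 := by
    rintro rfl
    rw [PiLp.inner_apply] at hort
    simp at hort
    rcases hort with h0 | h0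
    · exact hh (by ext i; have hi : i = 0 := Fin.ext (by omega)
                   rw [hi]; simpa using h0)
    · exact hN (by ext i; have hi : i = 0 := Fin.ext (by omega)
                   rw [hi]; simpa using h0)
  obtain ⟨R, hR, hdet, hRe⟩ := exists_rot (n := n) hn (u := ‖N‖⁻¹ • N) (by rw [norm_smul, norm_inv, norm_norm, inv_mul_cancel₀ hNp.ne'])
  have hNe : N = rotS R (0, ‖N‖) := by
    have : ‖N‖ • rotS R (0, 1) = N := by rw [hRe, smul_smul, mul_inv_cancel₀ hNp.ne', one_smul]
    rw [rotS_smul hR, smul_zero, mul_one] at this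
    exact this.symm
  obtain ⟨v, r, hv⟩ := exists_rotS hR h
  have hr : r = 0 := by
    have h1 := hort
    rw [hNe, hv, rotS_inner hR] at h1
    simpa [hNp.ne'] using h1
  subst hr
  set S : Set (EV (n+1)) := {z | t ≤ inner ℝ N z} with hS
  have mS : MeasurableSet S := measurableSet_le measurable_const (by fun_prop)
  have far : ∀ z ∈ S, t / ‖N‖ ≤ ‖z‖ := fun z hz => by
    rw [div_le_iff₀ hNp, mul_comm]
    exact le_trans hz (real_inner_le_norm N z)
  have hrm := (rotS_mp hR).measurable
  set T : Set (EV n × ℝ) := {q | t ≤ ‖N‖ * q.2} with hT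
  have mT : MeasurableSet T := measurableSet_le measurable_const (by fun_prop)
  have hST : ∀ q, rotS R q ∈ S ↔ q ∈ T := by
    intro q
    show t ≤ inner ℝ N (rotS R q) ↔ t ≤ ‖N‖ * q.2
    have : inner ℝ N (rotS R q) = ‖N‖ * q.2 := by
      conv_lhs => rw [hNe]
      rw [rotS_inner hR]; simp
    rw [this]
  set F : EV n × ℝ → EV n := T.indicator fun q => kernelJ k (rotS R q) • q.1 with hF
  have Fm : Measurable F := Measurable.indicator ((hk.measJ.comp hrm).smul measurable_fst) mT
  -- integrability
  have i0 : Integrable (S.indicator fun z => kernelJ k z * ‖z‖) := by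
    rw [integrable_indicator_iff mS]
    refine ((hk.int.const_mul (t / ‖N‖)⁻¹).integrableOn (s := S)).mono'
      ((hk.measJ.mul measurable_norm).aestronglyMeasurable) ?_
    filter_upwards [ae_restrict_mem mS] with z hz
    have hz' := far z hz
    have : 0 < t / ‖N‖ := div_pos ht hNp
    rw [Real.norm_of_nonneg (mul_nonneg (hk.J_nonneg z) (norm_nonneg _)), hk.J_one, mul_comm]
    exact mul_le_mul_of_nonneg_right (inv_anti₀ this hz') (hk.nonneg z)
  have i1 : Integrable (fun q => (S.indicator fun z => kernelJ k z * ‖z‖) (rotS R q)) (volume.prod volume) :=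
    ((rotS_mp hR).integrable_comp i0.1).2 i0
  have iF : Integrable F (volume.prod volume) := by
    refine i1.mono' Fm.aestronglyMeasurable (Eventually.of_forall fun q => ?_)
    by_cases hq : q ∈ T
    · rw [hF, Set.indicator_of_mem hq, Set.indicator_of_mem ((hST q).2 hq), norm_smul, Real.norm_of_nonneg (hk.J_nonneg _)]
      exact mul_le_mul_of_nonneg_left (norm_le_rotS hR q.1 q.2) (hk.J_nonneg _)
    · rw [hF, Set.indicator_of_notMem hq, Set.indicator_of_notMem (fun h' => hq ((hST q).1 h')), norm_zero]
  have zF : ∫ q, F q ∂(volume.prod volume) = 0 := by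
    rw [integral_prod_symm _ iF]
    have : ∀ s : ℝ, ∫ w : EV n, F (w, s) = 0 := by
      intro s
      by_cases hq : t ≤ ‖N‖ * s
      · have : ∀ w : EV n, F (w, s) = kernelJ k (rotS R (w, s)) • w := fun w => by
          rw [hF, Set.indicator_of_mem (by exact hq)]
        simp only [this]
        exact hs s R hR hdet
      · have : ∀ w : EV n, F (w, s) = 0 := fun w => by
          rw [hF, Set.indicator_of_notMem (by exact hq)]
        simp only [this, integral_zero]
    simp only [this, integral_zero]
  rw [← integral_indicator mS, ← (rotS_mp hR).map_eq, integral_map hrm.aemeasurable]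
  · have e1 : ∀ q, (S.indicator fun z => kernelJ k z * inner ℝ h z) (rotS R q) = inner ℝ v (F q) := by
      intro q
      by_cases hq : q ∈ T
      · rw [hF, Set.indicator_of_mem hq, Set.indicator_of_mem ((hST q).2 hq), inner_smul_right, hv, rotS_inner hR]
        simp
      · rw [hF, Set.indicator_of_notMem hq, Set.indicator_of_notMem (fun h' => hq ((hST q).1 h')), inner_zero_right]
    simp only [e1]
    rw [integral_inner iF, zF, inner_zero_right]
  · rw [(rotS_mp hR).map_eq]
    exact (Measurable.indicator (hk.measJ.mul (by fun_prop)) mS).aestronglyMeasurable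

end PartTwenty

section PartTwentyOne

variable {m n : ℕ}

lemma ker_of_A1 {ρ : EV m → ℝ} (h : A1 ρ) : Ker ρ := by
  obtain ⟨h1, h2, _, h4, h5⟩ := h
  refine ⟨h1, h2, h4, ?_, ?_⟩
  · refine h5.mono' h1.aestronglyMeasurable (Eventually.of_forall fun x => ?_)
    rw [Real.norm_of_nonneg (h2 x)]
    nlinarith [h2 x, norm_nonneg x]
  · refine h5.mono' (h1.mul measurable_norm).aestronglyMeasurable (Eventually.of_forall fun x => ?_)
    rw [Real.norm_of_nonneg (mul_nonneg (h2 x) (norm_nonneg x))]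
    nlinarith [h2 x, norm_nonneg x]

lemma norm_smul_inv {ε : ℝ} (hε : 0 < ε) (x : EV m) : ‖ε⁻¹ • x‖ = ε⁻¹ * ‖x‖ := by
  rw [norm_smul, Real.norm_of_nonneg (inv_nonneg.2 hε.le)]

lemma Ker.scaled {ρ : EV m → ℝ} (h : Ker ρ) {ε : ℝ} (hε : 0 < ε) : Ker (scaled ρ ε) := by
  have hi : ε⁻¹ ≠ 0 := inv_ne_zero hε.ne'
  refine ⟨?_, fun x => ?_, ?_, ?_, ?_⟩
  · unfold _root_.scaled
    exact (h.meas.comp (measurable_const_smul _)).const_mul _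
  · exact mul_nonneg (by positivity) (h.nonneg _)
  · have q : Measure.QuasiMeasurePreserving (fun x : EV m => ε⁻¹ • x) volume volume := by
      refine ⟨by fun_prop, ?_⟩
      rw [Measure.map_addHaar_smul (volume : Measure (EV m)) hi]
      exact Measure.smul_absolutelyContinuous
    filter_upwards [q.ae h.even] with x hx
    unfold _root_.scaled
    rw [smul_neg, hx]
  · exact (h.int.comp_smul hi).const_mul _
  · refine ((h.int1.comp_smul hi).const_mul ((ε ^ m)⁻¹ * ε)).congr (Eventually.of_forall fun x => ?_)
    simp only [_root_.scaled, norm_smul_inv hε]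
    field_simp

lemma kernelJ_scaled {ρ : EV m → ℝ} {ε : ℝ} (hε : 0 < ε) (x : EV m) :
    kernelJ (scaled ρ ε) x = (ε ^ m)⁻¹ * (ε⁻¹ ^ 2 * kernelJ ρ (ε⁻¹ • x)) := by
  unfold kernelJ scaled
  rw [norm_smul_inv hε]
  by_cases hx : ‖x‖ = 0
  · simp [hx]
  · field_simp

lemma momentum_scaled {ρ : EV m → ℝ} {ε : ℝ} (hε : 0 < ε) : momentum (scaled ρ ε) = momentum ρ := by
  ext i j
  simp only [momentum, Matrix.of_apply]
  congr 1
  have e1 : ∀ z : EV m, kernelJ (scaled ρ ε) z * z i * z j = (ε ^ m)⁻¹ * (fun z : EV m => kernelJ ρ z * z i * z j) (ε⁻¹ • z) := by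
    intro z
    rw [kernelJ_scaled hε]
    simp only [PiLp.smul_apply, smul_eq_mul]
    ring
  simp only [e1]
  rw [integral_const_mul, Measure.integral_comp_smul volume (fun z : EV m => kernelJ ρ z * z i * z j), finrank_euclideanSpace, Fintype.card_fin, inv_pow, inv_inv,
    abs_of_pos (by positivity), smul_eq_mul, inv_mul_cancel_left₀ (by positivity)]

lemma muK_scaled_univ {ρ : EV m → ℝ} (hρ : Measurable ρ) {ε : ℝ} (hε : 0 < ε) :
    muK (scaled ρ ε) Set.univ = muK ρ Set.univ := by
  have := muK_scaled hρ hε (F := fun _ => 1) measurable_const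
  simpa using this

lemma muK_scaled_norm {ρ : EV m → ℝ} (hρ : Measurable ρ) {ε : ℝ} (hε : 0 < ε) :
    ∫⁻ z, ENNReal.ofReal ‖z‖ ∂(muK (scaled ρ ε)) = ENNReal.ofReal ε * ∫⁻ z, ENNReal.ofReal ‖z‖ ∂(muK ρ) := by
  rw [muK_scaled hρ hε (F := fun z => ENNReal.ofReal ‖z‖) (by fun_prop), ← lintegral_const_mul _ (by fun_prop)]
  refine lintegral_congr fun z => ?_
  rw [norm_smul, Real.norm_of_nonneg hε.le, ENNReal.ofReal_mul hε.le]

lemma Ker.norm_fin {k : EV m → ℝ} (hk : Ker k) : ∫⁻ z, ENNReal.ofReal ‖z‖ ∂(muK k) ≠ ⊤ := by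
  rw [muK, lintegral_withDensity_eq_lintegral_mul _ hk.meas.ennreal_ofReal (by fun_prop)]
  have h := hk.int1.lintegral_lt_top
  refine ne_of_lt (lt_of_le_of_lt (le_of_eq ?_) h)
  refine lintegral_congr fun z => ?_
  rw [Pi.mul_apply, ENNReal.ofReal_mul (hk.nonneg z)]

lemma halfSym_scaled {ρ : EV (n+1) → ℝ} (hk : Ker ρ) (h2 : A2 ρ) (hM : momentum ρ = 1) {ε : ℝ} (hε : 0 < ε) :
    HalfSym (scaled ρ ε) := by
  obtain ⟨_, _, A, hA, hAA, hs⟩ := h2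
  have hA1 : A = 1 := posdef_sq_one hA (by rw [hAA, hM])
  subst hA1
  refine halfSym_of (hk.scaled hε) fun r R hR hdet => ?_
  have h3 := hs (ε⁻¹ * r) R hR hdet
  rw [Matrix.one_mul] at h3
  have e1 : ∀ w : EV n, kernelJ (scaled ρ ε) (rotS R (w, r)) • w =
      ((ε ^ (n+1))⁻¹ * ε⁻¹ ^ 2 * ε) • (fun v : EV n => kernelJ ρ (rotS R (v, ε⁻¹ * r)) • v) (ε⁻¹ • w) := by
    intro w
    rw [kernelJ_scaled hε, rotS_smul hR]
    simp only [smul_smul]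
    congr 1
    field_simp
  simp only [e1]
  rw [integral_smul, Measure.integral_comp_smul volume (fun v : EV n => kernelJ ρ (rotS R (v, ε⁻¹ * r)) • v)]
  have : ∫ v : EV n, kernelJ ρ (rotS R (v, ε⁻¹ * r)) • v = 0 := h3
  rw [this, smul_zero, smul_zero]

def phiF (α N : ℝ) (n : ℕ) (r : ℝ) : ℝ := r ^ (-α - (n:ℝ)) * (1 + r) ^ (-N)

lemma phi_anti {α N : ℝ} (hα : 0 < α) (hN : 0 < N) {r s : ℝ} (hr : 0 < r) (hrs : r ≤ s) :
    phiF α N n s ≤ phiF α N n r := by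
  unfold phiF
  have hs := hr.trans_le hrs
  refine mul_le_mul (Real.rpow_le_rpow_of_nonpos hr hrs ?_) (Real.rpow_le_rpow_of_nonpos (by linarith) (by linarith) (by linarith))
    (by positivity) (by positivity)
  have : (0:ℝ) ≤ n := Nat.cast_nonneg n
  linarith

lemma phi_int {α N : ℝ} (hα : 0 < α) (hα2 : α < 2) (hN : 3 - α < N) :
    ∫⁻ v : EV n, ENNReal.ofReal (‖v‖ ^ 2 * phiF α N n ‖v‖) ≠ ⊤ := by
  rcases Nat.eq_zero_or_pos n with rfl | hn
  · have : ∀ v : EV 0, ENNReal.ofReal (‖v‖ ^ 2 * phiF α N 0 ‖v‖) = 0 := fun v => by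
      rw [Subsingleton.elim v 0]; simp
    simp only [this, lintegral_zero]; simp
  · haveI : Nonempty (Fin n) := ⟨⟨0, hn⟩⟩
    haveI : Nontrivial (EV n) := inferInstance
    have hi : Integrable (fun v : EV n => (fun r : ℝ => r ^ 2 * phiF α N n r) ‖v‖) := by
      rw [integrable_fun_norm_addHaar volume (f := fun r : ℝ => r ^ 2 * phiF α N n r), finrank_euclideanSpace, Fintype.card_fin]
      have hm : Measurable fun y : ℝ => y ^ (n - 1) • (y ^ 2 * phiF α N n y) := by
        unfold phiF
        fun_prop
      have e1 : ∀ y : ℝ, 0 < y → y ^ (n - 1) • (y ^ 2 * phiF α N n y) = y ^ (1 - α) * (1 + y) ^ (-N) := by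
        intro y hy
        unfold phiF
        rw [smul_eq_mul, ← mul_assoc, ← mul_assoc, ← pow_add, ← Real.rpow_natCast, ← Real.rpow_add hy]
        congr 2
        have : ((n - 1 + 2 : ℕ) : ℝ) = n + 1 := by
          have : n - 1 + 2 = n + 1 := by omega
          rw [this]; push_cast; ring
        rw [this]; ring
      rw [← Set.Ioc_union_Ioi_eq_Ioi (zero_le_one' ℝ)]
      refine IntegrableOn.union ?_ ?_
      · have h1 : IntegrableOn (fun y : ℝ => y ^ (1 - α)) (Set.Ioc 0 1) := by
          rw [← intervalIntegrable_iff_integrableOn_Ioc_of_le zero_le_one]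
          exact intervalIntegral.intervalIntegrable_rpow' (by linarith)
        refine h1.mono' hm.aestronglyMeasurable ?_
        filter_upwards [ae_restrict_mem measurableSet_Ioc] with y hy
        have hy0 := hy.1
        rw [e1 y hy0, Real.norm_of_nonneg (by positivity)]
        refine mul_le_of_le_one_right (by positivity) (Real.rpow_le_one_of_one_le_of_nonpos (by linarith) (by linarith))
      · have h1 : IntegrableOn (fun y : ℝ => y ^ (1 - α - N)) (Set.Ioi 1) :=
          integrableOn_Ioi_rpow_of_lt (by linarith) zero_lt_one
        refine h1.mono' hm.aestronglyMeasurable ?_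
        filter_upwards [ae_restrict_mem measurableSet_Ioi] with y hy
        have hy0 : (0:ℝ) < y := zero_lt_one.trans hy
        rw [e1 y hy0, Real.norm_of_nonneg (by positivity), sub_eq_add_neg (1 - α), Real.rpow_add hy0]
        exact mul_le_mul_of_nonneg_left (Real.rpow_le_rpow_of_nonpos hy0 (by linarith) (by linarith)) (by positivity)
    exact hi.lintegral_lt_top.ne

/-- uniform bound of the boundary layer function -/
lemma Ef_unif {ρ : EV (n+1) → ℝ} (hk : Ker ρ) (h2 : A2 ρ) (K : ℝ) (hK : 0 ≤ K) : ∃ C : ℝ≥0∞, C ≠ ⊤ ∧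
    ∀ (Q : Matrix (Fin (n+1)) (Fin (n+1)) ℝ), Qᵀ * Q = 1 → ∀ τ : EV (n+1) → ℝ, Geo (rotS Q (0, 1)) τ K →
    ∀ ε : ℝ, 0 < ε → ∀ x, Ef τ (rotS Q (0, 1)) K (scaled ρ ε) x ≤ C := by
  obtain ⟨_, ⟨c0, c1, α, N, hc0, hc1, hα, hα2, hN, hb⟩, _⟩ := h2
  refine ⟨ENNReal.ofReal (2 * K * c0) * ∫⁻ v : EV n, ENNReal.ofReal (‖v‖ ^ 2 * phiF α N n ‖v‖),
    ENNReal.mul_ne_top ofReal_ne_top (phi_int hα hα2 hN), fun Q hQ τ G ε hε x => ?_⟩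
  refine (Geo.Ef_bound hQ G (hk.scaled hε) (Ψ := fun w => ENNReal.ofReal (c0 * (ε ^ (n+2))⁻¹ * phiF α N n ‖ε⁻¹ • w‖)) ?_ x).trans (le_of_eq ?_)
  · intro w s hw
    set z := rotS Q (w, s) with hz
    have hwz : ‖w‖ ≤ ‖z‖ := norm_le_rotS hQ w s
    have hw0 : 0 < ‖w‖ := norm_pos_iff.2 hw
    have hz0 : 0 < ‖z‖ := hw0.trans_le hwz
    rw [← ENNReal.ofReal_mul ((hk.scaled hε).nonneg z)]
    refine ENNReal.ofReal_le_ofReal ?_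
    have hne : ε⁻¹ • z ≠ 0 := smul_ne_zero (inv_ne_zero hε.ne') (norm_pos_iff.1 hz0)
    have hr0 : 0 < ‖ε⁻¹ • z‖ := norm_pos_iff.2 hne
    have h4 := (le_abs_self _).trans (hb _ hne).1
    have h5 : phiF α N n ‖ε⁻¹ • z‖ ≤ phiF α N n ‖ε⁻¹ • w‖ := by
      refine phi_anti hα (by linarith) (by rw [norm_smul_inv hε]; positivity) ?_
      rw [norm_smul_inv hε, norm_smul_inv hε]
      exact mul_le_mul_of_nonneg_left hwz (by positivity)
    have h6 : scaled ρ ε z * ‖z‖⁻¹ = (ε ^ (n+2))⁻¹ * (ρ (ε⁻¹ • z) * ‖ε⁻¹ • z‖⁻¹) := by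
      rw [norm_smul_inv hε, scaled]
      field_simp
      ring
    have h7 : ρ (ε⁻¹ • z) * ‖ε⁻¹ • z‖⁻¹ ≤ c0 * phiF α N n ‖ε⁻¹ • z‖ := by
      refine (mul_le_mul_of_nonneg_right h4 (inv_nonneg.2 hr0.le)).trans (le_of_eq ?_)
      unfold phiF
      rw [← Real.rpow_neg_one ‖ε⁻¹ • z‖]
      have : ‖ε⁻¹ • z‖ ^ (-α - (n:ℝ)) = ‖ε⁻¹ • z‖ ^ ((2:ℝ) - α - (n+1:ℝ)) * ‖ε⁻¹ • z‖ ^ (-1:ℝ) := by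
        rw [← Real.rpow_add hr0]; congr 1; ring
      rw [this]; ring
    rw [h6, mul_comm c0, mul_assoc]
    exact mul_le_mul_of_nonneg_left (h7.trans (mul_le_mul_of_nonneg_left h5 hc0.le)) (by positivity)
  · have hph : ∀ r : ℝ, 0 ≤ r → 0 ≤ phiF α N n r := fun r hr => by unfold phiF; positivity
    have e1 : ∀ w : EV n, ENNReal.ofReal (c0 * (ε ^ (n+2))⁻¹ * phiF α N n ‖ε⁻¹ • w‖) * ENNReal.ofReal (2 * (K * ‖w‖ ^ 2)) =
        (fun v : EV n => ENNReal.ofReal ((ε ^ n)⁻¹ * (2 * K * c0)) * ENNReal.ofReal (‖v‖ ^ 2 * phiF α N n ‖v‖)) (ε⁻¹ • w) := by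
      intro w
      have := hph ‖ε⁻¹ • w‖ (norm_nonneg _)
      simp only
      rw [← ENNReal.ofReal_mul (by positivity), ← ENNReal.ofReal_mul (by positivity)]
      congr 1
      set P := phiF α N n ‖ε⁻¹ • w‖
      rw [norm_smul_inv hε]
      field_simp
      ring
    have hmph : Measurable fun v : EV n => ENNReal.ofReal (‖v‖ ^ 2 * phiF α N n ‖v‖) := by
      unfold phiF
      fun_prop
    simp only [e1]
    rw [lintegral_smul_inv hε (f := fun v : EV n => ENNReal.ofReal ((ε ^ n)⁻¹ * (2 * K * c0)) * ENNReal.ofReal (‖v‖ ^ 2 * phiF α N n ‖v‖)) (hmph.const_mul _),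
      lintegral_const_mul _ hmph, ← mul_assoc, ← ENNReal.ofReal_mul (by positivity), mul_inv_cancel_left₀ (by positivity)]

end PartTwentyOne

section PartTwentyTwo

variable {m n : ℕ}

lemma eLpNorm_cmul {X : Type*} [MeasurableSpace X] (μ : Measure X) {p : ℝ≥0∞} (hp1 : 1 ≤ p) (hp : p ≠ ⊤)
    {c : ℝ≥0∞} (hc : c ≠ ⊤) (f : X → ℝ≥0∞) : eLpNorm (fun x => c * f x) p μ = c * eLpNorm f p μ := by
  have hr := toReal_one_le hp1 hp
  have hr0 : 0 < p.toReal := by linarith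
  have h : eLpNorm (fun x => c * f x) p μ ^ p.toReal = (c * eLpNorm f p μ) ^ p.toReal := by
    rw [eLpNorm_rpow_eq' μ hp1 hp, ENNReal.mul_rpow_of_nonneg _ _ hr0.le, eLpNorm_rpow_eq' μ hp1 hp,
      ← lintegral_const_mul' _ _ (ENNReal.rpow_ne_top_of_nonneg hr0.le hc)]
    exact lintegral_congr fun x => ENNReal.mul_rpow_of_nonneg _ _ hr0.le
  refine le_antisymm ?_ ?_
  · exact (ENNReal.rpow_le_rpow_iff hr0).1 h.le
  · exact (ENNReal.rpow_le_rpow_iff hr0).1 h.ge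

lemma eLpNorm_sum_enn {X ι : Type*} [MeasurableSpace X] (μ : Measure X) {p : ℝ≥0∞} (hp1 : 1 ≤ p) (s : Finset ι)
    {f : ι → X → ℝ≥0∞} (hf : ∀ i ∈ s, Measurable (f i)) {c : ℝ≥0∞} (h : ∀ i ∈ s, eLpNorm (f i) p μ ≤ c) :
    eLpNorm (fun x => ∑ i ∈ s, f i x) p μ ≤ s.card * c := by
  classical
  induction s using Finset.induction_on with
  | empty => simp
  | insert a s ha ih =>
    have hm : Measurable fun x => ∑ i ∈ s, f i x :=
      Finset.measurable_fun_sum _ fun i hi => hf i (Finset.mem_insert_of_mem hi)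
    simp only [Finset.sum_insert ha]
    refine (eLpNorm_add_le (f := f a) (g := fun x => ∑ i ∈ s, f i x)
      (hf a (Finset.mem_insert_self _ _)).aestronglyMeasurable hm.aestronglyMeasurable hp1).trans ?_
    rw [Finset.card_insert_of_notMem ha]
    push_cast
    rw [add_mul, one_mul, add_comm]
    exact add_le_add (ih (fun i hi => hf i (Finset.mem_insert_of_mem hi)) fun i hi => h i (Finset.mem_insert_of_mem hi))
      (h a (Finset.mem_insert_self _ _))

namespace Geo
variable {e : EV m} {τ : EV m → ℝ} {K : ℝ}

lemma jetBC_of (G : Geo e τ K) {p : ℝ≥0∞} (hp1 : 1 ≤ p) {u : EV m → ℝ} {D D' : List (Fin m) → EV m → ℝ}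
    (h : IsSobDerivs (Om τ) 2 p u D) (hN : NeumannBC (Om τ) 1 p u)
    (he : ∀ l : List (Fin m), l.length ≤ 2 → D' l =ᵐ[volume.restrict (Om τ)] D l) : JetBC τ D' := by
  intro φ φs φc
  have h1 := (NeumannBC_iff G.openOm hp1 h).1 hN φ φs φc
  have e1 : ∀ i, ∫ x in Om τ, D' [i, i] x * φ x = ∫ x in Om τ, D [i, i] x * φ x := fun i => by
    refine integral_congr_ae ?_
    filter_upwards [he [i, i] (by simp)] with x hx
    rw [hx]
  have e2 : ∀ i, ∫ x in Om τ, D' [i] x * partialD i φ x = ∫ x in Om τ, D [i] x * partialD i φ x := fun i => by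
    refine integral_congr_ae ?_
    filter_upwards [he [i] (by simp)] with x hx
    rw [hx]
  simp only [e1, e2]
  exact h1

lemma poincare_cc (G : Geo e τ K) {p : ℝ≥0∞} (hp1 : 1 ≤ p) (hp : p ≠ ⊤) {U : EV m → ℝ} (hU : ContDiff ℝ 2 U)
    (hc : HasCompactSupport U) (hN : NeumannBC (Om τ) 1 p U) {h : ℝ} (hh : 0 ≤ h) :
    eLpNorm (nGrad τ fun l => partialDList l U) p (volume.restrict (Sl τ h))
      ≤ ENNReal.ofReal h * eLpNorm (nGradE τ e fun l => partialDList l U) p (volume.restrict (Sl τ h)) := by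
  have hs := sob_of_cc (p := p) G.measOm (k := 2) (by exact_mod_cast hU) hc
  obtain ⟨D', hD', he⟩ := exists_jet G.measOm hs
  have hb := G.jetBC_of hp1 hs hN he
  have h1 := G.neumann_poincare hp1 hp hD' hb hh
  have hsub : Sl τ h ⊆ Om τ := fun x hx => hx.1
  have he' : ∀ l : List (Fin m), l.length ≤ 2 → D' l =ᵐ[volume.restrict (Sl τ h)] partialDList l U :=
    fun l hl => ae_mono (Measure.restrict_mono_set _ hsub) (he l hl)
  have a1 : ∀ᵐ x ∂(volume.restrict (Sl τ h)), ∀ i, D' [i] x = partialDList [i] U x :=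
    ae_all_iff.2 fun i => he' [i] (by simp)
  have a2 : ∀ᵐ x ∂(volume.restrict (Sl τ h)), ∀ i j, D' [i, j] x = partialDList [i, j] U x :=
    ae_all_iff.2 fun i => ae_all_iff.2 fun j => he' [i, j] (by simp)
  have e1 : nGrad τ D' =ᵐ[volume.restrict (Sl τ h)] nGrad τ fun l => partialDList l U := by
    filter_upwards [a1] with x hx
    simp only [nGrad, hx]
  have e2 : nGradE τ e D' =ᵐ[volume.restrict (Sl τ h)] nGradE τ e fun l => partialDList l U := by
    filter_upwards [a2] with x hx
    simp only [nGradE, dirD, hx]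
  rwa [eLpNorm_congr_ae e1, eLpNorm_congr_ae e2] at h1

lemma X1_meas (G : Geo e τ K) {k : EV m → ℝ} (hk : Ker k) {f : EV m → ℝ} (hf : Measurable f) : Measurable (X1 τ K e k f) := by
  haveI := hk.finite
  exact Measurable.lintegral_prod_right' (f := fun q : EV m × EV m => (∫⁻ r in Set.Ioc (0:ℝ) 1, {q : EV m × EV m | q.1 - q.2 ∈ Om τ}.indicator
    (fun q => ‖f (q.1 + pa K e q.2 r) - f q.1‖ₑ) q)) (G.X1_meas_aux hf)

lemma X2_meas (G : Geo e τ K) {k : EV m → ℝ} (hk : Ker k) {f : EV m → ℝ} (hf : Measurable f) : Measurable (X2 τ K k f) := by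
  haveI := hk.finite
  exact Measurable.lintegral_prod_right' (f := {q : EV m × EV m | τ q.1 ≤ K * ‖q.2‖}.indicator (fun q => ‖f q.1‖ₑ))
    ((by fun_prop : Measurable fun q : EV m × EV m => ‖f q.1‖ₑ).indicator G.measS)

lemma X3_meas (G : Geo e τ K) {k : EV m → ℝ} (hk : Ker k) {f : EV m → ℝ} (hf : Measurable f) : Measurable (X3 τ K k f) := by
  haveI := hk.finite
  exact Measurable.lintegral_prod_right' (f := {q : EV m × EV m | τ q.1 ≤ K * ‖q.2‖}.indicator (fun q => ENNReal.ofReal ‖q.2‖⁻¹ * ‖f q.1‖ₑ))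
    ((by fun_prop : Measurable fun q : EV m × EV m => ENNReal.ofReal ‖q.2‖⁻¹ * ‖f q.1‖ₑ).indicator G.measS)

/-- the boundary layer term -/
lemma trace_term (G : Geo e τ K) {k : EV m → ℝ} (hk : Ker k) {p : ℝ≥0∞} (hp1 : 1 ≤ p) (hp : p ≠ ⊤) {C : ℝ≥0∞}
    (hC : ∀ x, Ef τ e K k x ≤ C) (hCt : C ≠ ⊤) {U : EV m → ℝ} (hU : ContDiff ℝ 2 U) (i : Fin m) :
    eLpNorm (fun x => Ef τ e K k x * ‖partialD i U x‖ₑ) p (volume.restrict (Om τ)) ≤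
      (C ^ (p.toReal - 1) * (ENNReal.ofReal (2 * K) * ∫⁻ z, ENNReal.ofReal ‖z‖ ∂(muK k))) ^ (1 / p.toReal) *
      ((1 + m) * WNormD 2 p (volume.restrict (Om τ)) fun l => partialDList l U) := by
  have hr := toReal_one_le hp1 hp
  have hr0 : 0 < p.toReal := by linarith
  have hF : ContDiff ℝ 1 (partialD i U) := contDiff_partialDList (k := 1) [i] (by exact_mod_cast hU)
  refine (weighted_trace_smooth G.measOm (e := e) (fun x hx s hs => G.up hx hs) (G.Ef_meas hk) hp1 hp
    (κ := C ^ (p.toReal - 1) * (ENNReal.ofReal (2 * K) * ∫⁻ z, ENNReal.ofReal ‖z‖ ∂(muK k))) (fun x => ?_) hF).trans ?_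
  · refine le_trans ?_ (mul_le_mul_right (G.Ef_line hk x) _)
    rw [← lintegral_const_mul' _ _ (ENNReal.rpow_ne_top_of_nonneg (by linarith) hCt)]
    refine lintegral_mono fun s => ?_
    refine (Set.indicator_le_self _ _ _).trans ?_
    have : Ef τ e K k (x + s • e) ^ p.toReal = Ef τ e K k (x + s • e) ^ (p.toReal - 1) * Ef τ e K k (x + s • e) := by
      conv_lhs => rw [show p.toReal = (p.toReal - 1) + 1 by ring]
      rw [ENNReal.rpow_add_of_nonneg _ _ (by linarith) (by norm_num), ENNReal.rpow_one]
    rw [this]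
    exact mul_le_mul_left (ENNReal.rpow_le_rpow (hC _) (by linarith)) _
  · refine mul_le_mul_right ?_ _
    rw [add_mul, one_mul]
    refine add_le_add (le_WNormD p _ (fun l => partialDList l U) (l := [i]) (by simp)) ?_
    have e1 : (fun x => fderiv ℝ (partialD i U) x e) = ∑ j, fun x => e j * partialDList [j, i] U x := by
      funext x
      rw [clm_eq_sum]
      simp [partialDList, partialD]
    rw [e1]
    have hm : ∀ j ∈ (Finset.univ : Finset (Fin m)), AEStronglyMeasurable (fun x => e j * partialDList [j, i] U x) (volume.restrict (Om τ)) :=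
      fun j _ => (continuous_const.mul (cont_partialDList hU (by simp))).aestronglyMeasurable
    refine (eLpNorm_sum_le hm hp1).trans ?_
    have hj : ∀ j ∈ (Finset.univ : Finset (Fin m)), eLpNorm (fun x => e j * partialDList [j, i] U x) p (volume.restrict (Om τ)) ≤
        WNormD 2 p (volume.restrict (Om τ)) fun l => partialDList l U := fun j _ => by
      refine (eLpNorm_mono (g := partialDList [j, i] U) fun x => ?_).trans (le_WNormD p _ (fun l => partialDList l U) (l := [j, i]) (by simp))
      rw [norm_mul]
      refine mul_le_of_le_one_left (norm_nonneg _) ?_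
      exact (PiLp.norm_apply_le e j).trans G.e1.le
    refine (Finset.sum_le_card_nsmul _ _ _ hj).trans (le_of_eq ?_)
    simp

lemma main_norm (G : Geo e τ K) {k : EV m → ℝ} (hk : Ker k) (hs : HalfSym k) (hmom : momentum k = 1) {p : ℝ≥0∞}
    (hp1 : 1 ≤ p) (hp : p ≠ ⊤) {C : ℝ≥0∞} (hC : ∀ x, Ef τ e K k x ≤ C) (hCt : C ≠ ⊤) {U : EV m → ℝ}
    (hU : ContDiff ℝ 2 U) (hc : HasCompactSupport U) (hN : NeumannBC (Om τ) 1 p U) :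
    eLpNorm (fun x => Lval τ k U x + ∑ i, partialDList [i, i] U x) p (volume.restrict (Om τ)) ≤
      (ENNReal.ofReal ((1 + 2 * K) ^ 2) * (m * m) + m * m + ENNReal.ofReal (K * K)) *
        avg k p (Wm τ K p fun l => partialDList l U) +
      m * ((C ^ (p.toReal - 1) * (ENNReal.ofReal (2 * K) * ∫⁻ z, ENNReal.ofReal ‖z‖ ∂(muK k))) ^ (1 / p.toReal) *
      ((1 + m) * WNormD 2 p (volume.restrict (Om τ)) fun l => partialDList l U)) := by
  set T := (C ^ (p.toReal - 1) * (ENNReal.ofReal (2 * K) * ∫⁻ z, ENNReal.ofReal ‖z‖ ∂(muK k))) ^ (1 / p.toReal) *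
      ((1 + m) * WNormD 2 p (volume.restrict (Om τ)) fun l => partialDList l U) with hT
  set A := avg k p (Wm τ K p fun l => partialDList l U) with hA
  have m2 : ∀ i j, Measurable (partialDList [i, j] U) := fun i j => (cont_partialDList hU (by simp)).measurable
  have m1 : ∀ i, Measurable (partialD i U) := fun i => (cont_partialDList (l := [i]) hU (by simp)).measurable
  have mN : Measurable (nGrad τ fun l => partialDList l U) := by
    unfold nGrad
    refine Finset.measurable_fun_sum _ fun i _ => ?_
    exact (G.contDiff_N (EuclideanSpace.single i 1)).continuous.measurable.mul (m1 i)
  have q1 : Measurable fun x => ENNReal.ofReal ((1 + 2 * K) ^ 2) * ∑ i, ∑ j, X1 τ K e k (partialDList [i, j] U) x :=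
    (Finset.measurable_fun_sum _ fun i _ => Finset.measurable_fun_sum _ fun j _ => G.X1_meas hk (m2 i j)).const_mul _
  have q2 : Measurable fun x => ∑ i, ∑ j, X2 τ K k (partialDList [i, j] U) x :=
    Finset.measurable_fun_sum _ fun i _ => Finset.measurable_fun_sum _ fun j _ => G.X2_meas hk (m2 i j)
  have q3 := G.X3_meas hk mN
  have q4' : ∀ i, Measurable fun x => Ef τ e K k x * ‖partialD i U x‖ₑ := fun i => (G.Ef_meas hk).mul (m1 i).enorm
  have q4 : Measurable fun x => ∑ i, Ef τ e K k x * ‖partialD i U x‖ₑ :=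
    Finset.measurable_fun_sum _ fun i _ => q4' i
  have b1 : eLpNorm (fun x => ENNReal.ofReal ((1 + 2 * K) ^ 2) * ∑ i, ∑ j, X1 τ K e k (partialDList [i, j] U) x) p
      (volume.restrict (Om τ)) ≤ ENNReal.ofReal ((1 + 2 * K) ^ 2) * (m * (m * A)) := by
    rw [eLpNorm_cmul _ hp1 hp ofReal_ne_top]
    refine mul_le_mul_right ?_ _
    have := eLpNorm_sum_enn (volume.restrict (Om τ)) hp1 Finset.univ (f := fun i x => ∑ j, X1 τ K e k (partialDList [i, j] U) x)
      (fun i _ => Finset.measurable_fun_sum _ fun j _ => G.X1_meas hk (m2 i j)) (c := m * A) fun i _ => ?_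
    · simpa using this
    · have := eLpNorm_sum_enn (volume.restrict (Om τ)) hp1 Finset.univ (f := fun j x => X1 τ K e k (partialDList [i, j] U) x)
        (fun j _ => G.X1_meas hk (m2 i j)) (c := A) fun j _ => G.X1_bound hk hp1 hp (D := fun l => partialDList l U) (m2 i j)
      simpa using this
  have b2 : eLpNorm (fun x => ∑ i, ∑ j, X2 τ K k (partialDList [i, j] U) x) p
      (volume.restrict (Om τ)) ≤ m * (m * A) := by
    have := eLpNorm_sum_enn (volume.restrict (Om τ)) hp1 Finset.univ (f := fun i x => ∑ j, X2 τ K k (partialDList [i, j] U) x)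
      (fun i _ => Finset.measurable_fun_sum _ fun j _ => G.X2_meas hk (m2 i j)) (c := m * A) fun i _ => ?_
    · simpa using this
    · have := eLpNorm_sum_enn (volume.restrict (Om τ)) hp1 Finset.univ (f := fun j x => X2 τ K k (partialDList [i, j] U) x)
        (fun j _ => G.X2_meas hk (m2 i j)) (c := A) fun j _ => G.X2_bound hk hp1 hp (D := fun l => partialDList l U) (m2 i j)
      simpa using this
  have b3 : eLpNorm (X3 τ K k (nGrad τ fun l => partialDList l U)) p (volume.restrict (Om τ)) ≤ ENNReal.ofReal (K * K) * A :=
    G.X3_bound hk hp1 hp m2 mN fun h hh => G.poincare_cc hp1 hp hU hc hN hh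
  have b4 : eLpNorm (fun x => ∑ i, Ef τ e K k x * ‖partialD i U x‖ₑ) p (volume.restrict (Om τ)) ≤ m * T := by
    have := eLpNorm_sum_enn (volume.restrict (Om τ)) hp1 Finset.univ (f := fun i x => Ef τ e K k x * ‖partialD i U x‖ₑ)
      (fun i _ => q4' i) (c := T) fun i _ => G.trace_term hk hp1 hp hC hCt hU i
    simpa using this
  have key : eLpNorm (fun x => Lval τ k U x + ∑ i, partialDList [i, i] U x) p (volume.restrict (Om τ)) ≤
      eLpNorm (fun x => (ENNReal.ofReal ((1 + 2 * K) ^ 2) * ∑ i, ∑ j, X1 τ K e k (partialDList [i, j] U) x +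
      ∑ i, ∑ j, X2 τ K k (partialDList [i, j] U) x) +
      (X3 τ K k (nGrad τ fun l => partialDList l U) x + ∑ i, Ef τ e K k x * ‖partialD i U x‖ₑ)) p (volume.restrict (Om τ)) := by
    refine eLpNorm_mono_enorm_ae ?_
    filter_upwards [ae_restrict_mem G.measOm] with x hx
    rw [enorm_eq_self]
    exact G.main_pointwise hk hs hmom hU hc hx
  refine key.trans ?_
  refine (eLpNorm_add_le (q1.add q2).aestronglyMeasurable (q3.add q4).aestronglyMeasurable hp1).trans ?_
  refine (add_le_add (eLpNorm_add_le q1.aestronglyMeasurable q2.aestronglyMeasurable hp1)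
    (eLpNorm_add_le q3.aestronglyMeasurable q4.aestronglyMeasurable hp1)).trans ?_
  refine (add_le_add (add_le_add b1 b2) (add_le_add b3 b4)).trans (le_of_eq ?_)
  ring

end Geo
end PartTwentyTwo

section PartTwentyThree

variable {m n : ℕ}

lemma avg_eq (k : EV m → ℝ) {p : ℝ≥0∞} (hp1 : 1 ≤ p) (hp : p ≠ ⊤) (W : ℝ → ℝ≥0∞) :
    avg k p W = (muK k Set.univ ^ (p.toReal - 1)) ^ (1 / p.toReal) * eLpNorm (fun z => W ‖z‖) p (muK k) := by
  have hr := toReal_one_le hp1 hp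
  have hr0 : 0 < p.toReal := by linarith
  rw [avg, ENNReal.mul_rpow_of_nonneg _ _ (by positivity), ← eLpNorm_rpow_eq' _ hp1 hp, ← ENNReal.rpow_mul (eLpNorm (fun z => W ‖z‖) p (muK k)),
    mul_one_div_cancel hr0.ne', ENNReal.rpow_one]

lemma avg_mono (k : EV m → ℝ) (p : ℝ≥0∞) {W V : ℝ → ℝ≥0∞} (h : ∀ t, 0 ≤ t → W t ≤ V t) : avg k p W ≤ avg k p V := by
  unfold avg
  gcongr with z
  exact h _ (norm_nonneg z)

lemma avg_const {k : EV m → ℝ} {p : ℝ≥0∞} (hp1 : 1 ≤ p) (hp : p ≠ ⊤) (c : ℝ≥0∞) :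
    avg k p (fun _ => c) = muK k Set.univ * c := by
  have hr := toReal_one_le hp1 hp
  have hr0 : 0 < p.toReal := by linarith
  rw [avg, lintegral_const, mul_comm (c ^ _), ← mul_assoc]
  have : muK k Set.univ ^ (p.toReal - 1) * muK k Set.univ = muK k Set.univ ^ p.toReal := by
    conv_rhs => rw [show p.toReal = (p.toReal - 1) + 1 by ring]
    rw [ENNReal.rpow_add_of_nonneg _ _ (by linarith) (by norm_num), ENNReal.rpow_one]
  rw [this, ← ENNReal.mul_rpow_of_nonneg _ _ hr0.le, ← ENNReal.rpow_mul,
    mul_one_div_cancel hr0.ne', ENNReal.rpow_one]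

lemma avg_add {k : EV m → ℝ} {p : ℝ≥0∞} (hp1 : 1 ≤ p) (hp : p ≠ ⊤) {W V : ℝ → ℝ≥0∞} (hV : Monotone V) {c : ℝ≥0∞}
    (h : ∀ t, W t ≤ V t + c) : avg k p W ≤ avg k p V + muK k Set.univ * c := by
  rw [← avg_const (k := k) hp1 hp c]
  refine (avg_mono k p (V := fun t => V t + c) fun t _ => h t).trans ?_
  rw [avg_eq k hp1 hp, avg_eq k hp1 hp, avg_eq k hp1 hp, ← mul_add]
  have hm : Measurable fun z : EV m => V ‖z‖ := hV.measurable.comp measurable_norm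
  exact mul_le_mul_right (eLpNorm_add_le hm.aestronglyMeasurable measurable_const.aestronglyMeasurable hp1) _

lemma avg_scaled {ρ : EV m → ℝ} (hρ : Measurable ρ) {ε : ℝ} (hε : 0 < ε) (p : ℝ≥0∞) {W : ℝ → ℝ≥0∞} (hW : Measurable W) :
    avg (scaled ρ ε) p W = (muK ρ Set.univ ^ (p.toReal - 1) * ∫⁻ z, W (ε * ‖z‖) ^ p.toReal ∂(muK ρ)) ^ (1 / p.toReal) := by
  rw [avg, muK_scaled_univ hρ hε, muK_scaled hρ hε (F := fun z => W ‖z‖ ^ p.toReal)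
    ((hW.comp measurable_norm).pow_const _)]
  simp only [norm_smul, Real.norm_of_nonneg hε.le]

lemma avg_rate {ρ : EV m → ℝ} (hk : Ker ρ) {ε : ℝ} (hε : 0 < ε) {p : ℝ≥0∞} (hp1 : 1 ≤ p) (hp : p ≠ ⊤) {W : ℝ → ℝ≥0∞}
    {c : ℝ≥0∞} (h : ∀ t, 0 ≤ t → W t ≤ c * ENNReal.ofReal t ^ (1 / p.toReal)) :
    avg (scaled ρ ε) p W ≤ (muK ρ Set.univ ^ (p.toReal - 1) * ∫⁻ z, ENNReal.ofReal ‖z‖ ∂(muK ρ)) ^ (1 / p.toReal) *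
      ENNReal.ofReal ε ^ (1 / p.toReal) * c := by
  have hr := toReal_one_le hp1 hp
  have hr0 : 0 < p.toReal := by linarith
  refine (avg_mono _ p (V := fun t => c * ENNReal.ofReal t ^ (1 / p.toReal)) h).trans (le_of_eq ?_)
  rw [avg_scaled hk.meas hε p (by fun_prop)]
  have e1 : ∀ z : EV m, (c * ENNReal.ofReal (ε * ‖z‖) ^ (1 / p.toReal)) ^ p.toReal =
      c ^ p.toReal * ENNReal.ofReal ε * ENNReal.ofReal ‖z‖ := fun z => by
    rw [ENNReal.mul_rpow_of_nonneg _ _ hr0.le, ← ENNReal.rpow_mul, one_div_mul_cancel hr0.ne', ENNReal.rpow_one,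
      ENNReal.ofReal_mul hε.le, mul_assoc]
  simp only [e1]
  rw [lintegral_const_mul _ (by fun_prop), ← mul_assoc, mul_comm _ (c ^ p.toReal * _), mul_assoc,
    ENNReal.mul_rpow_of_nonneg _ _ (by positivity), ENNReal.mul_rpow_of_nonneg _ _ (by positivity), ← ENNReal.rpow_mul,
    mul_one_div_cancel hr0.ne', ENNReal.rpow_one]
  ring

lemma avg_tendsto {ρ : EV m → ℝ} (hk : Ker ρ) {p : ℝ≥0∞} (hp1 : 1 ≤ p) (hp : p ≠ ⊤) {W : ℝ → ℝ≥0∞} (hW : Monotone W)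
    {c : ℝ≥0∞} (hc : c ≠ ⊤) (hWc : ∀ t, W t ≤ c) (h0 : Tendsto W (𝓝[>] 0) (𝓝 0)) :
    Tendsto (fun ε : ℝ => avg (scaled ρ ε) p W) (𝓝[>] 0) (𝓝 0) := by
  haveI := hk.finite
  have hr := toReal_one_le hp1 hp
  have hr0 : 0 < p.toReal := by linarith
  have hW0 : W 0 = 0 := by
    refine le_antisymm (ge_of_tendsto h0 ?_) zero_le
    filter_upwards [self_mem_nhdsWithin] with t ht
    exact hW (le_of_lt ht)
  have l1 : Tendsto (fun ε : ℝ => ∫⁻ z, W (ε * ‖z‖) ^ p.toReal ∂(muK ρ)) (𝓝[>] 0) (𝓝 (∫⁻ _z : EV m, 0 ∂(muK ρ))) := by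
    refine tendsto_lintegral_filter_of_dominated_convergence (fun _ => c ^ p.toReal) ?_ ?_ ?_ ?_
    · exact Eventually.of_forall fun ε => (hW.measurable.comp (by fun_prop : Measurable fun z : EV m => ε * ‖z‖)).pow_const _
    · exact Eventually.of_forall fun ε => Eventually.of_forall fun z => ENNReal.rpow_le_rpow (hWc _) hr0.le
    · rw [lintegral_const]
      exact ENNReal.mul_ne_top (ENNReal.rpow_ne_top_of_nonneg hr0.le hc) (measure_ne_top _ _)
    · refine Eventually.of_forall fun z => ?_
      have l2 : Tendsto (fun ε : ℝ => W (ε * ‖z‖)) (𝓝[>] 0) (𝓝 0) := by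
        rcases eq_or_ne z 0 with rfl | hz
        · simp only [norm_zero, mul_zero, hW0]; exact tendsto_const_nhds
        · refine h0.comp (tendsto_nhdsWithin_iff.2 ⟨?_, ?_⟩)
          · have : Tendsto (fun ε : ℝ => ε * ‖z‖) (𝓝 0) (𝓝 (0 * ‖z‖)) := tendsto_id.mul_const _
            rw [zero_mul] at this
            exact this.mono_left nhdsWithin_le_nhds
          · filter_upwards [self_mem_nhdsWithin] with ε hε
            exact mul_pos hε (norm_pos_iff.2 hz)
      have := (ENNReal.continuous_rpow_const (y := p.toReal)).continuousAt.tendsto.comp l2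
      rw [ENNReal.zero_rpow_of_pos hr0] at this
      exact this
  rw [lintegral_zero] at l1
  have hμ : muK ρ Set.univ ^ (p.toReal - 1) ≠ ⊤ := ENNReal.rpow_ne_top_of_nonneg (by linarith) (measure_ne_top _ _)
  have l3 := ENNReal.Tendsto.const_mul l1 (Or.inr hμ)
  rw [mul_zero] at l3
  have l4 := (ENNReal.continuous_rpow_const (y := 1 / p.toReal)).continuousAt.tendsto.comp l3
  rw [ENNReal.zero_rpow_of_pos (by positivity)] at l4
  refine l4.congr' ?_
  filter_upwards [self_mem_nhdsWithin] with ε hε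
  exact (avg_scaled hk.meas hε p hW.measurable).symm

namespace Geo
variable {e : EV m} {τ : EV m → ℝ} {K : ℝ}

lemma Wm_mono (G : Geo e τ K) (p : ℝ≥0∞) (D : List (Fin m) → EV m → ℝ) : Monotone (Wm τ K p D) := by
  intro s t h
  unfold Wm
  exact Finset.sum_le_sum fun i _ => Finset.sum_le_sum fun j _ => G.mdl_mono p _ h

lemma sum2_le {c : ℝ≥0∞} {f : Fin m → Fin m → ℝ≥0∞} (h : ∀ i j, f i j ≤ c) : ∑ i, ∑ j, f i j ≤ m * m * c := by
  refine (Finset.sum_le_card_nsmul _ _ (m * c) fun i _ => ?_).trans (le_of_eq ?_)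
  · refine (Finset.sum_le_card_nsmul _ _ c fun j _ => h i j).trans (le_of_eq ?_)
    simp
  · simp [mul_assoc]

lemma Wm_le (G : Geo e τ K) {p : ℝ≥0∞} (hp1 : 1 ≤ p) {D : List (Fin m) → EV m → ℝ} (hD : ∀ i j, Measurable (D [i, j])) (t : ℝ) :
    Wm τ K p D t ≤ m * m * (3 * WNormD 2 p (volume.restrict (Om τ)) D) := by
  refine sum2_le fun i j => (G.mdl_le hp1 (hD i j) t).trans ?_
  exact mul_le_mul_right (le_WNormD p _ D (by simp)) _

lemma Wm_sub (G : Geo e τ K) {p : ℝ≥0∞} (hp1 : 1 ≤ p) {D D' : List (Fin m) → EV m → ℝ} (hD : ∀ i j, Measurable (D [i, j]))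
    (hD' : ∀ i j, Measurable (D' [i, j])) (t : ℝ) :
    Wm τ K p D t ≤ Wm τ K p D' t + m * m * (3 * WNormD 2 p (volume.restrict (Om τ)) fun l x => D l x - D' l x) := by
  have h1 : Wm τ K p D t ≤ ∑ i, ∑ j, (mdl τ K p (D' [i, j]) t +
      3 * eLpNorm (fun x => D [i, j] x - D' [i, j] x) p (volume.restrict (Om τ))) :=
    Finset.sum_le_sum fun i _ => Finset.sum_le_sum fun j _ => G.mdl_sub hp1 (hD i j) (hD' i j) t
  refine h1.trans ?_
  simp only [Finset.sum_add_distrib]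
  refine add_le_add le_rfl (sum2_le fun i j => ?_)
  exact mul_le_mul_right (le_WNormD p _ (fun l x => D l x - D' l x) (l := [i, j]) (by simp)) _

lemma Wm_tendsto (G : Geo e τ K) {p : ℝ≥0∞} (hp1 : 1 ≤ p) (hp : p ≠ ⊤) {D : List (Fin m) → EV m → ℝ} {k : ℕ}
    (hD : Jet (Om τ) k p D) : Tendsto (Wm τ K p D) (𝓝[>] 0) (𝓝 0) := by
  have : Tendsto (Wm τ K p D) (𝓝[>] 0) (𝓝 (∑ _i : Fin m, ∑ _j : Fin m, (0:ℝ≥0∞))) := by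
    unfold Wm
    exact tendsto_finsetSum _ fun i _ => tendsto_finsetSum _ fun j _ => G.mdl_tendsto hp1 hp (hD.meas _) (hD.memLp _)
  simpa using this

lemma Wm_rate (G : Geo e τ K) {p : ℝ≥0∞} (hp1 : 1 ≤ p) (hp : p ≠ ⊤) {D : List (Fin m) → EV m → ℝ}
    (hD : Jet (Om τ) 3 p D) {t : ℝ} (ht : 0 ≤ t) : Wm τ K p D t ≤
      (m * m * (ENNReal.ofReal ((1 + 2 * K) ^ 2 + K + 3) * ((1 + m) * WNormD 3 p (volume.restrict (Om τ)) D))) *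
        ENNReal.ofReal t ^ (1 / p.toReal) := by
  rw [mul_assoc]
  refine sum2_le fun i j => (G.mdl_rate hp1 hp hD (l := [i, j]) (by simp) ht).trans ?_
  rw [mul_assoc, mul_assoc]
  refine mul_le_mul_right ?_ _
  rw [mul_comm]
  refine mul_le_mul_left ?_ _
  rw [add_mul, one_mul]
  refine add_le_add (le_WNormD p _ D (by simp)) ?_
  refine (Finset.sum_le_card_nsmul _ _ _ fun i' _ => le_WNormD p _ D (k := 3) (l := [i', i, j]) (by simp)).trans (le_of_eq ?_)
  simp

lemma Lval_meas (G : Geo e τ K) {k : EV m → ℝ} (hk : Ker k) {U : EV m → ℝ} (hU : ContDiff ℝ 2 U) : Measurable (Lval τ k U) := by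
  have hUm : Measurable U := hU.continuous.measurable
  have hdU : Continuous (fderiv ℝ U) := hU.continuous_fderiv (by norm_num)
  have hd2 : Measurable fun q : EV m × EV m => fderiv ℝ U q.1 q.2 :=
    ((hdU.comp continuous_fst).clm_apply continuous_snd).measurable
  have hS : MeasurableSet {q : EV m × EV m | q.1 - q.2 ∈ Om τ} :=
    (by fun_prop : Measurable fun q : EV m × EV m => q.1 - q.2) G.measOm
  have hJ : Measurable fun q : EV m × EV m => kernelJ k q.2 := hk.measJ.comp measurable_snd
  have f1 : Measurable ({q : EV m × EV m | q.1 - q.2 ∈ Om τ}.indicator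
      fun q => kernelJ k q.2 * (U q.1 - U (q.1 - q.2) - fderiv ℝ U q.1 q.2)) :=
    (hJ.mul (((by fun_prop : Measurable fun q : EV m × EV m => U q.1 - U (q.1 - q.2))).sub hd2)).indicator hS
  have f2 : Measurable ({q : EV m × EV m | q.1 - q.2 ∈ Om τ}ᶜ.indicator
      fun q => kernelJ k q.2 * fderiv ℝ U q.1 q.2) := (hJ.mul hd2).indicator hS.compl
  have g1 := f1.stronglyMeasurable.integral_prod_right' (ν := (volume : Measure (EV m)))
  have g2 := f2.stronglyMeasurable.integral_prod_right' (ν := (volume : Measure (EV m)))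
  have e1 : Lval τ k U = fun x => (∫ z, ({q : EV m × EV m | q.1 - q.2 ∈ Om τ}.indicator
      fun q => kernelJ k q.2 * (U q.1 - U (q.1 - q.2) - fderiv ℝ U q.1 q.2)) (x, z)) -
      ∫ z, ({q : EV m × EV m | q.1 - q.2 ∈ Om τ}ᶜ.indicator fun q => kernelJ k q.2 * fderiv ℝ U q.1 q.2) (x, z) := by
    funext x
    unfold Lval
    rw [← integral_indicator (G.measAx x), ← integral_indicator (G.measAx x).compl]
    rfl
  rw [e1]
  exact (g1.sub g2).measurable

lemma Lval_comb (G : Geo e τ K) {k : EV m → ℝ} (hk : Ker k) {U V : EV m → ℝ} (hU : ContDiff ℝ 2 U) (hc : HasCompactSupport U)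
    (hV : ContDiff ℝ 2 V) (hc' : HasCompactSupport V) (a b : ℝ) {x : EV m} (hx : x ∈ Om τ) :
    Lval τ k (fun y => a * U y + b * V y) x = a * Lval τ k U x + b * Lval τ k V x := by
  have hK := G.Kpos
  have hx' : 0 < τ x := hx
  have r0 : 0 < τ x / K := div_pos hx' hK
  have far : ∀ z ∈ (Ax τ x)ᶜ, τ x / K ≤ ‖z‖ := fun z hz => by
    rw [div_le_iff₀ hK, mul_comm]; exact G.Axc_far hz
  have I1 : ∀ {W : EV m → ℝ}, ContDiff ℝ 2 W → HasCompactSupport W →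
      IntegrableOn (fun z => kernelJ k z * (W x - W (x - z) - fderiv ℝ W x z)) (Ax τ x) := by
    intro W hW hcW
    obtain ⟨C, hC0, hC⟩ := snd_bounded hW hcW
    have hWm : Measurable W := hW.continuous.measurable
    have hgm : Measurable fun z => W x - W (x - z) - fderiv ℝ W x z :=
      (by fun_prop : Measurable fun z => W x - W (x - z)).sub (fderiv ℝ W x).continuous.measurable
    exact (integrable_of_J2 hk hgm hC0 (taylor_one hW hC0 hC x)).integrableOn
  have I2 : ∀ W : EV m → ℝ, IntegrableOn (fun z => kernelJ k z * fderiv ℝ W x z) (Ax τ x)ᶜ := fun W =>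
    integrable_of_J1 hk _ (G.measAx x).compl r0 far
  have hd : ∀ z, fderiv ℝ (fun y => a * U y + b * V y) x z = a * fderiv ℝ U x z + b * fderiv ℝ V x z := by
    intro z
    have h1 : HasFDerivAt U (fderiv ℝ U x) x := (hU.differentiable (by norm_num) x).hasFDerivAt
    have h2 : HasFDerivAt V (fderiv ℝ V x) x := (hV.differentiable (by norm_num) x).hasFDerivAt
    have h3 : HasFDerivAt (fun y => a * U y + b * V y) (a • fderiv ℝ U x + b • fderiv ℝ V x) x :=
      (h1.const_mul a).add (h2.const_mul b)
    rw [h3.fderiv]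
    simp
  unfold Lval
  have e1 : ∫ z in Ax τ x, kernelJ k z * (a * U x + b * V x - (a * U (x - z) + b * V (x - z)) -
      fderiv ℝ (fun y => a * U y + b * V y) x z) =
      a * (∫ z in Ax τ x, kernelJ k z * (U x - U (x - z) - fderiv ℝ U x z)) +
      b * ∫ z in Ax τ x, kernelJ k z * (V x - V (x - z) - fderiv ℝ V x z) := by
    rw [← integral_const_mul, ← integral_const_mul, ← integral_add ((I1 hU hc).const_mul a) ((I1 hV hc').const_mul b)]
    congr 1; funext z; rw [hd]; ring
  have e2 : ∫ z in (Ax τ x)ᶜ, kernelJ k z * fderiv ℝ (fun y => a * U y + b * V y) x z =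
      a * (∫ z in (Ax τ x)ᶜ, kernelJ k z * fderiv ℝ U x z) +
      b * ∫ z in (Ax τ x)ᶜ, kernelJ k z * fderiv ℝ V x z := by
    rw [← integral_const_mul, ← integral_const_mul, ← integral_add ((I2 U).const_mul a) ((I2 V).const_mul b)]
    congr 1; funext z; rw [hd]; ring
  rw [e1, e2]; ring

end Geo
end PartTwentyThree

section PartTwentyFour

variable {m n : ℕ}

lemma WNormD_le_add {k : ℕ} {p : ℝ≥0∞} (hp1 : 1 ≤ p) {μ : Measure (EV m)} {D E : List (Fin m) → EV m → ℝ}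
    (hD : ∀ l, l.length ≤ k → AEStronglyMeasurable (D l) μ) (hE : ∀ l, l.length ≤ k → AEStronglyMeasurable (E l) μ) :
    WNormD k p μ D ≤ WNormD k p μ E + WNormD k p μ (fun l x => D l x - E l x) := by
  rw [WNormD_eq, WNormD_eq, WNormD_eq, ← Finset.sum_add_distrib]
  refine Finset.sum_le_sum fun l hl => ?_
  have hl' := mem_LL.1 hl
  have : D l = E l + fun x => D l x - E l x := by funext x; simp
  conv_lhs => rw [this]
  exact eLpNorm_add_le (hE l hl') ((hD l hl').sub (hE l hl')) hp1

lemma WNormD_mono {k k' : ℕ} (h : k ≤ k') (p : ℝ≥0∞) (μ : Measure (EV m)) (D : List (Fin m) → EV m → ℝ) :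
    WNormD k p μ D ≤ WNormD k' p μ D := by
  rw [WNormD_eq, WNormD_eq]
  refine Finset.sum_le_sum_of_subset fun l hl => ?_
  exact mem_LL.2 ((mem_LL.1 hl).trans h)

lemma WNormD_ne_top {k : ℕ} {p : ℝ≥0∞} {μ : Measure (EV m)} {D : List (Fin m) → EV m → ℝ}
    (h : ∀ l, l.length ≤ k → MemLp (D l) p μ) : WNormD k p μ D ≠ ⊤ := by
  rw [WNormD_eq]
  exact ENNReal.sum_ne_top.2 fun l hl => (h l (mem_LL.1 hl)).eLpNorm_ne_top

lemma WNormD_tendsto {α : Type*} {F : Filter α} {k : ℕ} {p : ℝ≥0∞} {μ : Measure (EV m)} {D : α → List (Fin m) → EV m → ℝ}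
    (h : ∀ l, l.length ≤ k → Tendsto (fun s => eLpNorm (D s l) p μ) F (𝓝 0)) :
    Tendsto (fun s => WNormD k p μ (D s)) F (𝓝 0) := by
  simp only [WNormD_eq]
  have := tendsto_finsetSum (LL m k) fun l hl => h l (mem_LL.1 hl)
  simpa using this

/-- admissible smooth functions -/
structure Adm (τ : EV m → ℝ) (p : ℝ≥0∞) (U : EV m → ℝ) : Prop where
  c2 : ContDiff ℝ 2 U
  cs : HasCompactSupport U
  wn : MemWN (Om τ) 1 2 p U

lemma Adm.sob {τ : EV m → ℝ} {p : ℝ≥0∞} {U : EV m → ℝ} (hm : MeasurableSet (Om τ)) (h : Adm τ p U) :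
    IsSobDerivs (Om τ) 2 p U (fun l => partialDList l U) :=
  sob_of_cc (k := 2) hm (by exact_mod_cast h.c2) h.cs

lemma partialDList_comb (l : List (Fin m)) (hl : l.length ≤ 2) {U V : EV m → ℝ} (hU : ContDiff ℝ 2 U) (hV : ContDiff ℝ 2 V)
    (a b : ℝ) : partialDList l (fun x => a * U x + b * V x) = fun x => a * partialDList l U x + b * partialDList l V x := by
  have key : ∀ l : List (Fin m), l.length ≤ 2 → partialDList l (fun x => a * U x + b * V x) =
      fun x => a * partialDList l U x + b * partialDList l V x := by
    intro l
    induction l with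
    | nil => intro _; rfl
    | cons i l ih =>
      intro hl
      simp only [List.length_cons] at hl
      funext x
      have e := ih (by omega)
      have dU : DifferentiableAt ℝ (partialDList l U) x :=
        (contDiff_partialDList (k := 1) l (hU.of_le (by
          have : l.length + 1 ≤ 2 := by omega
          exact_mod_cast (by omega : 1 + l.length ≤ 2)))).differentiable (by norm_num) x
      have dV : DifferentiableAt ℝ (partialDList l V) x :=
        (contDiff_partialDList (k := 1) l (hV.of_le (by
          exact_mod_cast (by omega : 1 + l.length ≤ 2)))).differentiable (by norm_num) x
      have h3 : HasFDerivAt (fun y => a * partialDList l U y + b * partialDList l V y)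
          (a • fderiv ℝ (partialDList l U) x + b • fderiv ℝ (partialDList l V) x) x :=
        (dU.hasFDerivAt.const_mul a).add (dV.hasFDerivAt.const_mul b)
      simp only [partialDList, partialD]
      rw [e, h3.fderiv]
      simp
  exact key l hl

lemma Adm.comb {τ : EV m → ℝ} {p : ℝ≥0∞} (hp1 : 1 ≤ p) (ho : IsOpen (Om τ)) {U V : EV m → ℝ} (h : Adm τ p U) (h' : Adm τ p V)
    (a b : ℝ) : Adm τ p (fun x => a * U x + b * V x) where
  c2 := (contDiff_const.mul h.c2).add (contDiff_const.mul h'.c2)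
  cs := (HasCompactSupport.mul_left (f := fun _ => a) h.cs).add (HasCompactSupport.mul_left (f := fun _ => b) h'.cs)
  wn := h.wn.comb ho hp1 h'.wn a b

/-- the main estimate -/
def MainEst (τ : EV m → ℝ) (K : ℝ) (ρ : EV m → ℝ) (p : ℝ≥0∞) (C : ℝ≥0∞) : Prop :=
  ∀ ε : ℝ, 0 < ε → ε ≤ 1 → ∀ U, Adm τ p U →
    eLpNorm (fun x => Lval τ (scaled ρ ε) U x + ∑ i, partialDList [i, i] U x) p (volume.restrict (Om τ)) ≤
      C * (avg (scaled ρ ε) p (Wm τ K p fun l => partialDList l U) +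
        ENNReal.ofReal ε ^ (1 / p.toReal) * WNormD 2 p (volume.restrict (Om τ)) fun l => partialDList l U)

lemma exists_mainEst {ρ : EV (n + 1) → ℝ} (hk : Ker ρ) (h2 : A2 ρ) (hM : momentum ρ = 1) {p : ℝ≥0∞} (hp1 : 1 ≤ p) (hp : p ≠ ⊤)
    {Q : Matrix (Fin (n + 1)) (Fin (n + 1)) ℝ} (hQ : Qᵀ * Q = 1) {τ : EV (n + 1) → ℝ} {K : ℝ} (G : Geo (rotS Q (0, 1)) τ K) :
    ∃ C, C ≠ ⊤ ∧ MainEst τ K ρ p C := by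
  obtain ⟨C, hCt, hC⟩ := Ef_unif hk h2 K G.Kpos.le
  have hr := toReal_one_le hp1 hp
  have hr0 : 0 < p.toReal := by linarith
  set N1 := ∫⁻ z, ENNReal.ofReal ‖z‖ ∂muK ρ with hN1
  set A : ℝ≥0∞ := ENNReal.ofReal ((1 + 2 * K) ^ 2) * (((n + 1 : ℕ) : ℝ≥0∞) * (n + 1 : ℕ)) + (n + 1 : ℕ) * (n + 1 : ℕ) +
    ENNReal.ofReal (K * K) with hA
  set B : ℝ≥0∞ := (n + 1 : ℕ) * ((C ^ (p.toReal - 1) * (ENNReal.ofReal (2 * K) * N1)) ^ (1 / p.toReal) * (1 + (n + 1 : ℕ))) with hB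
  have hAt : A ≠ ⊤ := by
    refine ENNReal.add_ne_top.2 ⟨ENNReal.add_ne_top.2 ⟨ENNReal.mul_ne_top ENNReal.ofReal_ne_top ?_, ?_⟩, ENNReal.ofReal_ne_top⟩ <;>
    exact ENNReal.mul_ne_top (ENNReal.natCast_ne_top _) (ENNReal.natCast_ne_top _)
  have hBt : B ≠ ⊤ := by
    refine ENNReal.mul_ne_top (ENNReal.natCast_ne_top _) (ENNReal.mul_ne_top (ENNReal.rpow_ne_top_of_nonneg (by positivity) ?_) ?_)
    · exact ENNReal.mul_ne_top (ENNReal.rpow_ne_top_of_nonneg (by linarith) hCt)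
        (ENNReal.mul_ne_top ENNReal.ofReal_ne_top hk.norm_fin)
    · exact ENNReal.add_ne_top.2 ⟨ENNReal.one_ne_top, ENNReal.natCast_ne_top _⟩
  refine ⟨A + B, ENNReal.add_ne_top.2 ⟨hAt, hBt⟩, fun ε hε hε1 U hU => ?_⟩
  refine (G.main_norm (hk.scaled hε) (halfSym_scaled hk h2 hM hε) ((momentum_scaled hε).trans hM) hp1 hp
    (hC Q hQ τ G ε hε) hCt hU.c2 hU.cs hU.wn.2).trans ?_
  rw [muK_scaled_norm hk.meas hε, ← hN1]
  have e1 : C ^ (p.toReal - 1) * (ENNReal.ofReal (2 * K) * (ENNReal.ofReal ε * N1)) =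
      ENNReal.ofReal ε * (C ^ (p.toReal - 1) * (ENNReal.ofReal (2 * K) * N1)) := by ring
  rw [e1, ENNReal.mul_rpow_of_nonneg _ _ (by positivity : 0 ≤ 1 / p.toReal), mul_add]
  refine add_le_add (mul_le_mul_left le_self_add _) ?_
  refine le_trans (le_of_eq ?_) (mul_le_mul_left (le_add_self : B ≤ A + B) _)
  rw [hB]; ring

lemma op_bound {τ : EV m → ℝ} {K : ℝ} {e : EV m} (G : Geo e τ K) {ρ : EV m → ℝ} (hk : Ker ρ) {p : ℝ≥0∞} (hp1 : 1 ≤ p) (hp : p ≠ ⊤)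
    {C : ℝ≥0∞} (hC : C ≠ ⊤) (hE : MainEst τ K ρ p C) :
    ∃ c, c ≠ ⊤ ∧ ∀ ε : ℝ, 0 < ε → ε ≤ 1 → ∀ U, Adm τ p U →
      eLpNorm (Lval τ (scaled ρ ε) U) p (volume.restrict (Om τ)) ≤
        c * WNormD 2 p (volume.restrict (Om τ)) fun l => partialDList l U := by
  haveI := hk.finite
  have hr := toReal_one_le hp1 hp
  have hr0 : 0 < p.toReal := by linarith
  have hmt : (m : ℝ≥0∞) ≠ ⊤ := ENNReal.natCast_ne_top _
  refine ⟨C * (muK ρ Set.univ * (m * m * 3) + 1) + m, ?_, fun ε hε hε1 U hU => ?_⟩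
  · refine ENNReal.add_ne_top.2 ⟨ENNReal.mul_ne_top hC (ENNReal.add_ne_top.2 ⟨ENNReal.mul_ne_top (measure_ne_top _ _)
      (ENNReal.mul_ne_top (ENNReal.mul_ne_top hmt hmt) (by norm_num)), ENNReal.one_ne_top⟩), hmt⟩
  set μ := volume.restrict (Om τ)
  set N := WNormD 2 p μ fun l => partialDList l U with hN
  have hc2 : ∀ i j : Fin m, Continuous (partialDList [i, j] U) := fun i j => cont_partialDList hU.c2 (by simp)
  have hS : Measurable fun x => ∑ i, partialDList [i, i] U x := Finset.measurable_fun_sum _ fun i _ => (hc2 i i).measurable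
  have hL := G.Lval_meas (hk.scaled hε) hU.c2
  have b1 : eLpNorm (fun x => ∑ i, partialDList [i, i] U x) p μ ≤ m * N := by
    have e0 : (fun x => ∑ i, partialDList [i, i] U x) = ∑ i, partialDList [i, i] U := by funext x; simp
    rw [e0]
    refine (eLpNorm_sum_le (fun i _ => (hc2 i i).measurable.aestronglyMeasurable) hp1).trans ?_
    refine (Finset.sum_le_card_nsmul _ _ N fun i _ => le_WNormD p μ (fun l => partialDList l U) (by simp)).trans (le_of_eq ?_)
    simp
  have e1 : Lval τ (scaled ρ ε) U = (fun x => Lval τ (scaled ρ ε) U x + ∑ i, partialDList [i, i] U x) -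
      fun x => ∑ i, partialDList [i, i] U x := by funext x; simp
  rw [e1]
  refine (eLpNorm_sub_le (hL.add hS).aestronglyMeasurable hS.aestronglyMeasurable hp1).trans ?_
  rw [add_mul]
  refine add_le_add ((hE ε hε hε1 U hU).trans ?_) b1
  rw [mul_assoc]
  refine mul_le_mul_right ?_ _
  rw [add_mul]
  refine add_le_add ?_ (mul_le_mul_left ?_ _)
  · refine (avg_mono _ p (V := fun _ => m * m * (3 * N)) fun t _ => G.Wm_le hp1 (fun i j => (hc2 i j).measurable) t).trans (le_of_eq ?_)
    rw [avg_const hp1 hp, muK_scaled_univ hk.meas hε]; ring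
  · refine ENNReal.rpow_le_one ?_ (by positivity)
    rw [← ENNReal.ofReal_one]; exact ENNReal.ofReal_le_ofReal hε1

lemma lp_limit {X : Type*} [MeasurableSpace X] {μ : Measure X} {p : ℝ≥0∞} (hp1 : 1 ≤ p) {f : ℕ → X → ℝ}
    (hf : ∀ k, MemLp (f k) p μ) {b : ℕ → ℝ≥0∞} (hb : Tendsto b atTop (𝓝 0))
    (h : ∀ i j, eLpNorm (fun x => f i x - f j x) p μ ≤ b i + b j) :
    ∃ g, MemLp g p μ ∧ Tendsto (fun k => eLpNorm (fun x => f k x - g x) p μ) atTop (𝓝 0) := by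
  haveI : Fact (1 ≤ p) := ⟨hp1⟩
  have hC : CauchySeq fun k => (hf k).toLp (f k) := by
    rw [EMetric.cauchySeq_iff]
    intro δ hδ
    have h2 : ∀ᶠ k in atTop, b k < δ / 2 := (tendsto_order.1 hb).2 _ (ENNReal.half_pos hδ.ne')
    obtain ⟨N, hN⟩ := eventually_atTop.1 h2
    refine ⟨N, fun i hi j hj => ?_⟩
    rw [Lp.edist_toLp_toLp]
    calc _ ≤ b i + b j := h i j
      _ < δ / 2 + δ / 2 := ENNReal.add_lt_add (hN i hi) (hN j hj)
      _ = δ := ENNReal.add_halves δ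
  obtain ⟨g, hg⟩ := cauchySeq_tendsto_of_complete hC
  refine ⟨g, Lp.memLp g, ?_⟩
  rw [tendsto_iff_edist_tendsto_0] at hg
  refine hg.congr fun k => ?_
  rw [Lp.edist_def]
  refine eLpNorm_congr_ae ?_
  filter_upwards [(hf k).coeFn_toLp] with x hx
  simp [hx]

end PartTwentyFour

section PartTwentyFive

variable {m n : ℕ} {e : EV m} {τ : EV m → ℝ} {K : ℝ} {p : ℝ≥0∞}

lemma aesm_pd {U : EV m → ℝ} (h : Adm τ p U) (μ : Measure (EV m)) (l : List (Fin m)) (hl : l.length ≤ 2) :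
    AEStronglyMeasurable (partialDList l U) μ := (cont_partialDList h.c2 hl).measurable.aestronglyMeasurable

lemma Geo.approx (G : Geo e τ K) (hp1 : 1 ≤ p) (hp : p ≠ ⊤) {u : EV m → ℝ} {D D' : List (Fin m) → EV m → ℝ}
    (h : IsSobDerivs (Om τ) 2 p u D) (hN : NeumannBC (Om τ) 1 p u) (hD' : Jet (Om τ) 2 p D')
    (he : ∀ l : List (Fin m), l.length ≤ 2 → D' l =ᵐ[volume.restrict (Om τ)] D l) :
    ∃ U : ℝ → EV m → ℝ, (∀ s, 0 < s → s ≤ 1 → Adm τ p (U s)) ∧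
      Tendsto (fun s => WNormD 2 p (volume.restrict (Om τ)) fun l x => partialDList l (U s) x - D' l x) (𝓝[>] 0) (𝓝 0) := by
  obtain ⟨U, hU, hU2⟩ := G.density hp1 hp hD' (G.jetBC_of hp1 h hN he)
  refine ⟨U, fun s h0 h1 => ?_, WNormD_tendsto fun l hl => (hU2 l hl).2⟩
  obtain ⟨a, b, c⟩ := hU s h0 h1
  exact ⟨a, b, G.memWN_of_cc hp1 a b c⟩

/-- `g` is the value at `u` of the extension by continuity -/
def IsLim (τ : EV m → ℝ) (k : EV m → ℝ) (p : ℝ≥0∞) (u g : EV m → ℝ) : Prop :=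
  MemLp g p (volume.restrict (Om τ)) ∧ ∃ (V : ℕ → EV m → ℝ) (D : List (Fin m) → EV m → ℝ),
    (∀ j, Adm τ p (V j)) ∧ IsSobDerivs (Om τ) 2 p u D ∧
    Tendsto (fun j => WNormD 2 p (volume.restrict (Om τ)) fun l x => partialDList l (V j) x - D l x) atTop (𝓝 0) ∧
    Tendsto (fun j => eLpNorm (fun x => Lval τ k (V j) x - g x) p (volume.restrict (Om τ))) atTop (𝓝 0)

/-- uniform bound -/
def OpB (τ : EV m → ℝ) (k : EV m → ℝ) (p : ℝ≥0∞) (c : ℝ≥0∞) : Prop :=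
  ∀ U, Adm τ p U → eLpNorm (Lval τ k U) p (volume.restrict (Om τ)) ≤
    c * WNormD 2 p (volume.restrict (Om τ)) fun l => partialDList l U

lemma WNormD_comb_le (hp1 : 1 ≤ p) {μ : Measure (EV m)} {D E : List (Fin m) → EV m → ℝ} (a b : ℝ)
    (hD : ∀ l, l.length ≤ 2 → AEStronglyMeasurable (D l) μ) (hE : ∀ l, l.length ≤ 2 → AEStronglyMeasurable (E l) μ) :
    WNormD 2 p μ (fun l x => a * D l x + b * E l x) ≤
      ENNReal.ofReal |a| * WNormD 2 p μ D + ENNReal.ofReal |b| * WNormD 2 p μ E := by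
  rw [WNormD_eq, WNormD_eq, WNormD_eq, Finset.mul_sum, Finset.mul_sum, ← Finset.sum_add_distrib]
  refine Finset.sum_le_sum fun l hl => ?_
  have hl' := mem_LL.1 hl
  have e1 : (fun x => a * D l x + b * E l x) = a • D l + b • E l := rfl
  rw [e1]
  refine (eLpNorm_add_le ((hD l hl').const_smul a) ((hE l hl').const_smul b) hp1).trans (le_of_eq ?_)
  rw [eLpNorm_const_smul, eLpNorm_const_smul, Real.enorm_eq_ofReal_abs, Real.enorm_eq_ofReal_abs]

lemma aesm_D {u : EV m → ℝ} {D : List (Fin m) → EV m → ℝ} (h : IsSobDerivs (Om τ) 2 p u D) (l : List (Fin m)) (hl : l.length ≤ 2) :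
    AEStronglyMeasurable (D l) (volume.restrict (Om τ)) := (h.2.2 l hl).aestronglyMeasurable

lemma OpB.memLp (G : Geo e τ K) {k : EV m → ℝ} (hk : Ker k) {c : ℝ≥0∞} (hc : c ≠ ⊤) (hB : OpB τ k p c) {U : EV m → ℝ}
    (hU : Adm τ p U) : MemLp (Lval τ k U) p (volume.restrict (Om τ)) :=
  ⟨(G.Lval_meas hk hU.c2).aestronglyMeasurable, (hB U hU).trans_lt
    (ENNReal.mul_lt_top hc.lt_top (WNormD_ne_top (hU.sob G.measOm).2.2).lt_top)⟩

lemma IsLim.of_adm (G : Geo e τ K) {k : EV m → ℝ} (hk : Ker k) {c : ℝ≥0∞} (hc : c ≠ ⊤) (hB : OpB τ k p c) {U : EV m → ℝ}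
    (hU : Adm τ p U) : IsLim τ k p U (Lval τ k U) := by
  refine ⟨hB.memLp G hk hc hU, fun _ => U, fun l => partialDList l U, fun _ => hU, hU.sob G.measOm, ?_, ?_⟩
  · refine WNormD_tendsto fun l _ => ?_
    simp
  · simp

lemma IsLim.comb (G : Geo e τ K) {k : EV m → ℝ} (hk : Ker k) (hp1 : 1 ≤ p) {u v g h : EV m → ℝ}
    (hu : IsLim τ k p u g) (hv : IsLim τ k p v h) (a b : ℝ) :
    IsLim τ k p (fun x => a * u x + b * v x) (fun x => a * g x + b * h x) := by
  obtain ⟨hg, V, D, hV, hD, l1, l2⟩ := hu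
  obtain ⟨hh, W, E, hW, hE, l3, l4⟩ := hv
  have z1 : Tendsto (fun j => ENNReal.ofReal |a| * WNormD 2 p (volume.restrict (Om τ)) (fun l x => partialDList l (V j) x - D l x) +
      ENNReal.ofReal |b| * WNormD 2 p (volume.restrict (Om τ)) fun l x => partialDList l (W j) x - E l x) atTop (𝓝 0) := by
    have := (ENNReal.Tendsto.const_mul l1 (Or.inr (ENNReal.ofReal_ne_top (r := |a|)))).add
      (ENNReal.Tendsto.const_mul l3 (Or.inr (ENNReal.ofReal_ne_top (r := |b|))))
    simpa using this
  have z2 : Tendsto (fun j => ENNReal.ofReal |a| * eLpNorm (fun x => Lval τ k (V j) x - g x) p (volume.restrict (Om τ)) +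
      ENNReal.ofReal |b| * eLpNorm (fun x => Lval τ k (W j) x - h x) p (volume.restrict (Om τ))) atTop (𝓝 0) := by
    have := (ENNReal.Tendsto.const_mul l2 (Or.inr (ENNReal.ofReal_ne_top (r := |a|)))).add
      (ENNReal.Tendsto.const_mul l4 (Or.inr (ENNReal.ofReal_ne_top (r := |b|))))
    simpa using this
  refine ⟨(hg.const_smul a).add (hh.const_smul b), fun j x => a * V j x + b * W j x, fun l x => a * D l x + b * E l x,
    fun j => (hV j).comb hp1 G.openOm (hW j) a b, hD.comb hp1 hE a b, ?_, ?_⟩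
  · refine tendsto_of_tendsto_of_tendsto_of_le_of_le tendsto_const_nhds z1 (fun _ => zero_le) fun j => ?_
    refine le_trans (le_of_eq (WNormD_congr p fun l hl => ?_)) (WNormD_comb_le hp1 a b
      (fun l hl => (aesm_pd (hV j) _ l hl).sub (aesm_D hD l hl)) (fun l hl => (aesm_pd (hW j) _ l hl).sub (aesm_D hE l hl)))
    refine Eventually.of_forall fun x => ?_
    simp only [partialDList_comb l hl (hV j).c2 (hW j).c2 a b]
    ring
  · refine tendsto_of_tendsto_of_tendsto_of_le_of_le tendsto_const_nhds z2 (fun _ => zero_le) fun j => ?_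
    have m1 := (G.Lval_meas hk (hV j).c2).aestronglyMeasurable (μ := volume.restrict (Om τ)) |>.sub hg.aestronglyMeasurable
    have m2 := (G.Lval_meas hk (hW j).c2).aestronglyMeasurable (μ := volume.restrict (Om τ)) |>.sub hh.aestronglyMeasurable
    have e1 : (fun x => Lval τ k (fun x => a * V j x + b * W j x) x - (a * g x + b * h x)) =ᵐ[volume.restrict (Om τ)]
        (a • (Lval τ k (V j) - g) + b • (Lval τ k (W j) - h)) := by
      filter_upwards [ae_restrict_mem G.measOm] with x hx
      rw [G.Lval_comb hk (hV j).c2 (hV j).cs (hW j).c2 (hW j).cs a b hx]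
      simp
      ring
    rw [eLpNorm_congr_ae e1]
    refine (eLpNorm_add_le (m1.const_smul a) (m2.const_smul b) hp1).trans (le_of_eq ?_)
    rw [eLpNorm_const_smul, eLpNorm_const_smul, Real.enorm_eq_ofReal_abs, Real.enorm_eq_ofReal_abs]
    rfl

lemma IsLim.bound (G : Geo e τ K) {k : EV m → ℝ} (hk : Ker k) (hp1 : 1 ≤ p) {c : ℝ≥0∞} (hc : c ≠ ⊤) (hB : OpB τ k p c)
    {u g : EV m → ℝ} (hu : IsLim τ k p u g) {D : List (Fin m) → EV m → ℝ} (hD : IsSobDerivs (Om τ) 2 p u D) :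
    eLpNorm g p (volume.restrict (Om τ)) ≤ c * WNormD 2 p (volume.restrict (Om τ)) D := by
  obtain ⟨hg, V, E, hV, hE, l1, l2⟩ := hu
  rw [WNormD_congr p (hD.unique G.openOm hp1 hE)]
  set N := WNormD 2 p (volume.restrict (Om τ)) E with hN
  have z : Tendsto (fun j => c * (N + WNormD 2 p (volume.restrict (Om τ)) fun l x => partialDList l (V j) x - E l x) +
      eLpNorm (fun x => Lval τ k (V j) x - g x) p (volume.restrict (Om τ))) atTop (𝓝 (c * (N + 0) + 0)) :=
    (ENNReal.Tendsto.const_mul (l1.const_add N) (Or.inr hc)).add l2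
  rw [add_zero, add_zero] at z
  refine ge_of_tendsto' z fun j => ?_
  have m1 := (G.Lval_meas hk (hV j).c2).aestronglyMeasurable (μ := volume.restrict (Om τ))
  have e1 : g = Lval τ k (V j) - fun x => Lval τ k (V j) x - g x := by funext x; simp
  conv_lhs => rw [e1]
  refine (eLpNorm_sub_le m1 (m1.sub hg.aestronglyMeasurable) hp1).trans ?_
  refine add_le_add ((hB _ (hV j)).trans (mul_le_mul_right ?_ _)) le_rfl
  exact WNormD_le_add hp1 (aesm_pd (hV j) _) (aesm_D hE)

lemma IsLim.unique (G : Geo e τ K) {k : EV m → ℝ} (hk : Ker k) (hp1 : 1 ≤ p) {c : ℝ≥0∞} (hc : c ≠ ⊤) (hB : OpB τ k p c)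
    {u g h : EV m → ℝ} (hg : IsLim τ k p u g) (hh : IsLim τ k p u h) : g =ᵐ[volume.restrict (Om τ)] h := by
  have h1 := hg.comb G hk hp1 hh 1 (-1)
  obtain ⟨_, _, D, _, hD, _⟩ := id hg
  have h2 := h1.bound G hk hp1 hc hB (hD.comb hp1 hD 1 (-1))
  have h3 : WNormD 2 p (volume.restrict (Om τ)) (fun l x => 1 * D l x + -1 * D l x) = 0 := by
    rw [WNormD_eq]
    refine Finset.sum_eq_zero fun l _ => ?_
    simp
  rw [h3, mul_zero, le_zero_iff, eLpNorm_eq_zero_iff h1.1.aestronglyMeasurable (by intro h0; rw [h0] at hp1; simp at hp1)] at h2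
  filter_upwards [h2] with x hx
  simp only [Pi.zero_apply] at hx
  linarith

lemma IsLim.exist (G : Geo e τ K) {k : EV m → ℝ} (hk : Ker k) (hp1 : 1 ≤ p) (hp : p ≠ ⊤) {c : ℝ≥0∞} (hc : c ≠ ⊤) (hB : OpB τ k p c)
    {u : EV m → ℝ} (hu : MemWN (Om τ) 1 2 p u) : ∃ g, IsLim τ k p u g := by
  obtain ⟨⟨D, hD⟩, hN⟩ := hu
  obtain ⟨D', hD', he⟩ := exists_jet G.measOm hD
  obtain ⟨U, hU, hU2⟩ := G.approx hp1 hp hD hN hD' he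
  have hs : Tendsto (fun j : ℕ => 1 / ((j : ℝ) + 1)) atTop (𝓝[>] 0) :=
    tendsto_nhdsWithin_iff.2 ⟨tendsto_one_div_add_atTop_nhds_zero_nat, Eventually.of_forall fun j => by
      simp only [Set.mem_Ioi]; positivity⟩
  have hV : ∀ j : ℕ, Adm τ p (U (1 / ((j : ℝ) + 1))) := fun j => hU _ (by positivity) (by
    rw [div_le_one (by positivity)]
    have : (0:ℝ) ≤ j := Nat.cast_nonneg j
    linarith)
  set V : ℕ → EV m → ℝ := fun j => U (1 / ((j : ℝ) + 1)) with hVd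
  have l0 : Tendsto (fun j => WNormD 2 p (volume.restrict (Om τ)) fun l x => partialDList l (V j) x - D' l x) atTop (𝓝 0) :=
    hU2.comp hs
  have e0 : ∀ j, (WNormD 2 p (volume.restrict (Om τ)) fun l x => partialDList l (V j) x - D' l x) =
      WNormD 2 p (volume.restrict (Om τ)) fun l x => partialDList l (V j) x - D l x := fun j =>
    WNormD_congr p fun l hl => by
      filter_upwards [he l hl] with x hx
      rw [hx]
  have l1 : Tendsto (fun j => WNormD 2 p (volume.restrict (Om τ)) fun l x => partialDList l (V j) x - D l x) atTop (𝓝 0) := by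
    simpa only [e0] using l0
  have l2 := ENNReal.Tendsto.const_mul l1 (Or.inr hc)
  rw [mul_zero] at l2
  obtain ⟨g, hg, l3⟩ := lp_limit (μ := volume.restrict (Om τ)) hp1 (f := fun j => Lval τ k (V j)) (fun j => hB.memLp G hk hc (hV j)) l2 (by
    intro i j
    have e1 : (fun x => Lval τ k (V i) x - Lval τ k (V j) x) =ᵐ[volume.restrict (Om τ)]
        Lval τ k (fun x => 1 * V i x + -1 * V j x) := by
      filter_upwards [ae_restrict_mem G.measOm] with x hx
      rw [G.Lval_comb hk (hV i).c2 (hV i).cs (hV j).c2 (hV j).cs 1 (-1) hx]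
      ring
    rw [eLpNorm_congr_ae e1, ← mul_add]
    refine (hB _ ((hV i).comb hp1 G.openOm (hV j) 1 (-1))).trans (mul_le_mul_right ?_ _)
    have h1 := WNormD_comb_le hp1 (μ := volume.restrict (Om τ)) 1 (-1) (D := fun l x => partialDList l (V i) x - D l x)
      (E := fun l x => partialDList l (V j) x - D l x)
      (fun l hl => (aesm_pd (hV i) _ l hl).sub (aesm_D hD l hl)) (fun l hl => (aesm_pd (hV j) _ l hl).sub (aesm_D hD l hl))
    simp only [abs_one, abs_neg, ENNReal.ofReal_one, one_mul] at h1
    refine le_trans (le_of_eq (WNormD_congr p fun l hl => ?_)) h1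
    refine Eventually.of_forall fun x => ?_
    simp only [partialDList_comb l hl (hV i).c2 (hV j).c2 1 (-1)]
    ring)
  exact ⟨g, hg, V, D, hV, hD, l1, l3⟩

open Classical in
/-- the extension -/
def LExt (τ : EV m → ℝ) (k : EV m → ℝ) (p : ℝ≥0∞) (u : EV m → ℝ) : EV m → ℝ :=
  if h : ∃ g, IsLim τ k p u g then h.choose else 0

lemma LExt_spec {k : EV m → ℝ} {u : EV m → ℝ} (h : ∃ g, IsLim τ k p u g) : IsLim τ k p u (LExt τ k p u) := by
  unfold LExt
  rw [dif_pos h]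
  exact h.choose_spec

lemma LExt_isExt (G : Geo e τ K) {ρ : EV m → ℝ} (hk : Ker ρ) (hp1 : 1 ≤ p) (hp : p ≠ ⊤) {c : ℝ≥0∞} (hc : c ≠ ⊤)
    {ε : ℝ} (hε : 0 < ε) (hB : OpB τ (scaled ρ ε) p c) {c' : ℝ} (hcc : c ≤ ENNReal.ofReal c') :
    IsNLExtOn (Om τ) 1 ρ p ε c' (LExt τ (scaled ρ ε) p) := by
  have hks := hk.scaled hε
  refine ⟨fun u h1 h2 h3 => ?_, fun u v hu hv a b => ?_, fun u hu => ?_, fun u D hu hD => ?_⟩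
  · have hA : Adm τ p u := ⟨h1, h2, h3⟩
    have hl := IsLim.of_adm G hks hc hB hA
    have := (LExt_spec ⟨_, hl⟩).unique G hks hp1 hc hB hl
    filter_upwards [this, ae_restrict_mem G.measOm] with x hx hxO
    rw [hx]
    exact G.pv hks h1 h2 hxO
  · have l1 := LExt_spec (IsLim.exist G hks hp1 hp hc hB hu)
    have l2 := LExt_spec (IsLim.exist G hks hp1 hp hc hB hv)
    have l3 := l1.comb G hks hp1 l2 a b
    exact (LExt_spec ⟨_, l3⟩).unique G hks hp1 hc hB l3
  · exact (LExt_spec (IsLim.exist G hks hp1 hp hc hB hu)).1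
  · exact ((LExt_spec (IsLim.exist G hks hp1 hp hc hB hu)).bound G hks hp1 hc hB hD).trans (mul_le_mul_left hcc _)

lemma ext_est (G : Geo e τ K) {ρ : EV m → ℝ} (hk : Ker ρ) (hp1 : 1 ≤ p) (hp : p ≠ ⊤) {C : ℝ≥0∞} (hC : C ≠ ⊤)
    (hE : MainEst τ K ρ p C) {ε c : ℝ} (hε : 0 < ε) (hε1 : ε ≤ 1) {L : (EV m → ℝ) → EV m → ℝ}
    (hL : IsNLExtOn (Om τ) 1 ρ p ε c L) {u : EV m → ℝ} {D D' : List (Fin m) → EV m → ℝ}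
    (hN : NeumannBC (Om τ) 1 p u) (hD : IsSobDerivs (Om τ) 2 p u D) (hD' : Jet (Om τ) 2 p D')
    (he : ∀ l : List (Fin m), l.length ≤ 2 → D' l =ᵐ[volume.restrict (Om τ)] D l) :
    eLpNorm (fun x => L u x + ∑ i, D [i, i] x) p (volume.restrict (Om τ)) ≤
      C * (avg (scaled ρ ε) p (Wm τ K p D') +
        ENNReal.ofReal ε ^ (1 / p.toReal) * WNormD 2 p (volume.restrict (Om τ)) D') := by
  haveI := hk.finite
  have hks := hk.scaled hε
  obtain ⟨U, hU, hU2⟩ := G.approx hp1 hp hD hN hD' he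
  set μ := volume.restrict (Om τ) with hμ
  set d : ℝ → ℝ≥0∞ := fun s => WNormD 2 p μ fun l x => partialDList l (U s) x - D' l x with hd
  set N := WNormD 2 p μ D' with hNN
  have hr := toReal_one_le hp1 hp
  have hr0 : 0 < p.toReal := by linarith
  have hu : MemWN (Om τ) 1 2 p u := ⟨⟨D, hD⟩, hN⟩
  have hmt : (m : ℝ≥0∞) ≠ ⊤ := ENNReal.natCast_ne_top _
  set θ := ENNReal.ofReal ε ^ (1 / p.toReal) with hθ
  have hθt : θ ≠ ⊤ := ENNReal.rpow_ne_top_of_nonneg (by positivity) ENNReal.ofReal_ne_top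
  set A := avg (scaled ρ ε) p (Wm τ K p D') with hA
  set M := muK ρ Set.univ * (m * m * 3) with hM
  have hMt : M ≠ ⊤ := ENNReal.mul_ne_top (measure_ne_top _ _) (ENNReal.mul_ne_top (ENNReal.mul_ne_top hmt hmt) (by norm_num))
  have z : Tendsto (fun s => ENNReal.ofReal c * d s + C * ((A + M * d s) + θ * (N + d s)) + m * d s) (𝓝[>] 0)
      (𝓝 (ENNReal.ofReal c * 0 + C * ((A + M * 0) + θ * (N + 0)) + m * 0)) := by
    refine ((ENNReal.Tendsto.const_mul hU2 (Or.inr ENNReal.ofReal_ne_top)).add (ENNReal.Tendsto.const_mul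
      (((ENNReal.Tendsto.const_mul hU2 (Or.inr hMt)).const_add A).add
        (ENNReal.Tendsto.const_mul (hU2.const_add N) (Or.inr hθt))) (Or.inr hC))).add
        (ENNReal.Tendsto.const_mul hU2 (Or.inr hmt))
  simp only [mul_zero, zero_add, add_zero] at z
  refine ge_of_tendsto z (ev01 fun s hs0 hs1 => ?_)
  have hV := hU s hs0 hs1
  set V := U s with hVd
  have hsV := hV.sob G.measOm
  have hLm := G.Lval_meas hks hV.c2
  have hc2 : ∀ i j : Fin m, Continuous (partialDList [i, j] V) := fun i j => cont_partialDList hV.c2 (by simp)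
  have a1 : L V =ᵐ[μ] Lval τ (scaled ρ ε) V := by
    filter_upwards [hL.1 V hV.c2 hV.cs hV.wn, ae_restrict_mem G.measOm] with x hx hxO
    exact tendsto_nhds_unique hx (G.pv hks hV.c2 hV.cs hxO)
  have a2 := hL.2.1 u V hu hV.wn 1 (-1)
  have hw := hu.comb G.openOm hp1 hV.wn 1 (-1)
  have a3 : ∀ᵐ x ∂μ, ∀ i : Fin m, D' [i, i] x = D [i, i] x := by
    rw [ae_all_iff]; intro i; exact he [i, i] (by simp)
  have e1 : (fun x => L u x + ∑ i, D [i, i] x) =ᵐ[μ] (L (fun x => 1 * u x + -1 * V x) +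
      fun x => Lval τ (scaled ρ ε) V x + ∑ i, partialDList [i, i] V x) - ∑ i, fun x => partialDList [i, i] V x - D' [i, i] x := by
    filter_upwards [a1, a2, a3] with x h1 h2 h3
    simp only [Pi.sub_apply, Pi.add_apply, Finset.sum_apply, Finset.sum_sub_distrib, h2, h1, h3]
    ring
  have m1 : AEStronglyMeasurable (L fun x => 1 * u x + -1 * V x) μ := (hL.2.2.1 _ hw).aestronglyMeasurable
  have m2 : AEStronglyMeasurable (fun x => Lval τ (scaled ρ ε) V x + ∑ i, partialDList [i, i] V x) μ :=
    (hLm.add (Finset.measurable_fun_sum _ fun i _ => (hc2 i i).measurable)).aestronglyMeasurable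
  have m3 : ∀ i : Fin m, AEStronglyMeasurable (fun x => partialDList [i, i] V x - D' [i, i] x) μ := fun i =>
    ((hc2 i i).measurable.sub (hD'.meas _)).aestronglyMeasurable
  rw [eLpNorm_congr_ae e1]
  refine (eLpNorm_sub_le (m1.add m2) (Finset.aestronglyMeasurable_sum _ fun i _ => m3 i) hp1).trans ?_
  refine add_le_add ((eLpNorm_add_le m1 m2 hp1).trans (add_le_add ?_ ((hE ε hε hε1 V hV).trans (mul_le_mul_right (add_le_add ?_
    (mul_le_mul_right ?_ _)) _)))) ?_
  · refine (hL.2.2.2 _ _ hw (hD.comb hp1 hsV 1 (-1))).trans (mul_le_mul_right (le_of_eq ?_) _)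
    show _ = WNormD 2 p μ fun l x => partialDList l V x - D' l x
    rw [WNormD_eq, WNormD_eq]
    refine Finset.sum_congr rfl fun l hl => ?_
    rw [← eLpNorm_neg]
    refine eLpNorm_congr_ae ?_
    filter_upwards [he l (mem_LL.1 hl)] with x hx
    simp only [Pi.neg_apply, hx]
    ring
  · have hm2 : ∀ i j : Fin m, Measurable ((fun l => partialDList l V) [i, j]) := fun i j => (hc2 i j).measurable
    have := avg_add (k := scaled ρ ε) hp1 hp (G.Wm_mono p D') (fun t => G.Wm_sub (D := fun l => partialDList l V) hp1 hm2 (fun i j => hD'.meas [i, j]) t)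
    refine this.trans (add_le_add le_rfl (le_of_eq ?_))
    rw [muK_scaled_univ hk.meas hε, hM, hd]
    ring
  · exact WNormD_le_add hp1 (aesm_pd hV _) fun l _ => (hD'.meas l).aestronglyMeasurable
  · refine (eLpNorm_sum_le (fun i _ => m3 i) hp1).trans ?_
    refine (Finset.sum_le_card_nsmul _ _ (d s) fun i _ => le_WNormD p μ
      (fun l x => partialDList l (U s) x - D' l x) (k := 2) (l := [i, i]) (by simp)).trans (le_of_eq ?_)
    simp

end PartTwentyFive

section PartTwentySix

variable {m n : ℕ}

lemma clm_iter_bd (ℓ : EV m →L[ℝ] ℝ) (k : ℕ) (hk : 1 ≤ k) (x : EV m) : ‖iteratedFDeriv ℝ k ℓ x‖ ≤ ‖ℓ‖ := by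
  obtain ⟨j, rfl⟩ : ∃ j, k = j + 1 := ⟨k - 1, by omega⟩
  rw [← norm_iteratedFDeriv_fderiv]
  have : fderiv ℝ (ℓ : EV m → ℝ) = fun _ => ℓ := by funext y; exact ℓ.fderiv
  rw [this]
  rcases Nat.eq_zero_or_pos j with rfl | hj
  · rw [norm_iteratedFDeriv_zero]
  · rw [iteratedFDeriv_const_of_ne hj.ne']; simp

/-- first coordinates as a linear map -/
def fcL (n : ℕ) : EV (n + 1) →L[ℝ] EV n :=
  LinearMap.toContinuousLinearMap
    { toFun := firstCoords
      map_add' := fun x y => by ext i; rfl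
      map_smul' := fun c x => by ext i; rfl }

lemma fcL_apply (x : EV (n + 1)) : fcL n x = firstCoords x := rfl

/-- defining function of the rotated half space -/
def tauQ {Q : Matrix (Fin (n + 1)) (Fin (n + 1)) ℝ} (hQ : Qᵀ * Q = 1) (γ : EV n → ℝ) (x : EV (n + 1)) : ℝ :=
  ((rotI hQ).symm x) (Fin.last n) - γ (firstCoords ((rotI hQ).symm x))

lemma Om_tauQ {Q : Matrix (Fin (n + 1)) (Fin (n + 1)) ℝ} (hQ : Qᵀ * Q = 1) (γ : EV n → ℝ) :
    mulVecE Q '' halfSpace γ = Om (tauQ hQ γ) := by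
  ext x
  constructor
  · rintro ⟨y, hy, rfl⟩
    show 0 < tauQ hQ γ _
    unfold tauQ
    rw [← rotI_apply hQ, LinearIsometryEquiv.symm_apply_apply]
    exact sub_pos.2 hy
  · intro hx
    refine ⟨(rotI hQ).symm x, (sub_pos.1 hx : γ (firstCoords ((rotI hQ).symm x)) < (rotI hQ).symm x (Fin.last n)), ?_⟩
    rw [← rotI_apply hQ, LinearIsometryEquiv.apply_symm_apply]

lemma firstCoords_snocE (w : EV n) (s : ℝ) : firstCoords (snocE w s) = w := by
  ext i
  exact snocE_castSucc w s i

lemma exists_geo {Q : Matrix (Fin (n + 1)) (Fin (n + 1)) ℝ} (hQ : Qᵀ * Q = 1) {γ : EV n → ℝ} (hγ : Ckb 3 γ) :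
    ∃ K, Geo (rotS Q (0, 1)) (tauQ hQ γ) K := by
  obtain ⟨h1, h2⟩ := hγ
  choose! C hC using h2
  set R : EV (n + 1) →L[ℝ] EV (n + 1) := ((rotI hQ).symm : EV (n + 1) →L[ℝ] EV (n + 1)) with hR
  set ℓ : EV (n + 1) →L[ℝ] ℝ := (EuclideanSpace.proj (Fin.last n)).comp R with hℓ
  set T : EV (n + 1) →L[ℝ] EV n := (fcL n).comp R with hT
  have hτ : tauQ hQ γ = fun x => ℓ x - (γ ∘ T) x := rfl
  have hγT : ContDiff ℝ 3 (γ ∘ T) := ContDiff.comp (by exact_mod_cast h1) T.contDiff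
  have b : ∀ k, 1 ≤ k → k ≤ 3 → ∀ x, ‖iteratedFDeriv ℝ k (tauQ hQ γ) x‖ ≤ ‖ℓ‖ + |C k| * ‖T‖ ^ k := by
    intro k hk1 hk3 x
    have e : (fun x => ℓ x - (γ ∘ T) x) = (ℓ : EV (n + 1) → ℝ) - (γ ∘ T) := rfl
    have hk3' : (k : WithTop ℕ∞) ≤ 3 := by
      have : (k : WithTop ℕ∞) ≤ ((3 : ℕ) : WithTop ℕ∞) := by exact_mod_cast hk3
      exact this
    rw [hτ, e, iteratedFDeriv_sub_apply (ℓ.contDiff.contDiffAt) ((hγT.of_le hk3').contDiffAt)]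
    refine (norm_sub_le _ _).trans (add_le_add (clm_iter_bd ℓ k hk1 x) ?_)
    rw [T.iteratedFDeriv_comp_right (by exact_mod_cast h1 : ContDiff ℝ 3 γ) x hk3']
    refine (ContinuousMultilinearMap.norm_compContinuousLinearMap_le _ _).trans ?_
    rw [Finset.prod_const, Finset.card_univ, Fintype.card_fin]
    exact mul_le_mul_of_nonneg_right ((hC k hk3 _).trans (le_abs_self _)) (by positivity)
  have nn : ∀ k, 0 ≤ ‖ℓ‖ + |C k| * ‖T‖ ^ k := fun k => by positivity
  refine ⟨1 + (‖ℓ‖ + |C 1| * ‖T‖ ^ 1) + (‖ℓ‖ + |C 2| * ‖T‖ ^ 2) + (‖ℓ‖ + |C 3| * ‖T‖ ^ 3), ?_, ?_, ?_, ?_, ?_⟩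
  · show ‖mulVecE Q (snocE 0 1)‖ = 1
    rw [norm_mulVecE hQ]
    have h3 : inner ℝ (snocE (0 : EV n) 1) (snocE 0 1) = 1 := by rw [inner_snocE]; simp
    rw [real_inner_self_eq_norm_sq] at h3
    nlinarith [norm_nonneg (snocE (0 : EV n) 1)]
  · linarith [nn 1, nn 2, nn 3]
  · rw [hτ]; exact ℓ.contDiff.sub hγT
  · intro x s
    have e1 : (rotI hQ).symm (x + s • rotS Q (0, 1)) = (rotI hQ).symm x + s • snocE 0 1 := by
      rw [map_add, map_smul]
      congr 2
      show (rotI hQ).symm (mulVecE Q (snocE 0 1)) = _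
      rw [← rotI_apply hQ, LinearIsometryEquiv.symm_apply_apply]
    unfold tauQ
    rw [e1]
    have e2 : firstCoords ((rotI hQ).symm x + s • snocE 0 1) = firstCoords ((rotI hQ).symm x) := by
      rw [← fcL_apply, map_add, map_smul, fcL_apply, fcL_apply, firstCoords_snocE]; simp
    rw [e2]
    have e3 : ((rotI hQ).symm x + s • snocE (0 : EV n) 1) (Fin.last n) = (rotI hQ).symm x (Fin.last n) + s := by
      simp [snocE_last]
    rw [e3]; ring
  · intro k hk1 hk3 x
    have := b k hk1 hk3 x
    interval_cases k <;> linarith [nn 1, nn 2, nn 3]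

lemma final_geo {ρ : EV (n + 1) → ℝ} (hρ1 : A1 ρ) (h2 : A2 ρ) (hM : momentum ρ = 1) {p : ℝ≥0∞} (hp1 : 1 ≤ p) (hp : p ≠ ⊤)
    {Q : Matrix (Fin (n + 1)) (Fin (n + 1)) ℝ} (hQ : Qᵀ * Q = 1) {τ : EV (n + 1) → ℝ} {K : ℝ} (G : Geo (rotS Q (0, 1)) τ K) :
    (∃ c : ℝ, 0 < c ∧ ∀ ε : ℝ, 0 < ε → ε ≤ 1 →
        ∃ L : (EV (n + 1) → ℝ) → EV (n + 1) → ℝ, IsNLExtOn (Om τ) 1 ρ p ε c L) ∧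
      (∀ L : ℝ → (EV (n + 1) → ℝ) → EV (n + 1) → ℝ,
        (∀ ε : ℝ, 0 < ε → ε ≤ 1 → ∃ c : ℝ, 0 < c ∧ IsNLExtOn (Om τ) 1 ρ p ε c (L ε)) →
        (∃ C : ℝ, 0 < C ∧ ∀ ε : ℝ, 0 < ε → ε ≤ 1 →
          ∀ (u : EV (n + 1) → ℝ) (D : List (Fin (n + 1)) → EV (n + 1) → ℝ),
            NeumannBC (Om τ) 1 p u → IsSobDerivs (Om τ) 3 p u D →
            eLpNorm (fun x => L ε u x + ∑ i : Fin (n + 1), D [i, i] x) p (volume.restrict (Om τ))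
              ≤ ENNReal.ofReal (C * ε ^ (1 / p.toReal)) * WNormD 3 p (volume.restrict (Om τ)) D) ∧
        (∀ (u : EV (n + 1) → ℝ) (D : List (Fin (n + 1)) → EV (n + 1) → ℝ),
          NeumannBC (Om τ) 1 p u → IsSobDerivs (Om τ) 2 p u D →
          Tendsto (fun ε : ℝ => eLpNorm (fun x => L ε u x + ∑ i : Fin (n + 1), D [i, i] x) p (volume.restrict (Om τ)))
            (𝓝[>] 0) (𝓝 0))) := by
  have hk := ker_of_A1 hρ1
  haveI := hk.finite
  have hr := toReal_one_le hp1 hp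
  have hr0 : 0 < p.toReal := by linarith
  obtain ⟨C, hC, hE⟩ := exists_mainEst hk h2 hM hp1 hp hQ G
  have hmt : ((n + 1 : ℕ) : ℝ≥0∞) ≠ ⊤ := ENNReal.natCast_ne_top _
  refine ⟨?_, fun L hL => ⟨?_, ?_⟩⟩
  · obtain ⟨c, hc, hB⟩ := op_bound G hk hp1 hp hC hE
    refine ⟨c.toReal + 1, by positivity, fun ε hε hε1 => ⟨LExt τ (scaled ρ ε) p, ?_⟩⟩
    refine LExt_isExt G hk hp1 hp hc hε (hB ε hε hε1) ?_
    rw [← ENNReal.ofReal_toReal hc]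
    exact ENNReal.ofReal_le_ofReal (by rw [ENNReal.toReal_ofReal ENNReal.toReal_nonneg]; linarith)
  · set a : ℝ≥0∞ := (muK ρ Set.univ ^ (p.toReal - 1) * ∫⁻ z, ENNReal.ofReal ‖z‖ ∂(muK ρ)) ^ (1 / p.toReal) with ha
    set b : ℝ≥0∞ := ((n + 1 : ℕ) : ℝ≥0∞) * (n + 1 : ℕ) * (ENNReal.ofReal ((1 + 2 * K) ^ 2 + K + 3) * (1 + (n + 1 : ℕ))) with hb
    have hat : a ≠ ⊤ := ENNReal.rpow_ne_top_of_nonneg (by positivity)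
      (ENNReal.mul_ne_top (ENNReal.rpow_ne_top_of_nonneg (by linarith) (measure_ne_top _ _)) hk.norm_fin)
    have hbt : b ≠ ⊤ := ENNReal.mul_ne_top (ENNReal.mul_ne_top hmt hmt) (ENNReal.mul_ne_top ENNReal.ofReal_ne_top
      (ENNReal.add_ne_top.2 ⟨ENNReal.one_ne_top, hmt⟩))
    have hct : C * (a * b + 1) ≠ ⊤ := ENNReal.mul_ne_top hC (ENNReal.add_ne_top.2 ⟨ENNReal.mul_ne_top hat hbt, ENNReal.one_ne_top⟩)
    refine ⟨(C * (a * b + 1)).toReal + 1, by positivity, fun ε hε hε1 u D hN hD => ?_⟩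
    obtain ⟨c, _, hLe⟩ := hL ε hε hε1
    obtain ⟨D', hD', he⟩ := exists_jet G.measOm hD
    refine (ext_est G hk hp1 hp hC hE hε hε1 hLe hN (hD.mono (by norm_num)) (hD'.mono (by norm_num))
      (fun l hl => he l (by omega))).trans ?_
    rw [← WNormD_congr p he]
    set N := WNormD 3 p (volume.restrict (Om τ)) D' with hNd
    set θ := ENNReal.ofReal ε ^ (1 / p.toReal) with hθ
    have i1 := avg_rate hk hε hp1 hp (fun t ht => G.Wm_rate hp1 hp hD' ht)
    have i2 : WNormD 2 p (volume.restrict (Om τ)) D' ≤ N := WNormD_mono (by norm_num) _ _ _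
    rw [ENNReal.ofReal_mul (by positivity), ← ENNReal.ofReal_rpow_of_pos hε, ← hθ]
    have i3 : C * (a * b + 1) ≤ ENNReal.ofReal ((C * (a * b + 1)).toReal + 1) := by
      conv_lhs => rw [← ENNReal.ofReal_toReal hct]
      exact ENNReal.ofReal_le_ofReal (by linarith)
    refine le_trans (mul_le_mul_right (add_le_add i1 (mul_le_mul_right i2 _)) _) (le_trans (le_of_eq ?_)
      (mul_le_mul_left (mul_le_mul_left i3 θ) N))
    rw [hb]; ring
  · intro u D hN hD
    obtain ⟨D', hD', he⟩ := exists_jet G.measOm hD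
    have hNt : WNormD 2 p (volume.restrict (Om τ)) D' ≠ ⊤ := WNormD_ne_top fun l _ => (hD'.memLp l).restrict _
    have t1 := avg_tendsto hk hp1 hp (G.Wm_mono p D') (ENNReal.mul_ne_top (ENNReal.mul_ne_top hmt hmt)
      (ENNReal.mul_ne_top (by norm_num : (3 : ℝ≥0∞) ≠ ⊤) hNt)) (fun t => G.Wm_le hp1 (fun i j => hD'.meas _) t)
      (G.Wm_tendsto hp1 hp hD')
    have t2 : Tendsto (fun ε : ℝ => ENNReal.ofReal ε ^ (1 / p.toReal)) (𝓝[>] 0) (𝓝 0) := by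
      have h3 : Tendsto (fun ε : ℝ => ENNReal.ofReal ε) (𝓝[>] 0) (𝓝 0) := by
        have := (ENNReal.continuous_ofReal.tendsto 0).mono_left (nhdsWithin_le_nhds (s := Set.Ioi 0))
        simpa using this
      have := (ENNReal.continuous_rpow_const (y := 1 / p.toReal)).continuousAt.tendsto.comp h3
      rw [ENNReal.zero_rpow_of_pos (by positivity)] at this
      exact this
    have t3 := ENNReal.Tendsto.const_mul (t1.add (ENNReal.Tendsto.mul_const t2 (Or.inr hNt))) (Or.inr hC)
    rw [zero_mul, add_zero, mul_zero] at t3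
    refine tendsto_zero_of_le01 (fun ε hε hε1 => ?_) t3
    obtain ⟨c, _, hLe⟩ := hL ε hε hε1
    exact ext_est G hk hp1 hp hC hE hε hε1 hLe hN hD hD' he

end PartTwentySix

/-- rotated curved half space: let `γ ∈ C³_b(ℝ^{n-1})`, `Q ∈ SO(n)`,
`p ∈ [1,∞)`, and let `ρ` satisfy (A1) and (A2) with `M = I`, with `‖γ‖_{C¹_b}`
sufficiently small. Then on `Qℝⁿ_γ`: the nonlocal operator extends to a bounded linear
operator `L_ε^{Qℝⁿ_γ} : W^{2,p}_N(Qℝⁿ_γ) → L^p(Qℝⁿ_γ)` with norm bounded uniformly in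
`ε ∈ (0,1]`; there is `C > 0` with
`‖L_ε^{Qℝⁿ_γ} u + Δu‖_{L^p} ≤ C ε^{1/p} ‖u‖_{W^{3,p}}` for all `ε ∈ (0,1]` and
`u ∈ W^{3,p}_N(Qℝⁿ_γ)`; and `L_ε^{Qℝⁿ_γ} u → -Δu` in `L^p(Qℝⁿ_γ)` as `ε → 0` for all
`u ∈ W^{2,p}_N(Qℝⁿ_γ)`. -/
theorem nlOp_rotated_half_space (n : ℕ) (ρ : EV (n + 1) → ℝ)
    (hρ1 : A1 ρ) (hρ2 : A2 ρ) (hM : momentum ρ = 1)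
    (p : ℝ≥0∞) (hp1 : 1 ≤ p) (hp : p ≠ ⊤) :
    ∃ δ : ℝ, 0 < δ ∧ ∀ γ : EV n → ℝ, Ckb 3 γ →
      (∀ x : EV n, |γ x| ≤ δ ∧ ‖fderiv ℝ γ x‖ ≤ δ) →
      ∀ Q : Matrix (Fin (n + 1)) (Fin (n + 1)) ℝ, Qᵀ * Q = 1 → Q.det = 1 →
      -- the rotated curved half space
      (∃ c : ℝ, 0 < c ∧ ∀ ε : ℝ, 0 < ε → ε ≤ 1 →
        ∃ L : (EV (n + 1) → ℝ) → EV (n + 1) → ℝ,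
          IsNLExtOn (mulVecE Q '' halfSpace γ)
            (1 : Matrix (Fin (n + 1)) (Fin (n + 1)) ℝ) ρ p ε c L) ∧
      (∀ L : ℝ → (EV (n + 1) → ℝ) → EV (n + 1) → ℝ,
        (∀ ε : ℝ, 0 < ε → ε ≤ 1 → ∃ c : ℝ, 0 < c ∧
          IsNLExtOn (mulVecE Q '' halfSpace γ)
            (1 : Matrix (Fin (n + 1)) (Fin (n + 1)) ℝ) ρ p ε c (L ε)) →
        (∃ C : ℝ, 0 < C ∧ ∀ ε : ℝ, 0 < ε → ε ≤ 1 →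
          ∀ (u : EV (n + 1) → ℝ) (D : List (Fin (n + 1)) → EV (n + 1) → ℝ),
            NeumannBC (mulVecE Q '' halfSpace γ)
              (1 : Matrix (Fin (n + 1)) (Fin (n + 1)) ℝ) p u →
            IsSobDerivs (mulVecE Q '' halfSpace γ) 3 p u D →
            eLpNorm (fun x => L ε u x + ∑ i : Fin (n + 1), D [i, i] x) p
                (volume.restrict (mulVecE Q '' halfSpace γ))
              ≤ ENNReal.ofReal (C * ε ^ (1 / p.toReal))
                  * WNormD 3 p (volume.restrict (mulVecE Q '' halfSpace γ)) D) ∧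
        (∀ (u : EV (n + 1) → ℝ) (D : List (Fin (n + 1)) → EV (n + 1) → ℝ),
          NeumannBC (mulVecE Q '' halfSpace γ)
            (1 : Matrix (Fin (n + 1)) (Fin (n + 1)) ℝ) p u →
          IsSobDerivs (mulVecE Q '' halfSpace γ) 2 p u D →
          Tendsto
            (fun ε : ℝ =>
              eLpNorm (fun x => L ε u x + ∑ i : Fin (n + 1), D [i, i] x) p
                (volume.restrict (mulVecE Q '' halfSpace γ)))
            (𝓝[>] 0) (𝓝 0))) := by
  refine ⟨1, one_pos, fun γ hγ _ Q hQ _ => ?_⟩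
  obtain ⟨K, G⟩ := exists_geo hQ hγ
  rw [Om_tauQ hQ γ]
  exact final_geo hρ1 hρ2 hM hp1 hp hQ G
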